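/- Let m ≥ 1, n ≥ 1, D ≥ 1 be integers. The vector-valued shape fields finiteness principle holds with the explicit finiteness number k♯ = 2^(D·binom(n+m−1, n)). That is: for each C_w > 0 there is a constant C depending only on m, n, D, C_w such that if E ⊆ ℝ^n is finite, (Γ⃗(x,M))_{x∈E, M>0} is a (C_w, δ_max)-convex vector-valued shape field, Q_0 ⊆ ℝ^n is a closed cube of side length δ_{Q_0} ≤ δ_max, x_0 ∈ E ∩ Q_0, M_0 > 0, and for each S ⊆ E with |S| ≤ 2^(D·binom(n+m−1, n)) there exists a Whitney field (P⃗^z)_{z∈S} with ‖(P⃗^z)_{z∈S}‖_{Ẇ^m(S)} ≤ M_0 and P⃗^z ∈ Γ⃗(z, M_0) for all z ∈ S, then there exist P⃗^0 ∈ Γ⃗(x_0, C·M_0) and a C^m function F : Q_0 → ℝ^D such that J_z F ∈ Γ⃗(z, C·M_0) for all z ∈ E ∩ Q_0, |∂^α(F − P⃗^0)(x)| ≤ C·M_0·δ_{Q_0}^{m−|α|} for all x ∈ Q_0 and |α| ≤ m, and in particular |∂^α F(x)| ≤ C·M_0 for all x ∈ Q_0 and |α| = m. -/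

import Mathlib

open scoped BigOperators Classical

noncomputable section

/-- `En n` is Euclidean space `ℝ^n`. -/
abbrev En (n : ℕ) : Type := EuclideanSpace ℝ (Fin n)

/-- First-order partial derivative `∂_i f` in the `i`-th coordinate direction. -/
noncomputable def pd1 {n : ℕ} (i : Fin n) (f : En n → ℝ) : En n → ℝ :=
  fun x => fderiv ℝ f x (EuclideanSpace.single i 1)

/-- Higher-order partial derivative `∂^α f` for a multi-index `α`. -/
noncomputable def pdalpha {n : ℕ} (α : Fin n → ℕ) (f : En n → ℝ) : En n → ℝ :=
  (List.finRange n).foldr (fun i g => (pd1 i)^[α i] g) f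

/-- First-order partial derivative within a set `s`. -/
noncomputable def pd1W {n : ℕ} (s : Set (En n)) (i : Fin n) (f : En n → ℝ) : En n → ℝ :=
  fun x => fderivWithin ℝ f s x (EuclideanSpace.single i 1)

/-- Higher-order partial derivative `∂^α f` within a set `s`. -/
noncomputable def pdalphaW {n : ℕ} (s : Set (En n)) (α : Fin n → ℕ) (f : En n → ℝ) : En n → ℝ :=
  (List.finRange n).foldr (fun i g => (pd1W s i)^[α i] g) f

/-- `∂^α` of a multivariate polynomial (formal derivative). -/
noncomputable def polyPD {n : ℕ} (α : Fin n → ℕ) (p : MvPolynomial (Fin n) ℝ) :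
    MvPolynomial (Fin n) ℝ :=
  (List.finRange n).foldr (fun i q => (fun r => MvPolynomial.pderiv i r)^[α i] q) p

/-- The value `∂^α p (x)` of the `α`-th derivative of a polynomial at `x`. -/
noncomputable def polyPDval {n : ℕ} (α : Fin n → ℕ) (p : MvPolynomial (Fin n) ℝ) (x : En n) : ℝ :=
  MvPolynomial.eval (fun i => x i) (polyPD α p)

/-- The `(m-1)`-jet (Taylor polynomial of degree `≤ m-1`) of `f` at `x`. -/
noncomputable def jetScalar (m : ℕ) {n : ℕ} (f : En n → ℝ) (x : En n) :
    MvPolynomial (Fin n) ℝ :=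
  ∑ α ∈ (Finset.univ : Finset (Fin n → Fin m)).filter (fun α => (∑ i, (α i : ℕ)) ≤ m - 1),
    MvPolynomial.C (pdalpha (fun i => (α i : ℕ)) f x / ((∏ i, Nat.factorial (α i : ℕ) : ℕ) : ℝ))
      * ∏ i, (MvPolynomial.X i - MvPolynomial.C (x i)) ^ ((α i : ℕ))

/-- The `(m-1)`-jet of `f` at `x`, with derivatives taken within a set `s`. -/
noncomputable def jetScalarW (m : ℕ) {n : ℕ} (s : Set (En n)) (f : En n → ℝ) (x : En n) :
    MvPolynomial (Fin n) ℝ :=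
  ∑ α ∈ (Finset.univ : Finset (Fin n → Fin m)).filter (fun α => (∑ i, (α i : ℕ)) ≤ m - 1),
    MvPolynomial.C (pdalphaW s (fun i => (α i : ℕ)) f x / ((∏ i, Nat.factorial (α i : ℕ) : ℕ) : ℝ))
      * ∏ i, (MvPolynomial.X i - MvPolynomial.C (x i)) ^ ((α i : ℕ))

/-- The vector-valued `(m-1)`-jet `J_x F ∈ 𝒫⃗` of `F : ℝ^n → ℝ^D` at `x`. -/
noncomputable def jetD (m : ℕ) {n D : ℕ} (F : En n → Fin D → ℝ) (x : En n) :
    Fin D → MvPolynomial (Fin n) ℝ :=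
  fun j => jetScalar m (fun y => F y j) x

/-- The vector-valued `(m-1)`-jet of `F` at `x`, derivatives within `s`. -/
noncomputable def jetDW (m : ℕ) {n D : ℕ} (s : Set (En n)) (F : En n → Fin D → ℝ) (x : En n) :
    Fin D → MvPolynomial (Fin n) ℝ :=
  fun j => jetScalarW m s (fun y => F y j) x

/-- Truncation of a polynomial to total degree `≤ k`. -/
noncomputable def truncDeg {n : ℕ} (k : ℕ) (p : MvPolynomial (Fin n) ℝ) :
    MvPolynomial (Fin n) ℝ :=
  ∑ s ∈ p.support.filter (fun s => (s.sum fun _ e => e) ≤ k),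
    MvPolynomial.monomial s (MvPolynomial.coeff s p)

/-- The degree-`k` Taylor truncation of a polynomial at `x` (the jet `J_x p` of order `k`). -/
noncomputable def taylorTrunc {n : ℕ} (k : ℕ) (x : En n) (p : MvPolynomial (Fin n) ℝ) :
    MvPolynomial (Fin n) ℝ :=
  MvPolynomial.bind₁ (fun i => MvPolynomial.X i - MvPolynomial.C (x i))
    (truncDeg k (MvPolynomial.bind₁ (fun i => MvPolynomial.X i + MvPolynomial.C (x i)) p))

/-- The ring multiplication `p ⊙_x q := J_x(pq)` on degree-`k` jets at `x`. -/
noncomputable def odot {n : ℕ} (k : ℕ) (x : En n) (p q : MvPolynomial (Fin n) ℝ) :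
    MvPolynomial (Fin n) ℝ :=
  taylorTrunc k x (p * q)

/-- `(Γ x M)_{x ∈ E, M > 0}` is a shape field with jets of degree `≤ k` and `d` components:
each `Γ x M` is a convex set of `d`-tuples of polynomials of degree `≤ k`, monotone in `M`. -/
def IsShapeField {N : ℕ} (k d : ℕ) (E : Finset (En N))
    (Γ : En N → ℝ → Set (Fin d → MvPolynomial (Fin N) ℝ)) : Prop :=
  (∀ x ∈ E, ∀ M : ℝ, 0 < M → Convex ℝ (Γ x M)) ∧
  (∀ x ∈ E, ∀ M : ℝ, 0 < M → ∀ P ∈ Γ x M, ∀ j, (P j).totalDegree ≤ k) ∧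
  (∀ x ∈ E, ∀ M' M : ℝ, 0 < M' → M' ≤ M → Γ x M' ⊆ Γ x M)

/-- `(C_w, δmax)`-convexity of a shape field with jets of degree `≤ k`. -/
def SFConvex {N : ℕ} (k d : ℕ) (E : Finset (En N))
    (Γ : En N → ℝ → Set (Fin d → MvPolynomial (Fin N) ℝ)) (Cw δmax : ℝ) : Prop :=
  ∀ δ : ℝ, 0 < δ → δ ≤ δmax → ∀ x ∈ E, ∀ M : ℝ, 0 < M →
    ∀ P₁ P₂ : Fin d → MvPolynomial (Fin N) ℝ, P₁ ∈ Γ x M → P₂ ∈ Γ x M →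
    ∀ Q₁ Q₂ : MvPolynomial (Fin N) ℝ, Q₁.totalDegree ≤ k → Q₂.totalDegree ≤ k →
    (∀ α : Fin N → ℕ, (∑ i, α i) ≤ k → ∀ j,
      |polyPDval α (P₁ j - P₂ j) x| ≤ M * δ ^ (k + 1 - ∑ i, α i)) →
    (∀ α : Fin N → ℕ, (∑ i, α i) ≤ k →
      |polyPDval α Q₁ x| ≤ δ ^ (-((∑ i, α i : ℕ) : ℤ)) ∧
      |polyPDval α Q₂ x| ≤ δ ^ (-((∑ i, α i : ℕ) : ℤ))) →
    odot k x Q₁ Q₁ + odot k x Q₂ Q₂ = 1 →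
    (fun j => odot k x (odot k x Q₁ Q₁) (P₁ j) + odot k x (odot k x Q₂ Q₂) (P₂ j))
      ∈ Γ x (Cw * M)

/-- `‖(P^x)_{x ∈ S}‖_{Ẇ^m(S)} ≤ M` : the homogeneous Whitney seminorm bound. -/
def WSemiLE (m : ℕ) {N d : ℕ} (S : Finset (En N))
    (P : En N → Fin d → MvPolynomial (Fin N) ℝ) (M : ℝ) : Prop :=
  ∀ x ∈ S, ∀ y ∈ S, x ≠ y → ∀ α : Fin N → ℕ, (∑ i, α i) ≤ m - 1 → ∀ j,
    |polyPDval α (P x j - P y j) x| ≤ M * dist x y ^ (m - ∑ i, α i)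

/-- The homogeneous Whitney seminorm `‖(P^x)_{x ∈ S}‖_{Ẇ^m(S)}`. -/
noncomputable def WNormHomog (m : ℕ) {N d : ℕ} (S : Finset (En N))
    (P : En N → Fin d → MvPolynomial (Fin N) ℝ) : ℝ :=
  sSup {r : ℝ | ∃ x ∈ S, ∃ y ∈ S, x ≠ y ∧ ∃ α : Fin N → ℕ, (∑ i, α i) ≤ m - 1 ∧ ∃ j : Fin d,
    r = |polyPDval α (P x j - P y j) x| / dist x y ^ (m - ∑ i, α i)}

/-- The lower-order part of the Whitney norm. -/
noncomputable def WNormLow (m : ℕ) {N d : ℕ} (S : Finset (En N))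
    (P : En N → Fin d → MvPolynomial (Fin N) ℝ) : ℝ :=
  sSup {r : ℝ | ∃ x ∈ S, ∃ α : Fin N → ℕ, (∑ i, α i) ≤ m - 1 ∧ ∃ j : Fin d,
    r = |polyPDval α (P x j) x|}

/-- The Whitney norm `‖(P^x)_{x ∈ S}‖_{W^m(S)}`. -/
noncomputable def WNormFull (m : ℕ) {N d : ℕ} (S : Finset (En N))
    (P : En N → Fin d → MvPolynomial (Fin N) ℝ) : ℝ :=
  WNormLow m S P + WNormHomog m S P

/-- `‖F‖_{C^m} ≤ M`: all partials of order `≤ m` of all components bounded by `M`. -/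
def CmLE (m : ℕ) {n D : ℕ} (F : En n → Fin D → ℝ) (M : ℝ) : Prop :=
  ∀ α : Fin n → ℕ, (∑ i, α i) ≤ m → ∀ x : En n, ∀ j, |pdalpha α (fun y => F y j) x| ≤ M

/-- `‖F‖_{Ċ^m} ≤ M`: all partials of order `= m` of all components bounded by `M`. -/
def CmHomogLE (m : ℕ) {n D : ℕ} (F : En n → Fin D → ℝ) (M : ℝ) : Prop :=
  ∀ α : Fin n → ℕ, (∑ i, α i) = m → ∀ x : En n, ∀ j, |pdalpha α (fun y => F y j) x| ≤ M

/-- `‖F‖_{C^{m-1,1}} ≤ M`. -/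
def Cm11LE (m : ℕ) {n D : ℕ} (F : En n → Fin D → ℝ) (M : ℝ) : Prop :=
  (∀ α : Fin n → ℕ, (∑ i, α i) ≤ m - 1 → ∀ x : En n, ∀ j,
    |pdalpha α (fun y => F y j) x| ≤ M) ∧
  (∀ α : Fin n → ℕ, (∑ i, α i) = m - 1 → ∀ j, ∀ x y : En n,
    |pdalpha α (fun z => F z j) x - pdalpha α (fun z => F z j) y| ≤ M * dist x y)

/-- A closed cube in `ℝ^n` with lower corner `a` and side length `δ`. -/
def cube {n : ℕ} (a : En n) (δ : ℝ) : Set (En n) := {y | ∀ i, a i ≤ y i ∧ y i ≤ a i + δ}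

/-- The embedding `ℝ^n → ℝ^{n+D}`, `x ↦ (x, 0)`. -/
noncomputable def embed (n D : ℕ) (x : En n) : En (n + D) :=
  (EuclideanSpace.equiv (Fin (n + D)) ℝ).symm
    (Fin.append (fun i : Fin n => x i) (fun _ : Fin D => (0 : ℝ)))

/-- The projection `ℝ^{n+D} → ℝ^n`, `(x, ξ) ↦ x`. -/
noncomputable def projn (n D : ℕ) (z : En (n + D)) : En n :=
  (EuclideanSpace.equiv (Fin n) ℝ).symm (fun i => z (Fin.castAdd D i))

/-- Restriction of a polynomial on `ℝ^{n+D}` to `ℝ^n × {0}`, as a polynomial on `ℝ^n`. -/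
noncomputable def restrict0 (n D : ℕ) (p : MvPolynomial (Fin (n + D)) ℝ) :
    MvPolynomial (Fin n) ℝ :=
  MvPolynomial.aeval
    (Fin.append (fun i : Fin n => (MvPolynomial.X i : MvPolynomial (Fin n) ℝ))
      (fun _ : Fin D => 0)) p


namespace SF

open scoped ContDiff

/-! ### Iterated commuting operators -/

/-- Iterated application of a family of operators along a list. -/
def itl {n : ℕ} {A : Type*} (f : Fin n → A → A) (l : List (Fin n)) (α : Fin n → ℕ) (a : A) : A :=
  l.foldr (fun i g => (f i)^[α i] g) a

section itl
variable {n : ℕ} {A : Type*} {p : A → Prop} {f : Fin n → A → A}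

theorem iter_pres (hp : ∀ i a, p a → p (f i a)) (i : Fin n) (N : ℕ) (a : A) (ha : p a) :
    p ((f i)^[N] a) := by
  induction N generalizing a with
  | zero => simpa
  | succ N ih => rw [Function.iterate_succ_apply]; exact ih _ (hp i a ha)

theorem iter_comm (hp : ∀ i a, p a → p (f i a))
    (hc : ∀ i j a, p a → f i (f j a) = f j (f i a)) (i j : Fin n) (N : ℕ) (a : A) (ha : p a) :
    f i ((f j)^[N] a) = (f j)^[N] (f i a) := by
  induction N generalizing a with
  | zero => simp
  | succ N ih =>
    rw [Function.iterate_succ_apply, Function.iterate_succ_apply, ih _ (hp j a ha), hc i j a ha]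

theorem itl_pres (hp : ∀ i a, p a → p (f i a)) (l : List (Fin n)) (α : Fin n → ℕ) (a : A)
    (ha : p a) : p (itl f l α a) := by
  induction l with
  | nil => simpa [itl]
  | cons j l ih => exact iter_pres hp j _ _ ih

theorem itl_comm (hp : ∀ i a, p a → p (f i a))
    (hc : ∀ i j a, p a → f i (f j a) = f j (f i a)) (l : List (Fin n)) (α : Fin n → ℕ)
    (i : Fin n) (a : A) (ha : p a) : f i (itl f l α a) = itl f l α (f i a) := by
  induction l with
  | nil => simp [itl]
  | cons j l ih =>
    change f i ((f j)^[α j] (itl f l α a)) = (f j)^[α j] (itl f l α (f i a))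
    rw [iter_comm hp hc i j _ _ (itl_pres hp l α a ha), ih]

theorem itl_add (hp : ∀ i a, p a → p (f i a))
    (hc : ∀ i j a, p a → f i (f j a) = f j (f i a)) (l : List (Fin n)) (hl : l.Nodup)
    (α : Fin n → ℕ) (i : Fin n) (a : A) (ha : p a) :
    itl f l (α + Pi.single i 1) a = if i ∈ l then f i (itl f l α a) else itl f l α a := by
  induction l with
  | nil => simp [itl]
  | cons j l ih =>
    have ih := ih (List.nodup_cons.1 hl).2
    have hjl := (List.nodup_cons.1 hl).1
    change (f j)^[(α + Pi.single i 1 : Fin n → ℕ) j] (itl f l (α + Pi.single i 1) a) =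
      if i ∈ j :: l then f i ((f j)^[α j] (itl f l α a)) else (f j)^[α j] (itl f l α a)
    rw [ih]
    by_cases hij : i = j
    · subst hij
      simp only [hjl, if_false, List.mem_cons, true_or, if_true, Pi.add_apply, Pi.single_eq_same]
      rw [Function.iterate_succ_apply']
    · have : (α + Pi.single i 1 : Fin n → ℕ) j = α j := by
        simp [Pi.single_eq_of_ne (Ne.symm hij)]
      rw [this]
      by_cases hil : i ∈ l
      · simp only [hil, if_true, List.mem_cons, or_true]
        rw [iter_comm hp hc i j _ _ (itl_pres hp l α a ha)]
      · simp [hil, hij]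

theorem itl_zero (l : List (Fin n)) (a : A) : itl f l 0 a = a := by
  induction l with
  | nil => simp [itl]
  | cons j l ih =>
    change (f j)^[0] (itl f l 0 a) = a
    simpa using ih
end itl

variable {n : ℕ}

/-- size of a multi-index -/
abbrev sz (α : Fin n → ℕ) : ℕ := ∑ i, α i

theorem sz_add_single (α : Fin n → ℕ) (i : Fin n) : sz (α + Pi.single i 1) = sz α + 1 := by
  simp [sz, Finset.sum_add_distrib]

theorem sz_add (α β : Fin n → ℕ) : sz (α + β) = sz α + sz β := by
  simp [sz, Finset.sum_add_distrib]

theorem sz_zero : sz (0 : Fin n → ℕ) = 0 := by simp [sz]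

theorem sz_eq_zero {α : Fin n → ℕ} (h : sz α = 0) : α = 0 := by
  funext i
  have := (Finset.sum_eq_zero_iff.1 h) i (Finset.mem_univ i)
  simpa using this

theorem exists_of_sz_succ {α : Fin n → ℕ} {N : ℕ} (h : sz α = N + 1) :
    ∃ (β : Fin n → ℕ) (i : Fin n), α = β + Pi.single i 1 ∧ sz β = N := by
  have : ∃ i, α i ≠ 0 := by
    by_contra hcon
    push Not at hcon
    have : sz α = 0 := Finset.sum_eq_zero (fun i _ => hcon i)
    omega
  obtain ⟨i, hi⟩ := this
  have e : α = (fun j => α j - (Pi.single i 1 : Fin n → ℕ) j) + Pi.single i 1 := by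
    funext j
    by_cases hj : j = i
    · subst hj; simp; omega
    · simp [Pi.single_eq_of_ne hj]
  refine ⟨fun j => α j - (Pi.single i 1 : Fin n → ℕ) j, i, e, ?_⟩
  have := sz_add_single (fun j => α j - (Pi.single i 1 : Fin n → ℕ) j) i
  rw [← e] at this
  omega

theorem mi_induction {motive : (Fin n → ℕ) → Prop} (h0 : motive 0)
    (hs : ∀ α i, motive α → motive (α + Pi.single i 1)) (α : Fin n → ℕ) : motive α := by
  obtain ⟨N, hN⟩ : ∃ N, sz α = N := ⟨_, rfl⟩
  induction N generalizing α with
  | zero => rw [sz_eq_zero hN]; exact h0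
  | succ N ih =>
    obtain ⟨β, i, rfl, hβ⟩ := exists_of_sz_succ hN
    exact hs _ _ (ih _ hβ)

/-! ### partial derivatives of smooth functions -/

theorem pd1_smooth (i : Fin n) (f : En n → ℝ) (hf : ContDiff ℝ ∞ f) : ContDiff ℝ ∞ (pd1 i f) := by
  unfold pd1
  exact (hf.fderiv_right (m := ∞) (by simp)).clm_apply contDiff_const

theorem pd1_comm (i j : Fin n) (f : En n → ℝ) (hf : ContDiff ℝ ∞ f) :
    pd1 i (pd1 j f) = pd1 j (pd1 i f) := by
  funext x
  have key : ∀ v w : En n, fderiv ℝ (fun y => fderiv ℝ f y v) x w = fderiv ℝ (fderiv ℝ f) x w v := by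
    intro v w
    have hd : DifferentiableAt ℝ (fderiv ℝ f) x :=
      ((hf.fderiv_right (m := ∞) (by simp)).differentiable (by simp)) x
    rw [fderiv_clm_apply hd (differentiableAt_const v)]
    simp
  have hs : IsSymmSndFDerivAt ℝ f x :=
    (hf.contDiffAt).isSymmSndFDerivAt (by simp only [minSmoothness_of_isRCLikeNormedField]; exact ENat.LEInfty.out)
  change fderiv ℝ (fun y => fderiv ℝ f y _) x _ = fderiv ℝ (fun y => fderiv ℝ f y _) x _
  rw [key, key]
  exact hs _ _

theorem pdalpha_eq_itl (α : Fin n → ℕ) (f : En n → ℝ) :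
    pdalpha α f = itl pd1 (List.finRange n) α f := rfl

theorem pdalpha_smooth (α : Fin n → ℕ) {f : En n → ℝ} (hf : ContDiff ℝ ∞ f) :
    ContDiff ℝ ∞ (pdalpha α f) :=
  itl_pres (p := fun f => ContDiff ℝ ∞ f) (fun i a => pd1_smooth i a) _ α f hf

theorem pdalpha_zero (f : En n → ℝ) : pdalpha 0 f = f := itl_zero _ f

theorem pdalpha_succ (α : Fin n → ℕ) (i : Fin n) {f : En n → ℝ} (hf : ContDiff ℝ ∞ f) :
    pdalpha (α + Pi.single i 1) f = pd1 i (pdalpha α f) := by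
  have := itl_add (p := fun f => ContDiff ℝ ∞ f) (fun i a => pd1_smooth i a)
    (fun i j a => pd1_comm i j a) (List.finRange n) (List.nodup_finRange n) α i f hf
  rw [if_pos (List.mem_finRange i)] at this
  exact this

theorem pdalpha_succ' (α : Fin n → ℕ) (i : Fin n) {f : En n → ℝ} (hf : ContDiff ℝ ∞ f) :
    pdalpha (α + Pi.single i 1) f = pdalpha α (pd1 i f) := by
  rw [pdalpha_succ α i hf]
  exact itl_comm (p := fun f => ContDiff ℝ ∞ f) (fun i a => pd1_smooth i a)
    (fun i j a => pd1_comm i j a) (List.finRange n) α i f hf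

theorem pd1_add (i : Fin n) {f g : En n → ℝ} (hf : ContDiff ℝ ∞ f) (hg : ContDiff ℝ ∞ g) :
    pd1 i (f + g) = pd1 i f + pd1 i g := by
  funext x
  simp only [pd1, Pi.add_apply]
  rw [fderiv_add (hf.differentiable (by simp) x) (hg.differentiable (by simp) x)]
  rfl

theorem pd1_smul (i : Fin n) (c : ℝ) {f : En n → ℝ} (hf : ContDiff ℝ ∞ f) :
    pd1 i (c • f) = c • pd1 i f := by
  funext x
  simp only [pd1, Pi.smul_apply]
  rw [fderiv_const_smul (hf.differentiable (by simp) x)]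
  rfl

theorem pd1_mul (i : Fin n) {f g : En n → ℝ} (hf : ContDiff ℝ ∞ f) (hg : ContDiff ℝ ∞ g) :
    pd1 i (f * g) = pd1 i f * g + f * pd1 i g := by
  funext x
  simp only [pd1, Pi.add_apply, Pi.mul_apply]
  rw [fderiv_mul (hf.differentiable (by simp) x) (hg.differentiable (by simp) x)]
  simp; ring

theorem smooth_add {f g : En n → ℝ} (hf : ContDiff ℝ ∞ f) (hg : ContDiff ℝ ∞ g) :
    ContDiff ℝ ∞ (f + g) := hf.add hg
theorem smooth_mul {f g : En n → ℝ} (hf : ContDiff ℝ ∞ f) (hg : ContDiff ℝ ∞ g) :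
    ContDiff ℝ ∞ (f * g) := hf.mul hg
theorem smooth_smul (c : ℝ) {f : En n → ℝ} (hf : ContDiff ℝ ∞ f) :
    ContDiff ℝ ∞ (c • f) := contDiff_const.smul hf

theorem pdalpha_add (α : Fin n → ℕ) {f g : En n → ℝ} (hf : ContDiff ℝ ∞ f) (hg : ContDiff ℝ ∞ g) :
    pdalpha α (f + g) = pdalpha α f + pdalpha α g := by
  induction α using mi_induction with
  | h0 => simp [pdalpha_zero]
  | hs α i ih =>
    rw [pdalpha_succ α i (smooth_add hf hg), pdalpha_succ α i hf, pdalpha_succ α i hg, ih,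
      pd1_add i (pdalpha_smooth α hf) (pdalpha_smooth α hg)]

theorem pdalpha_smul (α : Fin n → ℕ) (c : ℝ) {f : En n → ℝ} (hf : ContDiff ℝ ∞ f) :
    pdalpha α (c • f) = c • pdalpha α f := by
  induction α using mi_induction with
  | h0 => simp [pdalpha_zero]
  | hs α i ih =>
    rw [pdalpha_succ α i (smooth_smul c hf), pdalpha_succ α i hf, ih,
      pd1_smul i c (pdalpha_smooth α hf)]

theorem pdalpha_sub (α : Fin n → ℕ) {f g : En n → ℝ} (hf : ContDiff ℝ ∞ f) (hg : ContDiff ℝ ∞ g) :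
    pdalpha α (f - g) = pdalpha α f - pdalpha α g := by
  have : f - g = f + (-1 : ℝ) • g := by funext x; simp [sub_eq_add_neg]
  rw [this, pdalpha_add α hf (smooth_smul _ hg), pdalpha_smul α _ hg]
  funext x; simp [sub_eq_add_neg]

/-- Pointwise derivative bounds: `|∂^β f(z)| r^|β| ≤ a` for `|β| ≤ N`. -/
def DB (N : ℕ) (z : En n) (r a : ℝ) (f : En n → ℝ) : Prop :=
  ∀ β : Fin n → ℕ, sz β ≤ N → |pdalpha β f z| * r ^ sz β ≤ a

theorem DB.nonneg {N : ℕ} {z : En n} {r a : ℝ} {f : En n → ℝ} (h : DB N z r a f) : 0 ≤ a := by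
  have := h 0 (by simp [sz])
  simp [sz] at this
  exact (abs_nonneg _).trans this

theorem DB.mul {N : ℕ} {z : En n} {r a b : ℝ} (hr : 0 < r) {f g : En n → ℝ}
    (hf : ContDiff ℝ ∞ f) (hg : ContDiff ℝ ∞ g) (h1 : DB N z r a f) (h2 : DB N z r b g) :
    DB N z r (2 ^ N * (a * b)) (f * g) := by
  induction N generalizing f g a b with
  | zero =>
    intro β hβ
    have hb : β = 0 := sz_eq_zero (by omega)
    have e1 := h1 0 (by simp [sz])
    have e2 := h2 0 (by simp [sz])
    subst hb
    simp [sz, pdalpha_zero] at e1 e2 ⊢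
    exact mul_le_mul e1 e2 (abs_nonneg _) ((abs_nonneg _).trans e1)
  | succ N ih =>
    have ha := h1.nonneg
    have hb := h2.nonneg
    intro β hβ
    rcases Nat.eq_zero_or_pos (sz β) with h0 | h0
    · have hb0 : β = 0 := sz_eq_zero (by omega)
      have e1 := h1 0 (by simp [sz])
      have e2 := h2 0 (by simp [sz])
      subst hb0
      simp [sz, pdalpha_zero] at e1 e2 ⊢
      calc |f z| * |g z| ≤ a * b := mul_le_mul e1 e2 (abs_nonneg _) ((abs_nonneg _).trans e1)
        _ ≤ 2 ^ (N + 1) * (a * b) := by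
          have : (1 : ℝ) ≤ 2 ^ (N + 1) := one_le_pow₀ (by norm_num)
          nlinarith [mul_nonneg ha hb]
    · obtain ⟨M, hM⟩ : ∃ M, sz β = M + 1 := ⟨sz β - 1, by omega⟩
      obtain ⟨γ, i, rfl, hγ⟩ := exists_of_sz_succ hM
      have hγN : sz γ ≤ N := by omega
      have red : ∀ {c : ℝ} {u : En n → ℝ}, ContDiff ℝ ∞ u → DB (N + 1) z r c u →
          DB N z r (c / r) (pd1 i u) := by
        intro c u hu h δ hδ
        have := h (δ + Pi.single i 1) (by rw [sz_add_single]; omega)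
        rw [pdalpha_succ' δ i hu, sz_add_single, pow_succ] at this
        rw [le_div_iff₀ hr]
        linarith
      have low : ∀ {c : ℝ} {u : En n → ℝ}, DB (N + 1) z r c u → DB N z r c u :=
        fun h δ hδ => h δ (by omega)
      have A := ih (pd1_smooth i f hf) hg (red hf h1) (low h2) γ hγN
      have B := ih hf (pd1_smooth i g hg) (low h1) (red hg h2) γ hγN
      rw [pdalpha_succ' γ i (smooth_mul hf hg), pd1_mul i hf hg,
        pdalpha_add γ (smooth_mul (pd1_smooth i f hf) hg) (smooth_mul hf (pd1_smooth i g hg)),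
        sz_add_single, pow_succ]
      have hp : 0 < r ^ sz γ := pow_pos hr _
      calc |(pdalpha γ (pd1 i f * g) + pdalpha γ (f * pd1 i g)) z| * (r ^ sz γ * r)
          ≤ (|pdalpha γ (pd1 i f * g) z| + |pdalpha γ (f * pd1 i g) z|) * (r ^ sz γ * r) := by
            apply mul_le_mul_of_nonneg_right (abs_add_le _ _) (by positivity)
        _ = (|pdalpha γ (pd1 i f * g) z| * r ^ sz γ + |pdalpha γ (f * pd1 i g) z| * r ^ sz γ) * r := by
            ring
        _ ≤ (2 ^ N * (a / r * b) + 2 ^ N * (a * (b / r))) * r := by gcongr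
        _ = 2 ^ (N + 1) * (a * b) := by field_simp; ring

theorem DB.add {N : ℕ} {z : En n} {r a b : ℝ} (hr : 0 ≤ r) {f g : En n → ℝ}
    (hf : ContDiff ℝ ∞ f) (hg : ContDiff ℝ ∞ g) (h1 : DB N z r a f) (h2 : DB N z r b g) :
    DB N z r (a + b) (f + g) := by
  intro β hβ
  rw [pdalpha_add β hf hg]
  have hp : 0 ≤ r ^ sz β := pow_nonneg hr _
  calc _ ≤ (|pdalpha β f z| + |pdalpha β g z|) * r ^ sz β :=
        mul_le_mul_of_nonneg_right (abs_add_le _ _) hp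
    _ ≤ _ := by rw [add_mul]; exact add_le_add (h1 β hβ) (h2 β hβ)

theorem DB.smul {N : ℕ} {z : En n} {r a : ℝ} (c : ℝ) {f : En n → ℝ}
    (hf : ContDiff ℝ ∞ f) (h1 : DB N z r a f) : DB N z r (|c| * a) (c • f) := by
  intro β hβ
  rw [pdalpha_smul β c hf]
  simp only [Pi.smul_apply, smul_eq_mul, abs_mul, mul_assoc]
  exact mul_le_mul_of_nonneg_left (h1 β hβ) (abs_nonneg _)

theorem DB.mono {N N' : ℕ} {z : En n} {r r' a a' : ℝ} {f : En n → ℝ} (h : DB N z r a f)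
    (hN : N' ≤ N) (hr' : 0 ≤ r') (hr : r' ≤ r) (ha : a ≤ a') : DB N' z r' a' f := by
  intro β hβ
  refine le_trans ?_ ((h β (hβ.trans hN)).trans ha)
  gcongr

/-- jets of order `N` at `z` agree -/
def JE (N : ℕ) (z : En n) (f g : En n → ℝ) : Prop :=
  ∀ β : Fin n → ℕ, sz β ≤ N → pdalpha β f z = pdalpha β g z

theorem JE.iff_DB {N : ℕ} {z : En n} {f g : En n → ℝ} (hf : ContDiff ℝ ∞ f)
    (hg : ContDiff ℝ ∞ g) : JE N z f g ↔ DB N z 1 0 (f - g) := by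
  constructor
  · intro h β hβ
    rw [pdalpha_sub β hf hg]; simp [h β hβ]
  · intro h β hβ
    have := h β hβ
    rw [pdalpha_sub β hf hg] at this
    simp at this
    linarith

theorem smooth_sub {f g : En n → ℝ} (hf : ContDiff ℝ ∞ f) (hg : ContDiff ℝ ∞ g) :
    ContDiff ℝ ∞ (f - g) := hf.sub hg

theorem exists_DB (N : ℕ) (z : En n) (r : ℝ) (f : En n → ℝ) : ∃ a, DB N z r a f := by
  have : {β : Fin n → ℕ | sz β ≤ N}.Finite := by
    apply Set.Finite.subset (Set.finite_Iic (fun _ : Fin n => N))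
    intro β hβ i
    exact (Finset.single_le_sum (f := β) (fun _ _ => Nat.zero_le _) (Finset.mem_univ i)).trans hβ
  obtain ⟨a, ha⟩ := (this.image (fun β => |pdalpha β f z| * r ^ sz β)).bddAbove
  exact ⟨a, fun β hβ => ha ⟨β, hβ, rfl⟩⟩

theorem JE.mul {N : ℕ} {z : En n} {f f' g g' : En n → ℝ} (hf : ContDiff ℝ ∞ f)
    (hf' : ContDiff ℝ ∞ f') (hg : ContDiff ℝ ∞ g) (hg' : ContDiff ℝ ∞ g')
    (h1 : JE N z f f') (h2 : JE N z g g') : JE N z (f * g) (f' * g') := by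
  have aux : ∀ {u u' v : En n → ℝ}, ContDiff ℝ ∞ u → ContDiff ℝ ∞ u' → ContDiff ℝ ∞ v →
      JE N z u u' → JE N z (u * v) (u' * v) := by
    intro u u' v hu hu' hv h
    rw [JE.iff_DB hu hu'] at h
    obtain ⟨b, hb⟩ := exists_DB N z 1 v
    have := h.mul one_pos (smooth_sub hu hu') hv hb
    rw [JE.iff_DB (smooth_mul hu hv) (smooth_mul hu' hv)]
    simpa [sub_mul] using this
  intro β hβ
  rw [aux hf hf' hg h1 β hβ, mul_comm f' g, mul_comm f' g']
  exact aux hg hg' hf' h2 β hβ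

theorem JE.add {N : ℕ} {z : En n} {f f' g g' : En n → ℝ} (hf : ContDiff ℝ ∞ f)
    (hf' : ContDiff ℝ ∞ f') (hg : ContDiff ℝ ∞ g) (hg' : ContDiff ℝ ∞ g')
    (h1 : JE N z f f') (h2 : JE N z g g') : JE N z (f + g) (f' + g') := by
  intro β hβ
  rw [pdalpha_add β hf hg, pdalpha_add β hf' hg']
  simp [h1 β hβ, h2 β hβ]

theorem JE.symm {N : ℕ} {z : En n} {f g : En n → ℝ} (h : JE N z f g) : JE N z g f :=
  fun β hβ => (h β hβ).symm
theorem JE.trans {N : ℕ} {z : En n} {f g u : En n → ℝ} (h : JE N z f g) (h' : JE N z g u) :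
    JE N z f u := fun β hβ => (h β hβ).trans (h' β hβ)
theorem JE.refl {N : ℕ} {z : En n} (f : En n → ℝ) : JE N z f f := fun _ _ => rfl

theorem pd1_eventuallyEq (i : Fin n) {f g : En n → ℝ} {z : En n} (h : f =ᶠ[nhds z] g) :
    pd1 i f =ᶠ[nhds z] pd1 i g := by
  filter_upwards [h.fderiv (𝕜 := ℝ)] with y hy
  simp [pd1, hy]

theorem pdalpha_eventuallyEq (α : Fin n → ℕ) {f g : En n → ℝ} {z : En n} (h : f =ᶠ[nhds z] g) :
    pdalpha α f =ᶠ[nhds z] pdalpha α g := by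
  have key : ∀ (l : List (Fin n)), itl pd1 l α f =ᶠ[nhds z] itl pd1 l α g := by
    intro l
    induction l with
    | nil => simpa [itl]
    | cons j l ih =>
      change (pd1 j)^[α j] (itl pd1 l α f) =ᶠ[nhds z] (pd1 j)^[α j] (itl pd1 l α g)
      generalize α j = N
      induction N with
      | zero => simpa using ih
      | succ N ih2 => 
        rw [Function.iterate_succ_apply', Function.iterate_succ_apply']
        exact pd1_eventuallyEq j ih2
  exact key _

/-! ### mean value estimate -/

theorem abs_fderiv_le {f : En n → ℝ} {z : En n} {b : ℝ} (hb : ∀ i, |pd1 i f z| ≤ b) :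
    ‖fderiv ℝ f z‖ ≤ n * b := by
  rcases Nat.eq_zero_or_pos n with hn | hn
  · subst hn
    have : fderiv ℝ f z = 0 := by
      ext v
      rw [Subsingleton.elim v 0]; simp
    simp [this]
  have hb0 : 0 ≤ b := (abs_nonneg _).trans (hb ⟨0, hn⟩)
  refine ContinuousLinearMap.opNorm_le_bound _ (by positivity) (fun v => ?_)
  have hv : v = ∑ i, v i • EuclideanSpace.single i (1 : ℝ) := by
    ext j
    simp [Finset.sum_apply, Pi.single_apply]
  have : fderiv ℝ f z v = ∑ i, v i * pd1 i f z := by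
    conv_lhs => rw [hv]
    simp [pd1]
  rw [this]
  calc ‖∑ i, v i * pd1 i f z‖ ≤ ∑ i : Fin n, ‖v‖ * b := by
        refine norm_sum_le_of_le _ (fun i _ => ?_)
        rw [norm_mul]
        exact mul_le_mul (PiLp.norm_apply_le v i) (hb i) (abs_nonneg _) (norm_nonneg _)
    _ = n * b * ‖v‖ := by simp; ring

theorem mean_value {f : En n → ℝ} (hf : ContDiff ℝ ∞ f) {x y : En n} {r b : ℝ}
    (hy : dist y x ≤ r) (hb : ∀ z, dist z x ≤ r → ∀ i, |pd1 i f z| ≤ b) :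
    |f y - f x| ≤ n * b * dist y x := by
  have hr : 0 ≤ r := dist_nonneg.trans hy
  have := (convex_closedBall x r).norm_image_sub_le_of_norm_fderiv_le (𝕜 := ℝ) (f := f)
    (C := n * b) (fun z _ => hf.differentiable (by simp) z)
    (fun z hz => abs_fderiv_le (hb z hz)) (Metric.mem_closedBall_self hr) (show y ∈ _ from hy)
  rwa [← dist_eq_norm] at this

end SF

namespace SF

open scoped ContDiff

variable {n : ℕ}

/-- real polynomials in `n` variables -/
abbrev Pol (n : ℕ) : Type := MvPolynomial (Fin n) ℝ

/-- polynomial function -/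
def ev (p : Pol n) : En n → ℝ := fun z => MvPolynomial.eval (fun i => z i) p

theorem ev_add (p q : Pol n) : ev (p + q) = ev p + ev q := by funext z; simp [ev]
theorem ev_sub (p q : Pol n) : ev (p - q) = ev p - ev q := by funext z; simp [ev]
theorem ev_mul (p q : Pol n) : ev (p * q) = ev p * ev q := by funext z; simp [ev]
theorem ev_smul (c : ℝ) (p : Pol n) : ev (c • p) = c • ev p := by
  funext z; simp [ev, MvPolynomial.smul_eval]
theorem ev_neg (p : Pol n) : ev (-p) = -ev p := by funext z; simp [ev]
theorem ev_zero : ev (0 : Pol n) = 0 := by funext z; simp [ev]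
theorem ev_one : ev (1 : Pol n) = 1 := by funext z; simp [ev]

theorem coord_smooth (i : Fin n) : ContDiff ℝ ∞ (fun z : En n => z i) := by fun_prop

theorem pd1_const (i : Fin n) (c : ℝ) : pd1 i (fun _ : En n => c) = 0 := by
  funext z; simp [pd1]

theorem ev_smooth (p : Pol n) : ContDiff ℝ ∞ (ev p) := by
  induction p using MvPolynomial.induction_on with
  | C a =>
    have : ev (MvPolynomial.C a : Pol n) = fun _ => a := by funext z; simp [ev]
    rw [this]; exact contDiff_const
  | add p q hp hq => rw [ev_add]; exact smooth_add hp hq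
  | mul_X p i hp =>
    rw [ev_mul]; refine smooth_mul hp ?_
    have : ev (MvPolynomial.X i : Pol n) = fun z => z i := by funext z; simp [ev]
    rw [this]; exact coord_smooth i

theorem pd1_ev (i : Fin n) (p : Pol n) : pd1 i (ev p) = ev (MvPolynomial.pderiv i p) := by
  induction p using MvPolynomial.induction_on with
  | C a =>
    have : ev (MvPolynomial.C a : Pol n) = fun _ => a := by funext z; simp [ev]
    rw [this, pd1_const, MvPolynomial.pderiv_C, ev_zero]
  | add p q hp hq =>
    rw [ev_add, pd1_add i (ev_smooth p) (ev_smooth q), hp, hq, map_add, ev_add]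
  | mul_X p j hp =>
    rw [ev_mul, pd1_mul i (ev_smooth p) (ev_smooth _), hp, MvPolynomial.pderiv_mul, ev_add,
      ev_mul, ev_mul]
    congr 2
    funext z
    have : fderiv ℝ (ev (MvPolynomial.X j : Pol n)) z = EuclideanSpace.proj j := by
      have h : ev (MvPolynomial.X j : Pol n) = (EuclideanSpace.proj j : En n →L[ℝ] ℝ) := by
        funext w; simp [ev]
      rw [h]; exact ContinuousLinearMap.fderiv _
    simp only [pd1, this, ev, MvPolynomial.pderiv_X]
    by_cases hij : i = j
    · subst hij; simp
    · simp [Ne.symm hij]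

theorem pderiv_comm' (i j : Fin n) (p : Pol n) :
    MvPolynomial.pderiv i (MvPolynomial.pderiv j p) =
      MvPolynomial.pderiv j (MvPolynomial.pderiv i p) := by
  ext s
  simp only [MvPolynomial.coeff_pderiv]
  have : s + Finsupp.single i 1 + Finsupp.single j 1 = s + Finsupp.single j 1 + Finsupp.single i 1 := by
    abel
  rw [this]
  by_cases hij : i = j
  · subst hij; rfl
  · simp [hij, Ne.symm hij]; ring

theorem polyPD_zero (p : Pol n) : polyPD 0 p = p :=
  itl_zero (f := fun i r => MvPolynomial.pderiv i r) _ p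

theorem polyPD_succ (α : Fin n → ℕ) (i : Fin n) (p : Pol n) :
    polyPD (α + Pi.single i 1) p = MvPolynomial.pderiv i (polyPD α p) := by
  have := itl_add (p := fun _ : Pol n => True) (f := fun i r => MvPolynomial.pderiv i r)
    (fun _ _ _ => trivial)
    (fun i j a _ => pderiv_comm' i j a) (List.finRange n) (List.nodup_finRange n) α i p trivial
  rw [if_pos (List.mem_finRange i)] at this
  exact this

theorem polyPD_succ' (α : Fin n → ℕ) (i : Fin n) (p : Pol n) :
    polyPD (α + Pi.single i 1) p = polyPD α (MvPolynomial.pderiv i p) := by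
  rw [polyPD_succ α i]
  exact itl_comm (p := fun _ : Pol n => True) (f := fun i r => MvPolynomial.pderiv i r)
    (fun _ _ _ => trivial)
    (fun i j a _ => pderiv_comm' i j a) (List.finRange n) α i p trivial

theorem pdalpha_ev (α : Fin n → ℕ) (p : Pol n) : pdalpha α (ev p) = ev (polyPD α p) := by
  induction α using mi_induction with
  | h0 => rw [pdalpha_zero, polyPD_zero]
  | hs α i ih => rw [pdalpha_succ α i (ev_smooth p), ih, pd1_ev, polyPD_succ]

theorem polyPDval_eq (α : Fin n → ℕ) (p : Pol n) (x : En n) :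
    polyPDval α p x = pdalpha α (ev p) x := by rw [pdalpha_ev]; rfl

theorem polyPDval_add (α : Fin n → ℕ) (p q : Pol n) (x : En n) :
    polyPDval α (p + q) x = polyPDval α p x + polyPDval α q x := by
  simp only [polyPDval_eq, ev_add, pdalpha_add α (ev_smooth p) (ev_smooth q)]; rfl
theorem polyPDval_sub (α : Fin n → ℕ) (p q : Pol n) (x : En n) :
    polyPDval α (p - q) x = polyPDval α p x - polyPDval α q x := by
  simp only [polyPDval_eq, ev_sub, pdalpha_sub α (ev_smooth p) (ev_smooth q)]; rfl
theorem polyPDval_smul (α : Fin n → ℕ) (c : ℝ) (p : Pol n) (x : En n) :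
    polyPDval α (c • p) x = c * polyPDval α p x := by
  simp only [polyPDval_eq, ev_smul, pdalpha_smul α c (ev_smooth p)]; rfl
theorem polyPDval_neg (α : Fin n → ℕ) (p : Pol n) (x : En n) :
    polyPDval α (-p) x = - polyPDval α p x := by
  have : -p = (-1 : ℝ) • p := by simp
  rw [this, polyPDval_smul]; ring
theorem polyPDval_zero (α : Fin n → ℕ) (x : En n) : polyPDval α (0 : Pol n) x = 0 := by
  have := polyPDval_smul α 0 (0 : Pol n) x
  simpa using this

/-- `polyPDval` as a linear map. -/
def pvL (α : Fin n → ℕ) (x : En n) : Pol n →ₗ[ℝ] ℝ where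
  toFun p := polyPDval α p x
  map_add' p q := polyPDval_add α p q x
  map_smul' c p := by simp [polyPDval_smul]

theorem polyPDval_sum {ι : Type*} (s : Finset ι) (α : Fin n → ℕ) (p : ι → Pol n) (x : En n) :
    polyPDval α (∑ i ∈ s, p i) x = ∑ i ∈ s, polyPDval α (p i) x :=
  map_sum (pvL α x) p s

/-- multi-index as a finsupp -/
abbrev fs (α : Fin n → ℕ) : Fin n →₀ ℕ := Finsupp.equivFunOnFinite.symm α

theorem fs_add_single (α : Fin n → ℕ) (i : Fin n) :
    fs (α + Pi.single i 1) = fs α + Finsupp.single i 1 := by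
  ext j; simp [fs, Finsupp.single_apply, Pi.single_apply, eq_comm]

theorem coeff_polyPD (α : Fin n → ℕ) (p : Pol n) (s : Fin n →₀ ℕ) :
    MvPolynomial.coeff s (polyPD α p) =
      (∏ i, ((s i + 1).ascFactorial (α i) : ℝ)) * MvPolynomial.coeff (s + fs α) p := by
  induction α using mi_induction generalizing p with
  | h0 =>
    have : fs (0 : Fin n → ℕ) = 0 := by ext; simp [fs]
    rw [polyPD_zero, this]; simp
  | hs α i ih =>
    rw [polyPD_succ', ih, MvPolynomial.coeff_pderiv, fs_add_single, ← add_assoc]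
    have : ∏ j, (((s j + 1).ascFactorial ((α + Pi.single i 1 : Fin n → ℕ) j) : ℕ) : ℝ) =
        (∏ j, (((s j + 1).ascFactorial (α j) : ℕ) : ℝ)) * (((s + fs α) i : ℕ) + 1 : ℝ) := by
      rw [← Finset.mul_prod_erase _ _ (Finset.mem_univ i),
        ← Finset.mul_prod_erase _ (fun j => (((s j + 1).ascFactorial (α j) : ℕ) : ℝ)) (Finset.mem_univ i)]
      have h1 : ∏ x ∈ Finset.univ.erase i, (((s x + 1).ascFactorial ((α + Pi.single i 1 : Fin n → ℕ) x) : ℕ) : ℝ)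
        = ∏ x ∈ Finset.univ.erase i, (((s x + 1).ascFactorial (α x) : ℕ) : ℝ) := by
        refine Finset.prod_congr rfl (fun x hx => ?_)
        have : x ≠ i := (Finset.mem_erase.1 hx).1
        simp [Pi.single_eq_of_ne this]
      rw [h1]
      simp only [Pi.add_apply, Pi.single_eq_same, Nat.ascFactorial_succ, Finsupp.add_apply]
      simp [fs]; ring
    rw [this]; ring

theorem polyPD_eq_zero (α : Fin n → ℕ) (p : Pol n) {K : ℕ} (hp : p.totalDegree ≤ K)
    (hα : K < sz α) : polyPD α p = 0 := by
  ext s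
  rw [coeff_polyPD, MvPolynomial.coeff_eq_zero_of_totalDegree_lt]
  · simp
  · refine lt_of_le_of_lt hp (lt_of_lt_of_le hα ?_)
    rw [← Finsupp.degree_apply] 
    simp [Finsupp.degree_eq_sum, fs, sz, Finset.sum_add_distrib]

/-! ### Taylor translation -/

theorem DB_ev_iff {K : ℕ} {x : En n} {r a : ℝ} {p : Pol n} :
    DB K x r a (ev p) ↔ ∀ β : Fin n → ℕ, sz β ≤ K → |polyPDval β p x| * r ^ sz β ≤ a := by
  simp only [DB, polyPDval_eq]

theorem translate_aux {K : ℕ} {p : Pol n} (hp : p.totalDegree ≤ K) {x : En n} {r a : ℝ} (hr : 0 < r)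
    (h : DB K x r a (ev p)) (j : ℕ) : ∀ α : Fin n → ℕ, sz α + j = K + 1 → ∀ y, dist y x ≤ r →
      |polyPDval α p y| * r ^ sz α ≤ (n + 1 : ℝ) ^ j * a ∧
      |polyPDval α p y - polyPDval α p x| * r ^ sz α ≤ (n + 1 : ℝ) ^ j * a * (dist y x / r) := by
  have ha := h.nonneg
  have hn1 : (1 : ℝ) ≤ n + 1 := by linarith [n.cast_nonneg (α := ℝ)]
  induction j with
  | zero =>
    intro α hα y hy
    have : ∀ y, polyPDval α p y = 0 := by
      intro y; rw [polyPDval, polyPD_eq_zero α p hp (by omega)]; simp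
    simp only [this]
    constructor
    · simpa using ha
    · simp; positivity
  | succ j ih =>
    intro α hα y hy
    have key : |polyPDval α p y - polyPDval α p x| * r ^ sz α ≤
        n * ((n + 1 : ℝ) ^ j * a) * (dist y x / r) := by
      have hm := mean_value (f := pdalpha α (ev p)) (pdalpha_smooth α (ev_smooth p)) (x := x) (y := y)
        (r := r) (b := (n + 1 : ℝ) ^ j * a / r ^ (sz α + 1)) hy (by
          intro z hz i
          rw [← pdalpha_succ α i (ev_smooth p), ← polyPDval_eq, le_div_iff₀ (by positivity)]
          have := (ih (α + Pi.single i 1) (by rw [sz_add_single]; omega) z hz).1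
          rwa [sz_add_single] at this)
      rw [polyPDval_eq, polyPDval_eq]
      calc _ ≤ (n * ((n + 1 : ℝ) ^ j * a / r ^ (sz α + 1)) * dist y x) * r ^ sz α := by gcongr
        _ = _ := by rw [pow_succ]; field_simp
    have hpow : (n : ℝ) * ((n + 1 : ℝ) ^ j * a) + (n + 1 : ℝ) ^ j * a = (n + 1 : ℝ) ^ (j + 1) * a := by
      rw [pow_succ]; ring
    have hd : dist y x / r ≤ 1 := (div_le_one hr).2 hy
    have hd0 : 0 ≤ dist y x / r := by positivity
    have hx := DB_ev_iff.1 h α (by omega)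
    have hja : a ≤ (n + 1 : ℝ) ^ j * a := le_mul_of_one_le_left ha (one_le_pow₀ hn1)
    have hnn : 0 ≤ (n : ℝ) * ((n + 1 : ℝ) ^ j * a) := by positivity
    constructor
    · have : |polyPDval α p y| ≤ |polyPDval α p y - polyPDval α p x| + |polyPDval α p x| := by
        have := abs_add_le (polyPDval α p y - polyPDval α p x) (polyPDval α p x)
        simpa using this
      calc _ ≤ (|polyPDval α p y - polyPDval α p x| + |polyPDval α p x|) * r ^ sz α := by gcongr
        _ ≤ n * ((n + 1 : ℝ) ^ j * a) * (dist y x / r) + a := by rw [add_mul]; gcongr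
        _ ≤ n * ((n + 1 : ℝ) ^ j * a) + (n + 1 : ℝ) ^ j * a := by
          have := mul_le_mul_of_nonneg_left hd hnn
          linarith
        _ = _ := hpow
    · refine key.trans ?_
      rw [← hpow]
      refine mul_le_mul_of_nonneg_right ?_ hd0
      have : 0 ≤ (n + 1 : ℝ) ^ j * a := by positivity
      linarith

/-- the translation constant -/
def TC (n K : ℕ) : ℝ := (n + 1 : ℝ) ^ (K + 1)

theorem TC_one_le (n K : ℕ) : 1 ≤ TC n K := by
  apply one_le_pow₀
  linarith [n.cast_nonneg (α := ℝ)]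

theorem pow_le_TC {n K j : ℕ} (h : j ≤ K + 1) : (n + 1 : ℝ) ^ j ≤ TC n K :=
  pow_le_pow_right₀ (by linarith [n.cast_nonneg (α := ℝ)]) h

theorem DB.translate {K : ℕ} {p : Pol n} (hp : p.totalDegree ≤ K) {x y : En n} {r a : ℝ} (hr : 0 < r)
    (h : DB K x r a (ev p)) (hy : dist y x ≤ r) : DB K y r (TC n K * a) (ev p) := by
  rw [DB_ev_iff]
  intro β hβ
  refine (translate_aux hp hr h (K + 1 - sz β) β (by omega) y hy).1.trans ?_
  exact mul_le_mul_of_nonneg_right (pow_le_TC (by omega)) h.nonneg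

theorem DB.translate_diff {K : ℕ} {p : Pol n} (hp : p.totalDegree ≤ K) {x y : En n} {r a : ℝ}
    (hr : 0 < r) (h : DB K x r a (ev p)) (hy : dist y x ≤ r) (α : Fin n → ℕ) (hα : sz α ≤ K) :
    |polyPDval α p y - polyPDval α p x| * r ^ sz α ≤ TC n K * a * (dist y x / r) := by
  refine (translate_aux hp hr h (K + 1 - sz α) α (by omega) y hy).2.trans ?_
  refine mul_le_mul_of_nonneg_right ?_ (by positivity)
  exact mul_le_mul_of_nonneg_right (pow_le_TC (by omega)) h.nonneg

/-- uniqueness of a polynomial with given jet -/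
theorem pol_ext {K : ℕ} {p q : Pol n} (hp : p.totalDegree ≤ K) (hq : q.totalDegree ≤ K) (x : En n)
    (h : ∀ α : Fin n → ℕ, sz α ≤ K → polyPDval α p x = polyPDval α q x) : p = q := by
  have hd : (p - q).totalDegree ≤ K := (MvPolynomial.totalDegree_sub _ _).trans (max_le hp hq)
  rw [← sub_eq_zero]
  apply MvPolynomial.funext
  intro y
  have h0 : DB K x (dist (WithLp.toLp 2 y) x + 1) 0 (ev (p - q)) := by
    rw [DB_ev_iff]
    intro β hβ
    rw [polyPDval_sub, h β hβ]; simp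
  have := DB_ev_iff.1 (h0.translate hd (by positivity) (y := WithLp.toLp 2 y) (by linarith)) 0
    (by simp [sz])
  simp [sz, polyPDval, polyPD_zero] at this
  simpa using this

/-! ### Taylor polynomials -/

/-- shift a polynomial: `q(X - x)` -/
def sh (x : En n) (q : Pol n) : Pol n :=
  MvPolynomial.bind₁ (fun i => MvPolynomial.X i - MvPolynomial.C (x i)) q

theorem eval_sh (x : En n) (q : Pol n) (z : Fin n → ℝ) :
    MvPolynomial.eval z (sh x q) = MvPolynomial.eval (fun i => z i - x i) q := by
  induction q using MvPolynomial.induction_on with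
  | C a => simp [sh]
  | add p q hp hq => simp only [sh, map_add] at *; rw [hp, hq]
  | mul_X p i hp => simp only [sh, map_mul, MvPolynomial.bind₁_X_right] at *; rw [hp]; simp

theorem pderiv_sh (x : En n) (i : Fin n) (q : Pol n) :
    MvPolynomial.pderiv i (sh x q) = sh x (MvPolynomial.pderiv i q) := by
  induction q using MvPolynomial.induction_on with
  | C a => simp [sh]
  | add p q hp hq => simp only [sh, map_add] at *; rw [hp, hq]
  | mul_X p j hp =>
    simp only [sh, map_mul, MvPolynomial.bind₁_X_right, MvPolynomial.pderiv_mul, map_add] at *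
    rw [hp]
    by_cases hij : j = i
    · subst hij; simp
    · simp [MvPolynomial.pderiv_X_of_ne hij]

theorem polyPD_sh (x : En n) (α : Fin n → ℕ) (q : Pol n) : polyPD α (sh x q) = sh x (polyPD α q) := by
  induction α using mi_induction with
  | h0 => simp [polyPD_zero]
  | hs α i ih => rw [polyPD_succ, ih, pderiv_sh, polyPD_succ]

theorem polyPDval_sh (x z : En n) (α : Fin n → ℕ) (q : Pol n) :
    polyPDval α (sh x q) z = polyPDval α q (z - x) := by
  rw [polyPDval, polyPD_sh, eval_sh]; rfl

/-- multi-index factorial -/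
def mf (α : Fin n → ℕ) : ℝ := ((∏ i, Nat.factorial (α i) : ℕ) : ℝ)

theorem mf_pos (α : Fin n → ℕ) : 0 < mf α := by
  unfold mf
  exact_mod_cast Finset.prod_pos (fun i _ => Nat.factorial_pos _)

theorem polyPDval_at_zero (α : Fin n → ℕ) (q : Pol n) :
    polyPDval α q 0 = mf α * MvPolynomial.coeff (fs α) q := by
  have h := coeff_polyPD α q 0
  have h2 : MvPolynomial.eval (fun i => (0 : En n) i) (polyPD α q) =
      MvPolynomial.coeff 0 (polyPD α q) := by
    have : (fun i => (0 : En n) i) = (0 : Fin n → ℝ) := by funext i; simp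
    rw [this, MvPolynomial.eval_zero, MvPolynomial.constantCoeff_eq]
  rw [polyPDval, h2, h]
  simp [mf, Nat.one_ascFactorial]

theorem totalDegree_sh {K : ℕ} (x : En n) {q : Pol n} (hq : q.totalDegree ≤ K) :
    (sh x q).totalDegree ≤ K := by
  have hX : ∀ i : Fin n, (MvPolynomial.X i - MvPolynomial.C (x i) : Pol n).totalDegree ≤ 1 := by
    intro i
    refine (MvPolynomial.totalDegree_sub _ _).trans (max_le ?_ ?_)
    · simp
    · simp
  rw [MvPolynomial.as_sum q, sh, map_sum]
  refine MvPolynomial.totalDegree_finsetSum_le (fun s hs => ?_)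
  rw [MvPolynomial.bind₁_monomial]
  refine (MvPolynomial.totalDegree_mul _ _).trans ?_
  rw [MvPolynomial.totalDegree_C, zero_add]
  refine (MvPolynomial.totalDegree_finsetProd _ _).trans ?_
  refine le_trans (Finset.sum_le_sum (g := fun i => s i) (fun i _ => ?_)) ?_
  · refine (MvPolynomial.totalDegree_pow _ _).trans ?_
    have := Nat.mul_le_mul_left (s i) (hX i)
    simpa using this
  · exact (MvPolynomial.le_totalDegree hs).trans hq

theorem taylorTrunc_eq (k : ℕ) (x : En n) (p : Pol n) :
    taylorTrunc k x p = sh x (truncDeg k (sh (-x) p)) := by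
  simp [taylorTrunc, sh]

theorem coeff_truncDeg (k : ℕ) (p : Pol n) (s : Fin n →₀ ℕ) :
    MvPolynomial.coeff s (truncDeg k p) = if s.degree ≤ k then MvPolynomial.coeff s p else 0 := by
  simp only [truncDeg, MvPolynomial.coeff_sum, MvPolynomial.coeff_monomial]
  rw [Finset.sum_ite_eq' ]
  simp only [Finset.mem_filter, MvPolynomial.mem_support_iff]
  have : (s.sum fun _ e => e) = s.degree := by simp [Finsupp.degree_apply, Finsupp.sum]
  rw [this]
  by_cases h : s.degree ≤ k
  · by_cases h0 : MvPolynomial.coeff s p = 0 <;> simp [h, h0]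
  · simp [h]

theorem degree_fs (α : Fin n → ℕ) : (fs α).degree = sz α := by
  simp [Finsupp.degree_eq_sum, fs, sz]

theorem taylorTrunc_deg (k : ℕ) (x : En n) (p : Pol n) : (taylorTrunc k x p).totalDegree ≤ k := by
  rw [taylorTrunc_eq]
  apply totalDegree_sh
  refine Finset.sup_le (fun s hs => ?_)
  rw [MvPolynomial.mem_support_iff, coeff_truncDeg] at hs
  by_contra hc
  rw [if_neg] at hs
  · exact hs rfl
  · simpa [Finsupp.degree_apply, Finsupp.sum] using hc

theorem taylorTrunc_val (k : ℕ) (x : En n) (p : Pol n) (α : Fin n → ℕ) (hα : sz α ≤ k) :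
    polyPDval α (taylorTrunc k x p) x = polyPDval α p x := by
  rw [taylorTrunc_eq, polyPDval_sh, sub_self, polyPDval_at_zero, coeff_truncDeg, degree_fs,
    if_pos hα, ← polyPDval_at_zero, polyPDval_sh]
  simp

theorem odot_deg (k : ℕ) (x : En n) (p q : Pol n) : (odot k x p q).totalDegree ≤ k :=
  taylorTrunc_deg k x _

theorem odot_JE (k : ℕ) (x : En n) (p q : Pol n) : JE k x (ev (odot k x p q)) (ev p * ev q) := by
  intro β hβ
  rw [← polyPDval_eq, ← ev_mul, ← polyPDval_eq]
  exact taylorTrunc_val k x _ β hβ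

/-- polynomial with prescribed derivatives -/
def jetC (m : ℕ) (c : (Fin n → ℕ) → ℝ) (x : En n) : Pol n :=
  ∑ α ∈ (Finset.univ : Finset (Fin n → Fin m)).filter (fun α => (∑ i, (α i : ℕ)) ≤ m - 1),
    MvPolynomial.C (c (fun i => (α i : ℕ)) / ((∏ i, Nat.factorial (α i : ℕ) : ℕ) : ℝ))
      * ∏ i, (MvPolynomial.X i - MvPolynomial.C (x i)) ^ ((α i : ℕ))

theorem jetC_term (a : ℝ) (α : Fin n → ℕ) (x : En n) :
    (MvPolynomial.C a * ∏ i, (MvPolynomial.X i - MvPolynomial.C (x i)) ^ (α i) : Pol n) =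
      sh x (MvPolynomial.monomial (fs α) a) := by
  rw [MvPolynomial.monomial_eq, Finsupp.prod_fintype _ _ (by simp)]
  simp [sh, fs, map_prod]

theorem jetC_deg (k : ℕ) (c : (Fin n → ℕ) → ℝ) (x : En n) : (jetC (k + 1) c x).totalDegree ≤ k := by
  refine MvPolynomial.totalDegree_finsetSum_le (fun α hα => ?_)
  rw [jetC_term _ (fun i => (α i : ℕ)) x]
  apply totalDegree_sh
  refine (MvPolynomial.totalDegree_monomial_le _ _).trans ?_
  have := (Finset.mem_filter.1 hα).2
  have e := degree_fs (fun i => (α i : ℕ))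
  simp only [Nat.add_sub_cancel] at this
  rw [Finsupp.degree_apply] at e
  rw [Finsupp.sum]
  exact (le_of_eq e).trans this

theorem jetC_val (k : ℕ) (c : (Fin n → ℕ) → ℝ) (x : En n) (β : Fin n → ℕ) (hβ : sz β ≤ k) :
    polyPDval β (jetC (k + 1) c x) x = c β := by
  rw [jetC, polyPDval_sum]
  have hlt : ∀ i, β i < k + 1 := by
    intro i
    have := (Finset.single_le_sum (f := β) (fun _ _ => Nat.zero_le _) (Finset.mem_univ i)).trans hβ
    omega
  rw [Finset.sum_eq_single (fun i => (⟨β i, hlt i⟩ : Fin (k + 1)))]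
  · rw [jetC_term _ (fun i => ((⟨β i, hlt i⟩ : Fin (k + 1)) : ℕ)) x, polyPDval_sh, sub_self,
      polyPDval_at_zero]
    simp only [MvPolynomial.coeff_monomial, if_true]
    have := mf_pos β
    unfold mf at *
    field_simp
  · intro α _ hα
    rw [jetC_term _ (fun i => (α i : ℕ)) x, polyPDval_sh, sub_self,
      polyPDval_at_zero]
    simp only [MvPolynomial.coeff_monomial]
    rw [if_neg]
    · simp
    · intro h
      apply hα
      have := Finsupp.equivFunOnFinite.symm.injective h
      funext i
      exact Fin.ext (congrFun this i)
  · intro h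
    exfalso; apply h
    simpa using hβ

theorem jetScalar_eq (m : ℕ) (f : En n → ℝ) (x : En n) :
    jetScalar m f x = jetC m (fun α => pdalpha α f x) x := rfl

theorem jetScalarW_eq (m : ℕ) (s : Set (En n)) (f : En n → ℝ) (x : En n) :
    jetScalarW m s f x = jetC m (fun α => pdalphaW s α f x) x := rfl

/-- the `k`-jet of a smooth function as polynomial -/
def jt (k : ℕ) (f : En n → ℝ) (x : En n) : Pol n := jetScalar (k + 1) f x

theorem jt_deg (k : ℕ) (f : En n → ℝ) (x : En n) : (jt k f x).totalDegree ≤ k := by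
  rw [jt, jetScalar_eq]; exact jetC_deg k _ x

theorem jt_val (k : ℕ) (f : En n → ℝ) (x : En n) (β : Fin n → ℕ) (hβ : sz β ≤ k) :
    polyPDval β (jt k f x) x = pdalpha β f x := by
  rw [jt, jetScalar_eq]; exact jetC_val k _ x β hβ

theorem jt_JE (k : ℕ) (f : En n → ℝ) (x : En n) : JE k x (ev (jt k f x)) f := by
  intro β hβ; rw [← polyPDval_eq, jt_val k f x β hβ]

theorem pol_ext_JE {K : ℕ} {p q : Pol n} (hp : p.totalDegree ≤ K) (hq : q.totalDegree ≤ K) (x : En n)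
    (h : JE K x (ev p) (ev q)) : p = q :=
  pol_ext hp hq x (fun α hα => by rw [polyPDval_eq, polyPDval_eq, h α hα])

theorem jt_ev {K : ℕ} {p : Pol n} (hp : p.totalDegree ≤ K) (x : En n) : jt K (ev p) x = p :=
  pol_ext_JE (jt_deg K _ x) hp x (jt_JE K _ x)

theorem jt_congr {K : ℕ} {f g : En n → ℝ} {x : En n} (h : JE K x f g) : jt K f x = jt K g x :=
  pol_ext_JE (jt_deg K _ x) (jt_deg K _ x) x
    (((jt_JE K f x).trans h).trans (jt_JE K g x).symm)

theorem odot_jt (k : ℕ) (x : En n) {f g : En n → ℝ} (hf : ContDiff ℝ ∞ f) (hg : ContDiff ℝ ∞ g)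
    {p q : Pol n} (h1 : JE k x (ev p) f) (h2 : JE k x (ev q) g) : odot k x p q = jt k (f * g) x :=
  pol_ext_JE (odot_deg k x p q) (jt_deg k _ x) x
    (((odot_JE k x p q).trans (JE.mul (ev_smooth p) hf (ev_smooth q) hg h1 h2)).trans
      (jt_JE k _ x).symm)

end SF

namespace SF

open scoped ContDiff

variable {n : ℕ}

/-- vector polynomials -/
abbrev VPol (n D : ℕ) : Type := Fin D → Pol n

/-- `|P|_{x,δ} ≤ c`. -/
def NB (k : ℕ) {D : ℕ} (x : En n) (δ c : ℝ) (P : VPol n D) : Prop :=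
  ∀ j, ∀ α : Fin n → ℕ, sz α ≤ k → |polyPDval α (P j) x| ≤ c * δ ^ (k + 1 - sz α)

/-- degree bound -/
def VD (k : ℕ) {D : ℕ} (P : VPol n D) : Prop := ∀ j, (P j).totalDegree ≤ k

section basic
variable {k D : ℕ} {x y : En n} {δ c : ℝ} {P Q : VPol n D}

theorem NB_iff (hδ : 0 < δ) : NB k x δ c P ↔ ∀ j, DB k x δ (c * δ ^ (k + 1)) (ev (P j)) := by
  have e : ∀ α : Fin n → ℕ, sz α ≤ k → δ ^ (k + 1) = δ ^ (k + 1 - sz α) * δ ^ sz α := by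
    intro α hα; rw [← pow_add]; congr 1; omega
  constructor
  · intro h j
    rw [DB_ev_iff]
    intro α hα
    rw [e α hα, ← mul_assoc]
    exact mul_le_mul_of_nonneg_right (h j α hα) (by positivity)
  · intro h j α hα
    have := DB_ev_iff.1 (h j) α hα
    rw [e α hα, ← mul_assoc] at this
    exact le_of_mul_le_mul_right this (by positivity)

theorem VD.add (h1 : VD k P) (h2 : VD k Q) : VD k (P + Q) := fun j =>
  (MvPolynomial.totalDegree_add _ _).trans (max_le (h1 j) (h2 j))
theorem VD.sub (h1 : VD k P) (h2 : VD k Q) : VD k (P - Q) := fun j =>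
  (MvPolynomial.totalDegree_sub _ _).trans (max_le (h1 j) (h2 j))
theorem VD.smul (t : ℝ) (h1 : VD k P) : VD k (t • P) := fun j =>
  (MvPolynomial.totalDegree_smul_le _ _).trans (h1 j)
theorem VD.zero : VD k (0 : VPol n D) := fun j => by simp
theorem VD.neg (h1 : VD k P) : VD k (-P) := fun j => by simpa using h1 j
theorem VD.sum {ι : Type*} (s : Finset ι) (f : ι → VPol n D) (h : ∀ i ∈ s, VD k (f i)) :
    VD k (∑ i ∈ s, f i) := by
  induction s using Finset.induction_on with
  | empty => simpa using VD.zero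
  | insert a s ha ih =>
    rw [Finset.sum_insert ha]
    exact (h a (by simp)).add (ih (fun i hi => h i (by simp [hi])))

theorem NB.add {c' : ℝ} (h1 : NB k x δ c P) (h2 : NB k x δ c' Q) : NB k x δ (c + c') (P + Q) := by
  intro j α hα
  rw [Pi.add_apply, polyPDval_add, add_mul]
  exact (abs_add_le _ _).trans (add_le_add (h1 j α hα) (h2 j α hα))
theorem NB.smul (t : ℝ) (h1 : NB k x δ c P) : NB k x δ (|t| * c) (t • P) := by
  intro j α hα
  rw [Pi.smul_apply, polyPDval_smul, abs_mul, mul_assoc]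
  exact mul_le_mul_of_nonneg_left (h1 j α hα) (abs_nonneg _)
theorem NB.neg (h1 : NB k x δ c P) : NB k x δ c (-P) := by
  have := h1.smul (-1)
  simpa using this
theorem NB.sub {c' : ℝ} (h1 : NB k x δ c P) (h2 : NB k x δ c' Q) : NB k x δ (c + c') (P - Q) := by
  rw [sub_eq_add_neg]; exact h1.add h2.neg
theorem NB.zero (hδ : 0 ≤ δ) (hc : 0 ≤ c) : NB k x δ c (0 : VPol n D) := by
  intro j α hα
  rw [Pi.zero_apply, polyPDval_zero, abs_zero]; positivity
theorem NB.mono {c' : ℝ} (hδ : 0 ≤ δ) (h1 : NB k x δ c P) (h : c ≤ c') : NB k x δ c' P := by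
  intro j α hα
  exact (h1 j α hα).trans (by gcongr)
theorem NB.symm' (h1 : NB k x δ c (P - Q)) : NB k x δ c (Q - P) := by
  have := h1.neg; rwa [neg_sub] at this
/-- enlarging the scale: constants improve by the ratio -/
theorem NB.up {δ' : ℝ} (hδ : 0 < δ) (hδ' : δ ≤ δ') (hc : 0 ≤ c) (h1 : NB k x δ c P) :
    NB k x δ' (c * (δ / δ')) P := by
  intro j α hα
  refine (h1 j α hα).trans ?_
  have hp : 0 < δ' := hδ.trans_le hδ'
  obtain ⟨e, he⟩ : ∃ e, k + 1 - sz α = e + 1 := ⟨k - sz α, by omega⟩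
  rw [he, mul_assoc]
  refine mul_le_mul_of_nonneg_left ?_ hc
  have : δ / δ' * δ' ^ (e + 1) = δ * δ' ^ e := by rw [pow_succ]; field_simp
  rw [this, pow_succ, mul_comm]
  gcongr
theorem NB.up' {δ' : ℝ} (hδ : 0 ≤ δ) (hδ' : δ ≤ δ') (hc : 0 ≤ c) (h1 : NB k x δ c P) :
    NB k x δ' c P := by
  intro j α hα
  refine (h1 j α hα).trans ?_
  gcongr
/-- shrinking the scale -/
theorem NB.down {δ' R : ℝ} (hδ' : 0 ≤ δ') (hR : 1 ≤ R) (hδ : δ ≤ R * δ') (hδ0 : 0 ≤ δ) (hc : 0 ≤ c)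
    (h1 : NB k x δ c P) : NB k x δ' (c * R ^ (k + 1)) P := by
  intro j α hα
  refine (h1 j α hα).trans ?_
  rw [mul_assoc]
  refine mul_le_mul_of_nonneg_left ?_ hc
  calc δ ^ (k + 1 - sz α) ≤ (R * δ') ^ (k + 1 - sz α) := by gcongr
    _ = R ^ (k + 1 - sz α) * δ' ^ (k + 1 - sz α) := mul_pow _ _ _
    _ ≤ R ^ (k + 1) * δ' ^ (k + 1 - sz α) := by
      refine mul_le_mul_of_nonneg_right ?_ (by positivity)
      exact pow_le_pow_right₀ hR (by omega)
theorem NB.translate (hP : VD k P) (hδ : 0 < δ) (h1 : NB k x δ c P) (hy : dist y x ≤ δ) :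
    NB k y δ (TC n k * c) P := by
  rw [NB_iff hδ] at *
  intro j
  have := (h1 j).translate (hP j) hδ hy
  rwa [← mul_assoc] at this
theorem NB.nonneg [NeZero D] (hδ : 0 < δ) (h1 : NB k x δ c P) : 0 ≤ c := by
  have := (abs_nonneg _).trans (h1 0 0 (by simp [sz]))
  exact nonneg_of_mul_nonneg_left this (by positivity)
end basic

/-- The data of a shape field. -/
structure SD (n k D : ℕ) (Cw : ℝ) where
  E : Finset (En n)
  Γ : En n → ℝ → Set (VPol n D)
  dm : ℝ
  dm_pos : 0 < dm
  shape : IsShapeField k D E Γ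
  conv : SFConvex k D E Γ Cw dm

/-- Whitney convexity in terms of smooth functions. -/
theorem WC {k D : ℕ} {Cw : ℝ} (sd : SD n k D Cw) {x : En n} (hx : x ∈ sd.E) {M B δ : ℝ} (hM : 0 < M)
    (hB : 1 ≤ B) (hδ : 0 < δ) (hδm : δ ≤ sd.dm) {P₁ P₂ R : VPol n D} (h1 : P₁ ∈ sd.Γ x M)
    (h2 : P₂ ∈ sd.Γ x M) (h12 : NB k x δ M (P₁ - P₂)) {θ₁ θ₂ : En n → ℝ} (hθ₁ : ContDiff ℝ ∞ θ₁)
    (hθ₂ : ContDiff ℝ ∞ θ₂) (hJ : JE k x (θ₁ * θ₁ + θ₂ * θ₂) 1) (hb₁ : DB k x δ B θ₁)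
    (hb₂ : DB k x δ B θ₂) (hR : VD k R)
    (hRJ : ∀ j, JE k x (ev (R j)) (θ₁ * θ₁ * ev (P₁ j) + θ₂ * θ₂ * ev (P₂ j))) :
    R ∈ sd.Γ x (Cw * (M * B ^ (k + 1))) := by
  have hB0 : 0 < B := by linarith
  have hM' : 0 < M * B ^ (k + 1) := by positivity
  have hMle : M ≤ M * B ^ (k + 1) := le_mul_of_one_le_right hM.le (one_le_pow₀ hB)
  have hmon := sd.shape.2.2 x hx M (M * B ^ (k + 1)) hM hMle
  have hsq : θ₁ x * θ₁ x + θ₂ x * θ₂ x = 1 := by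
    have := hJ 0 (by simp [sz])
    simpa [pdalpha_zero] using this
  have ev1 : JE k x (ev (jt k θ₁ x)) θ₁ := jt_JE k θ₁ x
  have ev2 : JE k x (ev (jt k θ₂ x)) θ₂ := jt_JE k θ₂ x
  have o1 : odot k x (jt k θ₁ x) (jt k θ₁ x) = jt k (θ₁ * θ₁) x := odot_jt k x hθ₁ hθ₁ ev1 ev1
  have o2 : odot k x (jt k θ₂ x) (jt k θ₂ x) = jt k (θ₂ * θ₂) x := odot_jt k x hθ₂ hθ₂ ev2 ev2
  have bq : ∀ θ : En n → ℝ, |θ x| ≤ 1 → DB k x δ B θ → ∀ α : Fin n → ℕ, sz α ≤ k →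
      |polyPDval α (jt k θ x) x| ≤ (δ / B) ^ (-((∑ i, α i : ℕ) : ℤ)) := by
    intro θ h0 hb α hα
    rw [jt_val k θ x α hα, zpow_neg, zpow_natCast, div_pow, inv_div, le_div_iff₀ (by positivity)]
    rcases Nat.eq_zero_or_pos (sz α) with hz | hz
    · rw [sz_eq_zero hz]
      simpa [pdalpha_zero] using h0
    · refine (hb α hα).trans ?_
      exact le_self_pow₀ hB hz.ne'
  have hθ1 : |θ₁ x| ≤ 1 := abs_le_one_iff_mul_self_le_one.2 (by nlinarith [mul_self_nonneg (θ₂ x)])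
  have hθ2 : |θ₂ x| ≤ 1 := abs_le_one_iff_mul_self_le_one.2 (by nlinarith [mul_self_nonneg (θ₁ x)])
  have key := sd.conv (δ / B) (by positivity) ((div_le_self hδ.le hB).trans hδm) x hx
    (M * B ^ (k + 1)) hM' P₁ P₂ (hmon h1) (hmon h2) (jt k θ₁ x) (jt k θ₂ x)
    (jt_deg k _ x) (jt_deg k _ x)
    (by
      intro α hα j
      have := (h12.down (δ' := δ / B) (R := B) (by positivity) hB (by field_simp; rfl) hδ.le hM.le) j α hα
      simpa using this)
    (fun α hα => ⟨bq θ₁ hθ1 hb₁ α hα, bq θ₂ hθ2 hb₂ α hα⟩)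
    (by
      rw [o1, o2]
      refine pol_ext_JE (K := k) ((MvPolynomial.totalDegree_add _ _).trans
        (max_le (jt_deg k _ x) (jt_deg k _ x))) (by simp) x ?_
      rw [ev_add, ev_one]
      exact (JE.add (ev_smooth _) (smooth_mul hθ₁ hθ₁) (ev_smooth _) (smooth_mul hθ₂ hθ₂)
        (jt_JE k _ x) (jt_JE k _ x)).trans hJ)
  convert key using 1
  funext j
  rw [o1, o2]
  refine pol_ext_JE (hR j) ((MvPolynomial.totalDegree_add _ _).trans
        (max_le (odot_deg k x _ _) (odot_deg k x _ _))) x ?_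
  rw [ev_add]
  refine (hRJ j).trans (JE.symm ?_)
  refine JE.add (ev_smooth _) (smooth_mul (smooth_mul hθ₁ hθ₁) (ev_smooth _)) (ev_smooth _)
    (smooth_mul (smooth_mul hθ₂ hθ₂) (ev_smooth _)) ?_ ?_
  · exact (odot_JE k x _ _).trans (JE.mul (ev_smooth _) (smooth_mul hθ₁ hθ₁) (ev_smooth _)
      (ev_smooth _) (jt_JE k _ x) (JE.refl _))
  · exact (odot_JE k x _ _).trans (JE.mul (ev_smooth _) (smooth_mul hθ₂ hθ₂) (ev_smooth _)
      (ev_smooth _) (jt_JE k _ x) (JE.refl _))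

/-! ### symmetric differences -/

/-- `w` with `P ± w ∈ G`. -/
def PM {V : Type*} [AddCommGroup V] (G : Set V) (P : V) : Set V := {w | P + w ∈ G ∧ P - w ∈ G}

set_option linter.unusedSectionVars false
section PM
variable {V : Type*} [AddCommGroup V] [Module ℝ V] {G : Set V} {P w : V}

theorem PM.convex (hG : Convex ℝ G) (P : V) : Convex ℝ (PM G P) := by
  intro a ha b hb s t hs ht hst
  refine ⟨?_, ?_⟩
  · have := hG ha.1 hb.1 hs ht hst
    convert this using 1
    rw [smul_add, smul_add]
    calc P + (s • a + t • b) = (s + t) • P + (s • a + t • b) := by rw [hst, one_smul]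
      _ = _ := by rw [add_smul]; abel
  · have := hG ha.2 hb.2 hs ht hst
    convert this using 1
    rw [smul_sub, smul_sub]
    calc P - (s • a + t • b) = (s + t) • P - (s • a + t • b) := by rw [hst, one_smul]
      _ = _ := by rw [add_smul]; abel

theorem PM.neg (h : w ∈ PM G P) : -w ∈ PM G P := ⟨by simpa [sub_eq_add_neg] using h.2, by simpa using h.1⟩

theorem PM.base (hG : Convex ℝ G) (h : w ∈ PM G P) : P ∈ G := by
  have := hG h.1 h.2 (a := 1 / 2) (b := 1 / 2) (by norm_num) (by norm_num) (by norm_num)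
  convert this using 1
  rw [← smul_add]
  have : P + w + (P - w) = (2 : ℝ) • P := by rw [two_smul]; abel
  rw [this, smul_smul]; norm_num

theorem PM.zero (h : P ∈ G) : (0 : V) ∈ PM G P := ⟨by simpa, by simpa⟩

theorem PM.sum {ι : Type*} (hG : Convex ℝ G) (hP : P ∈ G) (s : Finset ι) (c : ι → ℝ) (w : ι → V)
    (hw : ∀ i ∈ s, w i ∈ PM G P) (hc : ∑ i ∈ s, |c i| ≤ 1) : ∑ i ∈ s, c i • w i ∈ PM G P := by
  have key : ∃ v ∈ PM G P, ∑ i ∈ s, c i • w i = (∑ i ∈ s, |c i|) • v := by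
    clear hc
    induction s using Finset.induction_on with
    | empty => exact ⟨0, PM.zero hP, by simp⟩
    | insert a s ha ih =>
      obtain ⟨v, hv, e⟩ := ih (fun i hi => hw i (by simp [hi]))
      rw [Finset.sum_insert ha, Finset.sum_insert ha, e]
      set S := ∑ i ∈ s, |c i| with hS
      have hS0 : 0 ≤ S := Finset.sum_nonneg (fun _ _ => abs_nonneg _)
      have hwa := hw a (by simp)
      obtain ⟨u, hu, eu⟩ : ∃ u ∈ PM G P, c a • w a = |c a| • u := by
        rcases le_total 0 (c a) with h | h
        · exact ⟨w a, hwa, by rw [abs_of_nonneg h]⟩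
        · exact ⟨-w a, PM.neg hwa, by rw [abs_of_nonpos h]; simp⟩
      rw [eu]
      by_cases h0 : |c a| + S = 0
      · have h1 : |c a| = 0 := by linarith [abs_nonneg (c a)]
        have h2 : S = 0 := by linarith [abs_nonneg (c a)]
        exact ⟨0, PM.zero hP, by simp [h1, h2]⟩
      · have hpos : 0 < |c a| + S := lt_of_le_of_ne (by positivity) (Ne.symm h0)
        refine ⟨(|c a| / (|c a| + S)) • u + (S / (|c a| + S)) • v,
          PM.convex hG P hu hv (by positivity) (by positivity) (by field_simp), ?_⟩
        rw [smul_add, smul_smul, smul_smul]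
        congr 2 <;> field_simp
  obtain ⟨v, hv, e⟩ := key
  rw [e]
  have := PM.convex hG P hv (PM.zero hP) (a := ∑ i ∈ s, |c i|) (b := 1 - ∑ i ∈ s, |c i|)
    (Finset.sum_nonneg (fun _ _ => abs_nonneg _)) (by linarith) (by ring)
  simpa using this

theorem PM.smul (hG : Convex ℝ G) (h : w ∈ PM G P) {t : ℝ} (ht : |t| ≤ 1) : t • w ∈ PM G P := by
  have := PM.sum hG (PM.base hG h) {()} (fun _ => t) (fun _ => w) (by simpa using h) (by simpa using ht)
  simpa using this

theorem PM.mono {G' : Set V} (hGG : G ⊆ G') (h : w ∈ PM G P) : w ∈ PM G' P := ⟨hGG h.1, hGG h.2⟩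

end PM

/-! ### the refinements `Γ_l` -/

variable {k D : ℕ} {Cw : ℝ}

/-- iterated refinement of the shape field -/
def SD.G (sd : SD n k D Cw) : ℕ → En n → ℝ → Set (VPol n D)
  | 0 => sd.Γ
  | l + 1 => fun x t => {P | P ∈ sd.G l x t ∧
      ∀ y ∈ sd.E, ∃ P' ∈ sd.G l y t, NB k x (dist x y) t (P - P')}

theorem SD.G_convex (sd : SD n k D Cw) (l : ℕ) {x : En n} (hx : x ∈ sd.E) {t : ℝ} (ht : 0 < t) :
    Convex ℝ (sd.G l x t) := by
  induction l generalizing x with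
  | zero => exact sd.shape.1 x hx t ht
  | succ l ih =>
    intro P hP Q hQ a b ha hb hab
    refine ⟨ih hx hP.1 hQ.1 ha hb hab, fun y hy => ?_⟩
    obtain ⟨P', hP', e1⟩ := hP.2 y hy
    obtain ⟨Q', hQ', e2⟩ := hQ.2 y hy
    refine ⟨a • P' + b • Q', ih hy hP' hQ' ha hb hab, ?_⟩
    have := (e1.smul a).add (e2.smul b)
    rw [abs_of_nonneg ha, abs_of_nonneg hb, ← add_mul, hab, one_mul] at this
    convert this using 1
    rw [smul_sub, smul_sub]; abel

theorem SD.G_deg (sd : SD n k D Cw) (l : ℕ) {x : En n} (hx : x ∈ sd.E) {t : ℝ} (ht : 0 < t)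
    {P : VPol n D} (hP : P ∈ sd.G l x t) : VD k P := by
  induction l generalizing x with
  | zero => exact sd.shape.2.1 x hx t ht P hP
  | succ l ih => exact ih hx hP.1

theorem SD.G_mono (sd : SD n k D Cw) (l : ℕ) {x : En n} (hx : x ∈ sd.E) {t t' : ℝ} (ht : 0 < t)
    (htt : t ≤ t') : sd.G l x t ⊆ sd.G l x t' := by
  induction l generalizing x with
  | zero => exact sd.shape.2.2 x hx t t' ht htt
  | succ l ih =>
    intro P hP
    refine ⟨ih hx hP.1, fun y hy => ?_⟩
    obtain ⟨P', hP', e1⟩ := hP.2 y hy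
    exact ⟨P', ih hy hP', e1.mono dist_nonneg htt⟩

theorem SD.G_anti (sd : SD n k D Cw) {l l' : ℕ} (h : l' ≤ l) (x : En n) (t : ℝ) :
    sd.G l x t ⊆ sd.G l' x t := by
  induction h with
  | refl => exact subset_rfl
  | step _ ih => exact fun P hP => ih hP.1

end SF

namespace SF

open scoped ContDiff

variable {n : ℕ}

/-- the coordinate function `(z_i - x_i)/δ` as a polynomial -/
def qp (i : Fin n) (x : En n) (δ : ℝ) : Pol n :=
  (1 / δ) • (MvPolynomial.X i - MvPolynomial.C (x i))

theorem ev_qp (i : Fin n) (x : En n) (δ : ℝ) (z : En n) : ev (qp i x δ) z = (z i - x i) / δ := by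
  simp [ev, qp, MvPolynomial.smul_eval]; ring

theorem qp_deg (i : Fin n) (x : En n) (δ : ℝ) : (qp i x δ).totalDegree ≤ 1 := by
  refine (MvPolynomial.totalDegree_smul_le _ _).trans ?_
  refine (MvPolynomial.totalDegree_sub _ _).trans (max_le ?_ ?_) <;> simp

theorem pd1_qp (i j : Fin n) (x : En n) (δ : ℝ) :
    pd1 j (ev (qp i x δ)) = fun _ => if j = i then 1 / δ else 0 := by
  rw [pd1_ev]
  funext z
  by_cases h : j = i
  · subst h; simp [qp, ev, MvPolynomial.smul_eval]
  · simp [qp, ev, MvPolynomial.pderiv_X_of_ne (Ne.symm h), h, MvPolynomial.smul_eval]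

theorem pdalpha_qp_mul (i : Fin n) (x : En n) (δ : ℝ) {f : En n → ℝ} (hf : ContDiff ℝ ∞ f)
    (β : Fin n → ℕ) :
    pdalpha β (ev (qp i x δ) * f) = ev (qp i x δ) * pdalpha β f +
      ((β i : ℝ) / δ) • pdalpha (fun j => β j - (Pi.single i 1 : Fin n → ℕ) j) f := by
  induction β using mi_induction with
  | h0 => simp [pdalpha_zero]
  | hs β j ih =>
    rw [pdalpha_succ β j (smooth_mul (ev_smooth _) hf), ih,
      pd1_add j (smooth_mul (ev_smooth _) (pdalpha_smooth _ hf)) (smooth_smul _ (pdalpha_smooth _ hf)),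
      pd1_mul j (ev_smooth _) (pdalpha_smooth _ hf), pd1_smul j _ (pdalpha_smooth _ hf), pd1_qp,
      ← pdalpha_succ β j hf, ← pdalpha_succ _ j hf]
    by_cases hij : j = i
    · subst hij
      have e1 : (fun l => (β + Pi.single j 1 : Fin n → ℕ) l - (Pi.single j 1 : Fin n → ℕ) l) = β := by
        funext l; simp
      rw [e1]
      rcases Nat.eq_zero_or_pos (β j) with h0 | h0
      · funext z; simp [h0]; ring
      · have e2 : (fun l => β l - (Pi.single j 1 : Fin n → ℕ) l) + Pi.single j 1 = β := by
          funext l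
          by_cases hl : l = j
          · subst hl; simp; omega
          · simp [Pi.single_eq_of_ne hl]
        rw [e2]
        funext z; simp; ring
    · have e3 : (fun l => β l - (Pi.single i 1 : Fin n → ℕ) l) + Pi.single j 1 =
          (fun l => (β + Pi.single j 1 : Fin n → ℕ) l - (Pi.single i 1 : Fin n → ℕ) l) := by
        funext l
        by_cases hl : l = i
        · subst hl; simp [Pi.single_eq_of_ne (Ne.symm hij)]
        · simp [Pi.single_eq_of_ne hl]
      rw [e3]
      have e4 : (β + Pi.single j 1 : Fin n → ℕ) i = β i := by
        simp [Pi.single_eq_of_ne (Ne.symm hij)]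
      rw [e4]
      funext z; simp [hij]

theorem pdalpha_qp_mul_at (i : Fin n) (x : En n) (δ : ℝ) {f : En n → ℝ} (hf : ContDiff ℝ ∞ f)
    (β : Fin n → ℕ) : pdalpha β (ev (qp i x δ) * f) x =
      (β i : ℝ) / δ * pdalpha (fun j => β j - (Pi.single i 1 : Fin n → ℕ) j) f x := by
  rw [pdalpha_qp_mul i x δ hf]
  simp [ev_qp]

theorem qp_pow_vanish (i : Fin n) (x : En n) (δ : ℝ) (N : ℕ) {f : En n → ℝ} (hf : ContDiff ℝ ∞ f)
    (β : Fin n → ℕ) (hβ : sz β < N) : pdalpha β (ev (qp i x δ) ^ N * f) x = 0 := by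
  induction N generalizing β with
  | zero => omega
  | succ N ih =>
    have hs : ContDiff ℝ ∞ (ev (qp i x δ) ^ N * f) :=
      smooth_mul ((ev_smooth _).pow N) hf
    rw [pow_succ', mul_assoc, pdalpha_qp_mul_at i x δ hs]
    rcases Nat.eq_zero_or_pos (β i) with h0 | h0
    · simp [h0]
    · rw [ih, mul_zero]
      have : β = (fun j => β j - (Pi.single i 1 : Fin n → ℕ) j) + Pi.single i 1 := by
        funext l
        by_cases hl : l = i
        · subst hl; simp; omega
        · simp [Pi.single_eq_of_ne hl]
      have e := sz_add_single (fun j => β j - (Pi.single i 1 : Fin n → ℕ) j) i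
      rw [← this] at e
      omega

theorem DB_qp (K : ℕ) (i : Fin n) (x : En n) {δ r : ℝ} (hr : 0 ≤ r) (hδ : 0 < δ) (hrδ : r ≤ δ) :
    DB K x r 1 (ev (qp i x δ)) := by
  intro β _
  have h := pdalpha_qp_mul_at i x δ (f := fun _ => 1) contDiff_const β
  have e : ev (qp i x δ) * (fun _ => (1 : ℝ)) = ev (qp i x δ) := by funext z; simp
  rw [e] at h
  rw [h]
  rcases Nat.eq_zero_or_pos (β i) with h0 | h0
  · simp [h0]
  set γ : Fin n → ℕ := fun j => β j - (Pi.single i 1 : Fin n → ℕ) j with hγ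
  have eβ : β = γ + Pi.single i 1 := by
    funext l
    by_cases hl : l = i
    · subst hl; simp [hγ]; omega
    · simp [hγ, Pi.single_eq_of_ne hl]
  by_cases hz : γ = 0
  · rw [hz, pdalpha_zero]
    have hi : β i = 1 := by rw [eβ, hz]; simp
    have hs : sz β = 1 := by rw [eβ, hz]; simp [sz]
    rw [hi, hs]
    simp
    rw [abs_of_pos hδ, inv_mul_le_iff₀ hδ]; linarith
  · have : pdalpha γ (fun _ : En n => (1 : ℝ)) = 0 := by
      obtain ⟨N, hN⟩ : ∃ N, sz γ = N + 1 := by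
        refine ⟨sz γ - 1, ?_⟩
        have : sz γ ≠ 0 := fun h => hz (sz_eq_zero h)
        omega
      obtain ⟨η, j, e, _⟩ := exists_of_sz_succ hN
      rw [e, pdalpha_succ' η j contDiff_const, pd1_const]
      have := pdalpha_smul η 0 (f := fun _ : En n => (0 : ℝ)) contDiff_const
      simpa using this
    rw [this]; simp

/-- square root of `1 + t` up to high order -/
theorem exists_sqrt_poly (N : ℕ) : ∃ S T : Polynomial ℝ, S * S = 1 + Polynomial.X +
    Polynomial.X ^ (N + 1) * T ∧ S.eval 0 = 1 := by
  induction N with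
  | zero => exact ⟨1, -1, by simp, by simp⟩
  | succ N ih =>
    obtain ⟨S, T, h, h0⟩ := ih
    have hroot : (T + Polynomial.C (-(T.eval 0)) * S
        + Polynomial.C ((T.eval 0 / 2) ^ 2) * Polynomial.X ^ (N + 1)).eval 0 = 0 := by
      simp [h0]
    have hdvd : Polynomial.X ∣ (T + Polynomial.C (-(T.eval 0)) * S
        + Polynomial.C ((T.eval 0 / 2) ^ 2) * Polynomial.X ^ (N + 1)) :=
      Polynomial.X_dvd_iff.2 (by rw [Polynomial.coeff_zero_eq_eval_zero]; exact hroot)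
    obtain ⟨U, hU⟩ := hdvd
    refine ⟨S + Polynomial.C (-(T.eval 0) / 2) * Polynomial.X ^ (N + 1), U, ?_, by simp [h0]⟩
    have e1 : Polynomial.C (-(T.eval 0)) = 2 * Polynomial.C (-(T.eval 0) / 2) := by
      have : (2 : Polynomial ℝ) = Polynomial.C 2 := rfl
      rw [this, ← Polynomial.C_mul]; congr 1; ring
    have e2 : Polynomial.C ((T.eval 0 / 2) ^ 2) = Polynomial.C (-(T.eval 0) / 2) * Polynomial.C (-(T.eval 0) / 2) := by
      rw [← Polynomial.C_mul]; congr 1; ring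
    rw [e1, e2] at hU
    have : Polynomial.X ^ (N + 1 + 1) * U = Polynomial.X ^ (N + 1) * (Polynomial.X * U) := by ring
    rw [this, ← hU]
    linear_combination h

/-- composition of a one variable polynomial with a function -/
def cmp (S : Polynomial ℝ) (f : En n → ℝ) : En n → ℝ := fun z => S.eval (f z)

theorem cmp_smooth (S : Polynomial ℝ) {f : En n → ℝ} (hf : ContDiff ℝ ∞ f) : ContDiff ℝ ∞ (cmp S f) := by
  have : ContDiff ℝ ∞ (fun t => S.eval t) := by
    have := S.contDiff_aeval (R := ℝ) (𝕜 := ℝ) (n := ∞)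
    simpa [Polynomial.aeval_def] using this
  exact this.comp hf

theorem DB_const (K : ℕ) (x : En n) (r c : ℝ) : DB K x r |c| (fun _ => c) := by
  intro β _
  obtain ⟨N, hN⟩ : ∃ N, sz β = N := ⟨_, rfl⟩
  cases N with
  | zero => rw [sz_eq_zero hN]; simp [pdalpha_zero, sz]
  | succ N =>
    obtain ⟨η, j, e, _⟩ := exists_of_sz_succ hN
    rw [e, pdalpha_succ' η j contDiff_const, pd1_const]
    have := pdalpha_smul η 0 (f := fun _ : En n => (0 : ℝ)) contDiff_const
    simp only [zero_smul] at this
    have e0 : (fun _ : En n => (0 : ℝ)) = 0 := rfl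
    rw [this]; simp

theorem DB_cmp (K : ℕ) (S : Polynomial ℝ) : ∃ B : ℝ, 1 ≤ B ∧ ∀ (x : En n) (r : ℝ), 0 < r →
    ∀ f : En n → ℝ, ContDiff ℝ ∞ f → DB K x r 1 f → DB K x r B (cmp S f) := by
  suffices h : ∃ B : ℝ, ∀ (x : En n) (r : ℝ), 0 < r →
      ∀ f : En n → ℝ, ContDiff ℝ ∞ f → DB K x r 1 f → DB K x r B (cmp S f) by
    obtain ⟨B, hB⟩ := h
    exact ⟨max 1 B, le_max_left _ _, fun x r hr f hf h =>
      (hB x r hr f hf h).mono le_rfl hr.le le_rfl (le_max_right _ _)⟩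
  induction S using Polynomial.induction_on with
  | C a =>
    refine ⟨|a|, fun x r hr f hf h => ?_⟩
    have : cmp (Polynomial.C a) f = fun _ => a := by funext z; simp [cmp]
    rw [this]; exact DB_const K x r a
  | add p q hp hq =>
    obtain ⟨B1, h1⟩ := hp
    obtain ⟨B2, h2⟩ := hq
    refine ⟨B1 + B2, fun x r hr f hf h => ?_⟩
    have : cmp (p + q) f = cmp p f + cmp q f := by funext z; simp [cmp]
    rw [this]
    exact (h1 x r hr f hf h).add hr.le (cmp_smooth p hf) (cmp_smooth q hf) (h2 x r hr f hf h)
  | monomial N a ih =>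
    obtain ⟨B1, h1⟩ := ih
    refine ⟨2 ^ K * (B1 * 1), fun x r hr f hf h => ?_⟩
    have : cmp (Polynomial.C a * Polynomial.X ^ (N + 1)) f =
        cmp (Polynomial.C a * Polynomial.X ^ N) f * f := by
      funext z; simp [cmp, pow_succ]; ring
    rw [this]
    exact (h1 x r hr f hf h).mul hr (cmp_smooth _ hf) hf h

variable {k D : ℕ} {Cw : ℝ}

/-- `q ⊙_x w` for `q = (z_i - x_i)/δ`. -/
def qw (k : ℕ) (i : Fin n) (x : En n) (δ : ℝ) (w : VPol n D) : VPol n D :=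
  fun j => odot k x (qp i x δ) (w j)

theorem qw_deg (i : Fin n) (x : En n) (δ : ℝ) (w : VPol n D) : VD k (qw k i x δ w) :=
  fun j => odot_deg k x _ _

theorem qw_JE (i : Fin n) (x : En n) (δ : ℝ) (w : VPol n D) (j : Fin D) :
    JE k x (ev (qw k i x δ w j)) (ev (qp i x δ) * ev (w j)) := odot_JE k x _ _

theorem DB_of_JE {N : ℕ} {z : En n} {r a : ℝ} {f g : En n → ℝ} (h : JE N z f g) (hg : DB N z r a g) :
    DB N z r a f := fun β hβ => by rw [h β hβ]; exact hg β hβ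

theorem qw_NB {i : Fin n} {x : En n} {δ r c : ℝ} {w : VPol n D} (hr : 0 < r) (hrδ : r ≤ δ)
    (h : NB k x r c w) : NB k x r (2 ^ k * c) (qw k i x δ w) := by
  rw [NB_iff hr] at *
  intro j
  refine DB_of_JE (qw_JE i x δ w j) ?_
  have := (DB_qp k i x hr.le (hr.trans_le hrδ) hrδ).mul hr (ev_smooth _) (ev_smooth _) (h j)
  rwa [one_mul, ← mul_assoc] at this

/-- the multiplier lemma at level `l` -/
def MC (n k D : ℕ) (Cw : ℝ) (l : ℕ) : Prop :=
  ∀ A : ℝ, 1 ≤ A → ∃ A' : ℝ, 1 ≤ A' ∧ ∀ (sd : SD n k D Cw) (x : En n), x ∈ sd.E →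
    ∀ (P w : VPol n D) (δ : ℝ) (i : Fin n), 0 < δ → δ ≤ sd.dm → w ∈ PM (sd.G l x A) P →
    NB k x δ A w → (1 / A') • qw k i x δ w ∈ PM (sd.G l x A') P

theorem VD_of_PM {sd : SD n k D Cw} {l : ℕ} {x : En n} (hx : x ∈ sd.E) {A : ℝ} (hA : 0 < A)
    {P w : VPol n D} (h : w ∈ PM (sd.G l x A) P) : VD k P ∧ VD k w := by
  have hc := sd.G_convex l hx hA
  have hP := sd.G_deg l hx hA (PM.base hc h)
  refine ⟨hP, ?_⟩
  have := (sd.G_deg l hx hA h.1).sub hP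
  simpa using this

theorem MC_zero (hCw : 0 < Cw) : MC n k D Cw 0 := by
  intro A hA
  obtain ⟨S, T, hS, hS0⟩ := exists_sqrt_poly k
  obtain ⟨B, hB, hBD⟩ := DB_cmp (n := n) k S
  have hA0 : 0 < A := by linarith
  set A1 : ℝ := Cw * (2 * A * B ^ (k + 1)) with hA1
  refine ⟨max 1 A1, le_max_left _ _, ?_⟩
  intro sd x hx P w δ i hδ hδm hw hNB
  have hmax : 0 < max 1 A1 := by positivity
  have hA1p : 0 < A1 := by positivity
  obtain ⟨hPd, hwd⟩ := VD_of_PM hx hA0 hw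
  -- the two halves
  have key : ∀ s : ℝ, s = 1 ∨ s = -1 → P + s • qw k i x δ w ∈ sd.Γ x A1 := by
    intro s hs
    have hss : s * s = 1 := by rcases hs with h | h <;> simp [h]
    have hsa : |s| = 1 := by rcases hs with h | h <;> simp [h]
    set q : En n → ℝ := s • ev (qp i x δ) with hq
    set q' : En n → ℝ := (-s) • ev (qp i x δ) with hq'
    have hqs : ContDiff ℝ ∞ q := smooth_smul s (ev_smooth _)
    have hqs' : ContDiff ℝ ∞ q' := smooth_smul (-s) (ev_smooth _)
    have hqD : DB k x δ 1 q := by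
      have := (DB_qp k i x hδ.le hδ le_rfl).smul s (ev_smooth _)
      rwa [hsa, one_mul] at this
    have hqD' : DB k x δ 1 q' := by
      have := (DB_qp k i x hδ.le hδ le_rfl).smul (-s) (ev_smooth _)
      rwa [abs_neg, hsa, one_mul] at this
    set c : ℝ := 1 / Real.sqrt 2 with hc
    have hcc : c * c = 1 / 2 := by
      rw [hc, div_mul_div_comm, Real.mul_self_sqrt (by norm_num)]; norm_num
    have hc1 : |c| ≤ 1 := abs_le_one_iff_mul_self_le_one.2 (by rw [hcc]; norm_num)
    have hD : ∀ u : En n → ℝ, ContDiff ℝ ∞ u → DB k x δ 1 u → DB k x δ B (c • cmp S u) := by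
      intro u hu h
      refine ((hBD x δ hδ u hu h).smul c (cmp_smooth S hu)).mono le_rfl hδ.le le_rfl ?_
      nlinarith
    have hJ : ∀ s' : ℝ, JE k x ((c • cmp S (s' • ev (qp i x δ))) * (c • cmp S (s' • ev (qp i x δ))))
        ((1 / 2 : ℝ) • (1 + s' • ev (qp i x δ))) := by
      intro s'
      have e : (c • cmp S (s' • ev (qp i x δ))) * (c • cmp S (s' • ev (qp i x δ))) =
          (1 / 2 : ℝ) • (1 + s' • ev (qp i x δ)) + ev (qp i x δ) ^ (k + 1) *
            ((1 / 2 * s' ^ (k + 1)) • cmp T (s' • ev (qp i x δ))) := by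
        funext z
        have := congrArg (fun p => Polynomial.eval (s' * ev (qp i x δ) z) p) hS
        simp only [Polynomial.eval_mul, Polynomial.eval_add, Polynomial.eval_one,
          Polynomial.eval_X, Polynomial.eval_pow] at this
        simp only [Pi.mul_apply, Pi.add_apply, Pi.smul_apply, cmp, smul_eq_mul, Pi.pow_apply,
          Pi.one_apply]
        rw [mul_pow] at this
        linear_combination (c * c) * this + (1 + s' * ev (qp i x δ) z +
          s' ^ (k + 1) * ev (qp i x δ) z ^ (k + 1) * Polynomial.eval (s' * ev (qp i x δ) z) T) * hcc
      have sm : ContDiff ℝ ∞ ((1 / 2 * s' ^ (k + 1)) • cmp T (s' • ev (qp i x δ))) :=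
        smooth_smul _ (cmp_smooth T (smooth_smul _ (ev_smooth _)))
      have sm2 : ContDiff ℝ ∞ ((1 / 2 : ℝ) • (1 + s' • ev (qp i x δ))) :=
        smooth_smul _ (smooth_add contDiff_const (smooth_smul _ (ev_smooth _)))
      have hpw : ContDiff ℝ ∞ (ev (qp i x δ) ^ (k + 1)) := (ev_smooth _).pow _
      intro β hβ
      rw [e, pdalpha_add β sm2 (smooth_mul hpw sm), Pi.add_apply,
        qp_pow_vanish i x δ (k + 1) sm β (by omega), add_zero]
    have hJ1 := hJ s
    have hJ2 := hJ (-s)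
    rw [← hq] at hJ1
    rw [← hq'] at hJ2
    have smS : ∀ u : En n → ℝ, ContDiff ℝ ∞ u → ContDiff ℝ ∞ (c • cmp S u) :=
      fun u hu => smooth_smul _ (cmp_smooth S hu)
    have sm1 : ContDiff ℝ ∞ ((1 / 2 : ℝ) • (1 + q)) := smooth_smul _ (smooth_add contDiff_const hqs)
    have sm2 : ContDiff ℝ ∞ ((1 / 2 : ℝ) • (1 + q')) := smooth_smul _ (smooth_add contDiff_const hqs')
    have m1 : P + w ∈ sd.Γ x (2 * A) := sd.G_mono 0 hx hA0 (by linarith) hw.1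
    have m2 : P - w ∈ sd.Γ x (2 * A) := sd.G_mono 0 hx hA0 (by linarith) hw.2
    refine WC sd hx (M := 2 * A) (by positivity) hB hδ hδm m1 m2 ?_ (smS q hqs) (smS q' hqs') ?_
      (hD q hqs hqD) (hD q' hqs' hqD') (hPd.add ((qw_deg i x δ w).smul s)) ?_
    · have : P + w - (P - w) = (2 : ℝ) • w := by rw [two_smul]; abel
      rw [this]
      have := hNB.smul 2
      simpa using this
    · refine (JE.add (smooth_mul (smS q hqs) (smS q hqs)) sm1
        (smooth_mul (smS q' hqs') (smS q' hqs')) sm2 hJ1 hJ2).trans ?_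
      have : (1 / 2 : ℝ) • (1 + q) + (1 / 2 : ℝ) • (1 + q') = 1 := by
        funext z; simp [hq, hq']; ring
      rw [this]; exact JE.refl _
    · intro j
      refine JE.trans ?_ (JE.symm (JE.add
        (smooth_mul (smooth_mul (smS q hqs) (smS q hqs)) (ev_smooth _))
        (smooth_mul sm1 (ev_smooth _))
        (smooth_mul (smooth_mul (smS q' hqs') (smS q' hqs')) (ev_smooth _))
        (smooth_mul sm2 (ev_smooth _))
        (JE.mul (smooth_mul (smS q hqs) (smS q hqs)) sm1 (ev_smooth _) (ev_smooth _) hJ1 (JE.refl _))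
        (JE.mul (smooth_mul (smS q' hqs') (smS q' hqs')) sm2 (ev_smooth _) (ev_smooth _) hJ2
          (JE.refl _))))
      have e : (1 / 2 : ℝ) • (1 + q) * ev ((P + w) j) + (1 / 2 : ℝ) • (1 + q') * ev ((P - w) j) =
          ev (P j) + s • (ev (qp i x δ) * ev (w j)) := by
        funext z
        simp [hq, hq', ev_add, ev_sub]; ring
      rw [e, Pi.add_apply, Pi.smul_apply, ev_add, ev_smul]
      refine JE.add (ev_smooth _) (ev_smooth _) (smooth_smul _ (ev_smooth _))
        (smooth_smul _ (smooth_mul (ev_smooth _) (ev_smooth _))) (JE.refl _) ?_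
      intro β hβ
      rw [pdalpha_smul β _ (ev_smooth _), pdalpha_smul β _ (smooth_mul (ev_smooth _) (ev_smooth _)),
        Pi.smul_apply, Pi.smul_apply, qw_JE i x δ w j β hβ]
  have h1 := key 1 (Or.inl rfl)
  have h2 := key (-1) (Or.inr rfl)
  have hPM : qw k i x δ w ∈ PM (sd.G 0 x A1) P := by
    refine ⟨by rw [one_smul] at h1; exact h1, ?_⟩
    have : P - qw k i x δ w = P + (-1 : ℝ) • qw k i x δ w := by simp [sub_eq_add_neg]
    rw [this]; exact h2
  have hPM' := PM.mono (sd.G_mono 0 hx hA1p (le_max_right 1 A1)) hPM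
  refine PM.smul (sd.G_convex 0 hx hmax) hPM' ?_
  rw [abs_of_pos (by positivity), div_le_one hmax]
  exact le_max_left _ _

end SF

namespace SF

open scoped ContDiff

variable {n k D : ℕ} {Cw : ℝ}

theorem DB_succ_of_deg {p : Pol n} (hp : p.totalDegree ≤ k) {x : En n} {r a : ℝ} (ha : 0 ≤ a)
    (h : DB k x r a (ev p)) : DB (k + 1) x r a (ev p) := by
  rw [DB_ev_iff] at *
  intro β hβ
  by_cases hb : sz β ≤ k
  · exact h β hb
  · have : polyPDval β p x = 0 := by
      unfold polyPDval
      rw [polyPD_eq_zero β p hp (by omega)]; simp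
    rw [this]; simpa

/-- change of base point for `J(q w)` -/
theorem qw_diff {i : Fin n} {x y : En n} {δ c : ℝ} {w : VPol n D} (hw : VD k w) (hδ : 0 < δ)
    (hc : 0 ≤ c) (hxy : 0 < dist x y) (hyδ : dist x y ≤ δ) (h : NB k x δ c w) :
    NB k x (dist x y) (TC n (k + 1) * (TC n (k + 1) * (2 ^ (k + 1) * c)))
      (qw k i x δ w - fun j => odot k y (qp i x δ) (w j)) := by
  set r := dist x y with hr
  rw [NB_iff hxy]
  rw [NB_iff hδ] at h
  intro j
  set g : Pol n := qp i x δ * w j with hg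
  have hgd : g.totalDegree ≤ k + 1 := by
    refine (MvPolynomial.totalDegree_mul _ _).trans ?_
    have := qp_deg i x δ
    have := hw j
    omega
  have hgD : DB (k + 1) x δ (2 ^ (k + 1) * (1 * (c * δ ^ (k + 1)))) (ev g) := by
    rw [hg, ev_mul]
    exact (DB_qp (k + 1) i x hδ.le hδ le_rfl).mul hδ (ev_smooth _) (ev_smooth _)
      (DB_succ_of_deg (hw j) (by positivity) (h j))
  have hgy := hgD.translate hgd hδ (y := y) (by rw [dist_comm]; exact hyδ)
  set u : Pol n := odot k y (qp i x δ) (w j) with hu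
  have huJ : JE k y (ev u) (ev g) := by rw [hg, ev_mul]; exact odot_JE k y _ _
  have hud : u.totalDegree ≤ k := odot_deg k y _ _
  have hTC := TC_one_le n (k + 1)
  have hDy : DB (k + 1) y r (TC n (k + 1) * (2 ^ (k + 1) * c) * r ^ (k + 1)) (ev (g - u)) := by
    intro β hβ
    rw [ev_sub, pdalpha_sub β (ev_smooth _) (ev_smooth _), Pi.sub_apply]
    by_cases hb : sz β ≤ k
    · rw [huJ β hb]; simp; positivity
    · have e : sz β = k + 1 := by omega
      have : pdalpha β (ev u) y = 0 := by
        rw [← polyPDval_eq]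
        unfold polyPDval
        rw [polyPD_eq_zero β u hud (by omega)]; simp
      rw [this, sub_zero, e]
      have := hgy β hβ
      rw [e] at this
      refine mul_le_mul_of_nonneg_right ?_ (by positivity)
      refine le_of_mul_le_mul_right (this.trans (le_of_eq ?_)) (pow_pos hδ (k + 1))
      ring
  have hDx := (hDy.translate ((MvPolynomial.totalDegree_sub _ _).trans (max_le hgd (by omega))) hxy
    (y := x) le_rfl).mono (Nat.le_succ k) hxy.le le_rfl le_rfl
  have eJ : JE k x (ev ((qw k i x δ w - fun j => odot k y (qp i x δ) (w j)) j)) (ev (g - u)) := by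
    intro β hβ
    rw [Pi.sub_apply, ev_sub, ev_sub, pdalpha_sub β (ev_smooth _) (ev_smooth _),
      pdalpha_sub β (ev_smooth _) (ev_smooth _), Pi.sub_apply, Pi.sub_apply, qw_JE i x δ w j β hβ, hg,
      ev_mul]
  have := DB_of_JE eJ hDx
  rwa [← mul_assoc] at this

theorem odot_shift (i : Fin n) (x y : En n) (δ : ℝ) (w : VPol n D) (hw : VD k w) :
    (fun j => odot k y (qp i x δ) (w j)) = qw k i y δ w + ((y i - x i) / δ) • w := by
  funext j
  refine pol_ext_JE (odot_deg k y _ _) (((qw_deg i y δ w).add (hw.smul _)) j) y ?_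
  refine (odot_JE k y _ _).trans (JE.symm ?_)
  rw [Pi.add_apply, ev_add, Pi.smul_apply, ev_smul]
  have e : ev (qp i x δ) * ev (w j) = ev (qp i y δ) * ev (w j) + ((y i - x i) / δ) • ev (w j) := by
    funext z
    simp only [Pi.mul_apply, Pi.add_apply, Pi.smul_apply, ev_qp, smul_eq_mul]
    ring
  rw [e]
  exact JE.add (ev_smooth _) (smooth_mul (ev_smooth _) (ev_smooth _)) (smooth_smul _ (ev_smooth _))
    (smooth_smul _ (ev_smooth _)) (qw_JE i y δ w j) (JE.refl _)

theorem qw_sub (i : Fin n) (x : En n) (δ : ℝ) (w w' : VPol n D) :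
    qw k i x δ (w - w') = qw k i x δ w - qw k i x δ w' := by
  funext j
  refine pol_ext_JE (odot_deg k x _ _) (((qw_deg i x δ w).sub (qw_deg i x δ w')) j) x ?_
  refine (qw_JE i x δ _ j).trans (JE.symm ?_)
  intro β hβ
  have e : ev (qp i x δ) * ev ((w - w') j) = ev (qp i x δ) * ev (w j) - ev (qp i x δ) * ev (w' j) := by
    rw [Pi.sub_apply, ev_sub, mul_sub]
  rw [e, Pi.sub_apply, ev_sub, pdalpha_sub β (ev_smooth _) (ev_smooth _),
    pdalpha_sub β (smooth_mul (ev_smooth _) (ev_smooth _)) (smooth_mul (ev_smooth _) (ev_smooth _)),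
    Pi.sub_apply, Pi.sub_apply, qw_JE i x δ w j β hβ, qw_JE i x δ w' j β hβ]

theorem abs_coord_le (y x : En n) (i : Fin n) : |y i - x i| ≤ dist x y := by
  rw [dist_comm, EuclideanSpace.dist_eq]
  refine Real.abs_le_sqrt ?_
  have := Finset.single_le_sum (f := fun i => dist (y i) (x i) ^ 2) (fun i _ => sq_nonneg _)
    (Finset.mem_univ i)
  simpa [Real.dist_eq, sq_abs] using this

theorem MC_succ {l : ℕ} (ih : MC n k D Cw l) : MC n k D Cw (l + 1) := by
  intro A hA
  have hA0 : 0 < A := by linarith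
  have hT := TC_one_le n k
  have hT1 := TC_one_le n (k + 1)
  obtain ⟨A1, hA1, h1⟩ := ih (TC n k * (2 * A)) (by nlinarith)
  set A2 := max A1 (TC n k * (2 * A)) with hA2
  have hA20 : 1 ≤ A2 := hA1.trans (le_max_left _ _)
  set A3 : ℝ := A + 2 ^ k * A + TC n (k + 1) * (TC n (k + 1) * (2 ^ (k + 1) * (2 * A))) with hA3
  set A' := 2 * A2 + A3 with hA'
  have hA3p : 0 < A3 := by positivity
  have hAA' : A2 ≤ A' := by linarith
  have hA'1 : 1 ≤ A' := by linarith
  have hA'0 : 0 < A' := by linarith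
  refine ⟨A', hA'1, ?_⟩
  have hA2A : TC n k * (2 * A) ≤ A2 := le_max_right _ _
  have hAT : A ≤ TC n k * (2 * A) := by nlinarith
  have hATp : 0 < TC n k * (2 * A) := by positivity
  intro sd x hx P w δ i hδ hδm hw hNB
  obtain ⟨hPd, hwd⟩ := VD_of_PM hx hA0 hw
  -- level l membership
  have hl : ∀ y ∈ sd.E, ∀ P' w' : VPol n D, w' ∈ PM (sd.G l y A) P' → NB k y δ (TC n k * (2 * A)) w' →
      ∀ s : ℝ, |s| ≤ 1 → (1 / A') • (qw k i y δ w' + s • w') ∈ PM (sd.G l y A') P' := by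
    intro y hy P' w' hw' hN s hs
    have hw2 := PM.mono (sd.G_mono l hy hA0 hAT) hw'
    have a1 := h1 sd y hy P' w' δ i hδ hδm hw2 hN
    have a2 := PM.mono (sd.G_mono l hy (by linarith) ((le_max_left A1 _).trans hAA')) a1
    have a3 := PM.mono (sd.G_mono l hy hATp (hA2A.trans hAA')) hw2
    have hG := sd.G_convex l hy hA'0
    have b1 : (A1 / A' * 2) • ((1 / A1) • qw k i y δ w') ∈ PM (sd.G l y A') P' := by
      refine PM.smul hG a2 ?_
      rw [abs_of_pos (by positivity), div_mul_eq_mul_div, div_le_one hA'0]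
      have := le_max_left A1 (TC n k * (2 * A))
      linarith
    have b2 : (s / A' * 2) • w' ∈ PM (sd.G l y A') P' := by
      refine PM.smul hG a3 ?_
      rw [abs_mul, abs_div, abs_of_pos hA'0, abs_of_pos (by norm_num : (0 : ℝ) < 2),
        div_mul_eq_mul_div, div_le_one hA'0]
      linarith
    have := PM.convex hG P' b1 b2 (a := 1 / 2) (b := 1 / 2) (by norm_num) (by norm_num) (by norm_num)
    convert this using 1
    rw [smul_add, smul_smul, smul_smul, smul_smul, smul_smul]
    congr 2 <;> field_simp
  have hx0 : (1 / A') • qw k i x δ w ∈ PM (sd.G l x A') P := by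
    have := hl x hx P w ⟨hw.1.1, hw.2.1⟩ (hNB.mono hδ.le hAT) 0 (by simp)
    simpa using this
  have hqN : NB k x δ (2 ^ k * A) (qw k i x δ w) := qw_NB hδ le_rfl hNB
  have main : ∀ s : ℝ, s = 1 ∨ s = -1 → P + s • ((1 / A') • qw k i x δ w) ∈ sd.G (l + 1) x A' := by
    intro s hs
    have hsa : |s| = 1 := by rcases hs with h | h <;> simp [h]
    have hPMs : ∀ y (P' v : VPol n D), v ∈ PM (sd.G l y A') P' → P' + s • v ∈ sd.G l y A' := by
      intro y P' v hv
      rcases hs with h | h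
      · rw [h, one_smul]; exact hv.1
      · rw [h, neg_one_smul, ← sub_eq_add_neg]; exact hv.2
    refine ⟨hPMs x P _ hx0, ?_⟩
    intro y hy
    obtain ⟨Pp, hPp, ep⟩ := hw.1.2 y hy
    obtain ⟨Pm, hPm, em⟩ := hw.2.2 y hy
    set P' : VPol n D := (1 / 2 : ℝ) • (Pp + Pm) with hP'
    set w' : VPol n D := (1 / 2 : ℝ) • (Pp - Pm) with hw'
    have eP : P' + w' = Pp := by
      rw [hP', hw', ← smul_add]
      have : Pp + Pm + (Pp - Pm) = (2 : ℝ) • Pp := by rw [two_smul]; abel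
      rw [this, smul_smul]; norm_num
    have eM : P' - w' = Pm := by
      rw [hP', hw', ← smul_sub]
      have : Pp + Pm - (Pp - Pm) = (2 : ℝ) • Pm := by rw [two_smul]; abel
      rw [this, smul_smul]; norm_num
    have hw'PM : w' ∈ PM (sd.G l y A) P' := ⟨by rw [eP]; exact hPp, by rw [eM]; exact hPm⟩
    have nP : NB k x (dist x y) A (P - P') := by
      have := (ep.add em).smul (1 / 2)
      have e1 : |(1 / 2 : ℝ)| * (A + A) = A := by rw [abs_of_pos (by norm_num)]; ring
      rw [e1] at this
      convert this using 1
      have : P + w - Pp + (P - w - Pm) = (2 : ℝ) • P - (Pp + Pm) := by rw [two_smul]; abel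
      rw [this, smul_sub, smul_smul, ← hP']; norm_num
    have nW : NB k x (dist x y) A (w - w') := by
      have := (ep.sub em).smul (1 / 2)
      have e1 : |(1 / 2 : ℝ)| * (A + A) = A := by rw [abs_of_pos (by norm_num)]; ring
      rw [e1] at this
      convert this using 1
      have : P + w - Pp - (P - w - Pm) = (2 : ℝ) • w - (Pp - Pm) := by rw [two_smul]; abel
      rw [this, smul_sub, smul_smul, ← hw']; norm_num
    have hPG : P' ∈ sd.G l y A' := by
      have := PM.base (sd.G_convex l hy hA0) hw'PM
      exact sd.G_mono l hy hA0 (by linarith) this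
    have h1A : |1 / A'| ≤ 1 := by rw [abs_of_pos (by positivity), div_le_one hA'0]; exact hA'1
    rcases lt_or_ge (dist x y) δ with hr | hr
    · by_cases hxy : x = y
      · subst hxy
        refine ⟨_, hPMs x P _ hx0, ?_⟩
        rw [sub_self]
        exact NB.zero (by simp) hA'0.le
      have hr0 : 0 < dist x y := dist_pos.2 hxy
      have hw'd : VD k w' := (VD_of_PM hy hA0 hw'PM).2
      have nw'x : NB k x δ (2 * A) w' := by
        have := (hNB.sub (nW.up' hr0.le hr.le hA0.le))
        rw [sub_sub_cancel] at this
        exact this.mono hδ.le (by linarith)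
      have nw'y : NB k y δ (TC n k * (2 * A)) w' :=
        nw'x.translate hw'd hδ (by rw [dist_comm]; exact hr.le)
      have hs' : |(y i - x i) / δ| ≤ 1 := by
        rw [abs_div, abs_of_pos hδ, div_le_one hδ]
        exact (abs_coord_le y x i).trans hr.le
      have hmem := hl y hy P' w' hw'PM nw'y _ hs'
      refine ⟨_, hPMs y P' _ hmem, ?_⟩
      rw [← odot_shift i x y δ w' hw'd]
      have d1 := qw_diff (i := i) hw'd hδ (by positivity) hr0 hr.le nw'x
      have d2 : NB k x (dist x y) (2 ^ k * A) (qw k i x δ (w - w')) := qw_NB hr0 hr.le nW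
      have d3 := (d2.add d1).smul (s * (1 / A'))
      have d4 := nP.add d3
      have e5 : P + s • ((1 / A') • qw k i x δ w) - (P' + s • ((1 / A') • fun j => odot k y (qp i x δ) (w' j)))
          = P - P' + (s * (1 / A')) • (qw k i x δ (w - w') +
            (qw k i x δ w' - fun j => odot k y (qp i x δ) (w' j))) := by
        rw [qw_sub, smul_smul, smul_smul, sub_add_sub_cancel, smul_sub]
        abel
      rw [e5]
      refine d4.mono hr0.le ?_
      rw [abs_mul, hsa, one_mul]
      have : |1 / A'| * (2 ^ k * A + TC n (k + 1) * (TC n (k + 1) * (2 ^ (k + 1) * (2 * A)))) ≤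
        1 * (2 ^ k * A + TC n (k + 1) * (TC n (k + 1) * (2 ^ (k + 1) * (2 * A)))) :=
        mul_le_mul_of_nonneg_right h1A (by positivity)
      linarith
    · refine ⟨P', hPG, ?_⟩
      have d3 := ((hqN.up' hδ.le hr (by positivity)).smul (s * (1 / A')))
      have d4 := nP.add d3
      have e5 : P + s • ((1 / A') • qw k i x δ w) - P' = P - P' + (s * (1 / A')) • qw k i x δ w := by
        rw [smul_smul]; abel
      rw [e5]
      refine d4.mono dist_nonneg ?_
      rw [abs_mul, hsa, one_mul]
      have : |1 / A'| * (2 ^ k * A) ≤ 1 * (2 ^ k * A) :=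
        mul_le_mul_of_nonneg_right h1A (by positivity)
      have : 0 < TC n (k + 1) * (TC n (k + 1) * (2 ^ (k + 1) * (2 * A))) := by positivity
      linarith
  have m1 := main 1 (Or.inl rfl)
  have m2 := main (-1) (Or.inr rfl)
  rw [one_smul] at m1
  rw [neg_one_smul, ← sub_eq_add_neg] at m2
  exact ⟨m1, m2⟩

theorem MC_all (hCw : 0 < Cw) (l : ℕ) : MC n k D Cw l := by
  induction l with
  | zero => exact MC_zero hCw
  | succ l ih => exact MC_succ ih

end SF

namespace SF

open scoped ContDiff

variable {n k D : ℕ} {Cw : ℝ}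

/-! ### labels -/

/-- labels `(α, j)` with `|α| ≤ k` -/
abbrev Lab (n k D : ℕ) : Type :=
  {a : (Fin n → Fin (k + 1)) × Fin D // ∑ i, (a.1 i : ℕ) ≤ k}

def Lab.al (a : Lab n k D) : Fin n → ℕ := fun i => (a.1.1 i : ℕ)
def Lab.j (a : Lab n k D) : Fin D := a.1.2

theorem Lab.sz_le (a : Lab n k D) : sz a.al ≤ k := a.2

theorem le_sz (α : Fin n → ℕ) (i : Fin n) : α i ≤ sz α :=
  Finset.single_le_sum (f := α) (fun _ _ => Nat.zero_le _) (Finset.mem_univ i)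

def mkLab (α : Fin n → ℕ) (j : Fin D) (h : sz α ≤ k) : Lab n k D :=
  ⟨(fun i => ⟨α i, by have := le_sz α i; omega⟩, j), h⟩

@[simp] theorem mkLab_al (α : Fin n → ℕ) (j : Fin D) (h : sz α ≤ k) : (mkLab α j h).al = α := rfl
@[simp] theorem mkLab_j (α : Fin n → ℕ) (j : Fin D) (h : sz α ≤ k) : (mkLab α j h).j = j := rfl
theorem Lab.ext' {a b : Lab n k D} (h1 : a.al = b.al) (h2 : a.j = b.j) : a = b := by
  apply Subtype.ext
  refine Prod.ext ?_ h2
  funext i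
  exact Fin.ext (congrFun h1 i)

/-- additive weight of a multiindex -/
def Lw (k : ℕ) (α : Fin n → ℕ) : ℕ := sz α * (k + 1) ^ n + ∑ i, α i * (k + 1) ^ (i : ℕ)

theorem Lw_add (α β : Fin n → ℕ) : Lw k (α + β) = Lw k α + Lw k β := by
  simp only [Lw, sz_add, Pi.add_apply, add_mul, Finset.sum_add_distrib]; ring

def key (a : Lab n k D) : ℕ := D * Lw k a.al + a.j

theorem digits_eq (a : Lab n k D) :
    ∑ i, a.al i * (k + 1) ^ (i : ℕ) = (finFunctionFinEquiv (a.1.1) : ℕ) := by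
  rw [finFunctionFinEquiv_apply]; rfl

theorem digits_lt (a : Lab n k D) : ∑ i, a.al i * (k + 1) ^ (i : ℕ) < (k + 1) ^ n := by
  rw [digits_eq]; exact Fin.is_lt _

theorem key_sz {a b : Lab n k D} (h : key a ≤ key b) : sz a.al ≤ sz b.al := by
  by_contra hc
  push Not at hc
  have h1 : Lw k b.al + 1 ≤ Lw k a.al := by
    have := digits_lt b
    have h2 : (sz b.al + 1) * (k + 1) ^ n ≤ sz a.al * (k + 1) ^ n := Nat.mul_le_mul_right _ hc
    unfold Lw
    rw [add_mul] at h2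
    omega
  have h3 := Nat.mul_le_mul_left D h1
  rw [mul_add, mul_one] at h3
  have := b.j.is_lt
  unfold key at h
  omega

theorem key_inj {a b : Lab n k D} (h : key a = key b) : a = b := by
  have hs : sz a.al = sz b.al := le_antisymm (key_sz h.le) (key_sz h.ge)
  unfold key at h
  have hD : 0 < D := a.j.pos
  have h1 := congrArg (· % D) h
  have h2 := congrArg (· / D) h
  simp only [Nat.mul_add_mod, Nat.mod_eq_of_lt a.j.is_lt, Nat.mod_eq_of_lt b.j.is_lt] at h1
  simp only [Nat.mul_add_div hD, Nat.div_eq_of_lt a.j.is_lt, Nat.div_eq_of_lt b.j.is_lt] at h2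
  have h3 : ∑ i, a.al i * (k + 1) ^ (i : ℕ) = ∑ i, b.al i * (k + 1) ^ (i : ℕ) := by
    unfold Lw at h2; rw [hs] at h2; omega
  rw [digits_eq, digits_eq] at h3
  have h4 := finFunctionFinEquiv.injective (Fin.ext h3)
  exact Lab.ext' (by funext i; simp [Lab.al, h4]) (Fin.ext h1)

theorem key_shift {α β γ : Fin n → ℕ} {j j' : Fin D} (h1 : sz (α + γ) ≤ k) (h2 : sz (β + γ) ≤ k)
    (h3 : sz α ≤ k) (h4 : sz β ≤ k)
    (h : key (mkLab (β + γ) j' h2) < key (mkLab (α + γ) j h1)) :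
    key (mkLab β j' h4) < key (mkLab α j h3) := by
  simp only [key, mkLab_al, mkLab_j, Lw_add, mul_add] at *
  omega

/-- a bound for all keys -/
def KB (n k D : ℕ) : ℕ := ∑ a : Lab n k D, key a

theorem key_le (a : Lab n k D) : key a ≤ KB n k D :=
  Finset.single_le_sum (f := fun a : Lab n k D => key a) (fun _ _ => Nat.zero_le _) (Finset.mem_univ a)

def rk (S : Finset (Lab n k D)) : ℕ := ∑ a ∈ S, 2 ^ (KB n k D - key a)

/-- the modified label set -/
def upd (S : Finset (Lab n k D)) (b : Lab n k D) : Finset (Lab n k D) :=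
  insert b (S.filter (fun a => key a < key b))

theorem rk_upd {S : Finset (Lab n k D)} {b : Lab n k D} (hb : b ∉ S) : rk S < rk (upd S b) := by
  unfold rk upd
  rw [Finset.sum_insert (by simp)]
  rw [← Finset.sum_filter_add_sum_filter_not S (fun a => key a < key b)]
  rw [add_comm]
  refine Nat.add_lt_add_right ?_ _
  set T := S.filter (fun a => ¬ key a < key b)
  have e : ∑ a ∈ T, 2 ^ (KB n k D - key a) = ∑ i ∈ T.image (fun a => KB n k D - key a), 2 ^ i := by
    rw [Finset.sum_image]
    intro a _ c _ h
    have h1 := key_le a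
    have h2 := key_le c
    refine key_inj ?_
    simp only at h
    omega
  rw [e]
  refine Nat.geomSum_lt le_rfl ?_
  intro i hi
  simp only [Finset.mem_image] at hi
  obtain ⟨a, ha, rfl⟩ := hi
  have h1 := key_le a
  have h2 := key_le b
  have h3 := (Finset.mem_filter.1 ha)
  have h4 : key a ≠ key b := fun h => hb (key_inj h ▸ h3.1)
  omega

theorem rk_le (S : Finset (Lab n k D)) : rk S ≤ rk (Finset.univ : Finset (Lab n k D)) :=
  Finset.sum_le_sum_of_subset (Finset.subset_univ S)

/-! ### brackets -/

/-- `[P]_{a; x, δ}` -/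
def br (x : En n) (δ : ℝ) (a : Lab n k D) (P : VPol n D) : ℝ :=
  polyPDval a.al (P a.j) x / δ ^ (k + 1 - sz a.al)

theorem br_add (x : En n) (δ : ℝ) (a : Lab n k D) (P Q : VPol n D) :
    br x δ a (P + Q) = br x δ a P + br x δ a Q := by
  simp [br, polyPDval_add, add_div]
theorem br_sub (x : En n) (δ : ℝ) (a : Lab n k D) (P Q : VPol n D) :
    br x δ a (P - Q) = br x δ a P - br x δ a Q := by
  simp [br, polyPDval_sub, sub_div]
theorem br_smul (x : En n) (δ : ℝ) (a : Lab n k D) (t : ℝ) (P : VPol n D) :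
    br x δ a (t • P) = t * br x δ a P := by
  simp [br, polyPDval_smul, mul_div_assoc]
theorem br_zero (x : En n) (δ : ℝ) (a : Lab n k D) : br x δ a (0 : VPol n D) = 0 := by
  simp [br, polyPDval_zero]
theorem br_sum {ι : Type*} (x : En n) (δ : ℝ) (a : Lab n k D) (s : Finset ι) (c : ι → ℝ)
    (w : ι → VPol n D) : br x δ a (∑ i ∈ s, c i • w i) = ∑ i ∈ s, c i * br x δ a (w i) := by
  induction s using Finset.induction_on with
  | empty => simp [br_zero]
  | insert i s hi ih => rw [Finset.sum_insert hi, Finset.sum_insert hi, br_add, br_smul, ih]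

theorem NB_br {x : En n} {δ c : ℝ} (hδ : 0 < δ) {P : VPol n D} :
    NB k x δ c P ↔ ∀ a : Lab n k D, |br x δ a P| ≤ c := by
  constructor
  · intro h a
    rw [br, abs_div, abs_of_pos (pow_pos hδ _), div_le_iff₀ (pow_pos hδ _)]
    exact h a.j a.al a.sz_le
  · intro h j α hα
    have := h (mkLab α j hα)
    rw [br, abs_div, abs_of_pos (pow_pos hδ _), div_le_iff₀ (pow_pos hδ _)] at this
    exact this

theorem br_scale {x : En n} {δ δ' : ℝ} (hδ : 0 < δ) (hδ' : 0 < δ') (a : Lab n k D) (P : VPol n D) :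
    br x δ' a P = br x δ a P * (δ / δ') ^ (k + 1 - sz a.al) := by
  rw [br, br, div_pow]
  field_simp

/-! ### bases -/

/-- abstract basis conditions; `full` asks for the strong bound -/
structure Bas (G : Set (VPol n D)) (x : En n) (δ : ℝ) (P : VPol n D) (S : Finset (Lab n k D)) (A : ℝ)
    (w : Lab n k D → VPol n D) : Prop where
  base : P ∈ G
  diag : ∀ a ∈ S, ∀ a' ∈ S, br x δ a' (w a) = if a' = a then 1 else 0
  bd : ∀ a ∈ S, ∀ b : Lab n k D, key a ≤ key b → |br x δ b (w a)| ≤ A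
  pm : ∀ a ∈ S, (1 / A) • w a ∈ PM G P

def WB (sd : SD n k D Cw) (l : ℕ) (x : En n) (P : VPol n D) (δ : ℝ) (S : Finset (Lab n k D)) (A : ℝ) :
    Prop := ∃ w, Bas (sd.G l x A) x δ P S A w

/-- strong bases -/
def SB (sd : SD n k D Cw) (l : ℕ) (x : En n) (P : VPol n D) (δ : ℝ) (S : Finset (Lab n k D)) (A : ℝ) :
    Prop := ∃ w, Bas (sd.G l x A) x δ P S A w ∧ ∀ a ∈ S, ∀ b : Lab n k D, |br x δ b (w a)| ≤ A

def MonoL (S : Finset (Lab n k D)) : Prop :=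
  ∀ a ∈ S, ∀ (i : Fin n) (h : sz (a.al + Pi.single i 1) ≤ k), mkLab (a.al + Pi.single i 1) a.j h ∈ S

theorem SB.wb {sd : SD n k D Cw} {l : ℕ} {x : En n} {P : VPol n D} {δ : ℝ} {S : Finset (Lab n k D)}
    {A : ℝ} (h : SB sd l x P δ S A) : WB sd l x P δ S A := let ⟨w, hw, _⟩ := h; ⟨w, hw⟩

theorem PM.shrink {G G' : Set (VPol n D)} (hG' : Convex ℝ G') (hGG : G ⊆ G') {P w : VPol n D} {A A' : ℝ}
    (hA : 0 < A) (hAA : A ≤ A') (h : (1 / A) • w ∈ PM G P) : (1 / A') • w ∈ PM G' P := by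
  have h1 := PM.smul hG' (PM.mono hGG h) (t := A / A') (by
    have : 0 < A' := hA.trans_le hAA
    rw [abs_of_nonneg (by positivity), div_le_one this]; exact hAA)
  rw [smul_smul] at h1
  have e : A / A' * (1 / A) = 1 / A' := by field_simp
  rwa [e] at h1

theorem Bas.mono {G G' : Set (VPol n D)} {x : En n} {P : VPol n D} {δ : ℝ} {S : Finset (Lab n k D)}
    {A A' : ℝ} {w : Lab n k D → VPol n D} (h : Bas G x δ P S A w) (hG' : Convex ℝ G') (hGG : G ⊆ G')
    (hA : 0 < A) (hAA : A ≤ A') : Bas G' x δ P S A' w :=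
  ⟨hGG h.base, h.diag, fun a ha b hb => (h.bd a ha b hb).trans hAA,
    fun a ha => PM.shrink hG' hGG hA hAA (h.pm a ha)⟩

theorem WB.mono {sd : SD n k D Cw} {l l' : ℕ} {x : En n} (hx : x ∈ sd.E) {P : VPol n D} {δ : ℝ}
    {S : Finset (Lab n k D)} {A A' : ℝ} (hA : 0 < A) (hAA : A ≤ A') (hl : l' ≤ l)
    (h : WB sd l x P δ S A) : WB sd l' x P δ S A' := by
  obtain ⟨w, hw⟩ := h
  exact ⟨w, hw.mono (sd.G_convex l' hx (hA.trans_le hAA))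
    ((sd.G_anti hl x A).trans (sd.G_mono l' hx hA hAA)) hA hAA⟩

theorem SB.mono {sd : SD n k D Cw} {l l' : ℕ} {x : En n} (hx : x ∈ sd.E) {P : VPol n D} {δ : ℝ}
    {S : Finset (Lab n k D)} {A A' : ℝ} (hA : 0 < A) (hAA : A ≤ A') (hl : l' ≤ l)
    (h : SB sd l x P δ S A) : SB sd l' x P δ S A' := by
  obtain ⟨w, hw, hs⟩ := h
  exact ⟨w, hw.mono (sd.G_convex l' hx (hA.trans_le hAA))
    ((sd.G_anti hl x A).trans (sd.G_mono l' hx hA hAA)) hA hAA, fun a ha b => (hs a ha b).trans hAA⟩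

theorem WB.scale {sd : SD n k D Cw} {l : ℕ} {x : En n} (hx : x ∈ sd.E) {P : VPol n D} {δ δ' : ℝ}
    {S : Finset (Lab n k D)} {A : ℝ} (hA : 0 < A) (hδ' : 0 < δ') (hδ : δ' ≤ δ)
    (h : WB sd l x P δ S A) : WB sd l x P δ' S A := by
  obtain ⟨w, hw⟩ := h
  have hd : 0 < δ := hδ'.trans_le hδ
  have hr1 : δ' / δ ≤ 1 := (div_le_one hd).2 hδ
  have hr0 : 0 < δ' / δ := by positivity
  have inv : δ / δ' = (δ' / δ)⁻¹ := (inv_div _ _).symm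
  have key2 : ∀ a b : Lab n k D, br x δ' b ((δ' / δ) ^ (k + 1 - sz a.al) • w a) =
      (δ' / δ) ^ (k + 1 - sz a.al) * (((δ' / δ) ^ (k + 1 - sz b.al))⁻¹ * br x δ b (w a)) := by
    intro a b
    rw [br_smul, br_scale hd hδ', inv, inv_pow, mul_comm (br x δ b (w a))]
  refine ⟨fun a => (δ' / δ) ^ (k + 1 - sz a.al) • w a, hw.base, ?_, ?_, ?_⟩
  · intro a ha a' ha'
    rw [key2, hw.diag a ha a' ha']
    by_cases h : a' = a
    · subst h
      have : (δ' / δ) ^ (k + 1 - sz a'.al) ≠ 0 := by positivity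
      simp [this]
    · simp [h]
  · intro a ha b hb
    rw [key2]
    have h1 := hw.bd a ha b hb
    have hs := key_sz hb
    have hbk := b.sz_le
    have e : k + 1 - sz a.al = (k + 1 - sz b.al) + (sz b.al - sz a.al) := by omega
    rw [e, pow_add]
    have : (δ' / δ) ^ (k + 1 - sz b.al) ≠ 0 := by positivity
    have e2 : (δ' / δ) ^ (k + 1 - sz b.al) * (δ' / δ) ^ (sz b.al - sz a.al) *
      (((δ' / δ) ^ (k + 1 - sz b.al))⁻¹ * br x δ b (w a)) = (δ' / δ) ^ (sz b.al - sz a.al) * br x δ b (w a) := by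
      field_simp
    rw [e2, abs_mul, abs_of_pos (by positivity)]
    calc _ ≤ 1 * |br x δ b (w a)| := by
            refine mul_le_mul_of_nonneg_right (pow_le_one₀ hr0.le hr1) (abs_nonneg _)
      _ ≤ A := by rw [one_mul]; exact h1
  · intro a ha
    rw [smul_comm]
    refine PM.smul (sd.G_convex l hx hA) (hw.pm a ha) ?_
    rw [abs_of_pos (by positivity)]
    exact pow_le_one₀ hr0.le hr1

/-- adding a direction -/
theorem AD {G : Set (VPol n D)} (hG : Convex ℝ G) {x : En n} {P : VPol n D} {δ : ℝ}
    {S : Finset (Lab n k D)} {A : ℝ} (hA : 1 ≤ A) {w : Lab n k D → VPol n D} (hw : Bas G x δ P S A w)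
    {b : Lab n k D} {u : VPol n D} (hub : 1 / A ≤ |br x δ b u|) (hu : ∀ c : Lab n k D, |br x δ c u| ≤ A)
    (hu0 : ∀ a ∈ S, key a < key b → br x δ a u = 0) (hupm : (1 / A) • u ∈ PM G P) :
    ∃ w', Bas G x δ P (upd S b) (A + A ^ 3) w' := by
  have hA0 : 0 < A := by linarith
  set t : ℝ := br x δ b u with ht
  have ht0 : t ≠ 0 := by
    intro h
    rw [h, abs_zero] at hub
    have : 0 < 1 / A := by positivity
    linarith
  have htp : 0 < |t| := abs_pos.2 ht0
  have hti : |t⁻¹| ≤ A := by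
    rw [abs_inv, inv_le_comm₀ htp hA0, ← one_div]; exact hub
  set v : VPol n D := t⁻¹ • u with hv
  have vb : br x δ b v = 1 := by rw [hv, br_smul, ← ht, inv_mul_cancel₀ ht0]
  have vc : ∀ c : Lab n k D, |br x δ c v| ≤ A ^ 2 := by
    intro c
    rw [hv, br_smul, abs_mul, sq]
    exact mul_le_mul hti (hu c) (abs_nonneg _) hA0.le
  have v0 : ∀ a ∈ S, key a < key b → br x δ a v = 0 := by
    intro a ha h; rw [hv, br_smul, hu0 a ha h, mul_zero]
  have vpm : (1 / A ^ 2) • v ∈ PM G P := by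
    have := PM.smul hG hupm (t := t⁻¹ / A) (by
      rw [abs_div, abs_of_pos hA0, div_le_one hA0]; exact hti)
    rw [smul_smul] at this
    rw [hv, smul_smul]
    convert this using 2
    field_simp
  have hA3 : 0 < A + A ^ 3 := by positivity
  have hsq : A ^ 2 ≤ A + A ^ 3 := by nlinarith [mul_self_nonneg (A - 1), mul_pos hA0 hA0]
  refine ⟨fun a => if a = b then v else w a - br x δ b (w a) • v, hw.base, ?_, ?_, ?_⟩
  · intro a ha a' ha'
    simp only [upd, Finset.mem_insert, Finset.mem_filter] at ha ha'
    by_cases h : a = b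
    · subst h
      simp only [if_true]
      rcases ha' with rfl | ⟨h1, h2⟩
      · simp [vb]
      · rw [v0 a' h1 h2, if_neg]
        rintro rfl; exact lt_irrefl _ h2
    · have haS := ha.resolve_left h
      simp only [if_neg h, br_sub, br_smul]
      rcases ha' with rfl | ⟨h1, h2⟩
      · rw [vb, if_neg (Ne.symm h)]; ring
      · rw [v0 a' h1 h2, hw.diag a haS.1 a' h1]; ring
  · intro a ha c hc
    simp only [upd, Finset.mem_insert, Finset.mem_filter] at ha
    by_cases h : a = b
    · subst h
      simp only [if_true]
      exact (vc c).trans hsq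
    · have haS := ha.resolve_left h
      simp only [if_neg h, br_sub, br_smul]
      refine (abs_sub _ _).trans (add_le_add (hw.bd a haS.1 c hc) ?_)
      rw [abs_mul, pow_succ']
      exact mul_le_mul (hw.bd a haS.1 b haS.2.le) (vc c) (abs_nonneg _) hA0.le
  · intro a ha
    simp only [upd, Finset.mem_insert, Finset.mem_filter] at ha
    by_cases h : a = b
    · subst h
      simp only [if_true]
      exact PM.shrink hG subset_rfl (by positivity) hsq vpm
    · have haS := ha.resolve_left h
      simp only [if_neg h]
      have h1 := hw.pm a haS.1
      have h2 := hw.bd a haS.1 b haS.2.le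
      set s := br x δ b (w a)
      have := PM.sum hG hw.base (Finset.univ : Finset (Fin 2))
        ![A / (A + A ^ 3), -(s * A ^ 2 / (A + A ^ 3))] ![(1 / A) • w a, (1 / A ^ 2) • v]
        (by intro i _; fin_cases i; exacts [h1, vpm]) (by
          simp only [Fin.sum_univ_two, Matrix.cons_val_zero, Matrix.cons_val_one]
          rw [abs_neg, abs_div, abs_div, abs_of_pos hA0, abs_of_pos hA3, ← add_div, div_le_one hA3,
            abs_mul, abs_of_pos (by positivity : 0 < A ^ 2)]
          have : |s| * A ^ 2 ≤ A * A ^ 2 := mul_le_mul_of_nonneg_right h2 (by positivity)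
          linarith [this])
      simp only [Fin.sum_univ_two, Matrix.cons_val_zero, Matrix.cons_val_one, smul_smul] at this
      convert this using 1
      rw [smul_sub, smul_smul, sub_eq_add_neg, ← neg_smul]
      congr 2 <;> field_simp

end SF

namespace SF

open scoped ContDiff

variable {n k D : ℕ} {Cw : ℝ}

theorem br_qw_zero (i : Fin n) (x : En n) {δ : ℝ} (w : VPol n D) (c : Lab n k D) (hc : c.al i = 0) :
    br x δ c (qw k i x δ w) = 0 := by
  rw [br, polyPDval_eq, qw_JE i x δ w c.j c.al c.sz_le, pdalpha_qp_mul_at i x δ (ev_smooth _), hc]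
  simp

theorem br_qw_succ (i : Fin n) (x : En n) {δ : ℝ} (hδ : 0 < δ) (w : VPol n D) (c : Lab n k D)
    (β : Fin n → ℕ) (hc : c.al = β + Pi.single i 1) (h : sz β ≤ k) :
    br x δ c (qw k i x δ w) = ((β i : ℝ) + 1) * br x δ (mkLab β c.j h) w := by
  rw [br, polyPDval_eq, qw_JE i x δ w c.j c.al c.sz_le, pdalpha_qp_mul_at i x δ (ev_smooth _)]
  have e : (fun j => c.al j - (Pi.single i 1 : Fin n → ℕ) j) = β := by
    funext j; rw [hc]; simp
  have hs : sz c.al = sz β + 1 := by rw [hc, sz_add_single]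
  have hk := c.sz_le
  have e2 : k + 1 - sz β = (k + 1 - sz c.al) + 1 := by omega
  have e3 : ((c.al i : ℕ) : ℝ) = (β i : ℝ) + 1 := by rw [hc]; simp
  rw [e, br, polyPDval_eq, mkLab_al, mkLab_j, e2, e3, pow_succ]
  field_simp

theorem PM.comb {V : Type*} [AddCommGroup V] [Module ℝ V] {G : Set V} {P : V} (hG : Convex ℝ G)
    {A B : ℝ} (hA : 0 < A) (hB : 0 < B) {u : V} (hu : (1 / A) • u ∈ PM G P) {ι : Type*} (s : Finset ι)
    (w : ι → V) (c : ι → ℝ) (hw : ∀ a ∈ s, (1 / B) • w a ∈ PM G P) {A' : ℝ}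
    (hA' : A + B * ∑ a ∈ s, |c a| ≤ A') : (1 / A') • (u - ∑ a ∈ s, c a • w a) ∈ PM G P := by
  have hs : 0 ≤ ∑ a ∈ s, |c a| := Finset.sum_nonneg (fun _ _ => abs_nonneg _)
  have hA0 : 0 < A' := by
    have := mul_nonneg hB.le hs
    linarith
  have := PM.sum hG (PM.base hG hu) (Finset.insertNone s)
    (fun o => o.elim (A / A') (fun a => -(B * c a / A')))
    (fun o => o.elim ((1 / A) • u) (fun a => (1 / B) • w a))
    (by
      intro o ho
      cases o with
      | none => exact hu
      | some a => exact hw a (Finset.some_mem_insertNone.1 ho))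
    (by
      rw [Finset.sum_insertNone]
      simp only [Option.elim, abs_neg, abs_div, abs_mul, abs_of_pos hA, abs_of_pos hB, abs_of_pos hA0]
      rw [← Finset.sum_div, ← Finset.mul_sum, ← add_div, div_le_one hA0]
      exact hA')
  rw [Finset.sum_insertNone] at this
  simp only [Option.elim, smul_smul] at this
  convert this using 1
  rw [smul_sub, sub_eq_add_neg, Finset.smul_sum, ← Finset.sum_neg_distrib]
  congr 1
  · congr 1; field_simp
  · refine Finset.sum_congr rfl (fun a _ => ?_)
    rw [smul_smul, ← neg_smul]
    congr 1; field_simp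

/-- one step of the relabelling procedure -/
theorem R_step (hCw : 0 < Cw) (l : ℕ) : ∀ A : ℝ, 1 ≤ A → ∃ A' : ℝ, 1 ≤ A' ∧
    ∀ (sd : SD n k D Cw) (x : En n), x ∈ sd.E → ∀ (P : VPol n D) (δ : ℝ) (S : Finset (Lab n k D)),
    0 < δ → δ ≤ sd.dm → WB sd l x P δ S A →
    (SB sd l x P δ S A' ∧ MonoL S) ∨ ∃ S', rk S < rk S' ∧ WB sd l x P δ S' A' := by
  intro A hA
  have hA0 : 0 < A := by linarith
  obtain ⟨A1, hA1, hMC⟩ := MC_all (n := n) (k := k) (D := D) hCw l A hA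
  set N : ℝ := (Fintype.card (Lab n k D) : ℝ) with hN
  have hN0 : 0 ≤ N := Nat.cast_nonneg _
  set ε : ℝ := 1 / (2 * (N + 1) * (k + 1) * A) with hε
  have hε0 : 0 < ε := by positivity
  have hε1 : ε ≤ A := by
    rw [hε, div_le_iff₀ (by positivity)]
    have h1 : (1:ℝ) ≤ (N + 1) * (k + 1) := by
      have : (0:ℝ) ≤ k := Nat.cast_nonneg _
      nlinarith
    nlinarith [mul_self_nonneg (A - 1)]
  have hNk : N * ((k + 1) * ε) * A ≤ 1 / 2 := by
    rw [hε]
    have : N * ((k + 1) * (1 / (2 * (N + 1) * (k + 1) * A))) * A = N / (2 * (N + 1)) := by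
      field_simp
    rw [this, div_le_div_iff₀ (by positivity) (by norm_num)]
    linarith
  set B : ℝ := A / ε + A1 * A + (k + 1) * A + 2 with hB
  have p1 : 0 < A / ε := by positivity
  have p2 : 0 < A1 * A := by positivity
  have p3 : 0 < ((k : ℝ) + 1) * A := by positivity
  have hB1 : 1 ≤ B := by linarith
  have hB0 : 0 < B := by linarith
  have hAB : A ≤ B := by
    have : A ≤ (k + 1) * A := le_mul_of_one_le_left hA0.le (by linarith [(Nat.cast_nonneg k : (0:ℝ) ≤ k)])
    linarith
  have hA1B : A1 ≤ B := by
    have : A1 ≤ A1 * A := le_mul_of_one_le_right (by linarith) hA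
    linarith
  have hBB : B ≤ B + B ^ 3 := by have := pow_pos hB0 3; linarith
  refine ⟨B + B ^ 3, by linarith, ?_⟩
  intro sd x hx P δ S hδ hδm ⟨w, hw⟩
  have cB := sd.G_convex l hx hB0
  have hwB : Bas (sd.G l x B) x δ P S B w := hw.mono cB (sd.G_mono l hx hA0 hAB) hA0 hAB
  have fin : ∀ b : Lab n k D, b ∉ S → ∀ u : VPol n D, 1 / B ≤ |br x δ b u| →
      (∀ c : Lab n k D, |br x δ c u| ≤ B) → (∀ a ∈ S, key a < key b → br x δ a u = 0) →
      (1 / B) • u ∈ PM (sd.G l x B) P → ∃ S', rk S < rk S' ∧ WB sd l x P δ S' (B + B ^ 3) := by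
    intro b hb u h1 h2 h3 h4
    obtain ⟨w', hw'⟩ := AD cB hB1 hwB h1 h2 h3 h4
    refine ⟨upd S b, rk_upd hb, w', ?_⟩
    have hB3 : 0 < B + B ^ 3 := by positivity
    exact hw'.mono (sd.G_convex l hx hB3) (sd.G_mono l hx hB0 hBB) hB3 le_rfl
  by_cases hsw : ∃ a ∈ S, ∃ b : Lab n k D, key b < key a ∧ ε < |br x δ b (w a)|
  · right
    obtain ⟨a, ha, b0, hb0, hb0'⟩ := hsw
    obtain ⟨b, hbm, hbmax⟩ := Finset.exists_max_image
      ((Finset.univ : Finset (Lab n k D)).filter (fun b => key b < key a)) (fun b => |br x δ b (w a)|)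
      ⟨b0, by simp [hb0]⟩
    have hba : key b < key a := (Finset.mem_filter.1 hbm).2
    have hbε : ε < |br x δ b (w a)| := hb0'.trans_le (hbmax b0 (by simp [hb0]))
    set t := br x δ b (w a) with ht
    have ht0 : 0 < |t| := hε0.trans hbε
    have htn : t ≠ 0 := abs_pos.1 ht0
    have hbS : b ∉ S := by
      intro h
      have := hw.diag a ha b h
      rw [if_neg (by rintro rfl; exact lt_irrefl _ hba)] at this
      exact htn this
    refine fin b hbS (t⁻¹ • w a) ?_ ?_ ?_ ?_
    · rw [br_smul, ← ht, inv_mul_cancel₀ htn, abs_one, div_le_one hB0]; exact hB1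
    · intro c
      rw [br_smul, abs_mul, abs_inv, inv_mul_le_iff₀ ht0]
      by_cases hc : key c < key a
      · have := hbmax c (by simp [hc])
        exact this.trans (le_mul_of_one_le_right ht0.le hB1)
      · push Not at hc
        refine (hw.bd a ha c hc).trans ?_
        calc A = ε * (A / ε) := by field_simp
          _ ≤ |t| * B := mul_le_mul hbε.le (by linarith) p1.le ht0.le
    · intro a' ha' hk
      rw [br_smul, hw.diag a ha a' ha', if_neg, mul_zero]
      rintro rfl; exact lt_asymm hk hba
    · rw [smul_smul]
      have h1 := PM.smul (sd.G_convex l hx hA0) (hw.pm a ha) (t := A * (1 / B * t⁻¹)) (by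
        rw [abs_mul, abs_mul, abs_inv, abs_of_pos hA0, abs_of_pos (by positivity : 0 < 1 / B)]
        rw [show A * (1 / B * |t|⁻¹) = A / (B * |t|) by field_simp, div_le_one (by positivity)]
        calc A = (A / ε) * ε := by field_simp
          _ ≤ B * |t| := mul_le_mul (by linarith) hbε.le hε0.le hB0.le)
      rw [smul_smul] at h1
      rw [show A * (1 / B * t⁻¹) * (1 / A) = 1 / B * t⁻¹ by field_simp] at h1
      exact PM.mono (sd.G_mono l hx hA0 hAB) h1
  push Not at hsw
  have strong : ∀ a ∈ S, ∀ b : Lab n k D, |br x δ b (w a)| ≤ A := by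
    intro a ha b
    by_cases h : key b < key a
    · exact (hsw a ha b h).trans hε1
    · exact hw.bd a ha b (by omega)
  by_cases hm : MonoL S
  · left
    refine ⟨?_, hm⟩
    have : SB sd l x P δ S A := ⟨w, hw, strong⟩
    exact this.mono hx hA0 (hAB.trans hBB) le_rfl
  right
  unfold MonoL at hm
  push Not at hm
  obtain ⟨a, ha, i, hsz, hbS⟩ := hm
  set b := mkLab (a.al + Pi.single i 1) a.j hsz with hb
  set v := qw k i x δ (w a) with hv
  have vpm : (1 / (A1 * A)) • v ∈ PM (sd.G l x B) P := by
    have h1 := hMC sd x hx P ((1 / A) • w a) δ i hδ hδm (hw.pm a ha) (by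
      rw [NB_br hδ]
      intro c
      rw [br_smul, abs_mul, abs_of_pos (by positivity : 0 < 1 / A)]
      have := strong a ha c
      calc 1 / A * |br x δ c (w a)| ≤ 1 / A * A := by gcongr
        _ = 1 := by field_simp
        _ ≤ A := hA)
    have e : qw k i x δ ((1 / A) • w a) = (1 / A) • v := by
      funext j
      refine pol_ext_JE (qw_deg i x δ _ j)
        ((MvPolynomial.totalDegree_smul_le _ _).trans (qw_deg i x δ (w a) j)) x ?_
      have e1 : ev (((1 / A) • v) j) = (1 / A) • ev (v j) := by
        rw [Pi.smul_apply, ev_smul]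
      intro β hβ
      rw [qw_JE i x δ _ j β hβ, e1, pdalpha_smul β _ (ev_smooth _), hv, Pi.smul_apply (1 / A) (pdalpha β _),
        qw_JE i x δ (w a) j β hβ, Pi.smul_apply, ev_smul]
      rw [show ev (qp i x δ) * (1 / A) • ev (w a j) = (1 / A) • (ev (qp i x δ) * ev (w a j)) by
        rw [mul_smul_comm]]
      rw [pdalpha_smul β _ (smooth_mul (ev_smooth _) (ev_smooth _)), Pi.smul_apply]
    rw [e, smul_smul] at h1
    rw [show 1 / A1 * (1 / A) = 1 / (A1 * A) by field_simp] at h1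
    exact PM.mono (sd.G_mono l hx (by linarith) hA1B) h1
  have vall : ∀ c : Lab n k D, |br x δ c v| ≤ (k + 1) * A := by
    intro c
    by_cases hc : c.al i = 0
    · rw [hv, br_qw_zero i x _ c hc, abs_zero]; positivity
    · have hce : c.al = (fun j => c.al j - (Pi.single i 1 : Fin n → ℕ) j) + Pi.single i 1 := by
        funext j
        by_cases hj : j = i
        · subst hj; simp; omega
        · simp [hj]
      set β := (fun j => c.al j - (Pi.single i 1 : Fin n → ℕ) j)
      have hs : sz β + 1 ≤ k := by
        have := c.sz_le; rw [hce, sz_add_single] at this; exact this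
      rw [hv, br_qw_succ i x hδ _ c β hce (by omega), abs_mul]
      have hβ : (β i : ℝ) ≤ k := by
        have := le_sz β i
        exact_mod_cast (by omega : β i ≤ k)
      rw [abs_of_nonneg (by positivity)]
      exact mul_le_mul (by linarith) (strong a ha _) (abs_nonneg _) (by positivity)
  have vb : 1 ≤ |br x δ b v| := by
    have haa : mkLab a.al b.j a.sz_le = a := Lab.ext' rfl rfl
    rw [hv, br_qw_succ i x hδ _ b a.al rfl a.sz_le, haa, hw.diag a ha a ha, if_pos rfl, mul_one,
      abs_of_nonneg (by positivity)]
    linarith [(Nat.cast_nonneg (a.al i) : (0:ℝ) ≤ _)]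
  have vsm : ∀ c : Lab n k D, key c < key b → |br x δ c v| ≤ (k + 1) * ε := by
    intro c hcb
    by_cases hc : c.al i = 0
    · rw [hv, br_qw_zero i x _ c hc, abs_zero]; positivity
    · have hce : c.al = (fun j => c.al j - (Pi.single i 1 : Fin n → ℕ) j) + Pi.single i 1 := by
        funext j
        by_cases hj : j = i
        · subst hj; simp; omega
        · simp [hj]
      set β := (fun j => c.al j - (Pi.single i 1 : Fin n → ℕ) j)
      have hs : sz β + 1 ≤ k := by
        have := c.sz_le; rw [hce, sz_add_single] at this; exact this
      rw [hv, br_qw_succ i x hδ _ c β hce (by omega), abs_mul]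
      have hβ : (β i : ℝ) ≤ k := by
        have := le_sz β i
        exact_mod_cast (by omega : β i ≤ k)
      rw [abs_of_nonneg (by positivity)]
      refine mul_le_mul (by linarith) (hsw a ha _ ?_) (abs_nonneg _) (by positivity)
      have h2 : sz (β + Pi.single i 1) ≤ k := hce ▸ c.sz_le
      have hcc : c = mkLab (β + Pi.single i 1) c.j h2 := Lab.ext' hce rfl
      rw [hcc] at hcb
      have := key_shift (γ := Pi.single i 1) hsz h2 a.sz_le (by omega) hcb
      have haa : mkLab a.al a.j a.sz_le = a := Lab.ext' rfl rfl
      rwa [haa] at this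
  set T := S.filter (fun a' => key a' < key b) with hT
  have hTS : ∀ c ∈ T, c ∈ S := fun c hc => (Finset.mem_filter.1 hc).1
  have hTk : ∀ c ∈ T, key c < key b := fun c hc => (Finset.mem_filter.1 hc).2
  have hsum : ∑ c ∈ T, |br x δ c v| ≤ N * ((k + 1) * ε) := by
    calc ∑ c ∈ T, |br x δ c v| ≤ ∑ c ∈ T, (k + 1) * ε := Finset.sum_le_sum (fun c hc => vsm c (hTk c hc))
      _ = T.card * ((k + 1) * ε) := by rw [Finset.sum_const, nsmul_eq_mul]
      _ ≤ _ := by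
        refine mul_le_mul_of_nonneg_right ?_ (by positivity)
        rw [hN]; exact_mod_cast Finset.card_le_univ T
  set u := v - ∑ c ∈ T, br x δ c v • w c with hu
  have hdiff : ∀ e : Lab n k D, |∑ c ∈ T, br x δ c v * br x δ e (w c)| ≤ 1 / 2 := by
    intro e
    calc _ ≤ ∑ c ∈ T, |br x δ c v * br x δ e (w c)| := Finset.abs_sum_le_sum_abs _ _
      _ ≤ ∑ c ∈ T, |br x δ c v| * A := by
        refine Finset.sum_le_sum (fun c hc => ?_)
        rw [abs_mul]
        exact mul_le_mul_of_nonneg_left (strong c (hTS c hc) e) (abs_nonneg _)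
      _ = (∑ c ∈ T, |br x δ c v|) * A := by rw [Finset.sum_mul]
      _ ≤ N * ((k + 1) * ε) * A := by gcongr
      _ ≤ 1 / 2 := hNk
  have hbu : ∀ e : Lab n k D, br x δ e u = br x δ e v - ∑ c ∈ T, br x δ c v * br x δ e (w c) := by
    intro e; rw [hu, br_sub, br_sum]
  refine fin b hbS u ?_ ?_ ?_ ?_
  · rw [hbu]
    have h1 := abs_sub_abs_le_abs_sub (br x δ b v) (∑ c ∈ T, br x δ c v * br x δ b (w c))
    have h2 : 1 / B ≤ 1 / 2 := one_div_le_one_div_of_le (by norm_num) (by linarith)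
    linarith [hdiff b]
  · intro c
    rw [hbu]
    refine (abs_sub _ _).trans ?_
    linarith [hdiff c, vall c]
  · intro c hc hk
    have hcT : c ∈ T := Finset.mem_filter.2 ⟨hc, hk⟩
    rw [hbu]
    rw [Finset.sum_congr rfl (fun e he => by rw [hw.diag e (hTS e he) c hc])]
    simp [hcT]
  · refine PM.comb cB p2 hA0 vpm T w _ (fun c hc => PM.mono (sd.G_mono l hx hA0 hAB) (hw.pm c (hTS c hc))) ?_
    have : A * ∑ c ∈ T, |br x δ c v| ≤ 1 / 2 := by
      calc _ = (∑ c ∈ T, |br x δ c v|) * A := mul_comm _ _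
        _ ≤ N * ((k + 1) * ε) * A := by gcongr
        _ ≤ 1 / 2 := hNk
    linarith

/-- the iterated relabelling procedure -/
theorem R_iter (hCw : 0 < Cw) (l : ℕ) : ∀ A : ℝ, 1 ≤ A → ∃ A' : ℝ, A ≤ A' ∧
    ∀ (sd : SD n k D Cw) (x : En n), x ∈ sd.E → ∀ (P : VPol n D) (δ : ℝ) (S : Finset (Lab n k D)),
    0 < δ → δ ≤ sd.dm → WB sd l x P δ S A →
    ∃ S', (S' = S ∨ rk S < rk S') ∧ SB sd l x P δ S' A' ∧ MonoL S' := by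
  have key : ∀ d : ℕ, ∀ A : ℝ, 1 ≤ A → ∃ A' : ℝ, A ≤ A' ∧
    ∀ (sd : SD n k D Cw) (x : En n), x ∈ sd.E → ∀ (P : VPol n D) (δ : ℝ) (S : Finset (Lab n k D)),
    rk (Finset.univ : Finset (Lab n k D)) ≤ rk S + d →
    0 < δ → δ ≤ sd.dm → WB sd l x P δ S A →
    ∃ S', (S' = S ∨ rk S < rk S') ∧ SB sd l x P δ S' A' ∧ MonoL S' := by
    intro d
    induction d with
    | zero =>
      intro A hA
      obtain ⟨A1, hA1, h1⟩ := R_step (n := n) (k := k) (D := D) hCw l A hA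
      refine ⟨max A A1, le_max_left _ _, ?_⟩
      intro sd x hx P δ S hr hδ hδm hw
      rcases h1 sd x hx P δ S hδ hδm hw with h | ⟨S', hS', _⟩
      · exact ⟨S, Or.inl rfl, h.1.mono hx (by linarith) (le_max_right _ _) le_rfl, h.2⟩
      · have := rk_le S'
        omega
    | succ d ih =>
      intro A hA
      obtain ⟨A1, hA1, h1⟩ := R_step (n := n) (k := k) (D := D) hCw l A hA
      obtain ⟨A2, hA2, h2⟩ := ih A1 hA1
      refine ⟨max A A2, le_max_left _ _, ?_⟩
      intro sd x hx P δ S hr hδ hδm hw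
      rcases h1 sd x hx P δ S hδ hδm hw with h | ⟨S', hS', hw'⟩
      · exact ⟨S, Or.inl rfl, h.1.mono hx (by linarith) (hA2.trans (le_max_right _ _)) le_rfl, h.2⟩
      · obtain ⟨S'', h3, h4, h5⟩ := h2 sd x hx P δ S' (by omega) hδ hδm hw'
        refine ⟨S'', Or.inr ?_, h4.mono hx (by linarith) (le_max_right _ _) le_rfl, h5⟩
        rcases h3 with rfl | h3
        · exact hS'
        · omega
  intro A hA
  obtain ⟨A', hA', h⟩ := key (rk (Finset.univ : Finset (Lab n k D))) A hA
  exact ⟨A', hA', fun sd x hx P δ S => h sd x hx P δ S (by omega)⟩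

end SF

namespace SF

open scoped ContDiff

variable {n k D : ℕ} {Cw : ℝ}

/-! ### more symmetric differences -/
section PM
variable {V : Type*} [AddCommGroup V] [Module ℝ V] {G : Set V} {P Q u v : V}

theorem PM.mix (hG : Convex ℝ G) (hQ : Q ∈ G) (hu : u ∈ PM G P) {t : ℝ} (h0 : 0 ≤ t) (h1 : t ≤ 1) :
    t • u ∈ PM G ((1 - t) • Q + t • P) := by
  constructor
  · have := hG hQ hu.1 (a := 1 - t) (b := t) (by linarith) h0 (by ring)
    rwa [smul_add, ← add_assoc] at this
  · have := hG hQ hu.2 (a := 1 - t) (b := t) (by linarith) h0 (by ring)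
    rwa [smul_sub, ← add_sub_assoc] at this

theorem PM.shift (hG : Convex ℝ G) (hv : P + (2:ℝ) • v ∈ G) (hu : (2:ℝ) • u ∈ PM G P) :
    u ∈ PM G (P + v) := by
  have := PM.mix hG hv hu (t := 1 / 2) (by norm_num) (by norm_num)
  rw [smul_smul] at this
  norm_num at this
  convert this using 2
  rw [smul_smul]
  norm_num
  rw [add_right_comm, ← add_smul]
  norm_num

theorem PM.avg {ι : Type*} [Fintype ι] (hG : Convex ℝ G) (f : ι → V) (hf : ∀ i, f i ∈ G) (i0 : ι)
    (hu : u ∈ PM G (f i0)) :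
    (1 / (Fintype.card ι : ℝ)) • u ∈ PM G ((1 / (Fintype.card ι : ℝ)) • ∑ i, f i) := by
  have hc : 0 < (Fintype.card ι : ℝ) := by
    have : 0 < Fintype.card ι := Fintype.card_pos_iff.2 ⟨i0⟩
    exact_mod_cast this
  have key : ∀ z, f i0 + z ∈ G → (1 / (Fintype.card ι : ℝ)) • (∑ i, f i) + (1 / (Fintype.card ι : ℝ)) • z ∈ G := by
    intro z hz
    have := hG.sum_mem (t := Finset.univ) (w := fun _ => 1 / (Fintype.card ι : ℝ))
      (z := fun i => f i + if i = i0 then z else 0)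
      (fun _ _ => by positivity) (by
        rw [Finset.sum_const, nsmul_eq_mul, Finset.card_univ]; field_simp)
      (fun i _ => by
        by_cases h : i = i0
        · subst h; simpa using hz
        · simpa [h] using hf i)
    rw [← Finset.smul_sum, Finset.sum_add_distrib] at this
    simpa using this
  refine ⟨key u hu.1, ?_⟩
  have := key (-u) (by simpa [sub_eq_add_neg] using hu.2)
  rwa [smul_neg, ← sub_eq_add_neg] at this
end PM

/-! ### near-identity matrices -/

theorem near_id {ι : Type*} [Fintype ι] [DecidableEq ι] (X : Matrix ι ι ℝ) (θ : ℝ)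
    (hθ : θ * (Fintype.card ι + 1) ≤ 1 / 2) (hX : ∀ i j, |X i j - if j = i then 1 else 0| ≤ θ) :
    ∃ M : Matrix ι ι ℝ, M * X = 1 ∧ ∀ i j, |M i j| ≤ 2 := by
  have hdet : X.det ≠ 0 := by
    refine det_ne_zero_of_sum_row_lt_diag (fun i => ?_)
    have h1 : ∑ j ∈ Finset.univ.erase i, ‖X i j‖ ≤ Fintype.card ι * θ := by
      have hθ0 : 0 ≤ θ := (abs_nonneg _).trans (hX i i)
      calc _ ≤ ∑ j ∈ Finset.univ.erase i, θ := by
            refine Finset.sum_le_sum (fun j hj => ?_)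
            have := hX i j
            rw [if_neg (Finset.ne_of_mem_erase hj), sub_zero] at this
            exact this
        _ ≤ ∑ j : ι, θ := Finset.sum_le_sum_of_subset_of_nonneg (Finset.subset_univ _) (fun _ _ _ => hθ0)
        _ = _ := by rw [Finset.sum_const, nsmul_eq_mul, Finset.card_univ]
    have h2 : 1 - θ ≤ ‖X i i‖ := by
      have := hX i i
      rw [if_pos rfl, abs_le] at this
      rw [Real.norm_eq_abs]
      linarith [le_abs_self (X i i)]
    nlinarith
  refine ⟨X⁻¹, Matrix.nonsing_inv_mul X (isUnit_iff_ne_zero.2 hdet), ?_⟩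
  set M := X⁻¹
  have hMX : M * X = 1 := Matrix.nonsing_inv_mul X (isUnit_iff_ne_zero.2 hdet)
  intro i j
  obtain ⟨j0, -, hj0⟩ := Finset.exists_max_image Finset.univ (fun j => |M i j|) ⟨j, Finset.mem_univ j⟩
  have hθ0 : 0 ≤ θ := (abs_nonneg _).trans (hX i i)
  have e : M i j0 = (1 : Matrix ι ι ℝ) i j0 + ∑ l, M i l * ((if j0 = l then 1 else 0) - X l j0) := by
    have h := congrFun (congrFun hMX i) j0
    rw [Matrix.mul_apply] at h
    simp only [mul_sub, Finset.sum_sub_distrib, h]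
    simp
  have b1 : |(1 : Matrix ι ι ℝ) i j0| ≤ 1 := by
    rw [Matrix.one_apply]; split_ifs <;> simp
  have b2 : |∑ l, M i l * ((if j0 = l then 1 else 0) - X l j0)| ≤ Fintype.card ι * (|M i j0| * θ) := by
    calc _ ≤ ∑ l, |M i l * ((if j0 = l then 1 else 0) - X l j0)| := Finset.abs_sum_le_sum_abs _ _
      _ ≤ ∑ l : ι, |M i j0| * θ := by
        refine Finset.sum_le_sum (fun l _ => ?_)
        rw [abs_mul, abs_sub_comm]
        exact mul_le_mul (hj0 l (Finset.mem_univ l)) (hX l j0) (abs_nonneg _) (abs_nonneg _)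
      _ = _ := by rw [Finset.sum_const, nsmul_eq_mul, Finset.card_univ]
  have b3 : |M i j0| ≤ 1 + Fintype.card ι * (|M i j0| * θ) := by
    calc |M i j0| = |(1 : Matrix ι ι ℝ) i j0 + ∑ l, M i l * ((if j0 = l then 1 else 0) - X l j0)| := by rw [← e]
      _ ≤ _ := (abs_add_le _ _).trans (add_le_add b1 b2)
  have b4 : (Fintype.card ι : ℝ) * θ ≤ 1 / 2 := by nlinarith
  have b5 : (Fintype.card ι : ℝ) * (|M i j0| * θ) ≤ 1 / 2 * |M i j0| := by
    calc _ = ((Fintype.card ι : ℝ) * θ) * |M i j0| := by ring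
      _ ≤ _ := mul_le_mul_of_nonneg_right b4 (abs_nonneg _)
  have h6 : |M i j| ≤ |M i j0| := hj0 j (Finset.mem_univ j)
  linarith

/-- the number of labels plus one -/
def NL (n k D : ℕ) : ℝ := (Fintype.card (Lab n k D) : ℝ) + 1
theorem NL_one_le : 1 ≤ NL n k D := by
  unfold NL; linarith [(Nat.cast_nonneg (Fintype.card (Lab n k D)) : (0:ℝ) ≤ _)]
theorem card_le_NL (S : Finset (Lab n k D)) : (S.card : ℝ) ≤ NL n k D := by
  have : (S.card : ℝ) ≤ Fintype.card (Lab n k D) := by exact_mod_cast Finset.card_le_univ S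
  unfold NL; linarith

theorem basis_fix {G : Set (VPol n D)} (hG : Convex ℝ G) {y : En n} {δ B : ℝ} {P : VPol n D}
    {S : Finset (Lab n k D)} (hB : 1 ≤ B) (hP : P ∈ G) {w : Lab n k D → VPol n D}
    (hpm : ∀ a ∈ S, (1 / B) • w a ∈ PM G P) (hbd : ∀ a ∈ S, ∀ b : Lab n k D, |br y δ b (w a)| ≤ B)
    (hid : ∀ a ∈ S, ∀ b ∈ S, |br y δ b (w a) - if b = a then 1 else 0| ≤ 1 / (2 * NL n k D)) :
    ∃ w', Bas G y δ P S (2 * NL n k D * B) w' ∧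
      ∀ a ∈ S, ∀ b : Lab n k D, |br y δ b (w' a)| ≤ 2 * NL n k D * B := by
  have hN := NL_one_le (n := n) (k := k) (D := D)
  have hB0 : 0 < B := by linarith
  have hcard : (Fintype.card {a // a ∈ S} : ℝ) + 1 ≤ NL n k D := by
    unfold NL
    have : Fintype.card {a // a ∈ S} ≤ Fintype.card (Lab n k D) := Fintype.card_subtype_le _
    have : (Fintype.card {a // a ∈ S} : ℝ) ≤ Fintype.card (Lab n k D) := by exact_mod_cast this
    linarith
  obtain ⟨M, hM, hMb⟩ := near_id (ι := {a // a ∈ S}) (fun a b => br y δ b.1 (w a.1))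
    (1 / (2 * NL n k D)) (by
      calc _ ≤ 1 / (2 * NL n k D) * NL n k D := by gcongr
        _ = 1 / 2 := by field_simp)
    (fun a b => by
      have h1 := hid a.1 a.2 b.1 b.2
      have h2 : (if b.1 = a.1 then (1:ℝ) else 0) = if b = a then 1 else 0 := by
        by_cases h : b = a
        · rw [if_pos h, if_pos (by rw [h])]
        · rw [if_neg h, if_neg (fun h' => h (Subtype.ext h'))]
      rw [h2] at h1
      exact h1)
  set w' : Lab n k D → VPol n D := fun a => if h : a ∈ S then ∑ c : {a // a ∈ S}, M ⟨a, h⟩ c • w c.1 else 0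
  have hw' : ∀ a (h : a ∈ S), w' a = ∑ c : {a // a ∈ S}, M ⟨a, h⟩ c • w c.1 := fun a h => dif_pos h
  have hsum : ∀ a (h : a ∈ S), ∑ c : {a // a ∈ S}, |M ⟨a, h⟩ c| ≤ 2 * NL n k D := by
    intro a h
    calc _ ≤ ∑ c : {a // a ∈ S}, (2:ℝ) := Finset.sum_le_sum (fun c _ => hMb _ c)
      _ = (Fintype.card {a // a ∈ S} : ℝ) * 2 := by rw [Finset.sum_const, nsmul_eq_mul, Finset.card_univ]
      _ ≤ _ := by linarith
  have hall : ∀ a ∈ S, ∀ b : Lab n k D, |br y δ b (w' a)| ≤ 2 * NL n k D * B := by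
    intro a h b
    rw [hw' a h, br_sum]
    calc _ ≤ ∑ c : {a // a ∈ S}, |M ⟨a, h⟩ c * br y δ b (w c.1)| := Finset.abs_sum_le_sum_abs _ _
      _ ≤ ∑ c : {a // a ∈ S}, |M ⟨a, h⟩ c| * B := by
        refine Finset.sum_le_sum (fun c _ => ?_)
        rw [abs_mul]
        exact mul_le_mul_of_nonneg_left (hbd c.1 c.2 b) (abs_nonneg _)
      _ = (∑ c : {a // a ∈ S}, |M ⟨a, h⟩ c|) * B := by rw [Finset.sum_mul]
      _ ≤ _ := mul_le_mul_of_nonneg_right (hsum a h) hB0.le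
  refine ⟨w', ⟨hP, ?_, fun a ha b _ => hall a ha b, ?_⟩, hall⟩
  · intro a ha a' ha'
    rw [hw' a ha, br_sum]
    have h := congrFun (congrFun hM ⟨a, ha⟩) ⟨a', ha'⟩
    have h' : ∑ c : {a // a ∈ S}, M ⟨a, ha⟩ c * br y δ a' (w c.1) =
        (1 : Matrix {a // a ∈ S} {a // a ∈ S} ℝ) ⟨a, ha⟩ ⟨a', ha'⟩ := h
    rw [h', Matrix.one_apply]
    by_cases hh : a' = a
    · subst hh; simp
    · rw [if_neg hh, if_neg (fun h' => hh (Subtype.ext_iff.1 h').symm)]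
  · intro a ha
    rw [hw' a ha]
    have hp : 0 < 2 * NL n k D * B := by positivity
    have := PM.sum hG hP (Finset.univ : Finset {a // a ∈ S})
      (fun c => M ⟨a, ha⟩ c * B / (2 * NL n k D * B)) (fun c => (1 / B) • w c.1)
      (fun c _ => hpm c.1 c.2) (by
        simp only [abs_div, abs_mul, abs_of_pos hB0]
        rw [← Finset.sum_div, ← Finset.sum_mul, div_le_one (by
          rw [abs_of_pos (show (0:ℝ) < 2 by norm_num), abs_of_pos (show 0 < NL n k D by linarith)]; exact hp)]
        rw [abs_of_pos (show (0:ℝ) < 2 by norm_num), abs_of_pos (show 0 < NL n k D by linarith)]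
        exact mul_le_mul_of_nonneg_right (hsum a ha) hB0.le)
    rw [Finset.smul_sum]
    convert this using 2 with c
    rw [smul_smul, smul_smul]
    congr 1
    field_simp

theorem br_translate {x y : En n} {δ c : ℝ} (hδ : 0 < δ) {P : VPol n D} (hP : VD k P) (h : NB k x δ c P)
    (hy : dist y x ≤ δ) (a : Lab n k D) : |br y δ a P - br x δ a P| ≤ TC n k * c * (dist y x / δ) := by
  have h1 := ((NB_iff hδ).1 h a.j).translate_diff (hP a.j) hδ hy a.al a.sz_le
  have hk := a.sz_le
  have e : δ ^ (k + 1) = δ ^ (k + 1 - sz a.al) * δ ^ sz a.al := by rw [← pow_add]; congr 1; omega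
  rw [br, br, ← sub_div, abs_div, abs_of_pos (pow_pos hδ (k + 1 - sz a.al)), div_le_iff₀ (by positivity)]
  rw [e] at h1
  have h2 : 0 < δ ^ sz a.al := by positivity
  refine le_of_mul_le_mul_right (h1.trans (le_of_eq ?_)) h2
  ring

theorem SB.deg {sd : SD n k D Cw} {l : ℕ} {x : En n} (hx : x ∈ sd.E) {P : VPol n D} {δ A : ℝ} (hA : 0 < A)
    {S : Finset (Lab n k D)} {w : Lab n k D → VPol n D} (h : Bas (sd.G l x A) x δ P S A w) {a : Lab n k D}
    (ha : a ∈ S) : VD k (w a) := by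
  have := (VD_of_PM hx hA (h.pm a ha)).2.smul A
  rw [smul_smul] at this
  rwa [show A * (1 / A) = 1 by field_simp, one_smul] at this

/-- transport of a strong basis to a nearby point -/
theorem transport (l : ℕ) : ∀ A : ℝ, 1 ≤ A → ∃ A' η : ℝ, A ≤ A' ∧ 0 < η ∧ η ≤ 1 ∧
    ∀ (sd : SD n k D Cw) (x y : En n), x ∈ sd.E → y ∈ sd.E → ∀ (P : VPol n D) (δ : ℝ)
    (S : Finset (Lab n k D)), 0 < δ → SB sd (l + 1) x P δ S A → dist x y ≤ η * δ →
    ∃ P', SB sd l y P' δ S A' ∧ NB k x (dist x y) A' (P' - P) := by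
  intro A hA
  have hA0 : 0 < A := by linarith
  have hN := NL_one_le (n := n) (k := k) (D := D)
  have hT := TC_one_le n k
  set T := TC n k with hTdef
  set N := NL n k D with hNdef
  set η : ℝ := 1 / (4 * N * T * (A * A)) with hη
  set B : ℝ := T * A + 1 + A * N with hB
  have hη0 : 0 < η := by positivity
  have hη1 : η ≤ 1 := by
    rw [hη, div_le_one (by positivity)]
    have h1 : 1 ≤ N * T := by nlinarith
    have h2 : 1 ≤ A * A := by nlinarith
    nlinarith [mul_le_mul h1 h2 (by norm_num) (by positivity)]
  have hTη : T * (A * A * η) = 1 / (4 * N) := by rw [hη]; field_simp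
  have hB1 : 1 ≤ B := by
    have : 0 < T * A := by positivity
    have : 0 < A * N := by positivity
    linarith
  have hB0 : 0 < B := by linarith
  have hAB : A ≤ 2 * N * B := by
    have h1 : A ≤ A * N := le_mul_of_one_le_right hA0.le hN
    have h2 : A ≤ B := by have : 0 < T * A := by positivity
                          linarith
    nlinarith
  refine ⟨2 * N * B, η, hAB, hη0, hη1, ?_⟩
  intro sd x y hx hy P δ S hδ ⟨w, hw, hs⟩ hxy
  by_cases hd0 : dist x y = 0
  · have : x = y := dist_eq_zero.1 hd0
    subst this
    refine ⟨P, SB.mono hx hA0 hAB (Nat.le_succ l) ⟨w, hw, hs⟩, ?_⟩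
    rw [sub_self]
    exact NB.zero dist_nonneg (by positivity)
  have hd : 0 < dist x y := lt_of_le_of_ne dist_nonneg (Ne.symm hd0)
  have hdδ : dist x y ≤ δ := hxy.trans (by nlinarith)
  have hdr : dist x y / δ ≤ η := (div_le_iff₀ hδ).2 hxy
  set v : Option (Lab n k D) → VPol n D := fun o => o.elim 0 (fun a => if a ∈ S then (1 / A) • w a else 0) with hv
  have hvpm : ∀ o, v o ∈ PM (sd.G (l + 1) x A) P := by
    intro o
    cases o with
    | none => exact PM.zero hw.base
    | some a =>
      simp only [hv, Option.elim]
      split_ifs with h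
      · exact hw.pm a h
      · exact PM.zero hw.base
  choose Pp hPp ePp using fun o => (hvpm o).1.2 y hy
  choose Pm hPm ePm using fun o => (hvpm o).2.2 y hy
  set Q : Option (Lab n k D) → VPol n D := fun o => (1 / 2 : ℝ) • (Pp o + Pm o) with hQ
  set z : Option (Lab n k D) → VPol n D := fun o => (1 / 2 : ℝ) • (Pp o - Pm o) with hz
  have hzpm : ∀ o, z o ∈ PM (sd.G l y A) (Q o) := by
    intro o
    constructor
    · have : Q o + z o = Pp o := by
        simp only [hQ, hz]; rw [← smul_add]
        rw [show Pp o + Pm o + (Pp o - Pm o) = (2:ℝ) • Pp o by rw [two_smul]; abel, smul_smul]; norm_num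
      rw [this]; exact hPp o
    · have : Q o - z o = Pm o := by
        simp only [hQ, hz]; rw [← smul_sub]
        rw [show Pp o + Pm o - (Pp o - Pm o) = (2:ℝ) • Pm o by rw [two_smul]; abel, smul_smul]; norm_num
      rw [this]; exact hPm o
  have cG := sd.G_convex l hy hA0
  have hQG : ∀ o, Q o ∈ sd.G l y A := fun o => PM.base cG (hzpm o)
  have hQP : ∀ o, NB k x (dist x y) A (P - Q o) := by
    intro o
    have := ((ePp o).add (ePm o)).smul (1 / 2)
    rw [abs_of_pos (by norm_num : (0:ℝ) < 1 / 2)] at this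
    convert this using 1
    · ring
    · simp only [hQ]
      rw [show P + v o - Pp o + (P - v o - Pm o) = (2:ℝ) • P - (Pp o + Pm o) by rw [two_smul]; abel,
        smul_sub, smul_smul]
      norm_num
  have hzv : ∀ o, NB k x (dist x y) A (v o - z o) := by
    intro o
    have := ((ePp o).sub (ePm o)).smul (1 / 2)
    rw [abs_of_pos (by norm_num : (0:ℝ) < 1 / 2)] at this
    convert this using 1
    · ring
    · simp only [hz]
      rw [show P + v o - Pp o - (P - v o - Pm o) = (2:ℝ) • v o - (Pp o - Pm o) by rw [two_smul]; abel,
        smul_sub (1 / 2 : ℝ) ((2:ℝ) • v o), smul_smul]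
      norm_num
  have hNc : N = (Fintype.card (Option (Lab n k D)) : ℝ) := by
    rw [Fintype.card_option]; push_cast; rfl
  set P' : VPol n D := (1 / N) • ∑ o, Q o with hP'
  set w' : Lab n k D → VPol n D := fun a => A • z (some a) with hw'
  have hpm' : ∀ o, (1 / N) • z o ∈ PM (sd.G l y A) P' := by
    intro o
    rw [hP', hNc]
    exact PM.avg cG Q hQG o (hzpm o)
  have hP'G : P' ∈ sd.G l y A := PM.base cG (hpm' none)
  have hw'd : ∀ a ∈ S, NB k x (dist x y) (A * A) (w a - w' a) := by
    intro a ha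
    have h1 := (hzv (some a)).smul A
    rw [abs_of_pos hA0] at h1
    convert h1 using 1
    simp only [hw', hv, Option.elim, if_pos ha]
    rw [smul_sub A ((1 / A) • w a), smul_smul A (1 / A), show A * (1 / A) = 1 by field_simp, one_smul]
  have degw : ∀ a ∈ S, VD k (w a) := fun a ha => SB.deg hx hA0 hw ha
  have degw' : ∀ a ∈ S, VD k (w' a) := fun a ha => (VD_of_PM hy hA0 (hzpm (some a))).2.smul A
  have hnear : ∀ a ∈ S, ∀ b : Lab n k D, |br y δ b (w' a) - br x δ b (w a)| ≤ 1 / (2 * N) := by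
    intro a ha b
    have h1 : NB k x δ A (w a) := (NB_br hδ).2 (fun b => hs a ha b)
    have h2 := br_translate hδ (degw a ha) h1 (by rw [dist_comm]; exact hdδ) b
    have h3 := (((hw'd a ha).up hd hdδ (by positivity)).translate ((degw a ha).sub (degw' a ha)) hδ
      (by rw [dist_comm]; exact hdδ))
    have h4 := (NB_br hδ).1 h3 b
    rw [br_sub] at h4
    have h5 : T * (A * A * (dist x y / δ)) ≤ 1 / (4 * N) := by rw [← hTη]; gcongr
    have h6 : T * A * (dist y x / δ) ≤ 1 / (4 * N) := by
      rw [← hTη, dist_comm, mul_assoc]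
      have : A * (dist x y / δ) ≤ A * A * η := by
        rw [mul_assoc]
        refine mul_le_mul_of_nonneg_left (hdr.trans ?_) hA0.le
        exact le_mul_of_one_le_left hη0.le hA
      gcongr
    have e : br y δ b (w' a) - br x δ b (w a) =
      (br y δ b (w a) - br x δ b (w a)) - (br y δ b (w a) - br y δ b (w' a)) := by ring
    rw [e]
    refine (abs_sub _ _).trans ?_
    have : 1 / (2 * N) = 1 / (4 * N) + 1 / (4 * N) := by field_simp; norm_num
    rw [this]
    exact add_le_add (h2.trans h6) (h4.trans h5)
  have h2N : 1 / (2 * N) ≤ 1 := by rw [div_le_one (by positivity)]; linarith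
  have hABB : A ≤ B := by
    have h1 : A ≤ A * N := le_mul_of_one_le_right hA0.le hN
    have : 0 < T * A := by positivity
    linarith
  have cGB := sd.G_convex l hy hB0
  have gm := sd.G_mono l hy hA0 hABB
  obtain ⟨w'', h1, h2⟩ := basis_fix (S := S) cGB (y := y) (δ := δ) (P := P') (w := w') hB1 (gm hP'G)
    (by
      intro a ha
      have h1 := PM.smul cGB (PM.mono gm (hpm' (some a))) (t := A * N / B) (by
        rw [abs_of_pos (by positivity), div_le_one hB0]
        have : 0 < T * A := by positivity
        linarith)
      rw [smul_smul] at h1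
      simp only [hw', smul_smul]
      convert h1 using 2
      field_simp)
    (by
      intro a ha b
      have h1 := hnear a ha b
      have h2 := hs a ha b
      have h3 : A ≤ T * A := le_mul_of_one_le_left hA0.le hT
      have h4 : 0 < A * N := by positivity
      have := abs_sub_abs_le_abs_sub (br y δ b (w' a)) (br x δ b (w a))
      linarith)
    (by
      intro a ha b hb
      have h1 := hnear a ha b
      rwa [hw.diag a ha b hb] at h1)
  have hBN : B ≤ 2 * N * B := by nlinarith
  have hp : 0 < 2 * N * B := by positivity
  refine ⟨P', ⟨w'', h1.mono (sd.G_convex l hy hp) (sd.G_mono l hy hB0 hBN) hp le_rfl, h2⟩, ?_⟩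
  have hfin : NB k x (dist x y) A (P - P') := by
    have : P - P' = (1 / N) • ∑ o, (P - Q o) := by
      rw [Finset.sum_sub_distrib, smul_sub, ← hP', Finset.sum_const, Finset.card_univ, ← Nat.cast_smul_eq_nsmul ℝ,
        ← hNc, smul_smul, show 1 / N * N = 1 by field_simp, one_smul]
    rw [this]
    have hsum : ∀ s : Finset (Option (Lab n k D)), NB k x (dist x y) (s.card * A) (∑ o ∈ s, (P - Q o)) := by
      intro s
      induction s using Finset.induction_on with
      | empty => simpa using NB.zero dist_nonneg le_rfl
      | insert a s ha ih =>
        rw [Finset.sum_insert ha, Finset.card_insert_of_notMem ha]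
        convert (hQP a).add ih using 1
        push_cast; ring
    have := (hsum Finset.univ).smul (1 / N)
    rw [Finset.card_univ, ← hNc, abs_of_pos (by positivity)] at this
    convert this using 1
    field_simp
  exact hfin.symm'.mono dist_nonneg hAB

/-! ### adjusting a point along the basis -/

theorem Bas.adjust {G : Set (VPol n D)} (hG : Convex ℝ G) {x : En n} {P : VPol n D} {δ A : ℝ}
    {S : Finset (Lab n k D)} (hA : 0 < A) {w : Lab n k D → VPol n D} (h : Bas G x δ P S A w)
    (t : Lab n k D → ℝ) (ht : (∑ a ∈ S, |t a|) * A ≤ 1 / 2) :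
    Bas G x δ (P - ∑ a ∈ S, t a • w a) S (2 * A) w := by
  have key : ∀ u, (2:ℝ) • u ∈ PM G P → u ∈ PM G (P - ∑ a ∈ S, t a • w a) := by
    intro u hu
    rw [sub_eq_add_neg]
    refine PM.shift hG ?_ hu
    have := PM.sum hG h.base S (fun a => 2 * t a * A) (fun a => (1 / A) • w a) h.pm (by
      simp only [abs_mul, abs_of_pos hA]
      rw [← Finset.sum_mul, ← Finset.mul_sum, abs_of_pos (by norm_num : (0:ℝ) < 2)]
      linarith)
    have h2 := this.2
    convert h2 using 1
    rw [smul_neg, ← sub_eq_add_neg, Finset.smul_sum]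
    congr 1
    refine Finset.sum_congr rfl (fun a _ => ?_)
    rw [smul_smul, smul_smul]
    congr 1
    field_simp
  refine ⟨?_, h.diag, fun a ha b hb => (h.bd a ha b hb).trans (by linarith), ?_⟩
  · have := key 0 (by simpa using PM.zero h.base)
    simpa using this.1
  · intro a ha
    refine key _ ?_
    rw [smul_smul, show 2 * (1 / (2 * A)) = 1 / A by field_simp]
    exact h.pm a ha

/-! ### the space `U(S)` -/

def Usp (S : Finset (Lab n k D)) (u : VPol n D) : Prop :=
  ∀ a ∈ S, ∀ x, polyPDval a.al (u a.j) x = 0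

theorem Usp.br {S : Finset (Lab n k D)} {u : VPol n D} (h : Usp S u) (x : En n) (δ : ℝ) {a : Lab n k D}
    (ha : a ∈ S) : SF.br x δ a u = 0 := by rw [SF.br, h a ha x, zero_div]

theorem Usp.add {S : Finset (Lab n k D)} {u v : VPol n D} (h : Usp S u) (h' : Usp S v) : Usp S (u + v) :=
  fun a ha x => by rw [Pi.add_apply, polyPDval_add, h a ha x, h' a ha x, add_zero]
theorem Usp.sub {S : Finset (Lab n k D)} {u v : VPol n D} (h : Usp S u) (h' : Usp S v) : Usp S (u - v) :=
  fun a ha x => by rw [Pi.sub_apply, polyPDval_sub, h a ha x, h' a ha x, sub_zero]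
theorem Usp.smul {S : Finset (Lab n k D)} {u : VPol n D} (t : ℝ) (h : Usp S u) : Usp S (t • u) :=
  fun a ha x => by rw [Pi.smul_apply, polyPDval_smul, h a ha x, mul_zero]

theorem Usp.of_point {S : Finset (Lab n k D)} (hS : MonoL S) {u : VPol n D} (hu : VD k u) {y : En n}
    {δ : ℝ} (hδ : 0 < δ) (h : ∀ a ∈ S, SF.br y δ a u = 0) : Usp S u := by
  have key : ∀ d : ℕ, ∀ a ∈ S, k ≤ sz a.al + d → ∀ x, polyPDval a.al (u a.j) x = 0 := by
    intro d
    induction d with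
    | zero =>
      intro a ha hd x
      have hc : ∀ z, ∀ i, |pd1 i (pdalpha a.al (ev (u a.j))) z| ≤ 0 := by
        intro z i
        rw [← pdalpha_succ _ _ (ev_smooth _), pdalpha_ev,
          polyPD_eq_zero _ _ (hu a.j) (by rw [sz_add_single]; omega), ev_zero]
        simp
      have h1 := mean_value (pdalpha_smooth a.al (ev_smooth (u a.j))) (x := y) (y := x) (r := dist x y) (b := 0)
        le_rfl (fun z _ i => hc z i)
      have h2 := h a ha
      rw [SF.br, div_eq_zero_iff] at h2
      have h3 := h2.resolve_right (by positivity)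
      rw [polyPDval_eq] at h3 ⊢
      rw [h3] at h1
      simpa using h1
    | succ d ih =>
      intro a ha hd x
      have hc : ∀ z, ∀ i, |pd1 i (pdalpha a.al (ev (u a.j))) z| ≤ 0 := by
        intro z i
        rw [← pdalpha_succ _ _ (ev_smooth _)]
        by_cases hk : sz (a.al + Pi.single i 1) ≤ k
        · have := ih _ (hS a ha i hk) (by rw [mkLab_al, sz_add_single]; omega) z
          rw [mkLab_al, mkLab_j, polyPDval_eq] at this
          rw [this]; simp
        · rw [pdalpha_ev, polyPD_eq_zero _ _ (hu a.j) (by omega), ev_zero]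
          simp
      have h1 := mean_value (pdalpha_smooth a.al (ev_smooth (u a.j))) (x := y) (y := x) (r := dist x y) (b := 0)
        le_rfl (fun z _ i => hc z i)
      have h2 := h a ha
      rw [SF.br, div_eq_zero_iff] at h2
      have h3 := h2.resolve_right (by positivity)
      rw [polyPDval_eq] at h3 ⊢
      rw [h3] at h1
      simpa using h1
  exact fun a ha x => key k a ha (by omega) x

end SF

namespace SF

open scoped ContDiff

variable {n k D : ℕ} {Cw : ℝ}

theorem NB.brs {x : En n} {δ A B : ℝ} (hδ : 0 < δ) {S : Finset (Lab n k D)} {w : Lab n k D → VPol n D}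
    (hs : ∀ a ∈ S, ∀ b : Lab n k D, |br x δ b (w a)| ≤ A) (hA : 0 ≤ A) (c : Lab n k D → ℝ)
    (hc : ∑ a ∈ S, |c a| ≤ B) : NB k x δ (B * A) (∑ a ∈ S, c a • w a) := by
  rw [NB_br hδ]
  intro b
  rw [br_sum]
  calc _ ≤ ∑ a ∈ S, |c a * br x δ b (w a)| := Finset.abs_sum_le_sum_abs _ _
    _ ≤ ∑ a ∈ S, |c a| * A := by
      refine Finset.sum_le_sum (fun a ha => ?_)
      rw [abs_mul]
      exact mul_le_mul_of_nonneg_left (hs a ha b) (abs_nonneg _)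
    _ = (∑ a ∈ S, |c a|) * A := by rw [Finset.sum_mul]
    _ ≤ _ := mul_le_mul_of_nonneg_right hc hA

theorem sum_abs_le {S : Finset (Lab n k D)} {c : Lab n k D → ℝ} {B : ℝ} (hB : 0 ≤ B)
    (h : ∀ a ∈ S, |c a| ≤ B) : ∑ a ∈ S, |c a| ≤ NL n k D * B := by
  calc _ ≤ ∑ a ∈ S, B := Finset.sum_le_sum h
    _ = S.card * B := by rw [Finset.sum_const, nsmul_eq_mul]
    _ ≤ _ := mul_le_mul_of_nonneg_right (card_le_NL S) hB

theorem br_kill {G : Set (VPol n D)} {x : En n} {δ A : ℝ} {P : VPol n D} {S : Finset (Lab n k D)}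
    {w : Lab n k D → VPol n D} (hw : Bas G x δ P S A w) (u : VPol n D) {a : Lab n k D} (ha : a ∈ S) :
    br x δ a (u - ∑ c ∈ S, br x δ c u • w c) = 0 := by
  rw [br_sub, br_sum, Finset.sum_congr rfl (fun e he => by rw [hw.diag e he a ha])]
  simp [ha]

/-- moving to the middle of a long segment -/
theorem mid_AD {G : Set (VPol n D)} (hG : Convex ℝ G) {x : En n} {δ A B : ℝ} {P Q : VPol n D}
    {S : Finset (Lab n k D)} (hA : 1 ≤ A) (hB : 0 ≤ B) {w : Lab n k D → VPol n D} (hw : Bas G x δ P S A w)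
    (hQ : Q ∈ G) (c : Lab n k D → ℝ) (hc : ∑ a ∈ S, |c a| ≤ B)
    (h0 : ∀ a ∈ S, br x δ a (Q - P - ∑ a ∈ S, c a • w a) = 0)
    (hbig : ¬ ∀ b : Lab n k D, |br x δ b (Q - P - ∑ a ∈ S, c a • w a)| ≤ 1) :
    ∃ τ : ℝ, 0 < τ ∧ τ ≤ 1 ∧ (∀ b : Lab n k D, |br x δ b (τ • (Q - P - ∑ a ∈ S, c a • w a))| ≤ 1) ∧
      ∃ (S' : Finset (Lab n k D)) (w' : Lab n k D → VPol n D), rk S < rk S' ∧ Bas G x δ (P + (τ / 2) • (Q - P)) S'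
        ((2 + 2 * A * (1 + B)) + (2 + 2 * A * (1 + B)) ^ 3) w' := by
  push Not at hbig
  obtain ⟨b0, hb0⟩ := hbig
  set u1 := Q - P - ∑ a ∈ S, c a • w a with hu1
  obtain ⟨b, -, hb⟩ := Finset.exists_max_image Finset.univ (fun b : Lab n k D => |br x δ b u1|)
    ⟨b0, Finset.mem_univ b0⟩
  set L := |br x δ b u1| with hL
  have hL1 : 1 < L := hb0.trans_le (hb b0 (Finset.mem_univ _))
  have hL0 : 0 < L := by linarith
  have hbS : b ∉ S := by
    intro h
    have := h0 b h
    rw [hL, this, abs_zero] at hL1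
    linarith
  set τ := 1 / L with hτ
  have hτ0 : 0 < τ := by positivity
  have hτ1 : τ ≤ 1 := by rw [hτ, div_le_one hL0]; exact hL1.le
  have hall : ∀ b : Lab n k D, |br x δ b (τ • u1)| ≤ 1 := by
    intro e
    rw [br_smul, abs_mul, abs_of_pos hτ0, hτ, one_div, inv_mul_le_iff₀ hL0, mul_one]
    exact hb e (Finset.mem_univ _)
  refine ⟨τ, hτ0, hτ1, hall, ?_⟩
  set P3 := P + (τ / 2) • (Q - P) with hP3
  have hA0 : 0 < A := by linarith
  have hwp : ∀ a ∈ S, (1 / (2 * A)) • w a ∈ PM G P3 := by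
    intro a ha
    have h1 := PM.mix hG hQ (hw.pm a ha) (t := 1 - τ / 2) (by linarith) (by linarith)
    have e : (1 - (1 - τ / 2)) • Q + (1 - τ / 2) • P = P3 := by
      rw [hP3]; module
    rw [e] at h1
    have h2 := PM.smul hG h1 (t := 1 / (2 * (1 - τ / 2))) (by
      rw [abs_of_pos (by apply div_pos <;> linarith), div_le_one (by linarith)]; linarith)
    rw [smul_smul, smul_smul] at h2
    convert h2 using 2
    have h3 : 1 - τ / 2 ≠ 0 := by linarith
    generalize 1 - τ / 2 = v at *
    field_simp
  have hup : (1 / 2 : ℝ) • (τ • (Q - P)) ∈ PM G P3 := by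
    constructor
    · have := hG hw.base hQ (a := 1 - τ) (b := τ) (by linarith) hτ0.le (by ring)
      convert this using 1
      rw [hP3, smul_smul, add_assoc, ← add_smul, sub_smul, one_smul,
        show τ / 2 + 1 / 2 * τ = τ by ring, smul_sub]
      abel
    · convert hw.base using 1
      rw [hP3, smul_smul, show 1 / 2 * τ = τ / 2 by ring]; abel
  have hP3G : P3 ∈ G := PM.base hG hup
  set A5 := 2 + 2 * A * (1 + B) with hA5
  have q1 : 0 ≤ A * B := by positivity
  have hA51 : 1 ≤ A5 := by rw [hA5]; nlinarith
  have h2A : 2 * A ≤ A5 := by rw [hA5]; nlinarith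
  have hA50 : 0 < A5 := by linarith
  have hbas : Bas G x δ P3 S A5 w := by
    refine ⟨hP3G, hw.diag, fun a ha b hb => (hw.bd a ha b hb).trans (by linarith), ?_⟩
    intro a ha
    exact PM.shrink hG subset_rfl (by positivity) h2A (hwp a ha)
  obtain ⟨w', hw'⟩ := AD hG hA51 hbas (b := b) (u := τ • u1)
    (by
      rw [br_smul, abs_mul, ← hL, abs_of_pos hτ0, hτ, one_div_mul_cancel hL0.ne', div_le_one hA50]
      exact hA51)
    (fun e => (hall e).trans hA51)
    (by intro a ha _; rw [br_smul, h0 a ha, mul_zero])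
    (by
      have h1 := PM.comb hG (A := 2) (B := 2 * A) (by norm_num) (by positivity) hup S w (fun a => τ * c a) hwp
        (A' := A5) (by
          have : ∑ a ∈ S, |τ * c a| ≤ B := by
            refine le_trans (Finset.sum_le_sum (fun a _ => ?_)) hc
            rw [abs_mul, abs_of_pos hτ0]
            exact mul_le_of_le_one_left (abs_nonneg _) hτ1
          have h2 : 2 * A * ∑ a ∈ S, |τ * c a| ≤ 2 * A * B := by gcongr
          rw [hA5]; nlinarith)
      convert h1 using 2
      rw [hu1, smul_sub, Finset.smul_sum]
      simp only [smul_smul])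
  exact ⟨upd S b, w', rk_upd hbS, hw'⟩


structure Dat (sd : SD n k D Cw) (l : ℕ) (S : Finset (Lab n k D)) (P0 : VPol n D) (δ0 A2 : ℝ) (y : En n)
    (Q : VPol n D) : Prop where
  mem : y ∈ sd.E
  sb : SB sd (l + 2) y Q δ0 S A2
  us : Usp S (Q - P0)
  nb : NB k y δ0 A2 (Q - P0)

def OKp (sd : SD n k D Cw) (l : ℕ) (S : Finset (Lab n k D)) (P0 : VPol n D) (δ0 A3 : ℝ) (y : En n)
    (r : ℝ) : Prop :=
  ∃ P, NB k y δ0 A3 (P - P0) ∧ ∃ S', rk S < rk S' ∧ WB sd l y P r S' A3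

theorem SB.base {sd : SD n k D Cw} {l : ℕ} {x : En n} {P : VPol n D} {δ A : ℝ} {S : Finset (Lab n k D)}
    (h : SB sd l x P δ S A) : P ∈ sd.G l x A := let ⟨_, hw, _⟩ := h; hw.base

theorem WB.base {sd : SD n k D Cw} {l : ℕ} {x : En n} {P : VPol n D} {δ A : ℝ} {S : Finset (Lab n k D)}
    (h : WB sd l x P δ S A) : P ∈ sd.G l x A := let ⟨_, hw⟩ := h; hw.base

theorem spread (l : ℕ) : ∀ A C6 : ℝ, 1 ≤ A → 1 ≤ C6 → ∃ A3 K0 : ℝ, 1 ≤ A3 ∧ 1 ≤ K0 ∧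
    ∀ (sd : SD n k D Cw) (S S' : Finset (Lab n k D)) (P0 P : VPol n D) (δ0 ρ r : ℝ) (c y : En n),
    VD k P0 → 0 < δ0 → 0 < r → y ∈ sd.E → dist y c ≤ C6 * r → K0 * r ≤ ρ → ρ ≤ δ0 → rk S < rk S' →
    SB sd (l + 1) y P ρ S' A → NB k y δ0 A (P - P0) →
    ∀ y' ∈ sd.E, dist y' c ≤ 2 * r → OKp sd l S P0 δ0 A3 y' (2 * r) := by
  intro A C6 hA hC
  obtain ⟨A', η, hAA, hη0, hη1, hT⟩ := transport (n := n) (k := k) (D := D) (Cw := Cw) l A hA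
  have hTC := TC_one_le n k
  have hA' : 1 ≤ A' := by linarith
  refine ⟨TC n k * (A' + A), (C6 + 2) / η, by nlinarith, by
    rw [le_div_iff₀ hη0]; linarith, ?_⟩
  intro sd S S' P0 P δ0 ρ r c y hP0 hδ0 hr hy hyc hKρ hρ hrk hsb hnb y' hy' hy'c
  have hρ0 : 0 < ρ := lt_of_lt_of_le (by positivity) hKρ
  have hd : dist y y' ≤ (C6 + 2) * r := by
    have := dist_triangle_right y y' c
    linarith
  have hd2 : dist y y' ≤ η * ρ := by
    have : η * ((C6 + 2) / η * r) ≤ η * ρ := by gcongr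
    have e : η * ((C6 + 2) / η * r) = (C6 + 2) * r := by field_simp
    linarith
  obtain ⟨P', hsb', hnb'⟩ := hT sd y y' hy hy' P ρ S' hρ0 hsb hd2
  have hdρ : dist y y' ≤ ρ := hd2.trans (by nlinarith)
  have hA3 : A' ≤ TC n k * (A' + A) := by nlinarith
  have degP : VD k P := sd.G_deg _ hy (by linarith) hsb.base
  have degP' : VD k P' := sd.G_deg _ hy' (by linarith) hsb'.base
  refine ⟨P', ?_, S', hrk, ?_⟩
  · have h1 := ((hnb'.up' dist_nonneg (hdρ.trans hρ) (by linarith)).add hnb).translate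
      (y := y') ((degP'.sub degP).add (degP.sub hP0)) hδ0 (by rw [dist_comm]; linarith)
    simpa using h1
  · refine (hsb'.wb.mono hy' (by linarith) hA3 le_rfl).scale hy' (by linarith) (by positivity) ?_
    have : 2 ≤ (C6 + 2) / η := by rw [le_div_iff₀ hη0]; nlinarith
    nlinarith

set_option maxHeartbeats 1600000 in
/-- consistency of the data at nearby points -/
theorem CONS (hCw : 0 < Cw) (l : ℕ) : ∀ A2 C6 : ℝ, 1 ≤ A2 → 1 ≤ C6 → ∃ A3 Λ : ℝ, 1 ≤ A3 ∧ 1 ≤ Λ ∧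
    ∀ (sd : SD n k D Cw) (S : Finset (Lab n k D)) (P0 Q Q' : VPol n D) (δ0 r : ℝ) (c y y' : En n),
    VD k P0 → 0 < δ0 → δ0 ≤ sd.dm → 0 < r → Dat sd l S P0 δ0 A2 y Q → Dat sd l S P0 δ0 A2 y' Q' →
    dist y c ≤ C6 * r → dist y' c ≤ C6 * r →
    (∀ y'' ∈ sd.E, dist y'' c ≤ 2 * r → OKp sd l S P0 δ0 A3 y'' (2 * r)) ∨ NB k y r Λ (Q - Q') := by
  intro A2 C6 hA2 hC6
  have hTC := TC_one_le n k
  have hN := NL_one_le (n := n) (k := k) (D := D)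
  set T := TC n k with hTdef
  set N := NL n k D with hNdef
  have hA20 : 0 < A2 := by linarith
  obtain ⟨A', hAA', hR⟩ := R_iter (n := n) (k := k) (D := D) hCw (l + 2) A2 hA2
  have hA' : 1 ≤ A' := by linarith
  set B := N * (T * A2) with hB
  have hB0 : 0 ≤ B := by positivity
  set A5 := (2 + 2 * A' * (1 + B)) + (2 + 2 * A' * (1 + B)) ^ 3 with hA5
  have hbase : 1 ≤ 2 + 2 * A' * (1 + B) := by nlinarith [mul_nonneg (by linarith : 0 ≤ A') hB0]
  have hA5' : A' ≤ 2 + 2 * A' * (1 + B) := by nlinarith [mul_nonneg (by linarith : 0 ≤ A') hB0]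
  have hA51 : 2 + 2 * A' * (1 + B) ≤ A5 := by
    have := pow_pos (lt_of_lt_of_le one_pos hbase) 3
    linarith
  have hA5A : A' ≤ A5 := hA5'.trans hA51
  have hA50 : 1 ≤ A5 := by linarith
  obtain ⟨A6, hAA6, hR6⟩ := R_iter (n := n) (k := k) (D := D) hCw (l + 1) A5 hA50
  set A7 := max A6 (A2 + (1 + B * A')) with hA7
  have hA71 : 1 ≤ A7 := by have := le_max_left A6 (A2 + (1 + B * A')); linarith
  have hq : 0 ≤ B * A' := by positivity
  have hA27 : A2 ≤ A7 := by have := le_max_right A6 (A2 + (1 + B * A')); linarith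
  obtain ⟨A3, K0, hA3, hK0, hspr⟩ := spread (n := n) (k := k) (D := D) (Cw := Cw) l A7 C6 hA71 hC6
  set K := K0 + 2 * C6 with hK
  have hK1 : 1 ≤ K := by linarith
  set Λ := (T + 1) * A2 * (K + 2 * C6) ^ (k + 1) + T * (A2 + (1 + B * A')) * (K + 2 * C6) ^ (k + 1) + 1 with hΛ
  have hp : 0 < (K + 2 * C6) ^ (k + 1) := by positivity
  have hΛ1 : 0 ≤ (T + 1) * A2 * (K + 2 * C6) ^ (k + 1) := by positivity
  have hΛ2 : 0 ≤ T * (A2 + (1 + B * A')) * (K + 2 * C6) ^ (k + 1) := by positivity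
  refine ⟨A3, Λ, hA3, by linarith, ?_⟩
  intro sd S P0 Q Q' δ0 r c y y' hP0 hδ0 hδm hr hy hy' hyc hy'c
  have hyy : dist y y' ≤ 2 * C6 * r := by
    have := dist_triangle_right y y' c
    linarith
  have degQ : VD k Q := sd.G_deg _ hy.mem hA20 hy.sb.base
  have degQ' : VD k Q' := sd.G_deg _ hy'.mem hA20 hy'.sb.base
  by_cases hKr : δ0 < K * r
  · right
    set s := (K + 2 * C6) * r with hs
    have hs0 : 0 < s := by positivity
    have hδs : δ0 ≤ s := by rw [hs]; nlinarith
    have h1 := hy.nb.up' hδ0.le hδs hA20.le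
    have h2 := (hy'.nb.up' hδ0.le hδs hA20.le).translate (y := y) (degQ'.sub hP0) hs0 (by rw [hs]; nlinarith)
    have h3 := (h1.sub h2).down (δ' := r) (R := K + 2 * C6) hr.le (by linarith) le_rfl hs0.le (by positivity)
    rw [sub_sub_sub_cancel_right] at h3
    refine h3.mono hr.le ?_
    have : (A2 + T * A2) * (K + 2 * C6) ^ (k + 1) = (T + 1) * A2 * (K + 2 * C6) ^ (k + 1) := by ring
    change (A2 + T * A2) * (K + 2 * C6) ^ (k + 1) ≤ Λ
    linarith
  push Not at hKr
  have hKr0 : 0 < K * r := by positivity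
  have hwb := hy'.sb.wb.scale hy'.mem hA20 hKr0 hKr
  obtain ⟨S', hS', hsb, -⟩ := hR sd y' hy'.mem Q' (K * r) S hKr0 (hKr.trans hδm) hwb
  rcases hS' with rfl | hrk
  swap
  · left
    refine hspr sd S S' P0 Q' δ0 (K * r) r c y' hP0 hδ0 hr hy'.mem hy'c (by gcongr; linarith) hKr hrk
      (hsb.mono hy'.mem (by linarith) ?_ (by omega)) (hy'.nb.mono hδ0.le hA27)
    exact hA5A.trans (hAA6.trans (le_max_left _ _))
  obtain ⟨w, hw, hstr⟩ := hsb
  obtain ⟨P'', hP'', hnb''⟩ := hy.sb.base.2 y' hy'.mem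
  have degP'' : VD k P'' := sd.G_deg _ hy'.mem hA20 hP''
  have hyK : dist y y' ≤ K * r := by nlinarith
  have hQP : NB k y' (K * r) (T * A2) (Q - P'') := by
    refine (hnb''.up' dist_nonneg hyK hA20.le).translate (degQ.sub degP'') hKr0 ?_
    rw [dist_comm]; exact hyK
  have hbr : ∀ a ∈ S', |br y' (K * r) a (P'' - Q')| ≤ T * A2 := by
    intro a ha
    have e : P'' - Q' = ((Q - P0) - (Q' - P0)) - (Q - P'') := by abel
    rw [e, br_sub, (hy.us.sub hy'.us).br y' _ ha, zero_sub, abs_neg]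
    exact (NB_br hKr0).1 hQP a
  have hsumc : ∑ a ∈ S', |br y' (K * r) a (P'' - Q')| ≤ B := sum_abs_le (by positivity) hbr
  have hA'0 : 0 < A' := by linarith
  have hW : NB k y' (K * r) (B * A') (∑ a ∈ S', br y' (K * r) a (P'' - Q') • w a) :=
    NB.brs hKr0 hstr hA'0.le _ hsumc
  have cG := sd.G_convex (l + 1) hy'.mem hA'0
  have hw1 : Bas (sd.G (l + 1) y' A') y' (K * r) Q' S' A' w :=
    hw.mono cG (sd.G_anti (by omega) _ _) hA'0 le_rfl
  by_cases hbig : ∀ b : Lab n k D, |br y' (K * r) b (P'' - Q' - ∑ a ∈ S', br y' (K * r) a (P'' - Q') • w a)| ≤ 1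
  · right
    have h1 : NB k y' (K * r) (1 + B * A') (P'' - Q') := by
      have := ((NB_br hKr0).2 hbig).add hW
      simpa using this
    have h2 := (h1.translate (y := y) (degP''.sub degQ') hKr0 hyK)
    have h3 := (hnb''.up' dist_nonneg hyK hA20.le).add h2
    have h4 := h3.down (δ' := r) (R := K) hr.le hK1 le_rfl hKr0.le (by positivity)
    rw [sub_add_sub_cancel] at h4
    refine h4.mono hr.le ?_
    have h5 : K ^ (k + 1) ≤ (K + 2 * C6) ^ (k + 1) := by gcongr; linarith
    have h6 : A2 + T * (1 + B * A') ≤ T * (A2 + (1 + B * A')) := by nlinarith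
    have h7 : (A2 + T * (1 + B * A')) * K ^ (k + 1) ≤ T * (A2 + (1 + B * A')) * (K + 2 * C6) ^ (k + 1) := by
      gcongr
    linarith
  left
  obtain ⟨τ, hτ0, hτ1, hall, S'', w', hrk, hbas⟩ := mid_AD cG hA' hB0 hw1
    (sd.G_mono (l + 1) hy'.mem hA20 hAA' hP'') _ hsumc (fun a ha => br_kill hw1 _ ha) hbig
  have hA5p : 0 < A5 := by linarith
  have hbas5 : WB sd (l + 1) y' (Q' + (τ / 2) • (P'' - Q')) (K * r) S'' A5 :=
    ⟨w', hbas.mono (sd.G_convex (l + 1) hy'.mem hA5p) (sd.G_mono (l + 1) hy'.mem hA'0 hA5A) hA5p le_rfl⟩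
  obtain ⟨S3, hS3, hsb3, -⟩ := hR6 sd y' hy'.mem _ (K * r) S'' hKr0 (hKr.trans hδm) hbas5
  have hrk3 : rk S' < rk S3 := by
    rcases hS3 with rfl | h
    · exact hrk
    · omega
  refine hspr sd S' S3 P0 _ δ0 (K * r) r c y' hP0 hδ0 hr hy'.mem hy'c (by gcongr; linarith) hKr hrk3
      (hsb3.mono hy'.mem (by linarith) (le_max_left _ _) le_rfl) ?_
  have h1 : NB k y' (K * r) (1 + B * A') ((τ / 2) • (P'' - Q')) := by
    have h2 := (((NB_br hKr0).2 hall).add (hW.smul τ)).smul (1 / 2)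
    rw [smul_sub τ (P'' - Q'), sub_add_cancel, smul_smul] at h2
    rw [show τ / 2 = 1 / 2 * τ by ring]
    refine h2.mono hKr0.le ?_
    rw [abs_of_pos (by norm_num : (0:ℝ) < 1 / 2), abs_of_pos hτ0]
    nlinarith [mul_le_mul_of_nonneg_right hτ1 hq]
  have h2 := hy'.nb.add (h1.up' hKr0.le hKr (by positivity))
  rw [show Q' - P0 + (τ / 2) • (P'' - Q') = Q' + (τ / 2) • (P'' - Q') - P0 by abel] at h2
  exact h2.mono hδ0.le (le_max_right _ _)

/-- choosing a good point near the reference polynomial -/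
theorem NEAR (l : ℕ) : ∀ A2 A3 : ℝ, 1 ≤ A2 → 1 ≤ A3 → ∃ A4 : ℝ, 1 ≤ A4 ∧
    ∀ (sd : SD n k D Cw) (S : Finset (Lab n k D)) (P0 Q : VPol n D) (δ0 r : ℝ) (y : En n),
    MonoL S → VD k P0 → 0 < δ0 → 0 < r → r ≤ δ0 → Dat sd l S P0 δ0 A2 y Q →
    OKp sd l S P0 δ0 A3 y r → ∃ P, NB k y r 1 (P - Q) ∧ ∃ S', rk S < rk S' ∧ WB sd l y P r S' A4 := by
  intro A2 A3 hA2 hA3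
  have hN := NL_one_le (n := n) (k := k) (D := D)
  set N := NL n k D with hNdef
  set A := A2 + A3 with hA
  have hA20 : 0 < A2 := by linarith
  have hA30 : 0 < A3 := by linarith
  have hA0 : 0 < A := by linarith
  have hA1 : 1 ≤ A := by linarith
  set t : ℝ := 1 / (2 * (N * A * A)) with ht
  have ht0 : 0 < t := by positivity
  have hNAA : 1 ≤ N * A * A := by
    have : 1 ≤ N * A := by nlinarith
    nlinarith
  have ht1 : t ≤ 1 / 2 := by
    rw [ht]
    exact one_div_le_one_div_of_le (by norm_num) (by linarith)
  set A4 := A / t + ((2 + 2 * A * (1 + 0)) + (2 + 2 * A * (1 + 0)) ^ 3) with hA4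
  have hAt : A ≤ A / t := by rw [le_div_iff₀ ht0]; nlinarith
  have hA4' : 0 < (2 + 2 * A * (1 + 0)) ^ 3 := by positivity
  refine ⟨A4, by linarith, ?_⟩
  intro sd S P0 Q δ0 r y hS hP0 hδ0 hr hrδ hy ⟨Ph, hPh, S', hrk, wh, hwh⟩
  obtain ⟨w, hw, hstr⟩ := hy.sb
  have cG := sd.G_convex l hy.mem hA0
  have hw1 : Bas (sd.G l y A) y δ0 Q S A w :=
    hw.mono cG ((sd.G_anti (by omega) _ _).trans (sd.G_mono l hy.mem hA20 (by linarith))) hA20 (by linarith)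
  have hwh1 : Bas (sd.G l y A) y r Ph S' A wh :=
    hwh.mono cG (sd.G_mono l hy.mem hA30 (by linarith)) hA30 (by linarith)
  have degQ : VD k Q := sd.G_deg _ hy.mem hA0 hw1.base
  have degPh : VD k Ph := sd.G_deg _ hy.mem hA0 hwh1.base
  have hbr : ∀ a ∈ S, |br y δ0 a (Ph - Q)| ≤ A := by
    intro a _
    have h1 := hPh.sub hy.nb
    rw [sub_sub_sub_cancel_right] at h1
    have := (NB_br hδ0).1 h1 a
    linarith
  have hsumc := sum_abs_le hA0.le hbr
  set W := ∑ a ∈ S, br y δ0 a (Ph - Q) • w a with hW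
  set u := t • (Ph - Q - W) with hu
  have hus : Usp S u := by
    refine Usp.smul t (Usp.of_point hS ?_ hδ0 (fun a ha => br_kill hw1 _ ha))
    exact (degPh.sub degQ).sub (VD.sum _ _ (fun a ha => (SB.deg hy.mem hA0 hw1 ha).smul _))
  set Pt := Q + u with hPt
  have hin : Q - (t / (1 - t)) • W ∈ sd.G l y A := by
    have h1 := PM.sum cG hw1.base S (fun a => (t / (1 - t)) * br y δ0 a (Ph - Q) * A) (fun a => (1 / A) • w a) hw1.pm
      (by
        have h1t : 0 < 1 - t := by linarith
        simp only [abs_mul, abs_of_pos hA0, abs_of_pos (show 0 < t / (1 - t) by positivity)]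
        rw [← Finset.sum_mul, ← Finset.mul_sum]
        have h2 : t / (1 - t) ≤ 2 * t := by
          rw [div_le_iff₀ h1t]; nlinarith
        calc _ ≤ 2 * t * (N * A) * A := by gcongr
          _ = 1 := by rw [ht]; field_simp)
    have h2 := h1.2
    convert h2 using 2
    rw [hW, Finset.smul_sum]
    refine Finset.sum_congr rfl (fun a _ => ?_)
    rw [smul_smul, smul_smul]
    congr 1
    field_simp
  have hmix : (1 - t) • (Q - (t / (1 - t)) • W) + t • Ph = Pt := by
    have h1t : 1 - t ≠ 0 := by linarith
    rw [smul_sub, smul_smul, show (1 - t) * (t / (1 - t)) = t by field_simp, hPt, hu, sub_smul, one_smul,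
      smul_sub, smul_sub]
    abel
  have hwt : ∀ a ∈ S', (1 / (A / t)) • wh a ∈ PM (sd.G l y A) Pt := by
    intro a ha
    have := PM.mix cG hin (hwh1.pm a ha) ht0.le (by linarith)
    rw [hmix, smul_smul] at this
    convert this using 2
    field_simp
  have hPtG : Pt ∈ sd.G l y A := by
    rw [← hmix]
    exact cG hin hwh1.base (by linarith) ht0.le (by ring)
  have hAA4 : A ≤ A4 := by linarith
  have hA40 : 0 < A4 := by linarith
  have cG4 := sd.G_convex l hy.mem hA40
  have gm4 := sd.G_mono l hy.mem hA0 hAA4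
  by_cases hsm : ∀ b : Lab n k D, |br y r b u| ≤ 1
  · refine ⟨Pt, ?_, S', hrk, wh, gm4 hPtG, hwh1.diag, fun a ha b hb => (hwh1.bd a ha b hb).trans hAA4, ?_⟩
    · rw [hPt, add_sub_cancel_left]; exact (NB_br hr).2 hsm
    · intro a ha
      exact PM.shrink cG4 gm4 (by positivity) (by linarith) (hwt a ha)
  · have hwbQ : WB sd l y Q r S A :=
      WB.scale hy.mem hA0 hr hrδ ⟨w, hw1⟩
    obtain ⟨w2, hw2⟩ := hwbQ
    have e : Pt - Q - ∑ a ∈ S, (0 : ℝ) • w2 a = u := by simp [hPt]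
    obtain ⟨τ, hτ0, hτ1, hall, S3, w3, hrk3, hbas⟩ := mid_AD cG hA1 le_rfl hw2 hPtG (fun _ => 0) (by simp)
      (by intro a ha; rw [e]; exact hus.br y r ha) (by rw [e]; exact hsm)
    rw [e] at hall
    refine ⟨Q + (τ / 2) • (Pt - Q), ?_, S3, hrk3, w3, hbas.mono cG4 gm4 (by positivity) ?_⟩
    · rw [add_sub_cancel_left, hPt, add_sub_cancel_left]
      have := ((NB_br hr).2 hall).smul (1 / 2)
      rw [smul_smul, show 1 / 2 * τ = τ / 2 by ring] at this
      refine this.mono hr.le ?_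
      rw [abs_of_pos (by norm_num : (0:ℝ) < 1 / 2)]; norm_num
    · linarith [show 0 < A / t by positivity]

end SF

namespace SF

open scoped ContDiff

variable {n k D : ℕ} {Cw : ℝ}

/-- vector valued functions -/
abbrev VFn (n D : ℕ) := Fin D → En n → ℝ

def VS (F : VFn n D) : Prop := ∀ j, ContDiff ℝ ∞ (F j)

/-- all derivatives of order up to `k+1` are bounded in the scaled sense -/
def FB (k : ℕ) (z : En n) (δ c : ℝ) (F : VFn n D) : Prop := ∀ j, DB (k + 1) z δ (c * δ ^ (k + 1)) (F j)

def vev (P : VPol n D) : VFn n D := fun j => ev (P j)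
def vj (k : ℕ) (F : VFn n D) (z : En n) : VPol n D := fun j => jt k (F j) z

theorem vev_smooth (P : VPol n D) : VS (vev P) := fun j => ev_smooth _
theorem VS.sub {F G : VFn n D} (hF : VS F) (hG : VS G) : VS (F - G) := fun j => smooth_sub (hF j) (hG j)
theorem vev_sub (P Q : VPol n D) : vev (P - Q) = vev P - vev Q := by
  funext j; simp only [vev, Pi.sub_apply, ev_sub]
theorem vj_vev {P : VPol n D} (hP : VD k P) (z : En n) : vj k (vev P) z = P := by
  funext j; exact jt_ev (hP j) z

theorem FB_of_NB {x : En n} {δ c : ℝ} {P : VPol n D} (hδ : 0 < δ) (hc : 0 ≤ c) (hP : VD k P)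
    (h : NB k x δ c P) : FB k x δ c (vev P) := by
  intro j
  rw [NB_iff hδ] at h
  intro β hβ
  rcases Nat.lt_or_ge k (sz β) with h1 | h1
  · have : polyPDval β (P j) x = 0 := by
      unfold polyPDval
      rw [polyPD_eq_zero β (P j) (hP j) h1, map_zero]
    rw [vev, ← polyPDval_eq, this, abs_zero, zero_mul]; positivity
  · exact h j β h1

theorem FB.down {x : En n} {δ c ρ R : ℝ} {F : VFn n D} (h : FB k x δ c F) (hρ : 0 < ρ) (hρδ : ρ ≤ δ)
    (hδ : δ ≤ R * ρ) (hc : 0 ≤ c) : FB k x ρ (c * R ^ (k + 1)) F := by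
  intro j
  refine (h j).mono le_rfl hρ.le hρδ ?_
  rw [mul_assoc, ← mul_pow]
  have : 0 ≤ δ := hρ.le.trans hρδ
  gcongr

theorem FB.up {x : En n} {δ c ρ : ℝ} {F : VFn n D} (h : FB k x ρ c F) (hρ : 0 < ρ) (hρδ : ρ ≤ δ)
    (hc : 0 ≤ c) : FB k x δ c F := by
  intro j β hβ
  have h1 := h j β hβ
  have hδ : 0 < δ := hρ.trans_le hρδ
  have e : ∀ t : ℝ, t ^ (k + 1) = t ^ (k + 1 - sz β) * t ^ sz β := by
    intro t; rw [← pow_add]; congr 1; omega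
  rw [e, ← mul_assoc] at h1 ⊢
  have h2 := le_of_mul_le_mul_right h1 (by positivity)
  gcongr
  refine h2.trans ?_
  gcongr

theorem FB.mono {x : En n} {δ c c' : ℝ} {F : VFn n D} (h : FB k x δ c F) (hδ : 0 ≤ δ) (hc : c ≤ c') :
    FB k x δ c' F := fun j => (h j).mono le_rfl hδ le_rfl (by gcongr)

theorem FB.tri {x : En n} {δ c c' : ℝ} {F G H : VFn n D} (hF : VS F) (hG : VS G) (hH : VS H) (hδ : 0 ≤ δ)
    (h : FB k x δ c (F - G)) (h' : FB k x δ c' (G - H)) : FB k x δ (c + c') (F - H) := by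
  intro j
  have h1 := DB.add hδ (smooth_sub (hF j) (hG j)) (smooth_sub (hG j) (hH j)) (h j) (h' j)
  have e : F j - G j + (G j - H j) = (F - H) j := by simp
  rw [e] at h1
  rwa [add_mul]

theorem FB.symm' {x : En n} {δ c : ℝ} {F G : VFn n D} (hF : VS F) (hG : VS G)
    (h : FB k x δ c (F - G)) : FB k x δ c (G - F) := by
  intro j
  have h1 := DB.smul (-1) (smooth_sub (hF j) (hG j)) (h j)
  have e : (-1 : ℝ) • (F j - G j) = (G - F) j := by simp
  rw [e] at h1
  simpa using h1

theorem FB.congr {x : En n} {δ c : ℝ} {F G R : VFn n D} (h : FB k x δ c (F - R))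
    (hFG : ∀ j, F j =ᶠ[nhds x] G j) : FB k x δ c (G - R) := by
  intro j β hβ
  have : pdalpha β ((G - R) j) x = pdalpha β ((F - R) j) x := by
    refine (pdalpha_eventuallyEq β ?_).self_of_nhds
    filter_upwards [hFG j] with y hy
    simp [hy]
  rw [this]
  exact h j β hβ

theorem vj_congr {x : En n} {F G : VFn n D} (hFG : ∀ j, F j =ᶠ[nhds x] G j) : vj k F x = vj k G x := by
  funext j
  exact jt_congr (fun β _ => (pdalpha_eventuallyEq β (hFG j)).self_of_nhds)

theorem FB.NB {x : En n} {δ c : ℝ} (hδ : 0 < δ) {F G : VFn n D} (hF : VS F) (hG : VS G)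
    (h : FB k x δ c (F - G)) : NB k x δ c (vj k F x - vj k G x) := by
  rw [NB_iff hδ]
  intro j β hβ
  have h1 := h j β (by omega)
  have e : pdalpha β (ev ((vj k F x - vj k G x) j)) x = pdalpha β ((F - G) j) x := by
    rw [← polyPDval_eq, Pi.sub_apply, polyPDval_sub, Pi.sub_apply, pdalpha_sub β (hF j) (hG j)]
    simp only [vj, jt_val k _ x β hβ, Pi.sub_apply]
  rwa [e]

/-! ### patching -/

/-- two cutoffs and a function -/
structure Pc (n D : ℕ) where
  c : En n
  s : ℝ
  a : En n → ℝ
  b : En n → ℝ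
  F : VFn n D

def patch : List (Pc n D) → VFn n D
  | [] => 0
  | p :: L => fun j => p.a * p.a * patch L j + p.b * p.b * p.F j

def Pc.sm (p : Pc n D) : Prop := ContDiff ℝ ∞ p.a ∧ ContDiff ℝ ∞ p.b ∧ VS p.F

theorem patch_smooth (L : List (Pc n D)) (h : ∀ p ∈ L, p.sm) : VS (patch L) := by
  induction L with
  | nil => intro j; exact contDiff_const
  | cons p L ih =>
    intro j
    obtain ⟨h1, h2, h3⟩ := h p (by simp)
    exact smooth_add (smooth_mul (smooth_mul h1 h1) (ih (fun q hq => h q (by simp [hq])) j))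
      (smooth_mul (smooth_mul h2 h2) (h3 j))

def Good (sd : SD n k D Cw) (z : En n) (ρ C : ℝ) (R G : VFn n D) : Prop :=
  FB k z ρ C (G - R) ∧ (z ∈ sd.E → vj k G z ∈ sd.Γ z C)

theorem Good.congr {sd : SD n k D Cw} {z : En n} {ρ C : ℝ} {R G G' : VFn n D} (h : Good sd z ρ C R G)
    (hFG : ∀ j, G j =ᶠ[nhds z] G' j) : Good sd z ρ C R G' :=
  ⟨h.1.congr hFG, fun hz => by rw [← vj_congr hFG]; exact h.2 hz⟩

theorem Good.mono {sd : SD n k D Cw} {z : En n} {ρ C C' : ℝ} {R G : VFn n D} (h : Good sd z ρ C R G)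
    (hρ : 0 ≤ ρ) (hC : 0 < C) (hCC : C ≤ C') : Good sd z ρ C' R G :=
  ⟨h.1.mono hρ hCC, fun hz => sd.shape.2.2 z hz C C' hC hCC (h.2 hz)⟩

structure Pc.act (k : ℕ) (p : Pc n D) (z : En n) (ρ B : ℝ) : Prop where
  sq : ∀ x, p.a x * p.a x + p.b x * p.b x = 1
  da : DB (k + 1) z ρ B p.a
  db : DB (k + 1) z ρ B p.b

def Pc.ina (p : Pc n D) (z : En n) : Prop := p.a =ᶠ[nhds z] 1 ∧ p.b =ᶠ[nhds z] 0
def Pc.dom (p : Pc n D) (z : En n) : Prop := p.a =ᶠ[nhds z] 0 ∧ p.b =ᶠ[nhds z] 1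

/-- the constant after one patching step -/
def stepC (k : ℕ) (Cw B C : ℝ) : ℝ := 2 * (4 ^ (k + 1) * (B * B)) * C + Cw * (2 * C * B ^ (k + 1)) + C

theorem stepC_le (hCw : 0 < Cw) {B C : ℝ} (hB : 1 ≤ B) (hC : 1 ≤ C) : C ≤ stepC k Cw B C := by
  have h1 : 0 ≤ 2 * (4 ^ (k + 1) * (B * B)) * C := by positivity
  have h2 : 0 ≤ Cw * (2 * C * B ^ (k + 1)) := by positivity
  unfold stepC; linarith

theorem patch_step (hCw : 0 < Cw) {sd : SD n k D Cw} {z : En n} {ρ B C : ℝ} (hρ : 0 < ρ) (hρd : ρ ≤ sd.dm)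
    (hB : 1 ≤ B) (hC : 1 ≤ C) {R G : VFn n D} (hR : VS R) (hG : VS G) {p : Pc n D} (hp : p.sm)
    (hact : p.act k z ρ B) (h1 : Good sd z ρ C R G) (h2 : Good sd z ρ C R p.F) :
    Good sd z ρ (stepC k Cw B C) R (fun j => p.a * p.a * G j + p.b * p.b * p.F j) := by
  obtain ⟨sa, sb, sF⟩ := hp
  have hC0 : 0 < C := by linarith
  have q1 : 0 ≤ 2 * (4 ^ (k + 1) * (B * B)) * C := by positivity
  have q2 : 0 ≤ Cw * (2 * C * B ^ (k + 1)) := by positivity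
  constructor
  · intro j
    have e : ((fun j => p.a * p.a * G j + p.b * p.b * p.F j) - R) j =
        p.a * p.a * (G - R) j + p.b * p.b * (p.F - R) j := by
      funext x
      have := hact.sq x
      simp only [Pi.sub_apply, Pi.add_apply, Pi.mul_apply]
      linear_combination (R j x) * this
    rw [e]
    have ha := DB.mul hρ sa sa hact.da hact.da
    have hb := DB.mul hρ sb sb hact.db hact.db
    have ha2 := DB.mul hρ (smooth_mul sa sa) (smooth_sub (hG j) (hR j)) ha (h1.1 j)
    have hb2 := DB.mul hρ (smooth_mul sb sb) (smooth_sub (sF j) (hR j)) hb (h2.1 j)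
    have h3 := DB.add hρ.le (smooth_mul (smooth_mul sa sa) (smooth_sub (hG j) (hR j)))
      (smooth_mul (smooth_mul sb sb) (smooth_sub (sF j) (hR j))) ha2 hb2
    refine h3.mono le_rfl hρ.le le_rfl ?_
    have e4 : (4 : ℝ) ^ (k + 1) = 2 ^ (k + 1) * 2 ^ (k + 1) := by rw [← mul_pow]; norm_num
    have : 2 ^ (k + 1) * (2 ^ (k + 1) * (B * B) * (C * ρ ^ (k + 1))) +
        2 ^ (k + 1) * (2 ^ (k + 1) * (B * B) * (C * ρ ^ (k + 1))) =
        (2 * (4 ^ (k + 1) * (B * B)) * C) * ρ ^ (k + 1) := by rw [e4]; ring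
    rw [this]
    have : 0 < ρ ^ (k + 1) := by positivity
    refine mul_le_mul_of_nonneg_right ?_ this.le
    unfold stepC; linarith
  · intro hz
    have m2 : ∀ P ∈ sd.Γ z C, P ∈ sd.Γ z (2 * C) := fun P hP => sd.shape.2.2 z hz C (2 * C) hC0 (by linarith) hP
    have hnb : NB k z ρ (2 * C) (vj k G z - vj k p.F z) := by
      have := FB.tri hG hR sF hρ.le h1.1 (FB.symm' sF hR h2.1)
      refine (FB.NB hρ hG sF this).mono hρ.le (by linarith)
    have key := WC sd hz (M := 2 * C) (B := B) (δ := ρ) (by positivity) hB hρ hρd (m2 _ (h1.2 hz)) (m2 _ (h2.2 hz))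
      hnb sa sb (by
        have : p.a * p.a + p.b * p.b = 1 := by funext x; simpa using hact.sq x
        rw [this]; exact JE.refl _)
      (hact.da.mono (by omega) hρ.le le_rfl le_rfl) (hact.db.mono (by omega) hρ.le le_rfl le_rfl)
      (R := vj k (fun j => p.a * p.a * G j + p.b * p.b * p.F j) z) (fun j => jt_deg k _ z)
      (by
        intro j
        refine (jt_JE k _ z).trans ?_
        refine JE.add (smooth_mul (smooth_mul sa sa) (hG j)) (smooth_mul (smooth_mul sa sa) (ev_smooth _))
          (smooth_mul (smooth_mul sb sb) (sF j)) (smooth_mul (smooth_mul sb sb) (ev_smooth _)) ?_ ?_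
        · exact JE.mul (smooth_mul sa sa) (smooth_mul sa sa) (hG j) (ev_smooth _) (JE.refl _) (jt_JE k _ z).symm
        · exact JE.mul (smooth_mul sb sb) (smooth_mul sb sb) (sF j) (ev_smooth _) (JE.refl _) (jt_JE k _ z).symm)
    refine sd.shape.2.2 z hz _ _ (by positivity) ?_ key
    unfold stepC; linarith

theorem stepC_iter (hCw : 0 < Cw) {B C : ℝ} (hB : 1 ≤ B) (hC : 1 ≤ C) (N : ℕ) :
    1 ≤ (stepC k Cw B)^[N] C ∧ ∀ j ≤ N, (stepC k Cw B)^[j] C ≤ (stepC k Cw B)^[N] C := by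
  induction N with
  | zero => exact ⟨hC, fun j hj => by rw [Nat.le_zero.1 hj]⟩
  | succ N ih =>
    have := stepC_le (k := k) hCw hB ih.1
    rw [Function.iterate_succ_apply']
    refine ⟨ih.1.trans this, fun j hj => ?_⟩
    rcases Nat.of_le_succ hj with h | rfl
    · exact (ih.2 j h).trans this
    · rw [Function.iterate_succ_apply']

theorem patch_good (hCw : 0 < Cw) {sd : SD n k D Cw} {z : En n} {ρ B C : ℝ} (hρ : 0 < ρ) (hρd : ρ ≤ sd.dm)
    (hB : 1 ≤ B) (hC : 1 ≤ C) {R : VFn n D} (hR : VS R) (act : Pc n D → Prop) (L : List (Pc n D)) :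
    (∀ p ∈ L, p.sm) → (∀ p ∈ L, ¬ act p → p.ina z) →
    (∀ p ∈ L, act p → p.act k z ρ B ∧ Good sd z ρ C R p.F) → (∃ p ∈ L, act p ∧ p.dom z) →
    Good sd z ρ ((stepC k Cw B)^[(L.filter act).length] C) R (patch L) := by
  have hmono : ∀ N : ℕ, 1 ≤ (stepC k Cw B)^[N] C ∧ C ≤ (stepC k Cw B)^[N] C := by
    intro N
    induction N with
    | zero => exact ⟨hC, le_rfl⟩
    | succ N ih =>
      rw [Function.iterate_succ_apply']
      have := stepC_le (k := k) hCw hB ih.1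
      exact ⟨ih.1.trans this, ih.2.trans this⟩
  induction L with
  | nil => rintro - - - ⟨p, hp, -⟩; simp at hp
  | cons p L ih =>
    intro hsm hin hac hdom
    by_cases hp : act p
    swap
    · obtain ⟨ha, hb⟩ := hin p (by simp) hp
      rw [List.filter_cons_of_neg (by simpa using hp)]
      have hd' : ∃ q ∈ L, act q ∧ q.dom z := by
        obtain ⟨q, hq, h1, h2⟩ := hdom
        rcases List.mem_cons.1 hq with rfl | hq
        · exact absurd h1 hp
        · exact ⟨q, hq, h1, h2⟩
      refine (ih (fun q hq => hsm q (by simp [hq])) (fun q hq => hin q (by simp [hq]))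
        (fun q hq => hac q (by simp [hq])) hd').congr ?_
      intro j
      filter_upwards [ha, hb] with y h1 h2
      simp [patch, h1, h2]
    rw [List.filter_cons_of_pos (by simpa using hp), List.length_cons]
    obtain ⟨hpa, hpG⟩ := hac p (by simp) hp
    by_cases hpd : p.dom z
    · refine (hpG.mono hρ.le (by linarith) (hmono _).2).congr ?_
      intro j
      filter_upwards [hpd.1, hpd.2] with y h1 h2
      simp [patch, h1, h2]
    · have hd' : ∃ q ∈ L, act q ∧ q.dom z := by
        obtain ⟨q, hq, h1, h2⟩ := hdom
        rcases List.mem_cons.1 hq with rfl | hq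
        · exact absurd h2 hpd
        · exact ⟨q, hq, h1, h2⟩
      have h1 := ih (fun q hq => hsm q (by simp [hq])) (fun q hq => hin q (by simp [hq]))
        (fun q hq => hac q (by simp [hq])) hd'
      rw [Function.iterate_succ_apply']
      exact patch_step hCw hρ hρd hB (hmono _).1 hR (patch_smooth L (fun q hq => hsm q (by simp [hq])))
        (hsm p (by simp)) hpa h1 (hpG.mono hρ.le (by linarith) (hmono _).2)

end SF

namespace SF

open scoped ContDiff

variable {n k D : ℕ} {Cw : ℝ}

theorem scale_smooth {f : En n → ℝ} (hf : ContDiff ℝ ∞ f) (t : ℝ) (c : En n) :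
    ContDiff ℝ ∞ (fun x => f (t • (x - c))) :=
  hf.comp ((contDiff_id.sub contDiff_const).const_smul t)

theorem pdalpha_scale {f : En n → ℝ} (hf : ContDiff ℝ ∞ f) (t : ℝ) (c : En n) (α : Fin n → ℕ) :
    pdalpha α (fun x => f (t • (x - c))) = fun x => t ^ sz α * pdalpha α f (t • (x - c)) := by
  induction α using mi_induction with
  | h0 => simp [pdalpha_zero, sz]
  | hs α i ih =>
    rw [pdalpha_succ α i (scale_smooth hf t c), ih, pdalpha_succ α i hf]
    funext x
    have hg : HasFDerivAt (fun x : En n => t • (x - c)) (t • ContinuousLinearMap.id ℝ (En n)) x :=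
      ((hasFDerivAt_id x).sub_const c).const_smul t
    have hd : HasFDerivAt (pdalpha α f) (fderiv ℝ (pdalpha α f) (t • (x - c))) (t • (x - c)) :=
      ((pdalpha_smooth α hf).differentiable (by simp) _).hasFDerivAt
    have h1 := (hd.comp x hg).const_mul (t ^ sz α)
    unfold pd1
    have h2 := h1.fderiv
    simp only [Function.comp_def] at h2
    rw [h2, sz_add_single, pow_succ]
    simp
    ring

theorem pdalpha_const (v : ℝ) (α : Fin n → ℕ) : ∃ c, pdalpha α (fun _ : En n => v) = fun _ => c := by
  induction α using mi_induction with
  | h0 => exact ⟨v, pdalpha_zero _⟩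
  | hs α i ih =>
    obtain ⟨c, hc⟩ := ih
    refine ⟨0, ?_⟩
    rw [pdalpha_succ α i contDiff_const, hc]
    funext x
    simp [pd1]

theorem bounded_derivs {f : En n → ℝ} (hf : ContDiff ℝ ∞ f) (v : ℝ) (hv : ∀ x, 9 < ‖x‖ → f x = v) (N : ℕ) :
    ∃ B, 1 ≤ B ∧ ∀ β : Fin n → ℕ, sz β ≤ N → ∀ x, |pdalpha β f x| ≤ B := by
  have hfin : {β : Fin n → ℕ | sz β ≤ N}.Finite := by
    apply Set.Finite.subset (Set.finite_Iic (fun _ : Fin n => N))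
    intro β hβ i
    exact (Finset.single_le_sum (f := β) (fun _ _ => Nat.zero_le _) (Finset.mem_univ i)).trans hβ
  have h1 : ∀ β : Fin n → ℕ, ∃ B, ∀ x, |pdalpha β f x| ≤ B := by
    intro β
    obtain ⟨B1, hB1⟩ := (isCompact_closedBall (0 : En n) 9).exists_bound_of_continuousOn
      (pdalpha_smooth β hf).continuous.continuousOn
    obtain ⟨c, hc⟩ := pdalpha_const (n := n) v β
    refine ⟨max B1 |c|, fun x => ?_⟩
    by_cases hx : ‖x‖ ≤ 9
    · exact (hB1 x (by simpa using hx)).trans (le_max_left _ _)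
    · push Not at hx
      have e : f =ᶠ[nhds x] fun _ => v := by
        filter_upwards [(isOpen_lt continuous_const continuous_norm).mem_nhds hx] with y hy
        exact hv y hy
      rw [(pdalpha_eventuallyEq β e).self_of_nhds, hc]
      exact le_max_right _ _
  choose B hB using h1
  refine ⟨max 1 (∑ β ∈ hfin.toFinset, |B β|), le_max_left _ _, fun β hβ x => ?_⟩
  refine (hB β x).trans ((le_abs_self _).trans (le_trans ?_ (le_max_right _ _)))
  exact Finset.single_le_sum (f := fun β => |B β|) (fun _ _ => abs_nonneg _) (by simpa using hβ)

theorem cutoffs (n k : ℕ) : ∃ B : ℝ, 1 ≤ B ∧ ∀ (c : En n) (s : ℝ), 0 < s → ∃ a b : En n → ℝ,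
    ContDiff ℝ ∞ a ∧ ContDiff ℝ ∞ b ∧ (∀ x, a x * a x + b x * b x = 1) ∧
    (∀ z r, 0 < r → r ≤ s → DB (k + 1) z r B a ∧ DB (k + 1) z r B b) ∧
    (∀ z, dist z c ≤ 5 * s → a =ᶠ[nhds z] 0 ∧ b =ᶠ[nhds z] 1) ∧
    (∀ z, ¬ dist z c ≤ 10 * s → a =ᶠ[nhds z] 1 ∧ b =ᶠ[nhds z] 0) := by
  let φ : ContDiffBump (0 : En n) := ⟨6, 9, by norm_num, by norm_num⟩
  let a0 : En n → ℝ := fun x => Real.cos (Real.pi / 2 * φ x)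
  let b0 : En n → ℝ := fun x => Real.sin (Real.pi / 2 * φ x)
  have hφ : ContDiff ℝ ∞ (φ : En n → ℝ) := φ.contDiff
  have ha0 : ContDiff ℝ ∞ a0 := Real.contDiff_cos.comp (contDiff_const.mul hφ)
  have hb0 : ContDiff ℝ ∞ b0 := Real.contDiff_sin.comp (contDiff_const.mul hφ)
  have hout : ∀ x : En n, 9 ≤ ‖x‖ → φ x = 0 := fun x hx => φ.zero_of_le_dist (by simpa using hx)
  have hin : ∀ x : En n, ‖x‖ ≤ 6 → φ x = 1 := fun x hx => φ.one_of_mem_closedBall (by simpa using hx)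
  obtain ⟨B1, hB1, hB1'⟩ := bounded_derivs ha0 1 (fun x hx => by simp [a0, hout x hx.le]) (k + 1)
  obtain ⟨B2, hB2, hB2'⟩ := bounded_derivs hb0 0 (fun x hx => by simp [b0, hout x hx.le]) (k + 1)
  refine ⟨max B1 B2, hB1.trans (le_max_left _ _), fun c s hs => ?_⟩
  have nrm : ∀ x, ‖s⁻¹ • (x - c)‖ = dist x c / s := by
    intro x
    rw [norm_smul, norm_inv, Real.norm_of_nonneg hs.le, dist_eq_norm, div_eq_inv_mul]
  have sc : ∀ (f : En n → ℝ) (M : ℝ), ContDiff ℝ ∞ f → (∀ β : Fin n → ℕ, sz β ≤ k + 1 → ∀ x, |pdalpha β f x| ≤ M) →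
      ∀ z r, 0 < r → r ≤ s → DB (k + 1) z r M (fun x => f (s⁻¹ • (x - c))) := by
    intro f M hf hM z r hr hrs β hβ
    rw [pdalpha_scale hf, abs_mul, abs_of_pos (by positivity)]
    have h1 := hM β hβ (s⁻¹ • (z - c))
    have h2 : s⁻¹ ^ sz β * r ^ sz β ≤ 1 := by
      rw [← mul_pow]
      refine pow_le_one₀ (by positivity) ?_
      rw [inv_mul_le_iff₀ hs]; linarith
    have h3 := abs_nonneg (pdalpha β f (s⁻¹ • (z - c)))
    nlinarith
  have cont : ∀ x : En n, Continuous (fun x : En n => dist x c / s) := fun x =>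
    (continuous_id.dist continuous_const).div_const s
  refine ⟨fun x => a0 (s⁻¹ • (x - c)), fun x => b0 (s⁻¹ • (x - c)), scale_smooth ha0 _ _, scale_smooth hb0 _ _, ?_,
    ?_, ?_, ?_⟩
  · intro x
    have := Real.sin_sq_add_cos_sq (Real.pi / 2 * φ (s⁻¹ • (x - c)))
    simp only [a0, b0]
    linarith
  · intro z r hr hrs
    exact ⟨(sc a0 B1 ha0 hB1' z r hr hrs).mono le_rfl hr.le le_rfl (le_max_left _ _),
      (sc b0 B2 hb0 hB2' z r hr hrs).mono le_rfl hr.le le_rfl (le_max_right _ _)⟩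
  · intro z hz
    have h0 : dist z c / s < 6 := by rw [div_lt_iff₀ hs]; linarith
    have h1 : ∀ᶠ y in nhds z, dist y c / s < 6 := (cont z).continuousAt.eventually_lt_const h0
    constructor
    · filter_upwards [h1] with y hy
      simp [a0, hin _ ((nrm y).trans_le hy.le)]
    · filter_upwards [h1] with y hy
      simp [b0, hin _ ((nrm y).trans_le hy.le)]
  · intro z hz
    push Not at hz
    have h0 : 9 < dist z c / s := by rw [lt_div_iff₀ hs]; linarith
    have h1 : ∀ᶠ y in nhds z, 9 < dist y c / s := (cont z).continuousAt.eventually_const_lt h0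
    constructor
    · filter_upwards [h1] with y hy
      simp [a0, hout _ (hy.le.trans_eq (nrm y).symm)]
    · filter_upwards [h1] with y hy
      simp [b0, hout _ (hy.le.trans_eq (nrm y).symm)]

/-- packing -/
theorem packing (n : ℕ) (R : ℝ) : ∃ N : ℕ, ∀ (s : Finset (En n)) (z : En n) (ρ : ℝ), 0 < ρ →
    (∀ c ∈ s, dist c z ≤ R * ρ) → (∀ c ∈ s, ∀ d ∈ s, c ≠ d → ρ ≤ dist c d) → s.card ≤ N := by
  obtain ⟨t, ht, htc⟩ := Metric.totallyBounded_iff.1 (isCompact_closedBall (0 : En n) R).totallyBounded (1 / 2)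
    (by norm_num)
  refine ⟨ht.toFinset.card, fun s z ρ hρ h1 h2 => ?_⟩
  have nrm : ∀ x y : En n, dist (ρ⁻¹ • (x - z)) (ρ⁻¹ • (y - z)) = dist x y / ρ := by
    intro x y
    rw [dist_eq_norm, ← smul_sub, sub_sub_sub_cancel_right, norm_smul, norm_inv, Real.norm_of_nonneg hρ.le,
      dist_eq_norm, div_eq_inv_mul]
  have hex : ∀ c ∈ s, ∃ u ∈ t, dist (ρ⁻¹ • (c - z)) u < 1 / 2 := by
    intro c hc
    have : ρ⁻¹ • (c - z) ∈ Metric.closedBall (0 : En n) R := by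
      rw [mem_closedBall_zero_iff, norm_smul, norm_inv, Real.norm_of_nonneg hρ.le, ← dist_eq_norm,
        inv_mul_le_iff₀ hρ]
      linarith [h1 c hc]
    have := htc this
    simpa using this
  choose! u hu hu' using hex
  refine Finset.card_le_card_of_injOn u (fun c hc => by simpa using hu c hc) ?_
  intro c hc d hd hcd
  by_contra hne
  have h3 := h2 c hc d hd hne
  have h4 := dist_triangle_right (ρ⁻¹ • (c - z)) (ρ⁻¹ • (d - z)) (u c)
  have h5 := hu' c hc
  have h6 := hu' d hd
  have hcd' : u c = u d := hcd
  rw [nrm] at h4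
  rw [← hcd'] at h6
  have : 1 ≤ dist c d / ρ := by rw [le_div_iff₀ hρ]; linarith
  linarith

/-- cover adapted to a Lipschitz scale function -/
theorem cover (n : ℕ) : ∃ N : ℕ, ∀ (δ : En n → ℝ) (dmin dmax κ : ℝ) (x0 : En n) (ρ : ℝ), 0 < dmin → 0 < κ → κ ≤ 1 / 100 →
    (∀ x, dmin ≤ δ x) → (∀ x, δ x ≤ dmax) → (∀ x y, δ x ≤ δ y + dist x y) →
    ∃ T : Finset (En n), (∀ c ∈ T, dist c x0 ≤ ρ) ∧
      (∀ z, dist z x0 ≤ ρ → ∃ c ∈ T, dist z c ≤ 5 * (κ * δ c)) ∧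
      ∀ z, (T.filter (fun c => dist z c ≤ 10 * (κ * δ c))).card ≤ N := by
  obtain ⟨N, hN⟩ := packing n 14
  refine ⟨N, fun δ dmin dmax κ x0 ρ hd hκ hκ1 h1 h2 h3 => ?_⟩
  obtain ⟨u, hut, hdis, hcov⟩ := Vitali.exists_disjoint_subfamily_covering_enlargement_closedBall
    (Metric.closedBall x0 ρ) (fun x => x) (fun x => κ * δ x) (κ * dmax)
    (fun a _ => mul_le_mul_of_nonneg_left (h2 a) hκ.le) 5 (by norm_num)
  have hδ : ∀ x, 0 < δ x := fun x => hd.trans_le (h1 x)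
  have hsep : ∀ c ∈ u, ∀ d ∈ u, c ≠ d → κ * δ c ≤ dist c d := by
    intro c hc d hdu hne
    have := hdis hc hdu hne
    by_contra hlt
    push Not at hlt
    have hm : d ∈ Metric.closedBall c (κ * δ c) := by rw [Metric.mem_closedBall, dist_comm]; exact hlt.le
    have hm' : d ∈ Metric.closedBall d (κ * δ d) :=
      Metric.mem_closedBall_self (mul_pos hκ (hδ d)).le
    exact Set.disjoint_left.1 this hm hm'
  have hfin : u.Finite := by
    obtain ⟨N', hN'⟩ := packing n (ρ / (κ * dmin))
    by_contra hinf
    obtain ⟨s, hs, hcard⟩ := Set.Infinite.exists_subset_card_eq hinf (N' + 1)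
    have hp : 0 < κ * dmin := by positivity
    have := hN' s x0 (κ * dmin) hp (fun c hc => by
      rw [div_mul_cancel₀ _ hp.ne']; exact hut (hs hc)) (fun c hc d hd' hne =>
        (mul_le_mul_of_nonneg_left (h1 c) hκ.le).trans (hsep c (hs hc) d (hs hd') hne))
    omega
  refine ⟨hfin.toFinset, fun c hc => hut (by simpa using hc), fun z hz => ?_, fun z => ?_⟩
  · obtain ⟨b, hb, hsub⟩ := hcov z hz
    refine ⟨b, by simpa using hb, ?_⟩
    exact hsub (Metric.mem_closedBall_self (mul_pos hκ (hδ z)).le)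
  · have hz := hδ z
    have cmp : ∀ c, dist z c ≤ 10 * (κ * δ c) → 10 / 11 * δ z ≤ δ c ∧ δ c ≤ 10 / 9 * δ z := by
      intro c hc
      have a1 := h3 z c
      have a2 := h3 c z
      rw [dist_comm c z] at a2
      have a3 := hδ c
      have a4 : κ * δ c ≤ 1 / 100 * δ c := by gcongr
      constructor <;> linarith
    refine hN _ z (κ * (10 / 11 * δ z)) (by positivity) ?_ ?_
    · intro c hc
      simp only [Finset.mem_filter] at hc
      have := (cmp c hc.2).2
      rw [dist_comm]
      refine hc.2.trans ?_
      have : κ * δ c ≤ κ * (10 / 9 * δ z) := by gcongr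
      nlinarith [mul_pos hκ hz]
    · intro c hc d hd' hne
      simp only [Finset.mem_filter, Set.Finite.mem_toFinset] at hc hd'
      refine le_trans ?_ (hsep c hc.1 d hd'.1 hne)
      exact mul_le_mul_of_nonneg_left (cmp c hc.2).1 hκ.le

end SF

namespace SF

open scoped ContDiff

variable {n k D : ℕ} {Cw : ℝ}

theorem radius {OK : En n → ℝ → Prop} {dmin r0 : ℝ} (hd : 0 < dmin) (hdr : dmin ≤ r0)
    (h1 : ∀ x, OK x dmin) (h2 : ∀ x x' r r', OK x r → 0 < r' → r' + dist x x' ≤ r → OK x' r') :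
    ∃ δ : En n → ℝ, (∀ x, dmin ≤ δ x) ∧ (∀ x, δ x ≤ r0) ∧ (∀ x y, δ x ≤ δ y + dist x y) ∧
      (∀ x r, 0 < r → r < δ x → OK x r) ∧ (∀ x r, δ x < r → r ≤ r0 → ¬ OK x r) := by
  let A : En n → Set ℝ := fun x => {r | 0 < r ∧ r ≤ r0 ∧ OK x r}
  have hb : ∀ x, BddAbove (A x) := fun x => ⟨r0, fun r hr => hr.2.1⟩
  have hm : ∀ x, dmin ∈ A x := fun x => ⟨hd, hdr, h1 x⟩
  have hmin : ∀ x, dmin ≤ sSup (A x) := fun x => le_csSup (hb x) (hm x)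
  refine ⟨fun x => sSup (A x), hmin, fun x => csSup_le ⟨_, hm x⟩ (fun r hr => hr.2.1), ?_, ?_, ?_⟩
  · intro x y
    refine csSup_le ⟨_, hm x⟩ (fun r hr => ?_)
    by_cases hlt : r ≤ dist x y
    · have := hmin y
      linarith
    · push Not at hlt
      have : r - dist x y ∈ A y := ⟨by linarith, by linarith [hr.2.1, dist_nonneg (x := x) (y := y)],
        h2 x y r _ hr.2.2 (by linarith) (by linarith)⟩
      have := le_csSup (hb y) this
      linarith
  · intro x r hr hrx
    obtain ⟨r', hr', hlt⟩ := exists_lt_of_lt_csSup ⟨_, hm x⟩ hrx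
    exact h2 x x r' r hr'.2.2 hr (by rw [dist_self]; linarith)
  · intro x r hxr hr h
    have h0 := hmin x
    have : r ∈ A x := ⟨by linarith, hr, h⟩
    have := le_csSup (hb x) this
    linarith

theorem exists_sep (E : Finset (En n)) : ∃ d : ℝ, 0 < d ∧ ∀ y ∈ E, ∀ y' ∈ E, dist y y' < d → y = y' := by
  rcases E.offDiag.eq_empty_or_nonempty with h | h
  · refine ⟨1, one_pos, fun y hy y' hy' _ => ?_⟩
    by_contra hne
    have : (y, y') ∈ E.offDiag := by simp [hy, hy', hne]
    rw [h] at this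
    simp at this
  · obtain ⟨p, hp, hmin⟩ := Finset.exists_min_image E.offDiag (fun p => dist p.1 p.2) h
    refine ⟨dist p.1 p.2, dist_pos.2 (Finset.mem_offDiag.1 hp).2.2, fun y hy y' hy' hlt => ?_⟩
    by_contra hne
    have := hmin (y, y') (by simp [hy, hy', hne])
    simp only at this
    linarith

def Sol (sd : SD n k D Cw) (x0 : En n) (r δ C : ℝ) (P0 : VPol n D) (F : VFn n D) : Prop :=
  VS F ∧ ∀ z, dist z x0 ≤ r → Good sd z δ C (vev P0) F

/-- the main lemma for ranks at least `R` -/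
def ML (n k D : ℕ) (Cw : ℝ) (l R : ℕ) : Prop := ∀ A : ℝ, 1 ≤ A → ∃ c C : ℝ, 0 < c ∧ c ≤ 1 ∧ 1 ≤ C ∧
  ∀ (sd : SD n k D Cw) (x : En n) (P : VPol n D) (δ : ℝ) (S : Finset (Lab n k D)), x ∈ sd.E → R ≤ rk S →
    0 < δ → δ ≤ sd.dm → WB sd l x P δ S A → ∃ F, Sol sd x (c * δ) δ C P F

/-- the local pieces -/
structure Piece (sd : SD n k D Cw) (P0 : VPol n D) (Q : En n → VPol n D) (r0 κ C1 : ℝ) (c : En n) (d : ℝ)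
    (F : VFn n D) : Prop where
  sm : VS F
  rf : (∃ y ∈ sd.E, dist y c ≤ 2 * d ∧ ∀ z, dist z c ≤ 10 * (κ * d) → FB k z d C1 (F - vev (Q y))) ∨
    (F = vev P0 ∧ r0 < 2 * d)
  jets : ∀ z ∈ sd.E, dist z c ≤ 10 * (κ * d) → vj k F z ∈ sd.Γ z C1

def OKd (sd : SD n k D Cw) (l : ℕ) (S : Finset (Lab n k D)) (P0 : VPol n D) (δ0 A3 : ℝ) (x : En n) (r : ℝ) : Prop :=
  (∀ y ∈ sd.E, ∀ y' ∈ sd.E, dist y x ≤ r → dist y' x ≤ r → y = y') ∨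
    ∀ y ∈ sd.E, dist y x ≤ r → OKp sd l S P0 δ0 A3 y r

theorem exists_piece {sd : SD n k D Cw} {l : ℕ} {S : Finset (Lab n k D)} {P0 : VPol n D}
    {Q : En n → VPol n D} {δ0 r0 κ A2 A3 A4 cI CI : ℝ} {c : En n} {d : ℝ} (hS : MonoL S) (hP0 : VD k P0)
    (hδ0 : 0 < δ0) (hd : 0 < d) (hdδ : d ≤ δ0) (hδm : δ0 ≤ sd.dm) (hA2 : 1 ≤ A2) (hCI : 1 ≤ CI) (hcI0 : 0 < cI)
    (hcI1 : cI ≤ 1)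
    (hκ : 0 < κ) (hκ1 : κ ≤ 1 / 100) (hκc : κ ≤ cI / 40)
    (hQ : ∀ y ∈ sd.E, dist y c ≤ 2 * d → Dat sd l S P0 δ0 A2 y (Q y))
    (hOK : OKd sd l S P0 δ0 A3 c (d / 2)) (hnOK : 2 * d ≤ r0 → ¬ OKd sd l S P0 δ0 A3 c (2 * d))
    (hN : ∀ y Q, Dat sd l S P0 δ0 A2 y Q → OKp sd l S P0 δ0 A3 y (d / 2) →
      ∃ P, NB k y (d / 2) 1 (P - Q) ∧ ∃ S', rk S < rk S' ∧ WB sd l y P (d / 2) S' A4)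
    (hA4 : 1 ≤ A4)
    (hI : ∀ (y : En n) P S', y ∈ sd.E → rk S < rk S' → WB sd l y P (d / 2) S' A4 →
      ∃ F, Sol sd y (cI * (d / 2)) (d / 2) CI P F) :
    ∃ F, Piece sd P0 Q r0 κ (CI + TC n k + A2) c d F := by
  have hTC := TC_one_le n k
  have hκd : κ * d ≤ 1 / 100 * d := by gcongr
  have zero : ∀ (P : VPol n D) z, FB k z d (CI + TC n k + A2) (vev P - vev P) := by
    intro P z
    have h := FB_of_NB (k := k) (x := z) hd (by linarith) VD.zero (NB.zero (D := D) hd.le (by linarith : 0 ≤ CI + TC n k + A2))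
    rw [← vev_sub, sub_self]; exact h
  by_cases hA : ∃ y ∈ sd.E, dist y c ≤ 10 * (κ * d)
  · obtain ⟨y, hy, hyc⟩ := hA
    have hyc2 : dist y c ≤ 2 * d := by linarith
    have hDy := hQ y hy hyc2
    have degQ : VD k (Q y) := sd.G_deg _ hy (by linarith) hDy.sb.base
    rcases hOK with hone | hok
    · refine ⟨vev (Q y), vev_smooth _, Or.inl ⟨y, hy, hyc2, fun z _ => zero _ z⟩, ?_⟩
      intro z hz hzc
      have : z = y := hone z hz y hy (by linarith) (by linarith)
      rw [this, vj_vev degQ]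
      have h1 := sd.G_anti (Nat.zero_le (l + 2)) y A2 hDy.sb.base
      exact sd.shape.2.2 y hy A2 _ (by linarith) (by linarith) h1
    · obtain ⟨P, hP, S', hrk, hwb⟩ := hN y _ hDy (hok y hy (by linarith))
      obtain ⟨F, hF, hsol⟩ := hI y P S' hy hrk hwb
      have degP : VD k P := sd.G_deg _ hy (by linarith) hwb.base
      have hd2 : 0 < d / 2 := by linarith
      have hzy : ∀ z, dist z c ≤ 10 * (κ * d) → dist z y ≤ cI * (d / 2) := by
        intro z hz
        have := dist_triangle_right z y c
        have : κ * d ≤ cI / 40 * d := by gcongr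
        linarith
      refine ⟨F, hF, Or.inl ⟨y, hy, hyc2, fun z hz => ?_⟩, ?_⟩
      · have h1 := (hsol z (hzy z hz)).1
        have hz2 : dist z y ≤ d / 2 := (hzy z hz).trans (mul_le_of_le_one_left hd2.le hcI1)
        have h2 := FB_of_NB hd2 (by linarith) (degP.sub degQ) (hP.translate (degP.sub degQ) hd2 hz2)
        rw [vev_sub] at h2
        have h3 := FB.tri hF (vev_smooth _) (vev_smooth _) hd2.le h1 h2
        exact (h3.up hd2 (by linarith) (by linarith)).mono hd.le (by linarith)
      · intro z hz hzc
        exact sd.shape.2.2 z hz CI _ (by linarith) (by linarith) ((hsol z (hzy z hzc)).2 hz)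
  · push Not at hA
    by_cases hB : ∃ y ∈ sd.E, dist y c ≤ 2 * d
    · obtain ⟨y, hy, hyc⟩ := hB
      refine ⟨vev (Q y), vev_smooth _, Or.inl ⟨y, hy, hyc, fun z _ => zero _ z⟩, ?_⟩
      intro z hz hzc
      exact absurd hzc (not_le.2 (hA z hz))
    · push Not at hB
      refine ⟨vev P0, vev_smooth _, Or.inr ⟨rfl, ?_⟩, fun z hz hzc => absurd hzc (not_le.2 (hA z hz))⟩
      by_contra hlt
      push Not at hlt
      refine hnOK hlt (Or.inl ?_)
      intro y hy _ _ hyc _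
      exact absurd hyc (not_le.2 (hB y hy))

set_option maxHeartbeats 1600000 in
theorem CORE (hCw : 0 < Cw) (l R : ℕ) (hML : ML n k D Cw l (R + 1)) : ∀ A2 K : ℝ, 1 ≤ A2 → 1 ≤ K → ∃ C : ℝ, 1 ≤ C ∧
    ∀ (sd : SD n k D Cw) (S : Finset (Lab n k D)) (P0 : VPol n D) (δ0 Rd : ℝ) (x0 : En n) (Q : En n → VPol n D),
    R ≤ rk S → MonoL S → VD k P0 → 0 < δ0 → δ0 ≤ sd.dm → δ0 ≤ K * Rd →
    (∀ y ∈ sd.E, dist y x0 ≤ Rd → Dat sd l S P0 δ0 A2 y (Q y)) → ∃ F, Sol sd x0 (Rd / 2) δ0 C P0 F := by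
  intro A2 K hA2 hK
  obtain ⟨A3, Λ, hA3, hΛ, hCONS⟩ := CONS (n := n) (k := k) (D := D) hCw l A2 4 hA2 (by norm_num)
  obtain ⟨A4, hA4, hNEAR⟩ := NEAR (n := n) (k := k) (D := D) (Cw := Cw) l A2 A3 hA2 hA3
  obtain ⟨cI, CI, hcI0, hcI1, hCI, hIH⟩ := hML A4 hA4
  obtain ⟨B, hB, hcut⟩ := cutoffs n k
  obtain ⟨N, hcover⟩ := cover n
  have hTC := TC_one_le n k
  obtain ⟨κ, hκ0, hκ1, hκc⟩ : ∃ κ : ℝ, 0 < κ ∧ κ ≤ 1 / 100 ∧ κ ≤ cI / 40 :=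
    ⟨min (1 / 100) (cI / 40), by positivity, min_le_left _ _, min_le_right _ _⟩
  set C1 := CI + TC n k + A2 with hC1
  have hC11 : 1 ≤ C1 := by linarith
  have hTA : 0 < TC n k * A2 := by positivity
  have hTΛ : 0 < TC n k * Λ := by positivity
  set KK := 64 * K / κ with hKK
  have hKK1 : 1 ≤ KK := by rw [hKK, le_div_iff₀ hκ0]; linarith
  set C2 := (C1 + TC n k * A2 + TC n k * Λ) * KK ^ (k + 1) with hC2
  have hKKp : 1 ≤ KK ^ (k + 1) := one_le_pow₀ hKK1
  have hC12 : C1 ≤ C2 := by rw [hC2]; nlinarith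
  have hC21 : 1 ≤ C2 := by linarith
  obtain ⟨hC31, hiter⟩ := stepC_iter (k := k) hCw hB hC21 N
  set C3 := (stepC k Cw B)^[N] C2 with hC3
  refine ⟨C3 + TC n k * A2, by linarith, ?_⟩
  intro sd S P0 δ0 Rd x0 Q hR hS hP0 hδ0 hδm hδK hDat
  set r0 := δ0 / (8 * K) with hr0
  have hr00 : 0 < r0 := by positivity
  have hr0δ : 8 * r0 ≤ δ0 := by
    rw [hr0, mul_div_assoc', div_le_iff₀ (by positivity)]; nlinarith
  have hδr0 : δ0 = 8 * K * r0 := by rw [hr0]; field_simp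
  have hRd : 8 * r0 ≤ Rd := by
    have : K * (8 * r0) ≤ K * Rd := by linarith
    exact le_of_mul_le_mul_left this (by linarith)
  -- the radius function
  obtain ⟨d0, hd0, hsep⟩ := exists_sep sd.E
  have hdm : 0 < min r0 (d0 / 3) := by positivity
  obtain ⟨δ, hδmin, hδmax, hδL, hδOK, hδN⟩ := radius (OK := OKd sd l S P0 δ0 A3) hdm (min_le_left r0 _)
    (by
      intro x
      left
      intro y hy y' hy' h1 h2
      refine hsep y hy y' hy' ?_
      have := dist_triangle_right y y' x
      have := min_le_right r0 (d0 / 3)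
      linarith)
    (by
      intro x x' r r' h hr' hrr
      have tri : ∀ y, dist y x' ≤ r' → dist y x ≤ r := by
        intro y hy
        have := dist_triangle y x' x
        rw [dist_comm x' x] at this
        linarith
      rcases h with h | h
      · left
        intro y hy y' hy' h1 h2
        exact h y hy y' hy' (tri y h1) (tri y' h2)
      · right
        intro y hy h1
        obtain ⟨P, hP, S', hrk, hwb⟩ := h y hy (tri y h1)
        refine ⟨P, hP, S', hrk, hwb.scale hy (by linarith) hr' ?_⟩
        have := dist_nonneg (x := x) (y := x')
        linarith)
  have hδp : ∀ x, 0 < δ x := fun x => hdm.trans_le (hδmin x)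
  obtain ⟨T, hT0, hTcov, hTN⟩ := hcover δ _ r0 κ x0 (Rd / 2) hdm hκ0 hκ1 hδmin hδmax hδL
  have hκδ : ∀ x, κ * δ x ≤ 1 / 100 * δ x := fun x => mul_le_mul_of_nonneg_right hκ1 (hδp x).le
  -- the pieces
  have hpiece : ∀ c ∈ T, ∃ F, Piece sd P0 Q r0 κ C1 c (δ c) F := by
    intro c hc
    have h1 := hδmax c
    have h2 := hδp c
    refine exists_piece (A3 := A3) (A4 := A4) hS hP0 hδ0 h2 (by linarith) hδm hA2 hCI hcI0 hcI1 hκ0 hκ1 hκc ?_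
      (hδOK c _ (by linarith) (by linarith)) (fun h => hδN c _ (by linarith) h) ?_ hA4 ?_
    · intro y hy hyc
      refine hDat y hy ?_
      have := dist_triangle y c x0
      have := hT0 c hc
      linarith
    · intro y Qy hDy hok
      exact hNEAR sd S P0 Qy δ0 _ y hS hP0 hδ0 (by linarith) (by linarith) hDy hok
    · intro y P S' hy hrk hwb
      exact hIH sd y P _ S' hy (by omega) (by linarith) (by linarith) hwb
  choose! Fp hFp using hpiece
  choose! ca cb hca hcb hcsq hcD hcdom hcina using hcut
  let mk : En n → Pc n D := fun c => ⟨c, κ * δ c, ca c (κ * δ c), cb c (κ * δ c), Fp c⟩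
  let L : List (Pc n D) := T.toList.map mk
  have hκp : ∀ c, 0 < κ * δ c := fun c => mul_pos hκ0 (hδp c)
  have hLmem : ∀ p ∈ L, ∃ c ∈ T, mk c = p := by
    intro p hp
    obtain ⟨c, hc, rfl⟩ := List.mem_map.1 hp
    exact ⟨c, by simpa using hc, rfl⟩
  have hLsm : ∀ p ∈ L, p.sm := by
    intro p hp
    obtain ⟨c, hc, rfl⟩ := hLmem p hp
    exact ⟨hca c _ (hκp c), hcb c _ (hκp c), (hFp c hc).sm⟩
  refine ⟨patch L, patch_smooth L hLsm, ?_⟩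
  intro z hz
  have hδz := hδp z
  have hκz := hκp z
  have hκz' := hκδ z
  set ρ := κ * δ z / 2 with hρ
  have hρ0 : 0 < ρ := by positivity
  have hρz : ρ ≤ δ z := by linarith
  have hzr := hδmax z
  let act : Pc n D → Prop := fun p => dist z p.c ≤ 10 * p.s
  have cmp : ∀ c, dist z c ≤ 10 * (κ * δ c) → 10 / 11 * δ z ≤ δ c ∧ δ c ≤ 10 / 9 * δ z := by
    intro c hc
    have a1 := hδL z c
    have a2 := hδL c z
    rw [dist_comm c z] at a2
    have a3 := hδp c
    have a4 := hκδ c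
    constructor <;> linarith
  have hcount : (L.filter act).length ≤ N := by
    refine le_trans (le_of_eq ?_) (hTN z)
    simp only [L, List.filter_map, List.length_map]
    rw [Finset.card_def, Finset.filter_val, ← Finset.coe_toList, Multiset.filter_coe, Multiset.coe_card]
    congr 1
  obtain ⟨c1, hc1T, hc1⟩ := hTcov z hz
  have hc1' : dist z c1 ≤ 10 * (κ * δ c1) := by have := hκp c1; linarith
  -- the general conclusion
  have fin : ∀ Rf : VPol n D, (∀ c ∈ T, dist z c ≤ 10 * (κ * δ c) → FB k z ρ C2 (Fp c - vev Rf)) →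
      FB k z δ0 (TC n k * A2) (vev Rf - vev P0) → Good sd z δ0 (C3 + TC n k * A2) (vev P0) (patch L) := by
    intro Rf h1 h2
    have h3 := patch_good (k := k) (sd := sd) (z := z) (ρ := ρ) (B := B) (C := C2) hCw hρ0 (by linarith) hB hC21
      (R := vev Rf) (vev_smooth Rf) act L hLsm
      (by
        intro p hp hna
        obtain ⟨c, hc, rfl⟩ := hLmem p hp
        exact hcina c _ (hκp c) z hna)
      (by
        intro p hp ha
        obtain ⟨c, hc, rfl⟩ := hLmem p hp
        have hc' : dist z c ≤ 10 * (κ * δ c) := ha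
        have hle : ρ ≤ κ * δ c := by
          have := mul_le_mul_of_nonneg_left (cmp c hc').1 hκ0.le
          rw [hρ]; linarith
        refine ⟨⟨hcsq c _ (hκp c), (hcD c _ (hκp c) z ρ hρ0 hle).1, (hcD c _ (hκp c) z ρ hρ0 hle).2⟩, h1 c hc hc', ?_⟩
        intro hzE
        exact sd.shape.2.2 z hzE C1 C2 (by linarith) hC12 ((hFp c hc).jets z hzE hc'))
      ⟨mk c1, List.mem_map.2 ⟨c1, by simpa using hc1T, rfl⟩, hc1', hcdom c1 _ (hκp c1) z hc1⟩
    have h4 := h3.mono hρ0.le (by linarith [(stepC_iter (k := k) hCw hB hC21 (L.filter act).length).1]) (hiter _ hcount)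
    refine ⟨?_, fun hzE => sd.shape.2.2 z hzE C3 _ (by linarith) (by linarith) (h4.2 hzE)⟩
    exact FB.tri (patch_smooth L hLsm) (vev_smooth _) (vev_smooth _) hδ0.le
      (h4.1.up hρ0 (by linarith) (by linarith)) h2
  have hzx : dist z x0 ≤ Rd / 2 := hz
  have near : ∀ c, dist z c ≤ 10 * (κ * δ c) → ∀ y, dist y c ≤ 2 * δ c → dist y z ≤ 4 * δ z := by
    intro c hc y hy
    have := dist_triangle_right y z c
    have := cmp c hc
    have := hκδ c
    linarith
  have hDz : ∀ y ∈ sd.E, dist y z ≤ 4 * δ z → Dat sd l S P0 δ0 A2 y (Q y) := by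
    intro y hy hyz
    refine hDat y hy ?_
    have := dist_triangle y z x0
    linarith
  have hQ0 : ∀ y ∈ sd.E, dist y z ≤ 4 * δ z → FB k z δ0 (TC n k * A2) (vev (Q y) - vev P0) := by
    intro y hy hyz
    have hDy := hDz y hy hyz
    have dg : VD k (Q y - P0) := (sd.G_deg _ hy (by linarith) hDy.sb.base).sub hP0
    have h1 := hDy.nb.translate (y := z) dg hδ0 (by rw [dist_comm]; linarith)
    have := FB_of_NB hδ0 hTA.le dg h1
    rwa [vev_sub] at this
  by_cases hbig : r0 / 4 ≤ δ z
  · have hP00 : ∀ c : ℝ, 0 ≤ c → ∀ s : ℝ, 0 < s → FB k z s c (vev P0 - vev P0) := by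
      intro c hc s hs
      have h := FB_of_NB (k := k) (x := z) hs hc VD.zero (NB.zero (D := D) hs.le hc)
      rw [← vev_sub, sub_self]; exact h
    refine fin P0 ?_ (hP00 _ hTA.le _ hδ0)
    intro c hc hzc
    rcases (hFp c hc).rf with ⟨y, hy, hyc, hF⟩ | ⟨h, -⟩
    · have hyz := near c hzc y hyc
      have h1 := (hF z hzc).up (δ := δ0) (hδp c) (by linarith [hδmax c]) (by linarith)
      have h2 := FB.tri (hFp c hc).sm (vev_smooth _) (vev_smooth _) hδ0.le h1 (hQ0 y hy hyz)
      refine (h2.down hρ0 (by linarith) (R := KK) ?_ (by linarith)).mono hρ0.le ?_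
      · have e : KK * ρ = 32 * K * δ z := by rw [hKK, hρ]; field_simp; norm_num
        rw [e, hδr0]
        nlinarith
      · rw [hC2]; exact mul_le_mul_of_nonneg_right (by linarith) (by positivity)
    · rw [h]; exact hP00 _ (by linarith) _ hρ0
  · push Not at hbig
    have typ : ∀ c ∈ T, dist z c ≤ 10 * (κ * δ c) → ∃ y ∈ sd.E, dist y c ≤ 2 * δ c ∧ FB k z (δ c) C1 (Fp c - vev (Q y)) := by
      intro c hc hzc
      rcases (hFp c hc).rf with ⟨y, hy, hyc, hF⟩ | ⟨-, h⟩
      · exact ⟨y, hy, hyc, hF z hzc⟩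
      · have := cmp c hzc
        linarith
    obtain ⟨y1, hy1, hy1c, -⟩ := typ c1 hc1T hc1'
    have hy1z := near c1 hc1' y1 hy1c
    refine fin (Q y1) ?_ (hQ0 y1 hy1 hy1z)
    intro c hc hzc
    obtain ⟨y, hy, hyc, hF⟩ := typ c hc hzc
    have hyz := near c hzc y hyc
    have hDy := hDz y hy hyz
    have hDy1 := hDz y1 hy1 hy1z
    have dg : VD k (Q y - Q y1) := (sd.G_deg _ hy (by linarith) hDy.sb.base).sub
      (sd.G_deg _ hy1 (by linarith) hDy1.sb.base)
    rcases hCONS sd S P0 (Q y) (Q y1) δ0 (δ z) z y y1 hP0 hδ0 hδm hδz hDy hDy1 hyz hy1z with h | h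
    · exact absurd (Or.inr h) (hδN z (2 * δ z) (by linarith) (by linarith))
    · have h4 : 0 < 4 * δ z := by linarith
      have h1 := (h.up' (δ' := 4 * δ z) hδz.le (by linarith) (by linarith)).translate (y := z) dg h4
        (by rw [dist_comm]; exact hyz)
      have h2 := FB_of_NB h4 hTΛ.le dg h1
      rw [vev_sub] at h2
      have h3 := FB.tri (hFp c hc).sm (vev_smooth _) (vev_smooth _) h4.le
        (hF.up (δ := 4 * δ z) (hδp c) (by linarith [(cmp c hzc).2]) (by linarith)) h2
      refine (h3.down hρ0 (by linarith) (R := KK) ?_ (by linarith)).mono hρ0.le ?_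
      · have e : KK * ρ = 32 * K * δ z := by rw [hKK, hρ]; field_simp; norm_num
        rw [e]
        nlinarith
      · rw [hC2]; gcongr; linarith

end SF

namespace SF

open scoped ContDiff

variable {n k D : ℕ} {Cw : ℝ}

/-! ### the main lemma -/

theorem ML_step (hCw : 0 < Cw) (l R : ℕ) (hML : ML n k D Cw l (R + 1)) : ML n k D Cw (l + 3) R := by
  intro A hA
  obtain ⟨A1, hA1, hR⟩ := R_iter (n := n) (k := k) (D := D) hCw (l + 3) A hA
  have hA11 : 1 ≤ A1 := hA.trans hA1
  obtain ⟨c1, C1, hc10, hc11, hC1, hIH⟩ := hML A1 hA11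
  obtain ⟨A', η, hA', hη0, hη1, hT⟩ := transport (n := n) (k := k) (D := D) (Cw := Cw) (l + 2) A1 hA11
  have hA'1 : 1 ≤ A' := hA11.trans hA'
  have hN := NL_one_le (n := n) (k := k) (D := D)
  have hTC := TC_one_le n k
  set T := TC n k with hTdef
  set N := NL n k D with hNdef
  set c0 : ℝ := min η (1 / (2 * N * T * (A' * A'))) with hc0
  have hA'0 : 0 < A' := by linarith
  have hc0p : 0 < c0 := lt_min hη0 (by positivity)
  have hc0η : c0 ≤ η := min_le_left _ _
  have hc0b : c0 * (2 * N * T * (A' * A')) ≤ 1 := by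
    have h1 : c0 ≤ 1 / (2 * N * T * (A' * A')) := min_le_right _ _
    rwa [le_div_iff₀ (by positivity)] at h1
  have hc01 : c0 ≤ 1 := hc0η.trans hη1
  set A2 : ℝ := 2 * T * A' + 1 with hA2
  have hTA : 1 ≤ T * A' := one_le_mul_of_one_le_of_one_le hTC hA'1
  have hTA' : A' ≤ T * A' := le_mul_of_one_le_left hA'0.le hTC
  obtain ⟨C2, hC2, hCO⟩ := CORE (n := n) (k := k) (D := D) hCw l R hML A2 (1 / c0) (by rw [hA2]; linarith)
    (by rw [le_div_iff₀ hc0p]; linarith)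
  refine ⟨min c1 (c0 / 2), max C1 C2, lt_min hc10 (by positivity), (min_le_left _ _).trans hc11,
    hC1.trans (le_max_left _ _), ?_⟩
  intro sd x P δ S hx hrk hδ hδm hWB
  have hCm : (0:ℝ) < max C1 C2 := lt_of_lt_of_le (by linarith) (le_max_left C1 C2)
  obtain ⟨S', hS', hSB, hmono⟩ := hR sd x hx P δ S hδ hδm hWB
  by_cases hbig : R + 1 ≤ rk S'
  · obtain ⟨F, hF, hG⟩ := hIH sd x P δ S' hx hbig hδ hδm (hSB.wb.mono hx (by linarith) le_rfl (by omega))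
    refine ⟨F, hF, fun z hz => (hG z (hz.trans ?_)).mono hδ.le (by linarith) (le_max_left _ _)⟩
    exact mul_le_mul_of_nonneg_right (min_le_left _ _) hδ.le
  have hSS : R ≤ rk S' := by rcases hS' with h | h; · rw [h]; exact hrk
                             · omega
  have hP : VD k P := sd.G_deg _ hx (by linarith) hSB.base
  have hex : ∀ y, ∃ Q, y ∈ sd.E → dist y x ≤ c0 * δ → Dat sd l S' P δ A2 y Q := by
    intro y
    by_cases hy : y ∈ sd.E ∧ dist y x ≤ c0 * δ
    swap
    · exact ⟨0, fun h1 h2 => absurd ⟨h1, h2⟩ hy⟩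
    obtain ⟨hyE, hyd⟩ := hy
    obtain ⟨P', hSB', hNB⟩ := hT sd x y hx hyE P δ S' hδ hSB (by
      rw [dist_comm]; exact hyd.trans (mul_le_mul_of_nonneg_right hc0η hδ.le))
    obtain ⟨w, hw, hws⟩ := hSB'
    have dg : VD k (P' - P) := (sd.G_deg _ hyE hA'0 hw.base).sub hP
    have hs : 0 < c0 * δ := by positivity
    have h1 := (hNB.up' (δ' := c0 * δ) dist_nonneg (by rw [dist_comm]; exact hyd) hA'0.le).translate (y := y)
      dg hs hyd
    have h2 : NB k y δ (T * A' * c0) (P' - P) := by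
      have := h1.up (δ' := δ) hs (by nlinarith) (by positivity)
      rwa [mul_div_assoc, div_self hδ.ne', mul_one] at this
    have h3 : ∀ a ∈ S', |br y δ a (P' - P)| ≤ T * A' * c0 := fun a _ => (NB_br hδ).1 h2 a
    have h4 := sum_abs_le (by positivity) h3
    have h5 : (∑ a ∈ S', |br y δ a (P' - P)|) * A' ≤ 1 / 2 := by
      have := mul_le_mul_of_nonneg_right h4 hA'0.le
      rw [← hNdef] at this
      linarith [show N * (T * A' * c0) * A' = c0 * (2 * N * T * (A' * A')) / 2 by ring]
    have hB := hw.adjust (sd.G_convex _ hyE hA'0) hA'0 _ h5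
    have hSBn : SB sd (l + 2) y (P' - ∑ a ∈ S', br y δ a (P' - P) • w a) δ S' A2 := by
      have hle : 2 * A' ≤ A2 := by rw [hA2]; linarith
      refine ⟨w, hB.mono (sd.G_convex _ hyE (by linarith)) (sd.G_mono _ hyE hA'0 (by linarith)) (by linarith) hle,
        fun a ha b => (hws a ha b).trans (by linarith)⟩
    have e : P' - ∑ a ∈ S', br y δ a (P' - P) • w a - P = (P' - P) - ∑ a ∈ S', br y δ a (P' - P) • w a := by abel
    refine ⟨P' - ∑ a ∈ S', br y δ a (P' - P) • w a, fun _ _ => ⟨hyE, hSBn, ?_, ?_⟩⟩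
    · refine Usp.of_point hmono ((sd.G_deg _ hyE (by linarith) hSBn.base).sub hP) hδ (y := y) ?_
      intro a ha
      rw [e]; exact br_kill hw _ ha
    · rw [e]
      have h6 := NB.brs hδ hws hA'0.le (fun a => br y δ a (P' - P)) le_rfl
      refine (h2.sub h6).mono hδ.le ?_
      have : T * A' * c0 ≤ T * A' := mul_le_of_le_one_right (by positivity) hc01
      rw [hA2]; linarith
  choose Q hQ using hex
  obtain ⟨F, hF, hG⟩ := hCO sd S' P δ (c0 * δ) x Q hSS hmono hP hδ hδm (by
    rw [← mul_assoc, one_div, inv_mul_cancel₀ hc0p.ne', one_mul]) (fun y hy hd => hQ y hy hd)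
  refine ⟨F, hF, fun z hz => (hG z (hz.trans ?_)).mono hδ.le (by linarith) (le_max_right _ _)⟩
  have := mul_le_mul_of_nonneg_right (min_le_right c1 (c0 / 2)) hδ.le
  linarith

theorem ML_all (hCw : 0 < Cw) : ∃ l, ML n k D Cw l 1 := by
  have h : ∀ d R : ℕ, rk (Finset.univ : Finset (Lab n k D)) < R + d → ∃ l, ML n k D Cw l R := by
    intro d
    induction d with
    | zero =>
      intro R hR
      refine ⟨0, fun A hA => ⟨1, 1, by norm_num, le_rfl, le_rfl, ?_⟩⟩
      intro sd x P δ S hx hrk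
      have := rk_le S
      omega
    | succ d ih =>
      intro R hR
      obtain ⟨l, hl⟩ := ih (R + 1) (by omega)
      exact ⟨l + 3, ML_step hCw l R hl⟩
  exact h _ 1 (Nat.lt_add_of_pos_left one_pos)

/-- Step A: a point of `Γ_l (x0)` gives an extension -/
theorem TOP (hCw : 0 < Cw) (N0 : ℝ) (hN0 : 1 ≤ N0) : ∃ l, ∀ A : ℝ, 1 ≤ A → ∃ C : ℝ, 1 ≤ C ∧
    ∀ (sd : SD n k D Cw) (x0 : En n) (P0 : VPol n D) (δ : ℝ), x0 ∈ sd.E → 0 < δ → δ ≤ sd.dm →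
    P0 ∈ sd.G l x0 A → ∃ F, Sol sd x0 (N0 * δ) δ C P0 F := by
  obtain ⟨l, hl⟩ := ML_all (n := n) (k := k) (D := D) hCw
  refine ⟨l + 3, fun A hA => ?_⟩
  have hTC := TC_one_le n k
  have hp : 1 ≤ (2 * N0) ^ (k + 1) := one_le_pow₀ (by linarith)
  have hA2 : A ≤ TC n k * A * (2 * N0) ^ (k + 1) := by
    have h1 : A ≤ TC n k * A := le_mul_of_one_le_left (by linarith) hTC
    exact h1.trans (le_mul_of_one_le_right (by linarith) hp)
  obtain ⟨C, hC, hCO⟩ := CORE (n := n) (k := k) (D := D) hCw l 0 hl (TC n k * A * (2 * N0) ^ (k + 1)) 1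
    (by linarith) le_rfl
  refine ⟨C, hC, ?_⟩
  intro sd x0 P0 δ hx0 hδ hδm hP0
  have hP : VD k P0 := sd.G_deg _ hx0 (by linarith) hP0
  have hex : ∀ y, ∃ Q, y ∈ sd.E → dist y x0 ≤ 2 * N0 * δ → Dat sd l ∅ P0 δ (TC n k * A * (2 * N0) ^ (k + 1)) y Q := by
    intro y
    by_cases hy : y ∈ sd.E ∧ dist y x0 ≤ 2 * N0 * δ
    swap
    · exact ⟨0, fun h1 h2 => absurd ⟨h1, h2⟩ hy⟩
    obtain ⟨hyE, hyd⟩ := hy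
    obtain ⟨P', hP', hNB⟩ := hP0.2 y hyE
    have hG' := sd.G_mono (l + 2) hyE (by linarith : 0 < A) hA2 hP'
    refine ⟨P', fun _ _ => ⟨hyE, ⟨fun _ => 0, ⟨hG', by simp, by simp, by simp⟩, by simp⟩, fun a ha => by simp at ha, ?_⟩⟩
    have dg : VD k (P' - P0) := (sd.G_deg _ hyE (by linarith) hP').sub hP
    have h1 := (hNB.symm'.up' (δ' := 2 * N0 * δ) dist_nonneg (by rw [dist_comm]; exact hyd) (by linarith)).translate
      (y := y) dg (by positivity) hyd
    exact h1.down hδ.le (by linarith) le_rfl (by positivity) (by nlinarith)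
  choose Q hQ using hex
  have := hCO sd ∅ P0 δ (2 * N0 * δ) x0 Q (Nat.zero_le _) (fun a ha => by simp at ha) hP hδ hδm (by nlinarith)
    (fun y hy hd => hQ y hy hd)
  rwa [show 2 * N0 * δ / 2 = N0 * δ by ring] at this

end SF

namespace SF

open scoped ContDiff Pointwise

/-! ### bodies, trees and fields -/

section Trees

variable {V : Type} [NormedAddCommGroup V] [NormedSpace ℝ V] {ι : Type}

structure Bod (B : Set V) : Prop where
  conv : Convex ℝ B
  symm : ∀ x ∈ B, -x ∈ B
  op : IsOpen B
  zero : (0:V) ∈ B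

theorem Bod.zero_mem {B : Set V} (h : Bod B) (a : ℝ) : (0:V) ∈ a • B :=
  Set.mem_smul_set.2 ⟨0, h.zero, smul_zero _⟩

theorem Bod.add {B : Set V} (h : Bod B) {a b : ℝ} (ha : 0 ≤ a) (hb : 0 ≤ b) {x y : V} (hx : x ∈ a • B)
    (hy : y ∈ b • B) : x + y ∈ (a + b) • B := by
  rw [h.conv.add_smul ha hb]; exact Set.add_mem_add hx hy

theorem Bod.mono {B : Set V} (h : Bod B) {a b : ℝ} (ha : 0 ≤ a) (hab : a ≤ b) {x : V} (hx : x ∈ a • B) :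
    x ∈ b • B := by
  have := h.add ha (sub_nonneg.2 hab) hx (h.zero_mem (b - a))
  simpa using this

theorem Bod.neg {B : Set V} (h : Bod B) {a : ℝ} {x : V} (hx : x ∈ a • B) : -x ∈ a • B := by
  obtain ⟨b, hb, rfl⟩ := Set.mem_smul_set.1 hx
  exact Set.mem_smul_set.2 ⟨-b, h.symm b hb, smul_neg _ _⟩

theorem Bod.smul {B : Set V} (h : Bod B) {a s : ℝ} (ha : 0 ≤ a) {t : ℝ} (ht : |t| ≤ s) {x : V} (hx : x ∈ a • B) :
    t • x ∈ (s * a) • B := by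
  have key : ∀ t' : ℝ, 0 ≤ t' → t' ≤ s → t' • x ∈ (s * a) • B := by
    intro t' h0 h1
    refine h.mono (mul_nonneg h0 ha) (mul_le_mul_of_nonneg_right h1 ha) ?_
    rw [mul_smul]; exact Set.smul_mem_smul_set hx
  rcases le_total 0 t with h0 | h0
  · rw [abs_of_nonneg h0] at ht; exact key t h0 ht
  · rw [abs_of_nonpos h0] at ht
    have := h.neg (key (-t) (by linarith) ht)
    simpa using this

theorem Bod.sub {B : Set V} (h : Bod B) {a b : ℝ} (ha : 0 ≤ a) (hb : 0 ≤ b) {x y : V} (hx : x ∈ a • B)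
    (hy : y ∈ b • B) : x - y ∈ (a + b) • B := by
  rw [sub_eq_add_neg]; exact h.add ha hb hx (h.neg hy)

theorem body_fun {B : Set V} {ν : V →ₗ[ℝ] ℝ} {β c : ℝ} (hν : ∀ b ∈ B, |ν b| ≤ β) (hc : 0 ≤ c) {x : V}
    (hx : x ∈ c • B) : |ν x| ≤ c * β := by
  obtain ⟨b, hb, rfl⟩ := Set.mem_smul_set.1 hx
  rw [map_smul, smul_eq_mul, abs_mul, abs_of_nonneg hc]
  exact mul_le_mul_of_nonneg_left (hν b hb) hc

theorem body_trans {B B' : Set V} {A c : ℝ} (h : B' ⊆ A • B) {x : V} (hx : x ∈ c • B') :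
    x ∈ (c * A) • B := by
  obtain ⟨b, hb, rfl⟩ := Set.mem_smul_set.1 hx
  rw [mul_smul]; exact Set.smul_mem_smul_set (h hb)

structure IsCone (G : Set V) : Prop where
  zero : (0:V) ∈ G
  add : ∀ x ∈ G, ∀ y ∈ G, x + y ∈ G
  smul : ∀ t : ℝ, 0 ≤ t → ∀ x ∈ G, t • x ∈ G

theorem IsCone.convex {G : Set V} (h : IsCone G) : Convex ℝ G := by
  intro x hx y hy a b ha hb _
  exact h.add _ (h.smul a ha x hx) _ (h.smul b hb y hy)

inductive Tr (ι V : Type) : Type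
  | leaf (i : ι) : Tr ι V
  | node (B : Set V) (l r : Tr ι V) : Tr ι V

inductive Fl (V : Type) : Type
  | leaf (v : V) : Fl V
  | node (v : V) (l r : Fl V) : Fl V

def Tr.depth : Tr ι V → ℕ
  | .leaf _ => 0
  | .node _ l r => max l.depth r.depth + 1

def Tr.All (Q : Set V → Prop) : Tr ι V → Prop
  | .leaf _ => True
  | .node B l r => Q B ∧ l.All Q ∧ r.All Q

def Tr.Nest (A : ℝ) : Tr ι V → Prop
  | .leaf _ => True
  | .node B l r => l.All (fun B' => B' ⊆ A • B) ∧ r.All (fun B' => B' ⊆ A • B) ∧ l.Nest A ∧ r.Nest A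

def Fl.root : Fl V → V
  | .leaf v => v
  | .node v _ _ => v

def Fl.All (Q : V → Prop) : Fl V → Prop
  | .leaf v => Q v
  | .node v l r => Q v ∧ l.All Q ∧ r.All Q

def Fl.smul (t : ℝ) : Fl V → Fl V
  | .leaf v => .leaf (t • v)
  | .node v l r => .node (t • v) (l.smul t) (r.smul t)

def Fl.add : Fl V → Fl V → Fl V
  | .leaf v, .leaf w => .leaf (v + w)
  | .node v l r, .node w l' r' => .node (v + w) (l.add l') (r.add r')
  | f, _ => f

def IsF (G : ι → Set V) (R : Set ι) (c : ℝ) : Tr ι V → Fl V → Prop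
  | .leaf i, .leaf v => i ∈ R → v ∈ G i
  | .node B l r, .node v f g => v - f.root ∈ c • B ∧ v - g.root ∈ c • B ∧ IsF G R c l f ∧ IsF G R c r g
  | _, _ => False

def Tr.const (v : V) : Tr ι V → Fl V
  | .leaf _ => .leaf v
  | .node _ l r => .node v (l.const v) (r.const v)

theorem Tr.const_root (v : V) (τ : Tr ι V) : (τ.const v).root = v := by cases τ <;> rfl

theorem Tr.All.imp {Q Q' : Set V → Prop} (hQ : ∀ B, Q B → Q' B) : ∀ {τ : Tr ι V}, τ.All Q → τ.All Q'
  | .leaf _, _ => trivial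
  | .node _ _ _, h => ⟨hQ _ h.1, Tr.All.imp hQ h.2.1, Tr.All.imp hQ h.2.2⟩

theorem Tr.All.and {Q Q' : Set V → Prop} : ∀ {τ : Tr ι V}, τ.All Q → τ.All Q' → τ.All (fun B => Q B ∧ Q' B)
  | .leaf _, _, _ => trivial
  | .node _ _ _, h, h' => ⟨⟨h.1, h'.1⟩, h.2.1.and h'.2.1, h.2.2.and h'.2.2⟩

theorem Fl.All.imp {Q Q' : V → Prop} (hQ : ∀ B, Q B → Q' B) : ∀ {τ : Fl V}, τ.All Q → τ.All Q'
  | .leaf _, h => hQ _ h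
  | .node _ _ _, h => ⟨hQ _ h.1, Fl.All.imp hQ h.2.1, Fl.All.imp hQ h.2.2⟩

theorem Fl.All.root {Q : V → Prop} : ∀ {τ : Fl V}, τ.All Q → Q τ.root
  | .leaf _, h => h
  | .node _ _ _, h => h.1

theorem Fl.smul_root (t : ℝ) (f : Fl V) : (f.smul t).root = t • f.root := by cases f <;> rfl

theorem IsF.mono {G : ι → Set V} {R : Set ι} {a b : ℝ} (ha : 0 ≤ a) (hab : a ≤ b) :
    ∀ {τ : Tr ι V} {f : Fl V}, τ.All Bod → IsF G R a τ f → IsF G R b τ f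
  | .leaf _, .leaf _, _, h => h
  | .node _ _ _, .node _ _ _, hB, h =>
    ⟨hB.1.mono ha hab h.1, hB.1.mono ha hab h.2.1, h.2.2.1.mono ha hab hB.2.1, h.2.2.2.mono ha hab hB.2.2⟩

theorem IsF.anti {G : ι → Set V} {R R' : Set ι} {a : ℝ} (hR : R' ⊆ R) :
    ∀ {τ : Tr ι V} {f : Fl V}, IsF G R a τ f → IsF G R' a τ f
  | .leaf _, .leaf _, h => fun hi => h (hR hi)
  | .node _ _ _, .node _ _ _, h => ⟨h.1, h.2.1, h.2.2.1.anti hR, h.2.2.2.anti hR⟩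

theorem IsF.smul {G : ι → Set V} (hG : ∀ i, IsCone (G i)) {R : Set ι} {a t : ℝ} (ht : 0 ≤ t) :
    ∀ {τ : Tr ι V} {f : Fl V}, IsF G R a τ f → IsF G R (t * a) τ (f.smul t)
  | .leaf i, .leaf _, h => fun hi => (hG i).smul t ht _ (h hi)
  | .node _ _ _, .node _ l r, h => by
    refine ⟨?_, ?_, h.2.2.1.smul hG ht, h.2.2.2.smul hG ht⟩
    · rw [Fl.smul_root, ← smul_sub, mul_smul]; exact Set.smul_mem_smul_set h.1
    · rw [Fl.smul_root, ← smul_sub, mul_smul]; exact Set.smul_mem_smul_set h.2.1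

theorem IsF.add {G : ι → Set V} (hG : ∀ i, IsCone (G i)) {R : Set ι} {a b : ℝ} (ha : 0 ≤ a) (hb : 0 ≤ b) :
    ∀ {τ : Tr ι V} {f g : Fl V}, τ.All Bod → IsF G R a τ f → IsF G R b τ g →
      IsF G R (a + b) τ (f.add g) ∧ (f.add g).root = f.root + g.root
  | .leaf i, .leaf _, .leaf _, _, h, h' => ⟨fun hi => (hG i).add _ (h hi) _ (h' hi), rfl⟩
  | .node _ _ _, .node _ _ _, .node _ _ _, hB, h, h' => by
    have h1 := h.2.2.1.add hG ha hb hB.2.1 h'.2.2.1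
    have h2 := h.2.2.2.add hG ha hb hB.2.2 h'.2.2.2
    refine ⟨⟨?_, ?_, h1.1, h2.1⟩, rfl⟩
    · rw [h1.2, add_sub_add_comm]; exact hB.1.add ha hb h.1 h'.1
    · rw [h2.2, add_sub_add_comm]; exact hB.1.add ha hb h.2.1 h'.2.1

theorem IsF.zero {G : ι → Set V} (hG : ∀ i, IsCone (G i)) {R : Set ι} {a : ℝ} :
    ∀ {τ : Tr ι V}, τ.All Bod → IsF G R a τ (τ.const 0)
  | .leaf i, _ => fun _ => (hG i).zero
  | .node _ _ _, hB => by
    refine ⟨?_, ?_, IsF.zero hG hB.2.1, IsF.zero hG hB.2.2⟩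
    · rw [Tr.const_root, sub_zero]; exact hB.1.zero_mem a
    · rw [Tr.const_root, sub_zero]; exact hB.1.zero_mem a

/-- all values of a field are close to the root value -/
theorem IsF.drift {G : ι → Set V} {R : Set ι} {c A : ℝ} (hc : 0 ≤ c) (hA : 0 ≤ A) {B : Set V} (hB : Bod B) :
    ∀ {h : ℕ} {τ : Tr ι V} {f : Fl V}, τ.depth ≤ h → τ.All (fun B' => B' ⊆ A • B) → IsF G R c τ f →
      f.All (fun v => f.root - v ∈ ((h : ℝ) * (c * A)) • B)
  | h, .leaf _, .leaf v, _, _, _ => by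
    show v - v ∈ _
    rw [sub_self]; exact hB.zero_mem _
  | 0, .node _ _ _, _, hd, _, _ => by simp [Tr.depth] at hd
  | h + 1, .node B' l r, .node v f g, hd, hAll, hF => by
    have hd1 : l.depth ≤ h := by simp only [Tr.depth] at hd; omega
    have hd2 : r.depth ≤ h := by simp only [Tr.depth] at hd; omega
    have hcA : 0 ≤ c * A := by positivity
    have e : ((h + 1 : ℕ) : ℝ) * (c * A) = c * A + (h : ℝ) * (c * A) := by push_cast; ring
    refine ⟨?_, ?_, ?_⟩
    · show v - v ∈ _
      rw [sub_self]; exact hB.zero_mem _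
    · refine Fl.All.imp ?_ (hF.2.2.1.drift hc hA hB hd1 hAll.2.1)
      intro w hw
      have h1 := hB.add hcA (by positivity) (body_trans hAll.1 hF.1) hw
      rw [e]; simpa [Fl.root] using h1
    · refine Fl.All.imp ?_ (hF.2.2.2.drift hc hA hB hd2 hAll.2.2)
      intro w hw
      have h1 := hB.add hcA (by positivity) (body_trans hAll.1 hF.2.1) hw
      rw [e]; simpa [Fl.root] using h1

/-- the cone of root values -/
def ZC (G : ι → Set V) (ν : V →ₗ[ℝ] ℝ) (R : Set ι) (c : ℝ) (τ : Tr ι V) : Set V :=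
  {u | 0 ≤ ν u ∧ ∃ f, f.root = u ∧ IsF G R (ν u * c) τ f}

theorem ZC.cone {G : ι → Set V} (hG : ∀ i, IsCone (G i)) (ν : V →ₗ[ℝ] ℝ) (R : Set ι) {c : ℝ} (hc : 0 ≤ c)
    {τ : Tr ι V} (hB : τ.All Bod) : IsCone (ZC G ν R c τ) where
  zero := ⟨by simp, τ.const 0, Tr.const_root _ _, IsF.zero hG hB⟩
  add := by
    rintro x ⟨hx, f, rfl, hf⟩ y ⟨hy, g, rfl, hg⟩
    have := hf.add hG (mul_nonneg hx hc) (mul_nonneg hy hc) hB hg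
    refine ⟨by rw [map_add]; positivity, f.add g, this.2, ?_⟩
    rw [map_add, add_mul]; exact this.1
  smul := by
    rintro t ht x ⟨hx, f, rfl, hf⟩
    refine ⟨by rw [map_smul, smul_eq_mul]; positivity, f.smul t, Fl.smul_root _ _, ?_⟩
    rw [map_smul, smul_eq_mul, mul_assoc]; exact hf.smul hG ht

end Trees

end SF

namespace SF

open scoped ContDiff Pointwise

section Proj

variable {V : Type} [NormedAddCommGroup V] [NormedSpace ℝ V] {ι : Type}

/-- projection to `ker ψ` along `a` -/
def prj (ψ : V →ₗ[ℝ] ℝ) (a : V) : V →ₗ[ℝ] LinearMap.ker ψ :=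
  if h : ψ a ≠ 0 then LinearMap.codRestrict (LinearMap.ker ψ) (LinearMap.id - (ψ a)⁻¹ • ψ.smulRight a) (by
    intro v
    simp [LinearMap.mem_ker, LinearMap.smulRight_apply]
    field_simp
    ring) else 0

theorem prj_coe {ψ : V →ₗ[ℝ] ℝ} {a : V} (h : ψ a ≠ 0) (v : V) : (prj ψ a v : V) = v - (ψ v / ψ a) • a := by
  rw [prj, dif_pos h]
  simp [LinearMap.codRestrict_apply, LinearMap.smulRight_apply, smul_smul, div_eq_inv_mul]

theorem prj_surj {ψ : V →ₗ[ℝ] ℝ} {a : V} (h : ψ a ≠ 0) : Function.Surjective (prj ψ a) := by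
  intro w
  refine ⟨w, Subtype.ext ?_⟩
  rw [prj_coe h, LinearMap.mem_ker.1 w.2, zero_div, zero_smul, sub_zero]

theorem prj_change {ψ : V →ₗ[ℝ] ℝ} {a e : V} (ha : ψ a ≠ 0) (he : ψ e ≠ 0) (v : V) :
    prj ψ e v = prj ψ a (v + (ψ v / ψ e) • (a - e)) := by
  apply Subtype.ext
  rw [prj_coe ha, prj_coe he, map_add, map_smul, map_sub, smul_eq_mul]
  match_scalars <;> field_simp <;> ring

def bar (ψ : V →ₗ[ℝ] ℝ) : Tr ι V → Fl V → Tr ι (LinearMap.ker ψ)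
  | .leaf i, _ => .leaf i
  | .node B l r, .node v f g => .node (prj ψ v '' B) (bar ψ l f) (bar ψ r g)
  | .node _ l r, .leaf v => .node ∅ (bar ψ l (.leaf v)) (bar ψ r (.leaf v))

def fwd (ψ : V →ₗ[ℝ] ℝ) : Fl V → Fl V → Fl (LinearMap.ker ψ)
  | .leaf a, .leaf v => .leaf (prj ψ a v)
  | .node a f g, .node v x y => .node (prj ψ a v) (fwd ψ f x) (fwd ψ g y)
  | _, _ => .leaf 0

theorem bar_depth (ψ : V →ₗ[ℝ] ℝ) : ∀ (τ : Tr ι V) (f : Fl V), (bar ψ τ f).depth = τ.depth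
  | .leaf _, _ => rfl
  | .node _ l r, .node _ f g => by simp only [bar, Tr.depth, bar_depth ψ l f, bar_depth ψ r g]
  | .node _ l r, .leaf v => by simp only [bar, Tr.depth, bar_depth ψ l _, bar_depth ψ r _]

theorem bar_All {ψ : V →ₗ[ℝ] ℝ} {G : ι → Set V} {R : Set ι} {c : ℝ} {Q : Set V → Prop} {Fp : V → Prop}
    {Q' : Set (LinearMap.ker ψ) → Prop} (hQ : ∀ B v, Q B → Fp v → Q' (prj ψ v '' B)) :
    ∀ {τ : Tr ι V} {f : Fl V}, τ.All Q → f.All Fp → IsF G R c τ f → (bar ψ τ f).All Q'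
  | .leaf _, .leaf _, _, _, _ => trivial
  | .node _ _ _, .node _ _ _, h, hf, hF =>
    ⟨hQ _ _ h.1 hf.1, bar_All hQ h.2.1 hf.2.1 hF.2.2.1, bar_All hQ h.2.2 hf.2.2 hF.2.2.2⟩

theorem Fl.All.and {Q Q' : V → Prop} : ∀ {τ : Fl V}, τ.All Q → τ.All Q' → τ.All (fun B => Q B ∧ Q' B)
  | .leaf _, h, h' => ⟨h, h'⟩
  | .node _ _ _, h, h' => ⟨⟨h.1, h'.1⟩, h.2.1.and h'.2.1, h.2.2.and h'.2.2⟩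

theorem mem_img {ψ : V →ₗ[ℝ] ℝ} {a : V} {B : Set V} {c : ℝ} {x : V} (hx : x ∈ c • B) :
    prj ψ a x ∈ c • (prj ψ a '' B) := by
  obtain ⟨b, hb, rfl⟩ := Set.mem_smul_set.1 hx
  exact Set.mem_smul_set.2 ⟨prj ψ a b, ⟨b, hb, rfl⟩, by rw [map_smul]⟩

theorem Bod.img [FiniteDimensional ℝ V] {ψ : V →ₗ[ℝ] ℝ} {a : V} (ha : ψ a ≠ 0) {B : Set V} (hB : Bod B) :
    Bod (prj ψ a '' B) where
  conv := hB.conv.linear_image (prj ψ a)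
  symm := by
    rintro _ ⟨b, hb, rfl⟩
    exact ⟨-b, hB.symm b hb, map_neg _ _⟩
  op := (LinearMap.isOpenMap_of_finiteDimensional _ (prj_surj ha)) _ hB.op
  zero := ⟨0, hB.zero, map_zero _⟩

theorem bar_nest {ψ : V →ₗ[ℝ] ℝ} {G : ι → Set V} {C1 A σ b : ℝ} (hA : 1 ≤ A) (hC1 : 0 ≤ C1) (hσ : 0 < σ)
    (hb : b ≤ σ) : ∀ {h : ℕ} {τ : Tr ι V} {f : Fl V}, τ.depth ≤ h → τ.All Bod → τ.All (fun B => ∀ x ∈ B, |ψ x| ≤ b) →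
      τ.Nest A → f.All (fun v => ψ v ≤ -σ) → IsF G Set.univ C1 τ f →
      (bar ψ τ f).Nest (A + (h : ℝ) * (C1 * A))
  | _, .leaf _, .leaf _, _, _, _, _, _, _ => trivial
  | 0, .node _ _ _, _, hd, _, _, _, _, _ => by simp [Tr.depth] at hd
  | h + 1, .node B l r, .node a f g, hd, hB, hψ, hN, hf, hF => by
    have hd1 : l.depth ≤ h + 1 := by simp only [Tr.depth] at hd; omega
    have hd2 : r.depth ≤ h + 1 := by simp only [Tr.depth] at hd; omega
    have hA0 : 0 ≤ A := by linarith
    have hself : B ⊆ A • B := by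
      intro x hx
      exact hB.1.mono zero_le_one hA (by rwa [one_smul])
    have hdr := hF.drift hC1 hA0 hB.1 hd ⟨hself, hN.1, hN.2.1⟩
    have ha : ψ a ≠ 0 := by have := hf.1; linarith
    have hstep : ∀ (B' : Set V) (v : V), (B' ⊆ A • B ∧ ∀ x ∈ B', |ψ x| ≤ b) →
        (a - v ∈ (((h + 1 : ℕ) : ℝ) * (C1 * A)) • B ∧ ψ v ≤ -σ) →
        prj ψ v '' B' ⊆ (A + ((h + 1 : ℕ) : ℝ) * (C1 * A)) • (prj ψ a '' B) := by
      rintro B' v ⟨h1, h2⟩ ⟨h3, h4⟩ _ ⟨x, hx, rfl⟩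
      rw [prj_change ha (by linarith : ψ v ≠ 0)]
      refine mem_img (hB.1.add hA0 (by positivity) (h1 hx) ?_)
      have h5 : |ψ x / ψ v| ≤ 1 := by
        rw [abs_div, abs_of_neg (by linarith : ψ v < 0), div_le_one (by linarith)]
        linarith [h2 x hx]
      have := hB.1.smul (by positivity) h5 h3
      rwa [one_mul] at this
    refine ⟨bar_All hstep (hN.1.and hψ.2.1) (hdr.2.1.and hf.2.1) hF.2.2.1,
      bar_All hstep (hN.2.1.and hψ.2.2) (hdr.2.2.and hf.2.2) hF.2.2.2,
      bar_nest hA hC1 hσ hb hd1 hB.2.1 hψ.2.1 hN.2.2.1 hf.2.1 hF.2.2.1,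
      bar_nest hA hC1 hσ hb hd2 hB.2.2 hψ.2.2 hN.2.2.2 hf.2.2 hF.2.2.2⟩

/-- the cones in the kernel -/
def kG (ψ : V →ₗ[ℝ] ℝ) (G : ι → Set V) : ι → Set (LinearMap.ker ψ) := fun i => {w | (w : V) ∈ G i}

theorem kG_cone {ψ : V →ₗ[ℝ] ℝ} {G : ι → Set V} (hG : ∀ i, IsCone (G i)) (i : ι) : IsCone (kG ψ G i) where
  zero := (hG i).zero
  add := fun x hx y hy => (hG i).add x hx y hy
  smul := fun t ht x hx => (hG i).smul t ht x hx

theorem fwd_isF {ψ : V →ₗ[ℝ] ℝ} {G : ι → Set V} (hG : ∀ i, IsCone (G i)) {R : Set ι} {C1 c0 σ M ρ : ℝ}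
    (hC1 : 0 ≤ C1) (hc0 : 0 ≤ c0) (hσ : 0 < σ) (hM : M ≤ ρ * σ) (hρ : 0 ≤ ρ) :
    ∀ {τ : Tr ι V} {f v : Fl V}, τ.All Bod → f.All (fun a => ψ a ≤ -σ) → v.All (fun a => 0 < ψ a ∧ ψ a ≤ M) →
      IsF G Set.univ C1 τ f → IsF G R c0 τ v →
      IsF (kG ψ G) R (c0 + ρ * C1) (bar ψ τ f) (fwd ψ f v) ∧ (fwd ψ f v).root = prj ψ f.root v.root
  | .leaf i, .leaf a, .leaf v, _, hf, hv, hF, hR => by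
    have ha : ψ a ≤ -σ := hf
    have hv' : 0 < ψ v ∧ ψ v ≤ M := hv
    refine ⟨fun hi => ?_, rfl⟩
    show (prj ψ a v : V) ∈ G i
    rw [prj_coe (by linarith), sub_eq_add_neg, ← neg_smul]
    refine (hG i).add _ (hR hi) _ ((hG i).smul _ ?_ _ (hF (Set.mem_univ _)))
    rw [← div_neg]
    exact div_nonneg hv'.1.le (by linarith)
  | .node B l r, .node a f g, .node v x y, hB, hf, hv, hF, hR => by
    have ih1 := fwd_isF hG hC1 hc0 hσ hM hρ hB.2.1 hf.2.1 hv.2.1 hF.2.2.1 hR.2.2.1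
    have ih2 := fwd_isF hG hC1 hc0 hσ hM hρ hB.2.2 hf.2.2 hv.2.2 hF.2.2.2 hR.2.2.2
    have ha : ψ a ≠ 0 := by have := hf.1; linarith
    have hstep : ∀ e w : V, ψ e ≤ -σ → (0 < ψ w ∧ ψ w ≤ M) → a - e ∈ C1 • B → v - w ∈ c0 • B →
        prj ψ a v - prj ψ e w ∈ (c0 + ρ * C1) • (prj ψ a '' B) := by
      intro e w he hw h1 h2
      rw [prj_change ha (by linarith : ψ e ≠ 0), ← map_sub]
      refine mem_img ?_
      rw [← sub_sub]
      refine hB.1.sub hc0 (by positivity) h2 (hB.1.smul hC1 ?_ h1)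
      rw [abs_div, abs_of_pos hw.1, abs_of_neg (by linarith : ψ e < 0), div_le_iff₀ (by linarith)]
      nlinarith
    refine ⟨⟨?_, ?_, ih1.1, ih2.1⟩, rfl⟩
    · rw [ih1.2]; exact hstep _ _ hf.2.1.root hv.2.1.root hF.1 hR.1
    · rw [ih2.2]; exact hstep _ _ hf.2.2.root hv.2.2.root hF.2.1 hR.2.1

theorem lift_isF {ψ : V →ₗ[ℝ] ℝ} {G : ι → Set V} (hG : ∀ i, IsCone (G i)) {C1 Cb σ b Lm : ℝ}
    (hC1 : 0 ≤ C1) (hCb : 0 ≤ Cb) (hσ : 0 < σ) (hL : Cb * b ≤ Lm * σ) (hLm : 0 ≤ Lm) :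
    ∀ {h : ℕ} {τ : Tr ι V} {f : Fl V} {w : Fl (LinearMap.ker ψ)} {ℓ : ℝ}, τ.depth ≤ h → τ.All Bod →
      τ.All (fun B => ∀ x ∈ B, |ψ x| ≤ b) → f.All (fun a => ψ a ≤ -σ) → IsF G Set.univ C1 τ f →
      IsF (kG ψ G) Set.univ Cb (bar ψ τ f) w → (h : ℝ) * Lm ≤ ℓ → ℓ + (h : ℝ) * Lm ≤ 1 →
      ∃ g, IsF G Set.univ (Cb + C1) τ g ∧ g.root = (w.root : V) + ℓ • f.root
  | h, .leaf i, .leaf a, .leaf w, ℓ, _, _, _, _, hF, hw, h0, _ =>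
    ⟨.leaf ((w : V) + ℓ • a), fun hi => (hG i).add _ (hw hi) _
      ((hG i).smul _ (le_trans (by positivity) h0) _ (hF hi)), rfl⟩
  | h, .leaf i, .leaf a, .node _ _ _, ℓ, _, _, _, _, hF, hw, h0, _ => absurd hw (by simp [bar, IsF])
  | 0, .node _ _ _, _, _, _, hd, _, _, _, _, _, _, _ => by simp [Tr.depth] at hd
  | h + 1, .node B l r, .node a f g, .node w x y, ℓ, hd, hB, hψ, hf, hF, hw, h0, h1 => by
    have hd1 : l.depth ≤ h := by simp only [Tr.depth] at hd; omega
    have hd2 : r.depth ≤ h := by simp only [Tr.depth] at hd; omega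
    have ha : ψ a ≠ 0 := by have := hf.1; linarith
    push_cast at h0 h1
    have hhL : 0 ≤ (h : ℝ) * Lm := by positivity
    have hstep : ∀ (e : V) (w' : LinearMap.ker ψ), a - e ∈ C1 • B → w - w' ∈ Cb • (prj ψ a '' B) →
        ∃ ℓ' : ℝ, (h : ℝ) * Lm ≤ ℓ' ∧ ℓ' + (h : ℝ) * Lm ≤ 1 ∧
          ((w : V) + ℓ • a) - ((w' : V) + ℓ' • e) ∈ (Cb + C1) • B := by
      intro e w' he hw'
      obtain ⟨_, ⟨c, hc, rfl⟩, hcw⟩ := Set.mem_smul_set.1 hw'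
      have hcw' : (w : V) - w' = Cb • (c - (ψ c / ψ a) • a) := by
        rw [← prj_coe ha, ← Submodule.coe_smul, hcw]; rfl
      set L : ℝ := - (Cb * (ψ c / ψ a)) with hLdef
      have hLb : |L| ≤ Lm := by
        rw [hLdef, abs_neg, abs_mul, abs_of_nonneg hCb, abs_div, abs_of_neg (by have := hf.1; linarith : ψ a < 0),
          ← mul_div_assoc, div_le_iff₀ (by have := hf.1; linarith)]
        have e1 := mul_le_mul_of_nonneg_left (hψ.1 c hc) hCb
        have e2 := mul_le_mul_of_nonneg_left (by have := hf.1; linarith : σ ≤ - ψ a) hLm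
        linarith
      have hLb' := abs_le.1 hLb
      refine ⟨ℓ + L, by linarith, by linarith, ?_⟩
      have e3 : ((w : V) + ℓ • a) - ((w' : V) + (ℓ + L) • e) = Cb • c + (ℓ + L) • (a - e) := by
        have : (w : V) = w' + Cb • (c - (ψ c / ψ a) • a) := by rw [← hcw']; abel
        rw [this, hLdef]
        module
      rw [e3]
      refine hB.1.add hCb hC1 (Set.smul_mem_smul_set hc) ?_
      have := hB.1.smul hC1 (t := ℓ + L) (s := 1) (by rw [abs_le]; constructor <;> linarith) he
      rwa [one_mul] at this
    obtain ⟨ℓ1, a1, a2, a3⟩ := hstep _ _ hF.1 hw.1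
    obtain ⟨ℓ2, b1, b2, b3⟩ := hstep _ _ hF.2.1 hw.2.1
    obtain ⟨g1, hg1, hr1⟩ := lift_isF hG hC1 hCb hσ hL hLm hd1 hB.2.1 hψ.2.1 hf.2.1 hF.2.2.1 hw.2.2.1 a1 a2
    obtain ⟨g2, hg2, hr2⟩ := lift_isF hG hC1 hCb hσ hL hLm hd2 hB.2.2 hψ.2.2 hf.2.2 hF.2.2.2 hw.2.2.2 b1 b2
    refine ⟨.node ((w : V) + ℓ • a) g1 g2, ⟨?_, ?_, hg1, hg2⟩, rfl⟩
    · rw [hr1]; exact a3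
    · rw [hr2]; exact b3

end Proj

end SF

namespace SF

open scoped ContDiff Pointwise

def kk : ℕ → ℕ
  | 0 => 0
  | d + 1 => 2 ^ d

/-- the homogeneous finiteness principle on trees -/
def Con (d : ℕ) : Prop := ∀ (h : ℕ) (A c0 : ℝ), 1 ≤ A → 1 ≤ c0 → ∃ ε C : ℝ, 0 < ε ∧ 1 ≤ C ∧
  ∀ (V : Type) [NormedAddCommGroup V] [NormedSpace ℝ V] [FiniteDimensional ℝ V] (ι : Type) (G : ι → Set V)
    (ν : V →ₗ[ℝ] ℝ) (τ : Tr ι V), Module.finrank ℝ V ≤ d → (∀ i, IsCone (G i)) → τ.depth ≤ h → τ.All Bod →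
    τ.All (fun B => ∀ x ∈ B, |ν x| ≤ ε) → τ.Nest A →
    (∀ R : Finset ι, R.card ≤ kk d → ∃ f, IsF G (R : Set ι) c0 τ f ∧ ν f.root = 1) →
    ∃ f, IsF G Set.univ C τ f ∧ ν f.root = 1

theorem IsF.fun_drift {V : Type} [NormedAddCommGroup V] [NormedSpace ℝ V] {ι : Type} {G : ι → Set V} {R : Set ι}
    {ν : V →ₗ[ℝ] ℝ} {c β : ℝ} (hc : 0 ≤ c) (hβ : 0 ≤ β) :
    ∀ {h : ℕ} {τ : Tr ι V} {f : Fl V}, τ.depth ≤ h → τ.All (fun B => ∀ x ∈ B, |ν x| ≤ β) → IsF G R c τ f →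
      f.All (fun v => |ν f.root - ν v| ≤ (h : ℝ) * (c * β))
  | h, .leaf _, .leaf v, _, _, _ => by
    show |ν v - ν v| ≤ _
    rw [sub_self, abs_zero]; positivity
  | 0, .node _ _ _, _, hd, _, _ => by simp [Tr.depth] at hd
  | h + 1, .node B' l r, .node v f g, hd, hAll, hF => by
    have hd1 : l.depth ≤ h := by simp only [Tr.depth] at hd; omega
    have hd2 : r.depth ≤ h := by simp only [Tr.depth] at hd; omega
    refine ⟨?_, ?_, ?_⟩
    · show |ν v - ν v| ≤ _
      rw [sub_self, abs_zero]; positivity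
    · refine Fl.All.imp ?_ (hF.2.2.1.fun_drift hc hβ hd1 hAll.2.1)
      intro w hw
      have h1 := body_fun hAll.1 hc hF.1
      rw [map_sub] at h1
      have := abs_add_le (ν v - ν f.root) (ν f.root - ν w)
      rw [sub_add_sub_cancel] at this
      show |ν v - ν w| ≤ _
      push_cast; linarith
    · refine Fl.All.imp ?_ (hF.2.2.2.fun_drift hc hβ hd2 hAll.2.2)
      intro w hw
      have h1 := body_fun hAll.1 hc hF.2.1
      rw [map_sub] at h1
      have := abs_add_le (ν v - ν g.root) (ν g.root - ν w)
      rw [sub_add_sub_cancel] at this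
      show |ν v - ν w| ≤ _
      push_cast; linarith

/-- separation of a cone from an open convex set `Z₁ + C • B` -/
theorem sep_fun {V : Type} [NormedAddCommGroup V] [NormedSpace ℝ V] {B Z1 K : Set V} (hB : Bod B) {C : ℝ} (hC : 0 < C)
    (hZ : Convex ℝ Z1) {z0 : V} (hz0 : z0 ∈ Z1) (hK : IsCone K)
    (hdisj : ∀ z ∈ Z1, ∀ u ∈ K, u - z ∉ C • B) :
    ∃ (μ : V →ₗ[ℝ] ℝ) (β : ℝ), 0 < β ∧ (∀ x ∈ B, |μ x| ≤ β) ∧ (∀ z ∈ Z1, C * β ≤ μ z) ∧ ∀ u ∈ K, μ u ≤ 0 := by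
  have hop : IsOpen (Z1 + C • B) := (hB.op.smul₀ hC.ne').add_left
  obtain ⟨f, u, hf1, hf2⟩ := geometric_hahn_banach_open (hZ.add (hB.conv.smul C)) hop hK.convex (by
    rw [Set.disjoint_left]
    rintro x hx hxK
    obtain ⟨z, hz, b, hb, rfl⟩ := Set.mem_add.1 hx
    exact hdisj z hz _ hxK (by rwa [add_sub_cancel_left]))
  have hu : u ≤ 0 := by simpa using hf2 0 hK.zero
  have hpos : ∀ z ∈ Z1, ∀ b ∈ B, C * f b < - f z := by
    intro z hz b hb
    have := hf1 (z + C • b) (Set.add_mem_add hz (Set.smul_mem_smul_set hb))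
    rw [map_add, map_smul, smul_eq_mul] at this
    linarith
  have hKn : ∀ v ∈ K, 0 ≤ f v := by
    intro v hv
    by_contra hneg
    push Not at hneg
    have h1 := hf2 (((u - 1) / f v) • v) (hK.smul _ (div_nonneg_of_nonpos (by linarith) hneg.le) v hv)
    rw [map_smul, smul_eq_mul, div_mul_cancel₀ _ hneg.ne] at h1
    linarith
  set X := (fun b => f b) '' B with hX
  have hbdd : BddAbove X := by
    refine ⟨- f z0 / C, ?_⟩
    rintro _ ⟨b, hb, rfl⟩
    rw [le_div_iff₀ hC]
    have := hpos z0 hz0 b hb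
    show f b * C ≤ _
    linarith
  have hle : ∀ b ∈ B, f b ≤ sSup X := fun b hb => le_csSup hbdd ⟨b, hb, rfl⟩
  have hβ0 : 0 < sSup X := by
    have hz0n : f z0 < 0 := by have := hpos z0 hz0 0 hB.zero; simp at this; linarith
    have hev : ∀ᶠ t : ℝ in nhds 0, t • (-z0) ∈ B := by
      have hc : ContinuousAt (fun t : ℝ => t • (-z0)) 0 := by fun_prop
      exact hc.eventually_mem (by simpa using hB.op.mem_nhds hB.zero)
    obtain ⟨r, hr, hrB⟩ := Metric.eventually_nhds_iff.1 hev
    have h1 := hle _ (hrB (y := r / 2) (by rw [Real.dist_eq, sub_zero, abs_of_pos (by positivity)]; linarith))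
    rw [map_smul, map_neg, smul_eq_mul] at h1
    have : 0 < r / 2 * - f z0 := mul_pos (by positivity) (by linarith)
    linarith
  refine ⟨-(f : V →ₗ[ℝ] ℝ), sSup X, hβ0, ?_, ?_, ?_⟩
  · intro x hx
    have h1 := hle x hx
    have h2 := hle _ (hB.symm x hx)
    rw [map_neg] at h2
    rw [LinearMap.neg_apply, abs_neg, ContinuousLinearMap.coe_coe, abs_le]
    constructor <;> linarith
  · intro z hz
    rw [LinearMap.neg_apply, ContinuousLinearMap.coe_coe]
    have : sSup X ≤ - f z / C := by
      refine csSup_le ⟨_, 0, hB.zero, rfl⟩ ?_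
      rintro _ ⟨b, hb, rfl⟩
      rw [le_div_iff₀ hC]
      have := hpos z hz b hb
      show f b * C ≤ _
      linarith
    rw [le_div_iff₀ hC] at this
    linarith
  · intro v hv
    rw [LinearMap.neg_apply, ContinuousLinearMap.coe_coe]
    linarith [hKn v hv]

end SF

namespace SF

open scoped ContDiff Pointwise

theorem finrank_ker_le {V : Type} [NormedAddCommGroup V] [NormedSpace ℝ V] [FiniteDimensional ℝ V] {d : ℕ}
    (hd : Module.finrank ℝ V ≤ d + 1) {ψ : V →ₗ[ℝ] ℝ} {a : V} (ha : ψ a ≠ 0) :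
    Module.finrank ℝ (LinearMap.ker ψ) ≤ d := by
  have h1 := LinearMap.finrank_range_add_finrank_ker ψ
  have h2 : LinearMap.range ψ = ⊤ := by
    rw [LinearMap.range_eq_top]
    intro t
    exact ⟨(t / ψ a) • a, by rw [map_smul, smul_eq_mul, div_mul_cancel₀ _ ha]⟩
  rw [h2, finrank_top, Module.finrank_self] at h1
  omega

set_option maxHeartbeats 4000000 in
theorem claim {d : ℕ} (hCon : Con d) : ∀ (h : ℕ) (A c0 C1 : ℝ), 1 ≤ A → 1 ≤ c0 → 1 ≤ C1 → ∃ ε C : ℝ, 0 < ε ∧ 1 ≤ C ∧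
    ∀ (V : Type) [NormedAddCommGroup V] [NormedSpace ℝ V] [FiniteDimensional ℝ V] (ι : Type) (G : ι → Set V)
    (ν : V →ₗ[ℝ] ℝ) (τ : Tr ι V), Module.finrank ℝ V ≤ d + 1 → (∀ i, IsCone (G i)) → τ.depth ≤ h → τ.All Bod →
    τ.All (fun B => ∀ x ∈ B, |ν x| ≤ ε) → τ.Nest A →
    ∀ B : Set V, Bod B → (∀ x ∈ B, |ν x| ≤ ε) → τ.All (fun B' => B' ⊆ A • B) →
    ∀ f, IsF G Set.univ C1 τ f → ν f.root = 1 → ∀ Z, IsCone Z →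
    (∀ R : Finset ι, R.card ≤ kk d → ∃ v, IsF G (R : Set ι) c0 τ v ∧ ν v.root = 1 ∧
      ∃ z ∈ Z, v.root - z ∈ c0 • B) →
    ∃ g, IsF G Set.univ C τ g ∧ ν g.root = 1 ∧ ∃ z ∈ Z, g.root - z ∈ C • B := by
  intro h A c0 C1 hA hc0 hC1
  have hh : (0:ℝ) ≤ h := Nat.cast_nonneg h
  have hA0 : 0 < A := by linarith
  have hhC : 0 ≤ (h:ℝ) * (C1 * A) := by positivity
  obtain ⟨εb, Cb, hεb, hCb, hC⟩ := hCon h (A + (h:ℝ) * (C1 * A)) (c0 + 4 * C1) (by linarith) (by linarith)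
  set U : ℝ := (h + 1) * A * (C1 + c0 + Cb) with hU
  set C2 : ℝ := 64 * U + 32 * A / εb with hC2
  have hU' : U = h * C1 * A + h * c0 * A + h * Cb * A + C1 * A + c0 * A + Cb * A := by rw [hU]; ring
  have p1 : 0 ≤ h * C1 * A := by positivity
  have p2 : 0 ≤ h * c0 * A := by positivity
  have p3 : 0 ≤ h * Cb * A := by positivity
  have p4 : C1 ≤ C1 * A := le_mul_of_one_le_right (by linarith) hA
  have p5 : c0 ≤ c0 * A := le_mul_of_one_le_right (by linarith) hA
  have p6 : Cb ≤ Cb * A := le_mul_of_one_le_right (by linarith) hA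
  have p7 : A ≤ C1 * A := le_mul_of_one_le_left hA0.le hC1
  have p8 : h * C1 ≤ h * C1 * A := le_mul_of_one_le_right (by positivity) hA
  have p9 : 0 < 32 * A / εb := by positivity
  have hC2e : 32 * A ≤ C2 * εb := by
    have : 32 * A / εb ≤ C2 := by linarith
    rwa [div_le_iff₀ hεb] at this
  have hC21 : 1 ≤ C2 := by linarith
  have hC20 : 0 < C2 := by linarith
  set ε : ℝ := min (εb / 2) (1 / (2 * C2)) with hε
  have hε0 : 0 < ε := lt_min (by positivity) (by positivity)
  have hεC : ε * C2 ≤ 1 / 2 := by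
    have : ε ≤ 1 / (2 * C2) := min_le_right _ _
    rw [le_div_iff₀ (by positivity)] at this
    linarith
  have hεb2 : ε ≤ εb / 2 := min_le_left _ _
  refine ⟨ε, 2 * C2, hε0, by linarith, ?_⟩
  intro V _ _ _ ι G ν τ hfin hG hdep hBod hν hNest B hB hνB hAB f hf hf1 Z hZ hR
  by_contra hcon
  have small : ∀ c : ℝ, 0 ≤ c → c ≤ C2 → c * ε ≤ 1 / 2 := by
    intro c h0 h1
    have := mul_le_mul_of_nonneg_right h1 hε0.le
    linarith
  -- the normalised part of `Z`
  set Z1 : Set V := {z | z ∈ Z ∧ ν z = 1} with hZ1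
  have hnorm : ∀ z ∈ Z, ∀ t, ν z = t → 0 < t → t⁻¹ • z ∈ Z1 := by
    intro z hz t h1 h2
    refine ⟨hZ.smul _ (by positivity) z hz, ?_⟩
    rw [map_smul, h1, smul_eq_mul, inv_mul_cancel₀ h2.ne']
  have hZ1c : Convex ℝ Z1 := by
    intro x hx y hy a b ha hb hab
    exact ⟨hZ.convex hx.1 hy.1 ha hb hab, by simp [hx.2, hy.2, hab]⟩
  obtain ⟨v0, hv0, hv01, z0, hz0, hvz0⟩ := hR ∅ (by simp)
  have hz0ν : 1 / 2 ≤ ν z0 := by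
    have h1 := body_fun hνB (by linarith : (0:ℝ) ≤ c0) hvz0
    rw [map_sub, hv01] at h1
    have := abs_le.1 h1
    have := small c0 (by linarith) (by linarith)
    linarith
  set K := ZC G ν Set.univ C2 τ with hK
  have hKc : IsCone K := ZC.cone hG ν _ hC20.le hBod
  obtain ⟨μ, β, hβ, hμB, hμZ, hμK⟩ := sep_fun hB hC20 hZ1c (hnorm z0 hz0 _ rfl (by linarith)) hKc (by
    rintro z hz u ⟨hu0, g, rfl, hg⟩ hmem
    apply hcon
    have h1 := body_fun hνB hC20.le hmem
    rw [map_sub, hz.2] at h1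
    have h2 := abs_le.1 h1
    have hu : 1 / 2 ≤ ν g.root := by linarith [small C2 hC20.le le_rfl]
    have hu' : 0 < ν g.root := by linarith
    refine ⟨g.smul (ν g.root)⁻¹, ?_, ?_, (ν g.root)⁻¹ • z, hZ.smul _ (by positivity) z hz.1, ?_⟩
    · have := hg.smul hG (inv_nonneg.2 hu'.le)
      rw [← mul_assoc, inv_mul_cancel₀ hu'.ne', one_mul] at this
      exact this.mono hC20.le (by linarith) hBod
    · rw [Fl.smul_root, map_smul, smul_eq_mul, inv_mul_cancel₀ hu'.ne']
    · rw [Fl.smul_root, ← smul_sub]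
      refine hB.smul hC20.le ?_ hmem
      rw [abs_of_pos (by positivity), inv_le_comm₀ hu' (by norm_num)]
      linarith)
  have hC2β : 0 < C2 * β := by positivity
  -- the functional `ψ`
  set ψ : V →ₗ[ℝ] ℝ := μ - (C2 * β / 2) • ν with hψ
  have hψv : ∀ v, ψ v = μ v - C2 * β / 2 * ν v := fun v => by simp [hψ]
  have hψbd : ∀ x, ∀ a, 1 ≤ a → |μ x| ≤ a * β → |ν x| ≤ ε → |ψ x| ≤ 2 * a * β := by
    intro x a ha h1 h2
    rw [hψv]
    have h3 : |C2 * β / 2 * ν x| ≤ β := by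
      rw [abs_mul, abs_of_pos (by positivity)]
      have := mul_le_mul_of_nonneg_left h2 (by positivity : 0 ≤ C2 * β / 2)
      nlinarith
    have h4 := abs_sub (μ x) (C2 * β / 2 * ν x)
    nlinarith
  have hψτ : τ.All (fun B' => ∀ x ∈ B', |ψ x| ≤ 2 * A * β) := by
    refine (hAB.and hν).imp ?_
    rintro B' ⟨h1, h2⟩ x hx
    exact hψbd x A hA (body_fun hμB hA0.le (h1 hx)) (h2 x hx)
  have hψB : ∀ x ∈ B, |ψ x| ≤ 2 * β := by
    intro x hx
    have := hψbd x 1 le_rfl (by rw [one_mul]; exact hμB x hx) (hνB x hx)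
    linarith
  have hAβ : 0 < 2 * A * β := by positivity
  -- the full field
  set p := f.root with hp
  set σ : ℝ := - ψ p with hσ
  have hσg : C2 * β / 2 ≤ σ := by
    have : μ p ≤ 0 := hμK p ⟨by rw [hf1]; norm_num, f, rfl, by
      rw [hf1, one_mul]; exact hf.mono (by linarith) (by linarith) hBod⟩
    rw [hσ, hψv, hf1]; linarith
  have hσ0 : 0 < σ := by linarith
  have key : ∀ t : ℝ, 16 * t ≤ C2 → 8 * t * β ≤ σ := by
    intro t ht
    have := mul_le_mul_of_nonneg_right ht hβ.le
    linarith
  have hfψ : f.All (fun v => ψ v ≤ -(σ / 2)) := by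
    refine (hf.fun_drift (by linarith) hAβ.le hdep hψτ).imp ?_
    intro v hv
    have h1 := (abs_le.1 hv).1
    have h2 := key (h * C1 * A) (by linarith)
    have h3 : (h:ℝ) * (C1 * (2 * A * β)) = 8 * (h * C1 * A) * β / 4 := by ring
    have h4 : ψ f.root = - σ := by rw [hσ, neg_neg]
    linarith
  have hfν : f.All (fun v => |ν v| ≤ 2) := by
    refine (hf.fun_drift (by linarith) hε0.le hdep hν).imp ?_
    intro v hv
    rw [← hp, hf1] at hv
    have h1 := abs_le.1 hv
    have h2 := small (h * C1) (by positivity) (by linarith)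
    rw [abs_le]; constructor <;> linarith
  have hψp : ψ p ≠ 0 := by linarith
  have hσ2 : 0 < σ / 2 := by linarith
  have hbσ : 2 * A * β ≤ σ / 2 := by have := key A (by linarith); linarith
  -- apply the principle in the kernel
  obtain ⟨w, hw, hw1⟩ := hC (LinearMap.ker ψ) ι (kG ψ G) (ν.comp (LinearMap.ker ψ).subtype) (bar ψ τ f)
    (finrank_ker_le hfin hψp) (kG_cone hG) (by rw [bar_depth]; exact hdep)
    (bar_All (Q := Bod) (Fp := fun v => ψ v ≤ -(σ / 2)) (fun B v hB hv => hB.img (by linarith)) hBod hfψ hf)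
    (by
      refine bar_All (Q := fun B => (∀ x ∈ B, |ψ x| ≤ 2 * A * β) ∧ ∀ x ∈ B, |ν x| ≤ ε)
        (Fp := fun v => ψ v ≤ -(σ / 2) ∧ |ν v| ≤ 2) ?_ (hψτ.and hν) (hfψ.and hfν) hf
      rintro B' v ⟨h1, h2⟩ ⟨h3, h4⟩ _ ⟨x, hx, rfl⟩
      rw [LinearMap.comp_apply, Submodule.subtype_apply, prj_coe (by linarith), map_sub, map_smul, smul_eq_mul]
      have h5 : |ψ x / ψ v| ≤ εb / 4 := by
        rw [abs_div, abs_of_neg (by linarith : ψ v < 0), div_le_iff₀ (by linarith)]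
        have h6 := h1 x hx
        have h7 : εb / 4 * (σ / 2) ≤ εb / 4 * (- ψ v) := mul_le_mul_of_nonneg_left (by linarith) (by positivity)
        have h8 : εb / 8 * (C2 * β / 2) ≤ εb / 8 * σ := mul_le_mul_of_nonneg_left hσg (by positivity)
        have h9 : 32 * A * β ≤ C2 * εb * β := mul_le_mul_of_nonneg_right hC2e hβ.le
        linarith [show εb / 8 * (C2 * β / 2) = C2 * εb * β / 16 by ring]
      have h6 : |ψ x / ψ v * ν v| ≤ εb / 4 * 2 := by
        rw [abs_mul]; exact mul_le_mul h5 h4 (abs_nonneg _) (by positivity)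
      have h7 := abs_sub (ν x) (ψ x / ψ v * ν v)
      linarith [h2 x hx])
    (bar_nest hA (by linarith) hσ2 hbσ hdep hBod hψτ hNest hfψ hf)
    (by
      intro R hRc
      obtain ⟨v, hv, hv1, z, hz, hvz⟩ := hR R hRc
      have hνz : 1 / 2 ≤ ν z := by
        have h1 := body_fun hνB (by linarith : (0:ℝ) ≤ c0) hvz
        rw [map_sub, hv1] at h1
        have := abs_le.1 h1
        have := small c0 (by linarith) (by linarith)
        linarith
      have hψz : C2 * β / 4 ≤ ψ z := by
        have h1 := hμZ _ (hnorm z hz _ rfl (by linarith))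
        rw [map_smul, smul_eq_mul, ← div_eq_inv_mul, le_div_iff₀ (by linarith)] at h1
        rw [hψv]
        have : C2 * β * (1 / 2) ≤ C2 * β * ν z := mul_le_mul_of_nonneg_left hνz hC2β.le
        linarith
      have hψq : C2 * β / 8 ≤ ψ v.root := by
        have h1 := body_fun hψB (by linarith : (0:ℝ) ≤ c0) hvz
        rw [map_sub] at h1
        have h2 := (abs_le.1 h1).1
        have h3 : 16 * c0 * β ≤ C2 * β := mul_le_mul_of_nonneg_right (by linarith) hβ.le
        linarith
      set q := v.root with hq
      have hvψ : v.All (fun a => 0 < ψ a ∧ ψ a ≤ 2 * ψ q) := by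
        refine (hv.fun_drift (by linarith) hAβ.le hdep hψτ).imp ?_
        intro a ha
        have h1 := abs_le.1 ha
        rw [← hq] at h1
        have h3 : 32 * (h * c0 * A) * β ≤ C2 * β := mul_le_mul_of_nonneg_right (by linarith) hβ.le
        constructor <;> linarith
      have hψq0 : 0 < ψ q := by linarith
      set r := ψ q / σ with hr
      have hr0 : 0 < r := by positivity
      have hrσ : r * σ = ψ q := div_mul_cancel₀ _ hσ0.ne'
      have h1 := fwd_isF hG (by linarith : 0 ≤ C1) (by linarith : 0 ≤ c0) hσ2 (M := 2 * ψ q) (ρ := 4 * r)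
        (by linarith) (by positivity) hBod hfψ hvψ hf hv
      have h1r : 0 < 1 + r := by linarith
      refine ⟨(fwd ψ f v).smul (1 + r)⁻¹, ?_, ?_⟩
      · have h2 := h1.1.smul (kG_cone hG) (inv_nonneg.2 h1r.le)
        refine h2.mono (by positivity) ?_ (bar_All (Q := Bod) (Fp := fun v => ψ v ≤ -(σ / 2))
          (fun B v hB hv => hB.img (by linarith)) hBod hfψ hf)
        rw [← div_eq_inv_mul, div_le_iff₀ h1r]
        nlinarith
      · rw [Fl.smul_root, h1.2, LinearMap.comp_apply, Submodule.subtype_apply, Submodule.coe_smul, map_smul,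
          smul_eq_mul, prj_coe hψp, map_sub, map_smul, hv1, hf1, smul_eq_mul, mul_one]
        have : ψ q / ψ p = - r := by rw [hr, hσ, div_neg, neg_neg]
        rw [this, sub_neg_eq_add, inv_mul_cancel₀ h1r.ne'])
  set Lm : ℝ := 4 * Cb * A * β / σ with hLm
  have hLσ : Lm * σ = 4 * Cb * A * β := div_mul_cancel₀ _ hσ0.ne'
  have hLm0 : 0 ≤ Lm := by positivity
  have hhL : (h:ℝ) * Lm ≤ 1 / 2 := by
    have h1 := key (h * Cb * A) (by linarith)
    by_contra hc
    push Not at hc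
    have h2 := mul_lt_mul_of_pos_right hc hσ0
    have h3 : (h:ℝ) * Lm * σ = 4 * (h * Cb * A) * β := by rw [mul_assoc, hLσ]; ring
    linarith
  obtain ⟨g, hg, hgr⟩ := lift_isF hG (by linarith : 0 ≤ C1) (by linarith : 0 ≤ Cb) hσ2 (b := 2 * A * β) (Lm := Lm)
    (by linarith) hLm0 (ℓ := (h:ℝ) * Lm) hdep hBod hψτ hfψ hf hw le_rfl (by linarith)
  have hw1' : ν (w.root : V) = 1 := hw1
  have hνg : ν g.root = 1 + h * Lm := by rw [hgr, map_add, map_smul, ← hp, hf1, hw1', smul_eq_mul, mul_one]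
  have hψg : ψ g.root = - (h * Lm * σ) := by
    rw [hgr, map_add, map_smul, LinearMap.mem_ker.1 w.root.2, zero_add, smul_eq_mul, ← hp, hσ]; ring
  have hhL0 : 0 ≤ (h:ℝ) * Lm := by positivity
  have hμg : μ g.root ≤ 0 := by
    refine hμK _ ⟨by linarith, g, rfl, hg.mono (by linarith) ?_ hBod⟩
    rw [hνg]
    nlinarith
  have h1 := hψv g.root
  rw [hψg, hνg] at h1
  have h3 : (h:ℝ) * Lm * σ = 4 * (h * Cb * A) * β := by rw [mul_assoc, hLσ]; ring
  have h4 : 64 * (h * Cb * A) * β ≤ C2 * β := mul_le_mul_of_nonneg_right (by linarith) hβ.le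
  have h5 : 0 ≤ (h * Cb * A) * β := by positivity
  nlinarith

end SF

namespace SF

open scoped ContDiff Pointwise

theorem norm_fl {V : Type} [NormedAddCommGroup V] [NormedSpace ℝ V] {ι : Type} {G : ι → Set V}
    (hG : ∀ i, IsCone (G i)) {ν : V →ₗ[ℝ] ℝ} {R : Set ι} {c : ℝ} (hc : 0 ≤ c) {τ : Tr ι V} (hBod : τ.All Bod) {f : Fl V}
    (hf : IsF G R c τ f) (hν : 1 / 2 ≤ ν f.root) :
    IsF G R (2 * c) τ (f.smul (ν f.root)⁻¹) ∧ ν (f.smul (ν f.root)⁻¹).root = 1 := by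
  have h0 : 0 < ν f.root := by linarith
  have h2 : (ν f.root)⁻¹ ≤ 2 := by
    rw [inv_le_comm₀ h0 (by norm_num)]; linarith
  refine ⟨(hf.smul hG (by positivity)).mono (by positivity) (mul_le_mul_of_nonneg_right h2 hc) hBod, ?_⟩
  rw [Fl.smul_root, map_smul, smul_eq_mul, inv_mul_cancel₀ h0.ne']

theorem Con_zero : Con 0 := by
  intro h A c0 _ _
  refine ⟨1, 1, one_pos, le_rfl, ?_⟩
  intro V _ _ _ ι G ν τ hfin _ _ _ _ _ hR
  obtain ⟨f, _, hf⟩ := hR ∅ (by simp)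
  have : Subsingleton V := (Module.finrank_zero_iff (R := ℝ)).1 (Nat.le_zero.1 hfin)
  rw [Subsingleton.elim f.root 0, map_zero] at hf
  norm_num at hf

theorem kk_le (d : ℕ) : 2 * kk d ≤ kk (d + 1) := by
  cases d with
  | zero => simp [kk]
  | succ d => simp only [kk]; rw [pow_succ]; omega

theorem one_le_kk (d : ℕ) : 1 ≤ kk (d + 1) := Nat.one_le_two_pow

theorem con_leaf {V : Type} [NormedAddCommGroup V] [NormedSpace ℝ V] {ι : Type} {G : ι → Set V} {ν : V →ₗ[ℝ] ℝ} {i : ι}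
    {c0 : ℝ} (C : ℝ) {K : ℕ} (hK : 1 ≤ K)
    (hR : ∀ R : Finset ι, R.card ≤ K → ∃ f, IsF G (R : Set ι) c0 (Tr.leaf i) f ∧ ν f.root = 1) :
    ∃ f, IsF G Set.univ C (Tr.leaf i) f ∧ ν f.root = 1 := by
  obtain ⟨f, hf, hf1⟩ := hR {i} (by simpa using hK)
  cases f with
  | leaf v => exact ⟨.leaf v, fun _ => hf (by simp), hf1⟩
  | node v f g => exact hf.elim

set_option maxHeartbeats 1000000 in
theorem Con_succ {d : ℕ} (hCon : Con d) : Con (d + 1) := by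
  intro h
  induction h with
  | zero =>
    intro A c0 _ _
    refine ⟨1, 1, one_pos, le_rfl, ?_⟩
    intro V _ _ _ ι G ν τ hfin hG hdep _ _ _ hR
    cases τ with
    | leaf i => exact con_leaf _ (one_le_kk d) hR
    | node B l r => simp [Tr.depth] at hdep
  | succ h ih =>
    intro A c0 hA hc0
    obtain ⟨ε1, C1, hε1, hC1, H1⟩ := ih A (2 * c0) hA (by linarith)
    obtain ⟨ε2, C2, hε2, hC2, H2⟩ := claim hCon h A (4 * c0) C1 hA (by linarith) hC1
    obtain ⟨ε3, C3, hε3, hC3, H3⟩ := claim hCon h A (2 * C2 + 2 * c0) C1 hA (by linarith) hC1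
    set T := c0 + C2 + C3 with hT
    set ε : ℝ := min (min ε1 ε2) (min ε3 (1 / (2 * T))) with hε
    have hT0 : 0 < T := by linarith
    have hε0 : 0 < ε := lt_min (lt_min hε1 hε2) (lt_min hε3 (by positivity))
    have e1 : ε ≤ ε1 := (min_le_left _ _).trans (min_le_left _ _)
    have e2 : ε ≤ ε2 := (min_le_left _ _).trans (min_le_right _ _)
    have e3 : ε ≤ ε3 := (min_le_right _ _).trans (min_le_left _ _)
    have e4 : ε * T ≤ 1 / 2 := by
      have : ε ≤ 1 / (2 * T) := (min_le_right _ _).trans (min_le_right _ _)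
      rw [le_div_iff₀ (by positivity)] at this
      linarith
    have small : ∀ c : ℝ, c ≤ T → c * ε ≤ 1 / 2 := by
      intro c h1
      have := mul_le_mul_of_nonneg_right h1 hε0.le
      linarith
    refine ⟨ε, C3 + 2 * C2 + C1, hε0, by linarith, ?_⟩
    intro V _ _ _ ι G ν τ hfin hG hdep hBod hν hNest hR
    cases τ with
    | leaf i => exact con_leaf _ (one_le_kk d) hR
    | node B l r =>
    have hd1 : l.depth ≤ h := by simp only [Tr.depth] at hdep; omega
    have hd2 : r.depth ≤ h := by simp only [Tr.depth] at hdep; omega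
    obtain ⟨hB, hBl, hBr⟩ := hBod
    obtain ⟨hνB, hνl, hνr⟩ := hν
    obtain ⟨hNl, hNr, hNl', hNr'⟩ := hNest
    have up : ∀ {τ : Tr ι V} {e : ℝ}, ε ≤ e → τ.All (fun B => ∀ x ∈ B, |ν x| ≤ ε) →
        τ.All (fun B => ∀ x ∈ B, |ν x| ≤ e) :=
      fun he hh => hh.imp fun B hx x hxB => (hx x hxB).trans he
    have half : ∀ {c : ℝ} {x y : V}, 0 ≤ c → c ≤ T → ν x = 1 → x - y ∈ c • B → 1 / 2 ≤ ν y ∧ ν y ≤ 2 := by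
      intro c x y hc hcT hx hxy
      have h1 := body_fun hνB hc hxy
      rw [map_sub, hx] at h1
      have := abs_le.1 h1
      have := small c hcT
      constructor <;> linarith
    have hcase : ∀ R : Finset ι, R.card ≤ kk (d + 1) → ∃ fl fr : Fl V, IsF G (R : Set ι) c0 l fl ∧
        IsF G (R : Set ι) c0 r fr ∧ 1 / 2 ≤ ν fl.root ∧ 1 / 2 ≤ ν fr.root ∧
        fr.root - fl.root ∈ (2 * c0) • B := by
      intro R hRc
      obtain ⟨f, hf, hf1⟩ := hR R hRc
      cases f with
      | leaf v => exact hf.elim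
      | node v fl fr =>
      have hv1 : ν v = 1 := hf1
      refine ⟨fl, fr, hf.2.2.1, hf.2.2.2, (half (by linarith) (by linarith) hv1 hf.1).1,
        (half (by linarith) (by linarith) hv1 hf.2.1).1, ?_⟩
      have := hB.sub (by linarith : 0 ≤ c0) (by linarith : 0 ≤ c0) hf.1 hf.2.1
      rw [sub_sub_sub_cancel_left] at this
      rwa [two_mul]
    have hc00 : 0 ≤ c0 := by linarith
    obtain ⟨f_l, hfl, hfl1⟩ := H1 V ι G ν l hfin hG hd1 hBl (up e1 hνl) hNl' (by
      intro R hRc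
      obtain ⟨fl, fr, h1, h2, h3, h4, h5⟩ := hcase R hRc
      exact ⟨_, norm_fl hG hc00 hBl h1 h3⟩)
    obtain ⟨f_r, hfr, hfr1⟩ := H1 V ι G ν r hfin hG hd2 hBr (up e1 hνr) hNr' (by
      intro R hRc
      obtain ⟨fl, fr, h1, h2, h3, h4, h5⟩ := hcase R hRc
      exact ⟨_, norm_fl hG hc00 hBr h2 h4⟩)
    have right : ∀ R1 : Finset ι, R1.card ≤ kk d → ∃ g, IsF G Set.univ C2 r g ∧ ν g.root = 1 ∧
        ∃ z ∈ ZC G ν (R1 : Set ι) (2 * c0) l, g.root - z ∈ C2 • B := by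
      intro R1 hR1
      refine H2 V ι G ν r hfin hG hd2 hBr (up e2 hνr) hNr' B hB (fun x hx => (hνB x hx).trans e2) hNr f_r hfr hfr1
        _ (ZC.cone hG ν _ (by linarith) hBl) ?_
      intro R2 hR2
      obtain ⟨fl, fr, h1, h2, h3, h4, h5⟩ := hcase (R1 ∪ R2) (by
        have := Finset.card_union_le R1 R2
        have := kk_le d
        omega)
      have hs : 0 < (ν fr.root)⁻¹ := inv_pos.2 (by linarith)
      have hs2 : (ν fr.root)⁻¹ ≤ 2 := by rw [inv_le_comm₀ (by linarith) (by norm_num)]; linarith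
      obtain ⟨k1, k2⟩ := norm_fl hG hc00 hBr h2 h4
      refine ⟨_, (k1.anti (by simp)).mono (by linarith) (by linarith) hBr, k2, (ν fr.root)⁻¹ • fl.root, ?_, ?_⟩
      · refine (ZC.cone hG ν _ (by linarith) hBl).smul _ hs.le _ ⟨by linarith, fl, rfl, ?_⟩
        refine (h1.anti (by simp)).mono hc00 ?_ hBl
        nlinarith
      · rw [Fl.smul_root, ← smul_sub]
        have := hB.smul (s := 2) (by linarith : 0 ≤ 2 * c0) (by rwa [abs_of_pos hs]) h5
        rwa [show 2 * (2 * c0) = 4 * c0 by ring] at this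
    obtain ⟨g_l, hgl, hgl1, z, ⟨hz0, gr, rfl, hgr⟩, hz⟩ := H3 V ι G ν l hfin hG hd1 hBl (up e3 hνl) hNl' B hB
      (fun x hx => (hνB x hx).trans e3) hNl f_l hfl hfl1 (ZC G ν Set.univ C2 r)
      (ZC.cone hG ν _ (by linarith) hBr) (by
        intro R1 hR1
        obtain ⟨g, hg, hg1, z, ⟨hz0, fl, rfl, hfl⟩, hz⟩ := right R1 hR1
        have hν := half (by linarith) (by linarith) hg1 hz
        have hν0 : 0 < ν fl.root := by linarith
        have hs : 0 < (ν fl.root)⁻¹ := inv_pos.2 hν0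
        have hs2 : (ν fl.root)⁻¹ ≤ 2 := by rw [inv_le_comm₀ (by linarith) (by norm_num)]; linarith
        refine ⟨fl.smul (ν fl.root)⁻¹, ?_, ?_, (ν fl.root)⁻¹ • g.root, ?_, ?_⟩
        · have := hfl.smul hG hs.le
          rw [← mul_assoc, inv_mul_cancel₀ hν0.ne', one_mul] at this
          exact this.mono (by linarith) (by linarith) hBl
        · rw [Fl.smul_root, map_smul, smul_eq_mul, inv_mul_cancel₀ hν0.ne']
        · refine (ZC.cone hG ν _ (by linarith) hBr).smul _ hs.le _ ⟨by linarith, g, rfl, ?_⟩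
          rwa [hg1, one_mul]
        · rw [Fl.smul_root, ← smul_sub]
          have := hB.smul (s := 2) (by linarith : 0 ≤ C2) (by rwa [abs_of_pos hs]) hz
          have := hB.neg (hB.mono (by linarith) (by linarith : 2 * C2 ≤ 2 * C2 + 2 * c0) this)
          rwa [← smul_neg, neg_sub] at this)
    have hν := half (by linarith) (by linarith) hgl1 hz
    refine ⟨.node g_l.root g_l gr, ⟨?_, ?_, ?_, ?_⟩, hgl1⟩
    · rw [sub_self]; exact hB.zero_mem _
    · exact hB.mono (by linarith) (by linarith) hz
    · exact hgl.mono (by linarith) (by linarith) hBl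
    · refine hgr.mono (mul_nonneg hz0 (by linarith)) ?_ hBr
      nlinarith

theorem Con_all : ∀ d, Con d
  | 0 => Con_zero
  | d + 1 => Con_succ (Con_all d)

end SF

namespace SF

open scoped ContDiff Pointwise

theorem card_exp (n k : ℕ) : Nat.card {s : Fin n →₀ ℕ | (s.sum fun _ e => e) ≤ k} = Nat.choose (n + k) n := by
  have h1 : {s : Fin n →₀ ℕ | (s.sum fun _ e => e) ≤ k} =
      (((Finset.range (k + 1)).biUnion fun i => Finset.finsuppAntidiag Finset.univ i : Finset (Fin n →₀ ℕ)) : Set _) := by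
    ext s
    have hs : (s.sum fun _ e => e) = Finset.univ.sum s := Finsupp.sum_fintype _ _ (fun _ => rfl)
    rw [Set.mem_setOf_eq, hs]
    simp only [Finset.coe_biUnion, Set.mem_iUnion, Finset.mem_coe, Finset.mem_finsuppAntidiag,
      Finset.mem_range, Finset.subset_univ, and_true]
    constructor
    · intro h; exact ⟨_, by omega, rfl⟩
    · rintro ⟨i, h, rfl⟩; omega
  rw [h1, Nat.card_coe_set_eq, Set.ncard_coe_finset, Finset.card_biUnion]
  · have : ∀ k, ∑ i ∈ Finset.range (k + 1), (Finset.finsuppAntidiag (Finset.univ : Finset (Fin n)) i).card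
        = Nat.multichoose (n + 1) k := by
      intro k
      induction k with
      | zero => simp
      | succ k ih =>
        rw [Finset.sum_range_succ, ih, Finset.card_finsuppAntidiag_nat_eq_multichoose, Nat.multichoose_succ_succ,
          Finset.card_univ, Fintype.card_fin]
        ring
    rw [this, Nat.multichoose_eq, show n + 1 + k - 1 = n + k by omega, Nat.choose_symm_add]
  · intro i _ j _ hij
    rw [Function.onFun, Finset.disjoint_left]
    intro s hs hs'
    rw [Finset.mem_finsuppAntidiag] at hs hs'
    exact hij (hs.1.symm.trans hs'.1)

theorem exists_Phi (n k D : ℕ) : ∃ (Φ : (Fin (D * Nat.choose (n + k) n) → ℝ) →ₗ[ℝ] VPol n D),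
    Function.Injective Φ ∧ (∀ w, VD k (Φ w)) ∧ ∀ P, VD k P → ∃ w, Φ w = P := by
  have hr : Module.finrank ℝ (MvPolynomial.restrictTotalDegree (Fin n) ℝ k) = Nat.choose (n + k) n := by
    rw [← card_exp n k]
    exact Module.finrank_eq_nat_card_basis (MvPolynomial.basisRestrictSupport ℝ _)
  have hf : Module.finrank ℝ (Fin (D * Nat.choose (n + k) n) → ℝ) =
      Module.finrank ℝ (Fin D → MvPolynomial.restrictTotalDegree (Fin n) ℝ k) := by
    rw [Module.finrank_fintype_fun_eq_card, Module.finrank_pi_fintype]; simp [hr]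
  let e := LinearEquiv.ofFinrankEq _ _ hf
  let c : (Fin D → MvPolynomial.restrictTotalDegree (Fin n) ℝ k) →ₗ[ℝ] VPol n D :=
    { toFun := fun p j => (p j : Pol n), map_add' := fun _ _ => rfl, map_smul' := fun _ _ => rfl }
  refine ⟨c.comp e.toLinearMap, ?_, ?_, ?_⟩
  · intro a b hab
    apply e.injective
    funext j
    exact Subtype.ext (congrFun hab j)
  · intro w j
    exact (MvPolynomial.mem_restrictTotalDegree _ _ _).1 (e w j).2
  · intro P hP
    obtain ⟨w, hw⟩ := e.surjective fun j => ⟨P j, (MvPolynomial.mem_restrictTotalDegree _ _ _).2 (hP j)⟩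
    refine ⟨w, ?_⟩
    funext j
    show ((e w) j : Pol n) = _
    rw [hw]

end SF

namespace SF

open scoped ContDiff Pointwise

section

variable {W : Type} [NormedAddCommGroup W] [NormedSpace ℝ W] {ι : Type}

/-- thickened body -/
def lb (e : ℝ) (B : Set W) : Set (W × ℝ) := B ×ˢ Set.Ioo (-e) e

def Tr.lift (e : ℝ) : Tr ι W → Tr ι (W × ℝ)
  | .leaf i => .leaf i
  | .node B l r => .node (lb e B) (l.lift e) (r.lift e)

def Fl.lift : Fl W → Fl (W × ℝ)
  | .leaf v => .leaf (v, 1)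
  | .node v l r => .node (v, 1) l.lift r.lift

def Fl.dn : Fl (W × ℝ) → Fl W
  | .leaf v => .leaf (v.2⁻¹ • v.1)
  | .node v l r => .node v.1 l.dn r.dn

theorem Fl.lift_root (f : Fl W) : f.lift.root = (f.root, 1) := by cases f <;> rfl

theorem Tr.lift_depth (e : ℝ) : ∀ τ : Tr ι W, (τ.lift e).depth = τ.depth
  | .leaf _ => rfl
  | .node _ l r => by simp only [Tr.lift, Tr.depth, l.lift_depth e, r.lift_depth e]

theorem Tr.lift_All (e : ℝ) {Q : Set W → Prop} {Q' : Set (W × ℝ) → Prop} (h : ∀ B, Q B → Q' (lb e B)) :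
    ∀ {τ : Tr ι W}, τ.All Q → (τ.lift e).All Q'
  | .leaf _, _ => trivial
  | .node _ _ _, hh => ⟨h _ hh.1, Tr.lift_All e h hh.2.1, Tr.lift_All e h hh.2.2⟩

theorem lb_mem {e c : ℝ} (he : 0 < e) (hc : 0 ≤ c) {B : Set W} {x : W} (hx : x ∈ c • B) : ((x, 0) : W × ℝ) ∈ c • lb e B := by
  obtain ⟨b, hb, rfl⟩ := Set.mem_smul_set.1 hx
  exact Set.mem_smul_set.2 ⟨(b, 0), ⟨hb, by simp [he]⟩, by simp⟩

theorem lb_fst {e c : ℝ} {B : Set W} {p : W × ℝ} (hp : p ∈ c • lb e B) : p.1 ∈ c • B := by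
  obtain ⟨b, hb, rfl⟩ := Set.mem_smul_set.1 hp
  exact Set.mem_smul_set.2 ⟨b.1, hb.1, rfl⟩

theorem lb_sub {e A : ℝ} (he : 0 < e) (hA : 1 ≤ A) {B B' : Set W} (h : B' ⊆ A • B) : lb e B' ⊆ A • lb e B := by
  rintro ⟨x, t⟩ ⟨hx, ht⟩
  obtain ⟨b, hb, hbx⟩ := Set.mem_smul_set.1 (h hx)
  have hA0 : 0 < A := by linarith
  refine Set.mem_smul_set.2 ⟨(b, A⁻¹ * t), ⟨hb, ?_⟩, ?_⟩
  · have h1 : |t| < e := abs_lt.2 ht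
    have h2 : |A⁻¹ * t| < e := by
      rw [abs_mul, abs_of_pos (by positivity)]
      have : A⁻¹ ≤ 1 := inv_le_one_of_one_le₀ hA
      nlinarith [abs_nonneg t]
    exact abs_lt.1 h2
  · ext
    · exact hbx
    · show A * (A⁻¹ * t) = t
      rw [← mul_assoc, mul_inv_cancel₀ hA0.ne', one_mul]

theorem lb_bod {e : ℝ} (he : 0 < e) {B : Set W} (h : Bod B) : Bod (lb e B) where
  conv := h.conv.prod (convex_Ioo _ _)
  symm := by
    rintro ⟨x, t⟩ ⟨hx, ht⟩
    exact ⟨h.symm x hx, by constructor <;> simp <;> linarith [ht.1, ht.2]⟩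
  op := h.op.prod isOpen_Ioo
  zero := ⟨h.zero, by simp [he]⟩

theorem Tr.lift_nest {e A : ℝ} (he : 0 < e) (hA : 1 ≤ A) : ∀ {τ : Tr ι W}, τ.Nest A → (τ.lift e).Nest A
  | .leaf _, _ => trivial
  | .node _ _ _, h => ⟨Tr.lift_All e (fun _ hB => lb_sub he hA hB) h.1, Tr.lift_All e (fun _ hB => lb_sub he hA hB) h.2.1,
    Tr.lift_nest he hA h.2.2.1, Tr.lift_nest he hA h.2.2.2⟩

/-- the cone over `Γ × {1}` -/
def cn (Γ : Set W) : Set (W × ℝ) := {p | 0 ≤ p.2 ∧ ∃ P : W, (p.2 = 0 ∨ P ∈ Γ) ∧ p.1 = p.2 • P}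

theorem cn_cone {Γ : Set W} (h : Convex ℝ Γ) : IsCone (cn Γ) where
  zero := ⟨le_rfl, 0, Or.inl rfl, by simp⟩
  add := by
    rintro ⟨x, s⟩ ⟨hs, P, hP, hx⟩ ⟨y, t⟩ ⟨ht, Q, hQ, hy⟩
    simp only at hs hP hx ht hQ hy
    subst hx hy
    rcases hP with rfl | hP
    · refine ⟨by simpa using ht, Q, by simpa using hQ, by simp⟩
    rcases hQ with rfl | hQ
    · refine ⟨by simpa using hs, P, by simp [hP], by simp⟩
    rcases eq_or_lt_of_le (add_nonneg hs ht) with h0 | h0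
    · have h1 : s = 0 := by linarith
      have h2 : t = 0 := by linarith
      subst h1 h2
      exact ⟨by simp, 0, by simp, by simp⟩
    · refine ⟨h0.le, (s / (s + t)) • P + (t / (s + t)) • Q, Or.inr ?_, ?_⟩
      · exact h hP hQ (by positivity) (by positivity) (by field_simp)
      · show s • P + t • Q = (s + t) • _
        rw [smul_add, smul_smul, smul_smul, mul_div_cancel₀ _ h0.ne', mul_div_cancel₀ _ h0.ne']
  smul := by
    rintro t ht ⟨x, s⟩ ⟨hs, P, hP, hx⟩
    simp only at hs hP hx
    subst hx
    refine ⟨mul_nonneg ht hs, P, ?_, by simp [smul_smul]⟩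
    rcases hP with rfl | hP
    · left; simp
    · exact Or.inr hP

theorem Fl.fin : ∀ f : Fl W, ∃ X : Set W, X.Finite ∧ f.All (fun v => v ∈ X)
  | .leaf v => ⟨{v}, Set.finite_singleton v, rfl⟩
  | .node v l r => by
    obtain ⟨X, hX, h⟩ := l.fin
    obtain ⟨Y, hY, h'⟩ := r.fin
    exact ⟨{v} ∪ X ∪ Y, ((Set.finite_singleton v).union hX).union hY, by simp,
      h.imp (by intro v hv; simp [hv]), h'.imp (by intro v hv; simp [hv])⟩

theorem Bod.absorb {B : Set W} (hB : Bod B) (x : W) : ∃ K : ℝ, 0 ≤ K ∧ x ∈ K • B := by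
  have hev : ∀ᶠ t : ℝ in nhds 0, t • x ∈ B := by
    have hc : ContinuousAt (fun t : ℝ => t • x) 0 := by fun_prop
    exact hc.eventually_mem (by simpa using hB.op.mem_nhds hB.zero)
  obtain ⟨r, hr, hrB⟩ := Metric.eventually_nhds_iff.1 hev
  have h1 := hrB (y := r / 2) (by rw [Real.dist_eq, sub_zero, abs_of_pos (by positivity)]; linarith)
  refine ⟨(r / 2)⁻¹, by positivity, Set.mem_smul_set.2 ⟨_, h1, ?_⟩⟩
  rw [smul_smul, inv_mul_cancel₀ (by positivity), one_smul]

theorem Bod.absorb' {B : Set W} (hB : Bod B) {X : Set W} (hX : X.Finite) :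
    ∃ K : ℝ, 0 ≤ K ∧ convexHull ℝ X ⊆ K • B := by
  have : ∃ K : ℝ, 0 ≤ K ∧ X ⊆ K • B := by
    refine Set.Finite.induction_on _ hX ⟨0, le_rfl, by simp⟩ ?_
    rintro a s _ _ ⟨K, hK, h⟩
    obtain ⟨K', hK', h'⟩ := hB.absorb a
    refine ⟨K + K', by linarith, ?_⟩
    rintro x (rfl | hx)
    · exact hB.mono hK' (by linarith) h'
    · exact hB.mono hK (by linarith) (h hx)
  obtain ⟨K, hK, h⟩ := this
  exact ⟨K, hK, convexHull_min h (hB.conv.smul K)⟩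

theorem Tr.absorb {X : Set W} (hX : X.Finite) : ∀ {τ : Tr ι W}, τ.All Bod →
    ∃ K : ℝ, 0 ≤ K ∧ τ.All (fun B => convexHull ℝ X ⊆ K • B)
  | .leaf _, _ => ⟨0, le_rfl, trivial⟩
  | .node B l r, h => by
    obtain ⟨K, hK, h1⟩ := h.1.absorb' hX
    obtain ⟨K', hK', h1'⟩ := Tr.absorb hX h.2.1
    obtain ⟨L, hL, h2⟩ := Tr.absorb hX h.2.2
    refine ⟨K + K' + L, by positivity, fun x hx => h.1.mono hK (by linarith) (h1 hx),
      (h1'.and h.2.1).imp ?_, (h2.and h.2.2).imp ?_⟩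
    · rintro B ⟨hh, hB⟩ x hx
      exact hB.mono hK' (by linarith) (hh hx)
    · rintro B ⟨hh, hB⟩ x hx
      exact hB.mono hL (by linarith) (hh hx)

theorem IsF.up {Γ : ι → Set W} {R : Set ι} {c e : ℝ} (he : 0 < e) (hc : 0 ≤ c) {X : Set W} :
    ∀ {τ : Tr ι W} {f : Fl W}, f.All (fun v => v ∈ X) → IsF Γ R c τ f →
      IsF (fun i => cn (convexHull ℝ (X ∩ Γ i))) R c (τ.lift e) f.lift
  | .leaf i, .leaf v, hX, h => fun hi => ⟨zero_le_one, v, Or.inr (subset_convexHull ℝ _ ⟨hX, h hi⟩), by simp⟩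
  | .node _ _ _, .node v f g, hX, h => by
    refine ⟨?_, ?_, h.2.2.1.up he hc hX.2.1, h.2.2.2.up he hc hX.2.2⟩
    · rw [Fl.lift_root]
      have := lb_mem he hc h.1
      simpa using this
    · rw [Fl.lift_root]
      have := lb_mem he hc h.2.1
      simpa using this

theorem IsF.dn {Γ : ι → Set W} (hΓ : ∀ i, Convex ℝ (Γ i)) {c e θ K : ℝ} (hc : 0 ≤ c) (hK : 0 ≤ K) (hθ : θ ≤ 1 / 2)
    (hθK : θ * K ≤ 1) {X : Set W} :
    ∀ {τ : Tr ι W} {f : Fl (W × ℝ)}, τ.All Bod → τ.All (fun B => convexHull ℝ X ⊆ K • B) →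
      f.All (fun v => |1 - v.2| ≤ θ) →
      IsF (fun i => cn (convexHull ℝ (X ∩ Γ i))) Set.univ c (τ.lift e) f →
      IsF Γ Set.univ (c + 1) τ f.dn ∧ ∀ B, Bod B → convexHull ℝ X ⊆ K • B → f.root.1 - f.dn.root ∈ (1:ℝ) • B
  | .leaf i, .leaf v, _, _, hv, h => by
    obtain ⟨h0, P, hP, hvP⟩ := h (Set.mem_univ i)
    have hv' : |1 - v.2| ≤ θ := hv
    have hv2 := abs_le.1 hv'
    have hpos : 0 < v.2 := by linarith
    have hP' := hP.resolve_left hpos.ne'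
    have e1 : v.2⁻¹ • v.1 = P := by rw [hvP, smul_smul, inv_mul_cancel₀ hpos.ne', one_smul]
    constructor
    · intro _
      show v.2⁻¹ • v.1 ∈ Γ i
      rw [e1]
      exact convexHull_min Set.inter_subset_right (hΓ i) hP'
    · intro B hB hX
      show v.1 - v.2⁻¹ • v.1 ∈ _
      have h1 := hX (convexHull_mono Set.inter_subset_left hP')
      have h2 := hB.smul hK hv' h1
      have h3 := hB.neg (hB.mono (mul_nonneg ((abs_nonneg _).trans hv') hK) hθK h2)
      rw [e1, hvP]
      convert h3 using 1
      rw [sub_smul, one_smul, neg_sub]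
  | .node B l r, .node v f g, hB, hX, hv, h => by
    obtain ⟨h1, h2⟩ := IsF.dn hΓ hc hK hθ hθK hB.2.1 hX.2.1 hv.2.1 h.2.2.1
    obtain ⟨h3, h4⟩ := IsF.dn hΓ hc hK hθ hθK hB.2.2 hX.2.2 hv.2.2 h.2.2.2
    refine ⟨⟨?_, ?_, h1, h3⟩, ?_⟩
    · have := hB.1.add hc zero_le_one (lb_fst h.1) (h2 B hB.1 hX.1)
      simpa using this
    · have := hB.1.add hc zero_le_one (lb_fst h.2.1) (h4 B hB.1 hX.1)
      simpa using this
    · intro B' hB' _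
      show v.1 - v.1 ∈ _
      rw [sub_self]; exact hB'.zero_mem _

end

theorem tree_main (d h : ℕ) (A c0 : ℝ) (hA : 1 ≤ A) (hc0 : 1 ≤ c0) : ∃ C : ℝ, 1 ≤ C ∧
    ∀ (W : Type) [NormedAddCommGroup W] [NormedSpace ℝ W] [FiniteDimensional ℝ W] (ι : Type) [Fintype ι] (Γ : ι → Set W)
    (τ : Tr ι W), Module.finrank ℝ W ≤ d → (∀ i, Convex ℝ (Γ i)) → τ.depth ≤ h → τ.All Bod → τ.Nest A →
    (∀ R : Finset ι, R.card ≤ 2 ^ d → ∃ f, IsF Γ (R : Set ι) c0 τ f) → ∃ f, IsF Γ Set.univ C τ f := by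
  obtain ⟨ε, C, hε, hC, H⟩ := Con_all (d + 1) h A c0 hA hc0
  refine ⟨C + 1, by linarith, ?_⟩
  intro W _ _ _ ι _ Γ τ hfin hΓ hdep hBod hNest hR
  have hR' : ∀ R : Finset ι, ∃ f, R.card ≤ 2 ^ d → IsF Γ (R : Set ι) c0 τ f := by
    intro R
    by_cases hc : R.card ≤ 2 ^ d
    · obtain ⟨f, hf⟩ := hR R hc
      exact ⟨f, fun _ => hf⟩
    · exact ⟨.leaf 0, fun h => absurd h hc⟩
  choose F hF using hR'
  choose X hX hFX using fun R => (F R).fin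
  set Y : Set W := ⋃ R, X R with hY
  have hYf : Y.Finite := Set.finite_iUnion hX
  obtain ⟨K, hK, hKτ⟩ := Tr.absorb hYf hBod
  have hh : (0:ℝ) ≤ h := Nat.cast_nonneg h
  set T : ℝ := (h + 1) * C * (K + 2) with hT
  have hT0 : 0 < T := by positivity
  set e : ℝ := min ε (1 / T) with he
  have he0 : 0 < e := lt_min hε (by positivity)
  have heT : e * T ≤ 1 := by
    have : e ≤ 1 / T := min_le_right _ _
    rwa [le_div_iff₀ hT0] at this
  have hν : ∀ e' : ℝ, e ≤ e' → (τ.lift e).All (fun B => ∀ x ∈ B, |LinearMap.snd ℝ W ℝ x| ≤ e') := by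
    intro e' he'
    refine Tr.lift_All e (Q := Bod) ?_ hBod
    rintro B _ x ⟨_, hx⟩
    exact (abs_lt.2 hx).le.trans he'
  obtain ⟨f, hf, hf1⟩ := H (W × ℝ) ι (fun i => cn (convexHull ℝ (Y ∩ Γ i))) (LinearMap.snd ℝ W ℝ) (τ.lift e)
    (by rw [Module.finrank_prod, Module.finrank_self]; omega) (fun i => cn_cone (convex_convexHull ℝ _))
    (by rw [Tr.lift_depth]; exact hdep) (Tr.lift_All e (fun B hB => lb_bod he0 hB) hBod)
    (hν ε (min_le_left _ _)) (Tr.lift_nest he0 hA hNest) (by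
      intro R hRc
      refine ⟨(F R).lift, (hF R hRc).up he0 (by linarith) ?_, ?_⟩
      · exact (hFX R).imp fun v hv => Set.mem_iUnion.2 ⟨R, hv⟩
      · rw [Fl.lift_root]; rfl)
  have hdr := hf.fun_drift (by linarith) he0.le (h := h) (by rw [Tr.lift_depth]; exact hdep) (hν e le_rfl)
  have hθ : (h:ℝ) * (C * e) * (K + 2) ≤ 1 := by
    have : (h:ℝ) * (C * e) * (K + 2) ≤ e * T := by
      rw [hT]
      have : 0 ≤ C * e * (K + 2) := by positivity
      nlinarith
    linarith
  have hθ0 : 0 ≤ (h:ℝ) * (C * e) := by positivity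
  refine ⟨f.dn, (IsF.dn hΓ (by linarith) hK (θ := (h:ℝ) * (C * e)) (by nlinarith) (by nlinarith) hBod hKτ ?_ hf).1⟩
  refine hdr.imp ?_
  intro v hv
  rwa [hf1] at hv

end SF

namespace SF

open scoped ContDiff Pointwise

section

variable {ι : Type} [MetricSpace ι]

/-- a finite set splits into two well separated pieces -/
theorem split {N : ℕ} {S : Finset ι} (hN : S.card ≤ N) (h2 : 1 < S.card) : ∃ (S1 S2 : Finset ι) (δ : ℝ), S1 ∪ S2 = S ∧
    Disjoint S1 S2 ∧ S1.Nonempty ∧ S2.Nonempty ∧ 0 < δ ∧ (∃ y ∈ S, ∃ z ∈ S, δ = dist y z) ∧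
    (∀ y ∈ S, ∀ z ∈ S, dist y z ≤ δ) ∧ ∀ y ∈ S1, ∀ z ∈ S2, δ ≤ N * dist y z := by
  obtain ⟨a, ha, b, hb, hab⟩ := Finset.one_lt_card.1 h2
  obtain ⟨⟨x, y⟩, hxy, hmax⟩ := Finset.exists_max_image (S ×ˢ S) (fun p => dist p.1 p.2) ⟨(a, b), by simp [ha, hb]⟩
  rw [Finset.mem_product] at hxy
  set δ := dist x y with hδ
  have hmax' : ∀ y ∈ S, ∀ z ∈ S, dist y z ≤ δ := fun y hy z hz => hmax (y, z) (Finset.mk_mem_product hy hz)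
  have hδ0 : 0 < δ := (dist_pos.2 hab).trans_le (hmax' a ha b hb)
  have hN0 : 0 < N := by omega
  have hN0' : (0:ℝ) < N := Nat.cast_pos.2 hN0
  have hx : x ∈ S := hxy.1
  obtain ⟨i, hi⟩ : ∃ i : Fin N, ∀ z ∈ S, (i:ℝ) * δ < N * dist x z → ((i:ℝ) + 1) * δ < N * dist x z := by
    by_contra hcon
    push Not at hcon
    choose z hz h1 h3 using hcon
    have hlt : ∀ i j : Fin N, i < j → N * dist x (z i) < N * dist x (z j) := by
      intro i j hij
      have h4 : (i:ℝ) + 1 ≤ j := by exact_mod_cast Nat.succ_le_of_lt hij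
      have := mul_le_mul_of_nonneg_right h4 hδ0.le
      linarith [h1 j, h3 i]
    have hinj : Function.Injective z := by
      intro i j hij
      rcases lt_trichotomy i j with h | h | h
      · have := hlt i j h; rw [hij] at this; exact absurd this (lt_irrefl _)
      · exact h
      · have := hlt j i h; rw [hij] at this; exact absurd this (lt_irrefl _)
    have hsub : (Finset.univ.image z) ⊆ S.erase x := by
      intro w hw
      obtain ⟨i, _, rfl⟩ := Finset.mem_image.1 hw
      refine Finset.mem_erase.2 ⟨?_, hz i⟩
      intro he
      have := h1 i
      rw [he, dist_self, mul_zero] at this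
      have : 0 ≤ (i:ℝ) * δ := by positivity
      linarith
    have hc := Finset.card_le_card hsub
    rw [Finset.card_image_of_injective _ hinj, Finset.card_univ, Fintype.card_fin, Finset.card_erase_of_mem hx] at hc
    omega
  refine ⟨S.filter (fun z => N * dist x z ≤ i * δ), S.filter (fun z => ¬ N * dist x z ≤ i * δ), δ,
    Finset.filter_union_filter_not_eq _ _, Finset.disjoint_filter_filter_not _ _ _, ⟨x, ?_⟩, ⟨y, ?_⟩, hδ0,
    ⟨x, hxy.1, y, hxy.2, rfl⟩, hmax', ?_⟩
  · rw [Finset.mem_filter]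
    refine ⟨hx, ?_⟩
    rw [dist_self, mul_zero]; positivity
  · rw [Finset.mem_filter]
    refine ⟨hxy.2, ?_⟩
    have : (i:ℝ) < N := by exact_mod_cast i.2
    have := mul_lt_mul_of_pos_right this hδ0
    push Not; linarith
  · intro u hu v hv
    rw [Finset.mem_filter] at hu hv
    have h1 := hi v hv.1 (lt_of_not_ge hv.2)
    have h3 := mul_le_mul_of_nonneg_left (dist_triangle x u v) hN0'.le
    linarith [hu.2]

variable {W : Type}

/-- cluster trees -/
inductive CT (Bd : ι → ℝ → Set W) (N : ℝ) : Finset ι → Tr ι W → Prop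
  | leaf (i : ι) : CT Bd N {i} (.leaf i)
  | node {S1 S2 : Finset ι} {l r : Tr ι W} {x : ι} {δ : ℝ} : CT Bd N S1 l → CT Bd N S2 r → Disjoint S1 S2 →
      x ∈ S1 ∪ S2 → 0 < δ → (∃ y ∈ S1 ∪ S2, ∃ z ∈ S1 ∪ S2, δ = dist y z) →
      (∀ y ∈ S1 ∪ S2, ∀ z ∈ S1 ∪ S2, dist y z ≤ δ) → (∀ y ∈ S1, ∀ z ∈ S2, δ ≤ N * dist y z) →
      CT Bd N (S1 ∪ S2) (.node (Bd x δ) l r)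

theorem CT_exists (Bd : ι → ℝ → Set W) (N : ℕ) : ∀ (c : ℕ) (S : Finset ι), S.card ≤ c → S.card ≤ N → S.Nonempty →
    ∃ τ, CT Bd N S τ := by
  intro c
  induction c with
  | zero =>
    intro S h _ hne
    exact absurd (Finset.card_pos.2 hne) (by omega)
  | succ c ih =>
    intro S hc hN hne
    by_cases h2 : 1 < S.card
    · obtain ⟨S1, S2, δ, rfl, hd, hn1, hn2, h0, h1, h3, h4⟩ := split hN h2
      rw [Finset.card_union_of_disjoint hd] at hc hN
      have k1 := Finset.card_pos.2 hn1
      have k2 := Finset.card_pos.2 hn2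
      obtain ⟨l, hl⟩ := ih S1 (by omega) (by omega) hn1
      obtain ⟨r, hr⟩ := ih S2 (by omega) (by omega) hn2
      obtain ⟨x, hx⟩ := hn1
      exact ⟨_, CT.node hl hr hd (Finset.mem_union_left _ hx) h0 h1 h3 h4⟩
    · have := Finset.card_pos.2 hne
      obtain ⟨i, rfl⟩ := Finset.card_eq_one.1 (show S.card = 1 by omega)
      exact ⟨_, CT.leaf i⟩

variable {Bd : ι → ℝ → Set W} {N : ℝ}

theorem CT.depth {S : Finset ι} {τ : Tr ι W} (h : CT Bd N S τ) : τ.depth + 1 ≤ S.card := by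
  induction h with
  | leaf i => simp [Tr.depth]
  | node h1 h2 hd _ _ _ _ _ ih1 ih2 =>
    rw [Finset.card_union_of_disjoint hd]
    simp only [Tr.depth]
    omega

theorem CT.all {S : Finset ι} {τ : Tr ι W} (h : CT Bd N S τ) : ∀ S' : Finset ι, S ⊆ S' →
    τ.All (fun B => ∃ x ∈ S', ∃ δ : ℝ, 0 < δ ∧ (∃ y ∈ S', ∃ z ∈ S', δ = dist y z) ∧ B = Bd x δ) := by
  induction h with
  | leaf i => intro S' _; trivial
  | node h1 h2 hd hx hδ hyz _ _ ih1 ih2 =>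
    intro S' hS
    obtain ⟨y, hy, z, hz, hyz⟩ := hyz
    exact ⟨⟨_, hS hx, _, hδ, ⟨y, hS hy, z, hS hz, hyz⟩, rfl⟩, ih1 S' (Finset.union_subset_left hS),
      ih2 S' (Finset.union_subset_right hS)⟩

variable [NormedAddCommGroup W] [NormedSpace ℝ W]

theorem CT.bod {S : Finset ι} {τ : Tr ι W} (h : CT Bd N S τ) (hB : ∀ x δ, 0 < δ → Bod (Bd x δ)) : τ.All Bod :=
  (h.all S (Finset.Subset.refl _)).imp (by rintro _ ⟨x, _, δ, hδ, _, rfl⟩; exact hB x δ hδ)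

theorem CT.sub {A : ℝ} (hA : ∀ x x' δ δ', 0 < δ' → δ' ≤ δ → dist x x' ≤ δ → Bd x' δ' ⊆ A • Bd x δ)
    {S S' : Finset ι} {τ : Tr ι W} (h : CT Bd N S τ) (hS : S ⊆ S') {x : ι} (hx : x ∈ S') {δ : ℝ}
    (hd : ∀ y ∈ S', ∀ z ∈ S', dist y z ≤ δ) : τ.All (fun B' => B' ⊆ A • Bd x δ) := by
  refine (h.all S' hS).imp ?_
  rintro _ ⟨x', hx', δ', hδ', ⟨y, hy, z, hz, rfl⟩, rfl⟩
  exact hA _ _ _ _ hδ' (hd y hy z hz) (hd _ hx _ hx')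

theorem CT.nest {A : ℝ} (hA : ∀ x x' δ δ', 0 < δ' → δ' ≤ δ → dist x x' ≤ δ → Bd x' δ' ⊆ A • Bd x δ)
    {S : Finset ι} {τ : Tr ι W} (h : CT Bd N S τ) : τ.Nest A := by
  induction h with
  | leaf i => trivial
  | node h1 h2 hd hx hδ hyz hdd _ ih1 ih2 =>
    exact ⟨h1.sub hA Finset.subset_union_left hx hdd, h2.sub hA Finset.subset_union_right hx hdd, ih1, ih2⟩

/-- a Whitney field gives a tree field -/
theorem CT.field {A c : ℝ} (hc : 0 ≤ c) (hA0 : 0 ≤ A)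
    (hA : ∀ x x' δ δ', 0 < δ' → δ' ≤ δ → dist x x' ≤ δ → Bd x' δ' ⊆ A • Bd x δ)
    (hB : ∀ x δ, 0 < δ → Bod (Bd x δ)) {Γ : ι → Set W} {R : Set ι} {P : ι → W} (hP : ∀ z ∈ R, P z ∈ Γ z)
    (hW : ∀ z ∈ R, ∀ y ∈ R, z ≠ y → P z - P y ∈ c • Bd z (dist z y))
    {S : Finset ι} {τ : Tr ι W} (h : CT Bd N S τ) : ∀ Q : W, ∃ f, IsF Γ R (c * A) τ f ∧
      ((∀ z ∈ S, z ∉ R) → f.root = Q) ∧ ((∃ z ∈ S, z ∈ R) → ∃ z ∈ S, z ∈ R ∧ f.root = P z) := by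
  induction h with
  | leaf i =>
    intro Q
    by_cases hi : i ∈ R
    · refine ⟨.leaf (P i), fun _ => hP i hi, ?_, ?_⟩
      · intro h; exact absurd hi (h i (by simp))
      · intro _; exact ⟨i, by simp, hi, rfl⟩
    · refine ⟨.leaf Q, fun h => absurd h hi, fun _ => rfl, ?_⟩
      rintro ⟨z, hz, hzR⟩
      rw [Finset.mem_singleton] at hz
      exact absurd (hz ▸ hzR) hi
  | @node S1 S2 l r x δ h1 h2 hd hx hδ hyz hdd _ ih1 ih2 =>
    intro Q
    obtain ⟨v, hv1, hv2⟩ : ∃ v : W, ((∀ z ∈ S1 ∪ S2, z ∉ R) → v = Q) ∧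
        ((∃ z ∈ S1 ∪ S2, z ∈ R) → ∃ z ∈ S1 ∪ S2, z ∈ R ∧ v = P z) := by
      by_cases hz : ∃ z ∈ S1 ∪ S2, z ∈ R
      · obtain ⟨z, hz1, hz2⟩ := hz
        exact ⟨P z, fun h => absurd hz2 (h z hz1), fun _ => ⟨z, hz1, hz2, rfl⟩⟩
      · exact ⟨Q, fun _ => rfl, fun h => absurd h hz⟩
    obtain ⟨f, hf, hf1, hf2⟩ := ih1 v
    obtain ⟨g, hg, hg1, hg2⟩ := ih2 v
    have key : ∀ (S' : Finset ι) (w : W), S' ⊆ S1 ∪ S2 → ((∀ z ∈ S', z ∉ R) → w = v) →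
        ((∃ z ∈ S', z ∈ R) → ∃ z ∈ S', z ∈ R ∧ w = P z) → v - w ∈ (c * A) • Bd x δ := by
      intro S' w hS hw1 hw2
      by_cases hz : ∃ z ∈ S', z ∈ R
      · obtain ⟨z, hz1, hz2, rfl⟩ := hw2 hz
        obtain ⟨y, hy1, hy2, rfl⟩ := hv2 ⟨z, hS hz1, hz2⟩
        by_cases hyz : y = z
        · rw [hyz, sub_self]; exact (hB x δ hδ).zero_mem _
        · exact body_trans (hA _ _ _ _ (dist_pos.2 hyz) (hdd _ hy1 _ (hS hz1)) (hdd _ hx _ hy1)) (hW y hy2 z hz2 hyz)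
      · push Not at hz
        rw [hw1 hz, sub_self]; exact (hB x δ hδ).zero_mem _
    exact ⟨.node v f g, ⟨key S1 _ Finset.subset_union_left hf1 hf2, key S2 _ Finset.subset_union_right hg1 hg2, hf, hg⟩,
      hv1, hv2⟩

/-- a full tree field gives a Whitney field -/
theorem CT.whitney {A A' C : ℝ} {h : ℕ} (hC : 0 ≤ C) (hA0 : 0 ≤ A)
    (hA : ∀ x x' δ δ', 0 < δ' → δ' ≤ δ → dist x x' ≤ δ → Bd x' δ' ⊆ A • Bd x δ)
    (hA' : ∀ x x' δ δ', 0 < δ' → 0 < δ → δ ≤ N * δ' → dist x x' ≤ δ → Bd x δ ⊆ A' • Bd x' δ')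
    (hB : ∀ x δ, 0 < δ → Bod (Bd x δ)) {Γ : ι → Set W}
    {S : Finset ι} {τ : Tr ι W} (hτ : CT Bd N S τ) : τ.depth ≤ h → ∀ f, IsF Γ Set.univ C τ f → ∃ P : ι → W,
      (∀ z ∈ S, P z ∈ Γ z) ∧ (∀ Q : W → Prop, f.All Q → ∀ z ∈ S, Q (P z)) ∧
      ∀ z ∈ S, ∀ y ∈ S, z ≠ y → P z - P y ∈ (2 * (C + h * (C * A)) * A') • Bd z (dist z y) := by
  induction hτ with
  | leaf i =>
    intro _ f hf
    cases f with
    | node v f g => exact hf.elim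
    | leaf v =>
    refine ⟨fun _ => v, ?_, ?_, ?_⟩
    · intro z hz
      rw [Finset.mem_singleton] at hz
      rw [hz]; exact hf (Set.mem_univ _)
    · intro Q hQ z _; exact hQ
    · intro z hz y hy hzy
      rw [Finset.mem_singleton] at hz hy
      exact absurd (hz.trans hy.symm) hzy
  | @node S1 S2 l r x δ h1 h2 hd hx hδ hyz hdd hN ih1 ih2 =>
    intro hdep f hf
    have hd1 : l.depth ≤ h := by simp only [Tr.depth] at hdep; omega
    have hd2 : r.depth ≤ h := by simp only [Tr.depth] at hdep; omega
    cases f with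
    | leaf v => exact hf.elim
    | node v f g =>
    obtain ⟨P1, hP1, hQ1, hW1⟩ := ih1 hd1 f hf.2.2.1
    obtain ⟨P2, hP2, hQ2, hW2⟩ := ih2 hd2 g hf.2.2.2
    have hBx := hB x δ hδ
    have hhC : 0 ≤ (h:ℝ) * (C * A) := by positivity
    have d1 : ∀ z ∈ S1, v - P1 z ∈ (C + h * (C * A)) • Bd x δ := by
      intro z hz
      have := hQ1 _ (hf.2.2.1.drift hC hA0 hBx hd1 (h1.sub hA Finset.subset_union_left hx hdd)) z hz
      simpa using hBx.add hC hhC hf.1 this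
    have d2 : ∀ z ∈ S2, v - P2 z ∈ (C + h * (C * A)) • Bd x δ := by
      intro z hz
      have := hQ2 _ (hf.2.2.2.drift hC hA0 hBx hd2 (h2.sub hA Finset.subset_union_right hx hdd)) z hz
      simpa using hBx.add hC hhC hf.2.1 this
    have d3 : ∀ z ∈ S1, ∀ y ∈ S2, P1 z - P2 y ∈ (2 * (C + h * (C * A))) • Bd x δ := by
      intro z hz y hy
      have := hBx.sub (by positivity) (by positivity) (d2 y hy) (d1 z hz)
      rw [← two_mul] at this
      simpa using this
    have hne : ∀ z ∈ S2, z ∉ S1 := fun z hz hz' => Finset.disjoint_left.1 hd hz' hz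
    refine ⟨fun z => if z ∈ S1 then P1 z else P2 z, ?_, ?_, ?_⟩
    · intro z hz
      rcases Finset.mem_union.1 hz with hz | hz
      · simp only [hz, if_true]; exact hP1 z hz
      · simp only [hne z hz, if_false]; exact hP2 z hz
    · intro Q hQ z hz
      rcases Finset.mem_union.1 hz with hz | hz
      · simp only [hz, if_true]; exact hQ1 Q hQ.2.1 z hz
      · simp only [hne z hz, if_false]; exact hQ2 Q hQ.2.2 z hz
    · intro z hz y hy hzy
      have hxz := hdd x hx z hz
      rcases Finset.mem_union.1 hz with hz | hz <;> rcases Finset.mem_union.1 hy with hy | hy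
      · simp only [hz, hy, if_true]; exact hW1 z hz y hy hzy
      · simp only [hz, hne y hy, if_true, if_false]
        exact body_trans (hA' _ _ _ _ (dist_pos.2 hzy) hδ (hN z hz y hy) hxz) (d3 z hz y hy)
      · simp only [hy, hne z hz, if_true, if_false]
        have := hBx.neg (d3 y hy z hz)
        rw [neg_sub] at this
        exact body_trans (hA' _ _ _ _ (dist_pos.2 hzy) hδ (by rw [dist_comm]; exact hN y hy z hz) hxz) this
      · simp only [hne z hz, hne y hy, if_false]; exact hW2 z hz y hy hzy

end

end SF

namespace SF

open scoped ContDiff Pointwise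

section

variable {n k D : ℕ} {Cw : ℝ} {d : ℕ}

/-- the open unit ball of the jet norm at `x` and scale `δ`, in coordinates -/
def Bj (k : ℕ) (Φ : (Fin d → ℝ) →ₗ[ℝ] VPol n D) (x : En n) (δ : ℝ) : Set (Fin d → ℝ) :=
  {w | ∀ j, ∀ α : Fin n → ℕ, sz α ≤ k → |polyPDval α (Φ w j) x| < δ ^ (k + 1 - sz α)}

theorem sz_finite (k : ℕ) : {α : Fin n → ℕ | sz α ≤ k}.Finite := by
  refine (Set.finite_Iic (fun _ : Fin n => k)).subset ?_
  intro α hα i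
  exact (Finset.single_le_sum (f := α) (fun _ _ => Nat.zero_le _) (Finset.mem_univ i)).trans hα

/-- a jet functional in coordinates -/
def jfun (Φ : (Fin d → ℝ) →ₗ[ℝ] VPol n D) (x : En n) (j : Fin D) (α : Fin n → ℕ) : (Fin d → ℝ) →ₗ[ℝ] ℝ where
  toFun w := polyPDval α (Φ w j) x
  map_add' u v := by rw [map_add, Pi.add_apply, polyPDval_add]
  map_smul' c v := by rw [map_smul, Pi.smul_apply, polyPDval_smul]; rfl

theorem Bj_bod (Φ : (Fin d → ℝ) →ₗ[ℝ] VPol n D) (x : En n) {δ : ℝ} (hδ : 0 < δ) : Bod (Bj k Φ x δ) := by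
  have he : Bj k Φ x δ = ⋂ j : Fin D, ⋂ α ∈ {α : Fin n → ℕ | sz α ≤ k},
      (jfun Φ x j α) ⁻¹' (Set.Ioo (-(δ ^ (k + 1 - sz α))) (δ ^ (k + 1 - sz α))) := by
    ext w
    simp only [Bj, Set.mem_setOf_eq, Set.mem_iInter, Set.mem_preimage, Set.mem_Ioo, abs_lt]
    rfl
  refine ⟨?_, ?_, ?_, ?_⟩
  · rw [he]
    exact convex_iInter fun j => convex_iInter₂ fun α _ => (convex_Ioo _ _).linear_preimage _
  · intro w hw j α hα
    have := hw j α hα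
    rwa [map_neg, Pi.neg_apply, polyPDval_neg, abs_neg]
  · rw [he]
    exact isOpen_iInter_of_finite fun j => (sz_finite k).isOpen_biInter fun α _ =>
      isOpen_Ioo.preimage (LinearMap.continuous_of_finiteDimensional _)
  · intro j α hα
    rw [map_zero, Pi.zero_apply, polyPDval_zero, abs_zero]; positivity

theorem Bj_NB {Φ : (Fin d → ℝ) →ₗ[ℝ] VPol n D} {x : En n} {δ c : ℝ} (hc : 0 ≤ c) {w : Fin d → ℝ}
    (hw : w ∈ c • Bj k Φ x δ) : NB k x δ c (Φ w) := by
  obtain ⟨v, hv, rfl⟩ := Set.mem_smul_set.1 hw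
  have h1 : NB k x δ 1 (Φ v) := fun j α hα => by rw [one_mul]; exact (hv j α hα).le
  have := h1.smul c
  rwa [abs_of_nonneg hc, mul_one, ← map_smul] at this

theorem NB_Bj {Φ : (Fin d → ℝ) →ₗ[ℝ] VPol n D} {x : En n} {δ c : ℝ} (hδ : 0 < δ) (hc : 0 < c) {w : Fin d → ℝ}
    (hw : NB k x δ c (Φ w)) : w ∈ (2 * c) • Bj k Φ x δ := by
  have h2 : (2 * c) ≠ 0 := by positivity
  rw [Set.mem_smul_set_iff_inv_smul_mem₀ h2]
  intro j α hα
  have h1 := hw.smul (2 * c)⁻¹ j α hα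
  rw [map_smul]
  refine h1.trans_lt ?_
  rw [abs_of_pos (by positivity)]
  have : (2 * c)⁻¹ * c = 1 / 2 := by field_simp
  rw [this]
  have : 0 < δ ^ (k + 1 - sz α) := by positivity
  linarith

theorem Bj_one {Φ : (Fin d → ℝ) →ₗ[ℝ] VPol n D} {x : En n} {δ : ℝ} {w : Fin d → ℝ}
    (hw : w ∈ Bj k Φ x δ) : NB k x δ 1 (Φ w) := Bj_NB zero_le_one (by rwa [one_smul])

/-- Whitney fields subordinate to the shape field -/
def SD.Wh (sd : SD n k D Cw) (S : Finset (En n)) (t : ℝ) (P : En n → VPol n D) : Prop :=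
  (∀ z ∈ S, P z ∈ sd.Γ z t) ∧ ∀ z ∈ S, ∀ y ∈ S, NB k z (dist z y) t (P z - P y)

theorem whitney_N (n k D : ℕ) (Cw : ℝ) (N : ℕ) : ∃ C : ℝ, 1 ≤ C ∧ ∀ sd : SD n k D Cw,
    (∀ R ⊆ sd.E, R.card ≤ 2 ^ (D * Nat.choose (n + k) n) → ∃ P, sd.Wh R 1 P) →
    ∀ S ⊆ sd.E, S.card ≤ N → ∃ P, sd.Wh S C P := by
  obtain ⟨Φ, hΦi, hΦd, hΦs⟩ := exists_Phi n k D
  have hT : 1 ≤ TC n k := TC_one_le n k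
  set A : ℝ := 2 * (TC n k * 1) with hAdef
  have hA1 : 1 ≤ A := by linarith
  have hA0 : 0 ≤ A := by linarith
  set N' : ℕ := N + 1 with hN'
  set A' : ℝ := 2 * (TC n k * 1 * (N' : ℝ) ^ (k + 1)) with hA'def
  have hN1 : (1:ℝ) ≤ N' := by rw [hN']; push_cast; linarith [Nat.cast_nonneg (α := ℝ) N]
  have hA'0 : 0 ≤ A' := by positivity
  obtain ⟨C0, hC0, H⟩ := tree_main (D * Nat.choose (n + k) n) N A (2 * A) hA1 (by linarith)
  have hC1 : 0 ≤ 2 * (C0 + N * (C0 * A)) * A' := by positivity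
  refine ⟨1 + 2 * (C0 + N * (C0 * A)) * A', by linarith, ?_⟩
  intro sd hyp S hS hcard
  rcases S.eq_empty_or_nonempty with rfl | hne
  · exact ⟨fun _ => 0, by simp, by simp⟩
  let ι : Type := {x // x ∈ S}
  let Bd : ι → ℝ → Set (Fin (D * Nat.choose (n + k) n) → ℝ) := fun x δ => Bj k Φ x.1 δ
  let Γ' : ι → Set (Fin (D * Nat.choose (n + k) n) → ℝ) := fun x => Φ ⁻¹' (sd.Γ x.1 1)
  have hB : ∀ x δ, 0 < δ → Bod (Bd x δ) := fun x δ hδ => Bj_bod Φ x.1 hδ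
  have hA : ∀ x x' δ δ', 0 < δ' → δ' ≤ δ → dist x x' ≤ δ → Bd x' δ' ⊆ A • Bd x δ := by
    intro x x' δ δ' hδ' hle hd w hw
    have h1 : NB k x'.1 δ' 1 (Φ w) := Bj_one hw
    exact NB_Bj (hδ'.trans_le hle) (by positivity)
      ((h1.up' hδ'.le hle zero_le_one).translate (hΦd w) (hδ'.trans_le hle) hd)
  have hA' : ∀ x x' (δ δ' : ℝ), 0 < δ' → 0 < δ → δ ≤ N' * δ' → dist x x' ≤ δ → Bd x δ ⊆ A' • Bd x' δ' := by
    intro x x' δ δ' hδ' hδ hle hd w hw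
    have h1 : NB k x.1 δ 1 (Φ w) := Bj_one hw
    have h2 : dist x'.1 x.1 ≤ δ := by rw [dist_comm]; exact hd
    exact NB_Bj hδ' (by positivity) ((h1.translate (hΦd w) hδ h2).down hδ'.le hN1 hle hδ.le (by positivity))
  have hcu : (Finset.univ : Finset ι).card = S.card := by
    rw [Finset.card_univ]; exact Fintype.card_coe S
  obtain ⟨τ, hτ⟩ := CT_exists Bd N' S.card Finset.univ hcu.le (by omega) (by
    obtain ⟨x, hx⟩ := hne
    exact ⟨⟨x, hx⟩, Finset.mem_univ _⟩)
  have hdep : τ.depth ≤ N := by have := hτ.depth; omega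
  obtain ⟨f, hf⟩ := H _ ι Γ' τ (by simp) (fun i => (sd.shape.1 _ (hS i.2) 1 one_pos).linear_preimage Φ) hdep
    (hτ.bod hB) (hτ.nest hA) (by
      intro R hR
      obtain ⟨P, hP1, hP2⟩ := hyp (R.map (Function.Embedding.subtype _)) (by
        intro x hx
        obtain ⟨y, _, rfl⟩ := Finset.mem_map.1 hx
        exact hS y.2) (by rwa [Finset.card_map])
      have hmem : ∀ z ∈ R, z.1 ∈ R.map (Function.Embedding.subtype _) := fun z hz =>
        Finset.mem_map.2 ⟨z, hz, rfl⟩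
      have hw : ∀ z : ι, ∃ w, z ∈ R → Φ w = P z.1 := by
        intro z
        by_cases hz : z ∈ R
        · obtain ⟨w, hw⟩ := hΦs (P z.1) (sd.shape.2.1 _ (hS z.2) 1 one_pos _ (hP1 _ (hmem z hz)))
          exact ⟨w, fun _ => hw⟩
        · exact ⟨0, fun h => absurd h hz⟩
      choose w hw using hw
      obtain ⟨f, hf, _⟩ := CT.field (Γ := Γ') (R := (R : Set ι)) (P := w) (c := 2) (by norm_num) hA0 hA hB (by
          intro z hz
          change Φ (w z) ∈ sd.Γ z.1 1
          rw [hw z hz]; exact hP1 _ (hmem z hz)) (by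
          intro z hz y hy hzy
          have h1 := hP2 _ (hmem z hz) _ (hmem y hy)
          rw [← hw z hz, ← hw y hy, ← map_sub] at h1
          have := NB_Bj (dist_pos.2 (fun h => hzy (Subtype.ext h))) one_pos h1
          rwa [mul_one] at this) hτ 0
      exact ⟨f, hf⟩)
  obtain ⟨P, hP1, _, hP2⟩ := CT.whitney (by linarith) hA0 hA hA' hB hτ hdep f hf
  refine ⟨fun x => if h : x ∈ S then Φ (P ⟨x, h⟩) else 0, ?_, ?_⟩
  · intro z hz
    simp only [hz, dif_pos]
    exact sd.shape.2.2 _ (hS hz) _ _ one_pos (by linarith) (hP1 ⟨z, hz⟩ (Finset.mem_univ _))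
  · intro z hz y hy
    simp only [hz, hy, dif_pos]
    by_cases hzy : z = y
    · subst hzy
      rw [sub_self]; exact NB.zero dist_nonneg (by linarith)
    · rw [← map_sub]
      exact (Bj_NB hC1 (hP2 ⟨z, hz⟩ (Finset.mem_univ _) ⟨y, hy⟩ (Finset.mem_univ _)
        (fun h => hzy (congrArg Subtype.val h)))).mono dist_nonneg (by linarith)

end

end SF

namespace SF

open scoped ContDiff Pointwise

section

variable {n k D : ℕ} {Cw : ℝ}

theorem SD.Wh.mono_set {sd : SD n k D Cw} {S T : Finset (En n)} {t : ℝ} {P : En n → VPol n D}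
    (h : sd.Wh T t P) (hS : S ⊆ T) : sd.Wh S t P :=
  ⟨fun z hz => h.1 z (hS hz), fun z hz y hy => h.2 z (hS hz) y (hS hy)⟩

theorem SD.Wh_convex (sd : SD n k D Cw) {S : Finset (En n)} (hS : S ⊆ sd.E) {t : ℝ} (ht : 0 < t) :
    Convex ℝ {P | sd.Wh S t P} := by
  intro P hP Q hQ a b ha hb hab
  refine ⟨fun z hz => sd.shape.1 z (hS hz) t ht (hP.1 z hz) (hQ.1 z hz) ha hb hab, ?_⟩
  intro z hz y hy
  have h1 := ((hP.2 z hz y hy).smul a).add ((hQ.2 z hz y hy).smul b)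
  rw [abs_of_nonneg ha, abs_of_nonneg hb, ← add_mul, hab, one_mul] at h1
  have he : (a • P + b • Q) z - (a • P + b • Q) y = a • (P z - P y) + b • (Q z - Q y) := by
    simp only [Pi.add_apply, Pi.smul_apply, smul_sub]; abel
  rw [he]; exact h1

/-- Helly's theorem for Whitney fields -/
theorem helly_fields (sd : SD n k D Cw) {t : ℝ} (ht : 0 < t) {y : En n} {B : Finset (En n)} (hB : B ⊆ sd.E)
    (hy : y ∈ B) {Q : Set (En n → VPol n D)} (hQ : Convex ℝ Q) (K : ℕ)
    (hyp : ∀ S ⊆ sd.E, S.card ≤ (D * Nat.choose (n + k) n + 1) * K → ∃ p ∈ Q, sd.Wh (B ∪ S) t p) :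
    ∃ P', ∀ S ⊆ sd.E, S.card ≤ K → ∃ p ∈ Q, sd.Wh (B ∪ S) t p ∧ p y = P' := by
  obtain ⟨Φ, hΦi, hΦd, hΦs⟩ := exists_Phi n k D
  set 𝒮 := sd.E.powerset.filter (fun S => S.card ≤ K) with h𝒮
  have h1 : ∀ S ∈ 𝒮, S ⊆ sd.E ∧ S.card ≤ K := fun S hS => by
    rw [h𝒮, Finset.mem_filter, Finset.mem_powerset] at hS; exact hS
  obtain ⟨w, hw⟩ := Convex.helly_theorem' (𝕜 := ℝ) (s := 𝒮)
    (F := fun S : Finset (En n) => {w | ∃ p ∈ Q, sd.Wh (B ∪ S) t p ∧ p y = Φ w}) (by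
      rintro S hS w ⟨p, hp, hpw, hpy⟩ w' ⟨p', hp', hpw', hpy'⟩ a b ha hb hab
      refine ⟨a • p + b • p', hQ hp hp' ha hb hab,
        sd.Wh_convex (Finset.union_subset hB (h1 S hS).1) ht hpw hpw' ha hb hab, ?_⟩
      rw [map_add, map_smul, map_smul, ← hpy, ← hpy']; rfl) (by
      intro I hI hcard
      have hU : I.biUnion id ⊆ sd.E := by
        intro x hx
        obtain ⟨S, hS, hxS⟩ := Finset.mem_biUnion.1 hx
        exact (h1 S (hI hS)).1 hxS
      obtain ⟨p, hp, hpw⟩ := hyp (I.biUnion id) hU (by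
        refine (Finset.card_biUnion_le_card_mul I id K fun S hS => (h1 S (hI hS)).2).trans ?_
        refine Nat.mul_le_mul_right _ ?_
        simpa using hcard)
      obtain ⟨w, hw⟩ := hΦs (p y) (sd.shape.2.1 y (hB hy) t ht _ (hpw.1 y (Finset.mem_union_left _ hy)))
      refine ⟨w, Set.mem_iInter₂.2 fun S hS => ⟨p, hp, hpw.mono_set ?_, hw.symm⟩⟩
      exact Finset.union_subset_union_right (Finset.subset_biUnion_of_mem id hS))
  refine ⟨Φ w, fun S hS hc => ?_⟩
  exact Set.mem_iInter₂.1 hw S (by rw [h𝒮, Finset.mem_filter, Finset.mem_powerset]; exact ⟨hS, hc⟩)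

/-- values of Whitney fields on all `K`-point sets lie in the refined shape fields -/
theorem fin_sub_G (n k D : ℕ) (Cw : ℝ) (l : ℕ) : ∃ K : ℕ, ∀ (sd : SD n k D Cw) (t : ℝ), 0 < t → ∀ x ∈ sd.E, ∀ P,
    (∀ S ⊆ sd.E, S.card ≤ K → ∃ p, sd.Wh ({x} ∪ S) t p ∧ p x = P) → P ∈ sd.G l x t := by
  induction l with
  | zero =>
    refine ⟨0, fun sd t ht x hx P h => ?_⟩
    obtain ⟨p, hp, rfl⟩ := h ∅ (by simp) (by simp)
    exact hp.1 x (by simp)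
  | succ l ih =>
    obtain ⟨K, hK⟩ := ih
    refine ⟨(D * Nat.choose (n + k) n + 1) * K + 1, fun sd t ht x hx P h => ⟨?_, ?_⟩⟩
    · refine hK sd t ht x hx P fun S hS hc => h S hS (hc.trans ?_)
      nlinarith [Nat.zero_le (D * Nat.choose (n + k) n * K)]
    · intro y hy
      obtain ⟨P', hP'⟩ := helly_fields sd ht (y := y) (B := {x, y}) (by
          intro z hz
          rcases Finset.mem_insert.1 hz with rfl | hz
          · exact hx
          · rw [Finset.mem_singleton.1 hz]; exact hy) (by simp) (Q := {p | p x = P}) (by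
          intro p hp q hq a b ha hb hab
          have hp' : p x = P := hp
          have hq' : q x = P := hq
          change a • p x + b • q x = P
          rw [hp', hq', ← add_smul, hab, one_smul]) K (by
          intro S hS hc
          obtain ⟨p, hp, hpx⟩ := h (insert y S) (Finset.insert_subset hy hS)
            ((Finset.card_insert_le _ _).trans (by omega))
          refine ⟨p, hpx, hp.mono_set ?_⟩
          intro z hz
          simp only [Finset.mem_union, Finset.mem_insert, Finset.mem_singleton] at hz ⊢
          tauto)
      refine ⟨P', hK sd t ht y hy P' ?_, ?_⟩
      · intro S hS hc
        obtain ⟨p, hp, hpw, hpy⟩ := hP' S hS hc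
        refine ⟨p, hpw.mono_set ?_, hpy⟩
        intro z hz
        simp only [Finset.mem_union, Finset.mem_insert, Finset.mem_singleton] at hz ⊢
        tauto
      · obtain ⟨p, hp, hpw, hpy⟩ := hP' ∅ (by simp) (by simp)
        have := hpw.2 x (by simp) y (by simp)
        have hp' : p x = P := hp
        rwa [hpy, hp'] at this

/-- the finiteness hypothesis implies nonempty refined shape fields -/
theorem G_nonempty (n k D : ℕ) (Cw : ℝ) (l : ℕ) : ∃ C : ℝ, 1 ≤ C ∧ ∀ sd : SD n k D Cw,
    (∀ R ⊆ sd.E, R.card ≤ 2 ^ (D * Nat.choose (n + k) n) → ∃ P, sd.Wh R 1 P) →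
    ∀ x ∈ sd.E, ∃ P, P ∈ sd.G l x C := by
  obtain ⟨K, hK⟩ := fin_sub_G n k D Cw l
  obtain ⟨C, hC, H⟩ := whitney_N n k D Cw (1 + (D * Nat.choose (n + k) n + 1) * K)
  refine ⟨C, hC, fun sd hyp x hx => ?_⟩
  obtain ⟨P, hP⟩ := helly_fields sd (by linarith : 0 < C) (y := x) (B := {x}) (by simpa using hx) (by simp)
    (Q := Set.univ) convex_univ K (by
      intro S hS hc
      obtain ⟨p, hp⟩ := H sd hyp ({x} ∪ S) (Finset.union_subset (by simpa using hx) hS)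
        ((Finset.card_union_le _ _).trans (by simpa using hc))
      exact ⟨p, trivial, hp⟩)
  refine ⟨P, hK sd C (by linarith) x hx P fun S hS hc => ?_⟩
  obtain ⟨p, _, h⟩ := hP S hS hc
  exact ⟨p, h⟩

end

end SF

namespace SF

open scoped ContDiff Pointwise

section

variable {n k D : ℕ} {Cw : ℝ}

theorem odot_smul' (k : ℕ) (x : En n) (c : ℝ) (p q : Pol n) : odot k x p (c • q) = c • odot k x p q := by
  refine pol_ext (odot_deg k x _ _) ((MvPolynomial.totalDegree_smul_le _ _).trans (odot_deg k x _ _)) x ?_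
  intro α hα
  have h1 : ∀ r : Pol n, polyPDval α (odot k x p r) x = polyPDval α (p * r) x := by
    intro r
    have := odot_JE k x p r α hα
    rwa [← polyPDval_eq, ← ev_mul, ← polyPDval_eq] at this
  rw [h1, polyPDval_smul, h1, mul_smul_comm, polyPDval_smul]

/-- rescaled shape field data -/
def resc (sd : SD n k D Cw) (M : ℝ) (hM : 0 < M) : SD n k D Cw where
  E := sd.E
  Γ x t := {P | M • P ∈ sd.Γ x (t * M)}
  dm := sd.dm
  dm_pos := sd.dm_pos
  shape := by
    refine ⟨?_, ?_, ?_⟩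
    · intro x hx t ht P hP Q hQ a b ha hb hab
      have := sd.shape.1 x hx (t * M) (by positivity) hP hQ ha hb hab
      change M • (a • P + b • Q) ∈ sd.Γ x (t * M)
      rwa [smul_add, smul_comm M a, smul_comm M b]
    · intro x hx t ht P hP j
      have h1 := sd.shape.2.1 x hx (t * M) (by positivity) _ hP j
      have h2 : P j = M⁻¹ • (M • P) j := by
        rw [Pi.smul_apply, smul_smul, inv_mul_cancel₀ hM.ne', one_smul]
      rw [h2]
      exact (MvPolynomial.totalDegree_smul_le _ _).trans h1
    · intro x hx t t' ht htt P hP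
      exact sd.shape.2.2 x hx (t * M) (t' * M) (by positivity) (by gcongr) hP
  conv := by
    intro δ hδ hδm x hx t ht P₁ P₂ h1 h2 Q₁ Q₂ hQ1 hQ2 hP hQ hQQ
    have := sd.conv δ hδ hδm x hx (t * M) (by positivity) (M • P₁) (M • P₂) h1 h2 Q₁ Q₂ hQ1 hQ2 (by
      intro α hα j
      have h3 := hP α hα j
      have h4 : (M • P₁) j - (M • P₂) j = M • (P₁ j - P₂ j) := by simp [smul_sub]
      rw [h4, polyPDval_smul, abs_mul, abs_of_pos hM]
      calc M * |polyPDval α (P₁ j - P₂ j) x| ≤ M * (t * δ ^ (k + 1 - ∑ i, α i)) := by gcongr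
        _ = _ := by ring) hQ hQQ
    change M • _ ∈ sd.Γ x (Cw * t * M)
    rw [mul_assoc]
    convert this using 1
    funext j
    simp only [Pi.smul_apply, odot_smul', smul_add]

theorem cube_convex (a : En n) (δ : ℝ) : Convex ℝ (cube a δ) := by
  intro x hx y hy s t hs ht hst i
  have h1 := hx i
  have h2 := hy i
  have e : (s • x + t • y) i = s * x i + t * y i := by simp
  rw [e]
  have ea : a i = s * a i + t * a i := by rw [← add_mul, hst, one_mul]
  have eb : a i + δ = s * (a i + δ) + t * (a i + δ) := by rw [← add_mul, hst, one_mul]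
  constructor
  · rw [ea]; exact add_le_add (mul_le_mul_of_nonneg_left h1.1 hs) (mul_le_mul_of_nonneg_left h2.1 ht)
  · rw [eb]; exact add_le_add (mul_le_mul_of_nonneg_left h1.2 hs) (mul_le_mul_of_nonneg_left h2.2 ht)

theorem cube_uniqueDiff (a : En n) {δ : ℝ} (hδ : 0 < δ) : UniqueDiffOn ℝ (cube a δ) := by
  refine uniqueDiffOn_convex (cube_convex a δ) ?_
  have ho : IsOpen (⋂ i : Fin n, {y : En n | y i ∈ Set.Ioo (a i) (a i + δ)}) := by
    refine isOpen_iInter_of_finite fun i => ?_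
    exact isOpen_Ioo.preimage (by fun_prop : Continuous fun y : En n => y i)
  refine ⟨WithLp.toLp 2 (fun i => a i + δ / 2), ?_⟩
  refine interior_maximal (t := ⋂ i : Fin n, {y : En n | y i ∈ Set.Ioo (a i) (a i + δ)}) ?_ ho ?_
  · intro y hy i
    have := Set.mem_iInter.1 hy i
    exact ⟨this.1.le, this.2.le⟩
  · refine Set.mem_iInter.2 fun i => ?_
    change a i < a i + δ / 2 ∧ a i + δ / 2 < a i + δ
    constructor <;> linarith

theorem cube_dist {a : En n} {δ : ℝ} (hδ : 0 < δ) {x y : En n} (hx : x ∈ cube a δ) (hy : y ∈ cube a δ) :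
    dist x y ≤ ((n:ℝ) + 1) * δ := by
  rw [EuclideanSpace.dist_eq]
  refine Real.sqrt_le_iff.2 ⟨by positivity, ?_⟩
  have h1 : ∀ i ∈ (Finset.univ : Finset (Fin n)), dist (x i) (y i) ^ 2 ≤ δ ^ 2 := by
    intro i _
    have h2 := hx i
    have h3 := hy i
    have : dist (x i) (y i) ≤ δ := by
      rw [Real.dist_eq, abs_le]; constructor <;> linarith
    gcongr
  refine (Finset.sum_le_sum h1).trans ?_
  rw [Finset.sum_const, Finset.card_univ, Fintype.card_fin, nsmul_eq_mul, mul_pow]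
  have hn0 : (0:ℝ) ≤ n := Nat.cast_nonneg n
  gcongr
  nlinarith

theorem pd1W_eq {s : Set (En n)} (hs : UniqueDiffOn ℝ s) (i : Fin n) {g h : En n → ℝ} (hh : ContDiff ℝ ∞ h)
    (hg : Set.EqOn g h s) : Set.EqOn (pd1W s i g) (pd1 i h) s := by
  intro x hx
  unfold pd1W pd1
  rw [fderivWithin_congr hg (hg hx)]
  have hd : DifferentiableAt ℝ h x := (hh.differentiable (by simp)).differentiableAt
  rw [hd.fderivWithin (hs x hx)]

theorem pdalphaW_eq {s : Set (En n)} (hs : UniqueDiffOn ℝ s) (α : Fin n → ℕ) {f : En n → ℝ} (hf : ContDiff ℝ ∞ f) :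
    Set.EqOn (pdalphaW s α f) (pdalpha α f) s := by
  have hit : ∀ (i : Fin n) (N : ℕ) (g h : En n → ℝ), ContDiff ℝ ∞ h → Set.EqOn g h s →
      ContDiff ℝ ∞ ((pd1 i)^[N] h) ∧ Set.EqOn ((pd1W s i)^[N] g) ((pd1 i)^[N] h) s := by
    intro i N
    induction N with
    | zero => intro g h hh hg; exact ⟨hh, hg⟩
    | succ N ih =>
      intro g h hh hg
      rw [Function.iterate_succ_apply', Function.iterate_succ_apply']
      obtain ⟨h1, h2⟩ := ih g h hh hg
      exact ⟨pd1_smooth i _ h1, pd1W_eq hs i h1 h2⟩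
  have key : ∀ l : List (Fin n), ContDiff ℝ ∞ (itl pd1 l α f) ∧ Set.EqOn (itl (pd1W s) l α f) (itl pd1 l α f) s := by
    intro l
    induction l with
    | nil => exact ⟨hf, fun x _ => rfl⟩
    | cons j l ih => exact hit j (α j) _ _ ih.1 ih.2
  exact (key _).2

end

end SF

namespace SF

open scoped ContDiff Pointwise

/-- the main theorem in normalized form -/
theorem final_form (n k D : ℕ) (Cw : ℝ) (hCw : 0 < Cw) : ∃ C : ℝ, 1 ≤ C ∧ ∀ sd : SD n k D Cw,
    (∀ R ⊆ sd.E, R.card ≤ 2 ^ (D * Nat.choose (n + k) n) → ∃ P, sd.Wh R 1 P) →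
    ∀ (x0 : En n) (δ : ℝ), x0 ∈ sd.E → 0 < δ → δ ≤ sd.dm → ∃ P0 ∈ sd.Γ x0 C, ∃ F,
      Sol sd x0 (((n:ℝ) + 1) * δ) δ C P0 F := by
  obtain ⟨l, hl⟩ := TOP (n := n) (k := k) (D := D) hCw ((n:ℝ) + 1) (by linarith [Nat.cast_nonneg (α := ℝ) n])
  obtain ⟨A, hA, hG⟩ := G_nonempty n k D Cw l
  obtain ⟨C, hC, H⟩ := hl A hA
  refine ⟨max A C, hA.trans (le_max_left _ _), ?_⟩
  intro sd hyp x0 δ hx0 hδ hδm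
  obtain ⟨P0, hP0⟩ := hG sd hyp x0 hx0
  obtain ⟨F, hF, hF'⟩ := H sd x0 P0 δ hx0 hδ hδm hP0
  refine ⟨P0, ?_, F, hF, ?_⟩
  · exact sd.shape.2.2 x0 hx0 _ _ (by linarith) (le_max_left _ _) (sd.G_anti (Nat.zero_le l) x0 A hP0)
  · intro z hz
    obtain ⟨h1, h2⟩ := hF' z hz
    exact ⟨h1.mono hδ.le (le_max_right _ _), fun hzE =>
      sd.shape.2.2 z hzE _ _ (by linarith) (le_max_right _ _) (h2 hzE)⟩

end SF
/-- **Finiteness principle for vector-valued shape fields with improved finiteness number**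
`k♯ = 2^(dim 𝒫⃗) = 2^(D·binom(n+m-1,n))` (Theorem 2.6). -/
theorem shape_field_finiteness_principle_improved
    (m n D : ℕ) (hm : 1 ≤ m) (hn : 1 ≤ n) (hD : 1 ≤ D) :
    ∀ Cw : ℝ, 0 < Cw → ∃ C : ℝ, 0 < C ∧
      ∀ δmax : ℝ, 0 < δmax →
      ∀ E : Finset (En n), ∀ Γ : En n → ℝ → Set (Fin D → MvPolynomial (Fin n) ℝ),
        IsShapeField (m - 1) D E Γ → SFConvex (m - 1) D E Γ Cw δmax →
        ∀ a : En n, ∀ δQ : ℝ, 0 < δQ → δQ ≤ δmax →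
        ∀ x₀ ∈ E, x₀ ∈ cube a δQ →
        ∀ M₀ : ℝ, 0 < M₀ →
        (∀ S : Finset (En n), S ⊆ E → S.card ≤ 2 ^ (D * Nat.choose (n + m - 1) n) →
          ∃ P : En n → Fin D → MvPolynomial (Fin n) ℝ,
            (∀ z ∈ S, ∀ j, (P z j).totalDegree ≤ m - 1) ∧
            WSemiLE m S P M₀ ∧ (∀ z ∈ S, P z ∈ Γ z M₀)) →
        ∃ P0 ∈ Γ x₀ (C * M₀), ∃ F : En n → Fin D → ℝ,
          ContDiffOn ℝ m F (cube a δQ) ∧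
          (∀ z ∈ E, z ∈ cube a δQ → jetDW m (cube a δQ) F z ∈ Γ z (C * M₀)) ∧
          (∀ x ∈ cube a δQ, ∀ α : Fin n → ℕ, (∑ i, α i) ≤ m → ∀ j,
            |pdalphaW (cube a δQ) α (fun y => F y j) x - polyPDval α (P0 j) x|
              ≤ C * M₀ * δQ ^ (m - ∑ i, α i)) ∧
          (∀ x ∈ cube a δQ, ∀ α : Fin n → ℕ, (∑ i, α i) = m → ∀ j,
            |pdalphaW (cube a δQ) α (fun y => F y j) x| ≤ C * M₀) := by
  intro Cw hCw
  obtain ⟨k, rfl⟩ : ∃ k, m = k + 1 := ⟨m - 1, by omega⟩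
  obtain ⟨C, hC, H⟩ := SF.final_form n k D Cw hCw
  refine ⟨C, by linarith, ?_⟩
  intro δmax hδmax E Γ hsh hconv a δQ hδQ hδle x₀ hx₀E hx₀Q M₀ hM₀ hyp
  let sd0 : SF.SD n k D Cw := ⟨E, Γ, δmax, hδmax, hsh, hconv⟩
  let sd := SF.resc sd0 M₀ hM₀
  have hMi : M₀ * M₀⁻¹ = 1 := mul_inv_cancel₀ hM₀.ne'
  obtain ⟨P0, hP0, F, hF, hS⟩ := H sd (by
    intro R hR hcard
    obtain ⟨P, hdeg, hW, hPΓ⟩ := hyp R hR hcard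
    refine ⟨fun z => M₀⁻¹ • P z, ?_, ?_⟩
    · intro z hz
      change M₀ • M₀⁻¹ • P z ∈ Γ z (1 * M₀)
      rw [smul_smul, hMi, one_smul, one_mul]
      exact hPΓ z hz
    · intro z hz y hy
      by_cases hzy : z = y
      · subst hzy
        rw [sub_self]; exact SF.NB.zero dist_nonneg zero_le_one
      have h1 : SF.NB k z (dist z y) M₀ (P z - P y) := fun j α hα => hW z hz y hy hzy α hα j
      have h2 := h1.smul M₀⁻¹
      rwa [abs_of_pos (inv_pos.2 hM₀), mul_comm, hMi, smul_sub] at h2) x₀ δQ hx₀E hδQ hδle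
  have hud := SF.cube_uniqueDiff a hδQ
  have hdist : ∀ x ∈ cube a δQ, dist x x₀ ≤ ((n:ℝ) + 1) * δQ := fun x hx => SF.cube_dist hδQ hx hx₀Q
  have hpd : ∀ (α : Fin n → ℕ) (j : Fin D), ∀ x ∈ cube a δQ,
      pdalphaW (cube a δQ) α (fun y => M₀ * F j y) x = M₀ * pdalpha α (F j) x := by
    intro α j x hx
    have h1 := SF.pdalphaW_eq hud α (SF.smooth_smul M₀ (hF j)) hx
    rw [SF.pdalpha_smul α M₀ (hF j)] at h1
    exact h1
  have hdeg0 : SF.VD k P0 := sd.shape.2.1 x₀ hx₀E C (by linarith) P0 hP0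
  have hmain : ∀ x ∈ cube a δQ, ∀ α : Fin n → ℕ, (∑ i, α i) ≤ k + 1 → ∀ j,
      |pdalphaW (cube a δQ) α (fun y => M₀ * F j y) x - polyPDval α ((M₀ • P0) j) x|
        ≤ C * M₀ * δQ ^ (k + 1 - ∑ i, α i) := by
    intro x hx α hα j
    have h1 := (hS x (hdist x hx)).1 j α hα
    rw [hpd α j x hx, Pi.smul_apply, SF.polyPDval_smul, ← mul_sub, abs_mul, abs_of_pos hM₀]
    have h2 : pdalpha α ((F - SF.vev P0) j) x = pdalpha α (F j) x - polyPDval α (P0 j) x := by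
      have := SF.pdalpha_sub α (hF j) (SF.ev_smooth (P0 j))
      rw [SF.polyPDval_eq]
      exact congrFun this x
    rw [h2] at h1
    have hp : 0 < δQ ^ SF.sz α := by positivity
    have h3 : δQ ^ (k + 1) = δQ ^ (k + 1 - ∑ i, α i) * δQ ^ SF.sz α := by
      rw [← pow_add]
      congr 1
      change k + 1 = k + 1 - (∑ i, α i) + ∑ i, α i
      omega
    rw [h3, ← mul_assoc] at h1
    have h4 := le_of_mul_le_mul_right h1 hp
    calc M₀ * |pdalpha α (F j) x - polyPDval α (P0 j) x| ≤ M₀ * (C * δQ ^ (k + 1 - ∑ i, α i)) := by gcongr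
      _ = _ := by ring
  refine ⟨M₀ • P0, hP0, fun y j => M₀ * F j y, ?_, ?_, hmain, ?_⟩
  · refine ContDiff.contDiffOn (contDiff_pi.2 fun j => ?_)
    have h1 : ContDiff ℝ ((k + 1 : ℕ) : WithTop ℕ∞) (F j) := (hF j).of_le (by exact_mod_cast le_top)
    exact contDiff_const.mul h1
  · intro z hzE hzQ
    have hj : ∀ j, jetDW (k + 1) (cube a δQ) (fun y j => M₀ * F j y) z j =
        SF.jetC (k + 1) (fun α => pdalphaW (cube a δQ) α (fun y => M₀ * F j y) z) z := fun j =>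
      SF.jetScalarW_eq (k + 1) (cube a δQ) (fun y => M₀ * F j y) z
    have h1 := (hS z (hdist z hzQ)).2 hzE
    change M₀ • SF.vj k F z ∈ Γ z (C * M₀) at h1
    convert h1 using 1
    funext j
    refine SF.pol_ext (K := k) ?_ ((MvPolynomial.totalDegree_smul_le _ _).trans (SF.jt_deg k _ z)) z ?_
    · rw [hj j]; exact SF.jetC_deg k _ z
    · intro α hα
      have h2 : polyPDval α (jetDW (k + 1) (cube a δQ) (fun y j => M₀ * F j y) z j) z =
          pdalphaW (cube a δQ) α (fun y => M₀ * F j y) z := by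
        rw [hj j]; exact SF.jetC_val k _ z α hα
      rw [h2, hpd α j z hzQ, Pi.smul_apply, SF.polyPDval_smul]
      congr 1
      exact (SF.jt_val k (F j) z α hα).symm
  · intro x hx α hα j
    have h1 := hmain x hx α hα.le j
    have h2 : polyPDval α ((M₀ • P0) j) x = 0 := by
      rw [Pi.smul_apply, polyPDval, SF.polyPD_eq_zero α _ (K := k) ((MvPolynomial.totalDegree_smul_le _ _).trans (hdeg0 j))
        (by change k < ∑ i, α i; omega)]
      simp
    rw [h2, sub_zero, hα, Nat.sub_self, pow_zero, mul_one] at h1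
    exact h1

end
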